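/- Let 𝒫 be a Chebotarev set of primes with level of distribution θ > 0 (with excluded modulus M = Δ), attached to a Galois extension K/ℚ with group G, discriminant Δ, and conjugacy class C, and set δ = |C|/|G|. Let ℋ = {h₁, …, h_k} be an admissible set, let M_k = sup_{F ∈ 𝒮_k} (Σ_{i=1}^k J_k^{(i)}(F))/I_k(F), and let r_k = ⌈δθφ(Δ)M_k/(2Δ)⌉. Then there are infinitely many integers n such that at least r_k of the numbers n + h₁, …, n + h_k lie in 𝒫; in particular, if p_n denotes the n-th prime of 𝒫, then liminf_{n→∞}(p_{n+r_k−1} − p_n) ≤ max_{1 ≤ i < j ≤ k}(h_j − h_i). -/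

import Mathlib

open NumberField MeasureTheory

/-- `σ` is a Frobenius automorphism attached to some prime ideal of `K` lying over `p`. -/
def IsFrobeniusAt (K : Type) [Field K] [NumberField K] (p : ℕ) (σ : K ≃ₐ[ℚ] K) : Prop :=
  ∃ P : Ideal (𝓞 K), P.IsMaximal ∧ (p : 𝓞 K) ∈ P ∧
    ∀ x : 𝓞 K, galRestrict ℤ ℚ K (𝓞 K) σ x - x ^ p ∈ P

/-- The Chebotarev set of rational primes `p ∤ Δ` whose Artin symbol `[K/ℚ, p]` equals `C`. -/
def chebotarevSet (K : Type) [Field K] [NumberField K]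
    (C : ConjClasses (K ≃ₐ[ℚ] K)) : Set ℕ :=
  {p | p.Prime ∧ ¬ p ∣ (discr K).natAbs ∧ {σ | IsFrobeniusAt K p σ} = C.carrier}

/-- `π_𝒫(N) = #{N ≤ p < 2N : p ∈ 𝒫}`. -/
noncomputable def chebCount (P : Set ℕ) (N : ℕ) : ℕ :=
  {p | p ∈ P ∧ N ≤ p ∧ p < 2 * N}.ncard

/-- `π_𝒫(N; q, a) = #{N ≤ p < 2N : p ∈ 𝒫, p ≡ a (mod q)}`. -/
noncomputable def chebCountMod (P : Set ℕ) (N q a : ℕ) : ℕ :=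
  {p | p ∈ P ∧ N ≤ p ∧ p < 2 * N ∧ p % q = a % q}.ncard

/-- `max_{y ≤ N} max_{a ∈ (ℤ/qℤ)ˣ} |π_𝒫(y; q, a) − π_𝒫(y)/φ(q)|`. -/
noncomputable def chebErr (P : Set ℕ) (N q : ℕ) : ℝ :=
  sSup {x : ℝ | ∃ y ≤ N, ∃ a : ℕ, Nat.Coprime a q ∧
    x = |(chebCountMod P y q a : ℝ) - (chebCount P y : ℝ) / (Nat.totient q : ℝ)|}

/-- `𝒫` has level of distribution `θ` with excluded modulus `M`. -/
def HasLevelOfDistribution (P : Set ℕ) (θ : ℝ) (M : ℕ) : Prop :=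
  0 < θ ∧ ∀ A : ℝ, 0 < A → ∃ c : ℝ, ∀ N : ℕ, 2 ≤ N →
    ∑ q ∈ (Finset.Icc 1 ⌊(N : ℝ) ^ θ⌋₊).filter (fun q => Nat.Coprime q M),
      chebErr P N q ≤ c * N / Real.log N ^ A

/-- The simplex `ℛ_k = {x ∈ [0,1]^k : Σ x_i ≤ 1}`. -/
def maynardSimplex (k : ℕ) : Set (Fin k → ℝ) :=
  {t | (∀ i, t i ∈ Set.Icc (0 : ℝ) 1) ∧ ∑ i, t i ≤ 1}

/-- `I_k(F) = ∫_{[0,1]^k} F(t)² dt`. -/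
noncomputable def maynardI (k : ℕ) (F : (Fin k → ℝ) → ℝ) : ℝ :=
  ∫ t in Set.univ.pi fun _ : Fin k => Set.Icc (0 : ℝ) 1, F t ^ 2

/-- `J_k^{(i)}(F) = ∫_{[0,1]^{k-1}} (∫_0^1 F(t) dt_i)² dt_1⋯dt_{i-1}dt_{i+1}⋯dt_k`. -/
noncomputable def maynardJ (k : ℕ) (i : Fin k) (F : (Fin k → ℝ) → ℝ) : ℝ :=
  ∫ t in Set.univ.pi fun _ : Fin k => Set.Icc (0 : ℝ) 1,
    (∫ x in (0:ℝ)..1, F (Function.update t i x)) ^ 2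

/-- The class `𝒮_k` of smooth functions supported on `ℛ_k` with nonvanishing `I_k`, `J_k^{(i)}`. -/
def maynardS (k : ℕ) : Set ((Fin k → ℝ) → ℝ) :=
  {F | ContDiff ℝ (⊤ : ℕ∞) F ∧ Function.support F ⊆ maynardSimplex k ∧
    maynardI k F ≠ 0 ∧ ∀ i, maynardJ k i F ≠ 0}

/-- `M_k = sup_{F ∈ 𝒮_k} (Σ_i J_k^{(i)}(F)) / I_k(F)`. -/
noncomputable def maynardM (k : ℕ) : ℝ :=
  sSup {r : ℝ | ∃ F ∈ maynardS k, r = (∑ i, maynardJ k i F) / maynardI k F}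

set_option linter.unusedSectionVars false
set_option linter.unnecessarySimpa false
set_option linter.style.longLine false
set_option linter.unusedVariables false
set_option linter.style.haveILetI false
set_option linter.deprecated false

namespace MCheb
section
/-- tent function -/
noncomputable def tent (x : ℝ) : ℝ := max 0 (1 - |x|)

lemma tent_nonneg (x : ℝ) : 0 ≤ tent x := le_max_left _ _
lemma tent_le_one (x : ℝ) : tent x ≤ 1 := by
  unfold tent; have := abs_nonneg x; exact max_le (by norm_num) (by linarith)
lemma tent_lip (x y : ℝ) : |tent x - tent y| ≤ |x - y| := by
  unfold tent
  refine (abs_max_sub_max_le_max _ _ _ _).trans ?_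
  simp only [sub_self, abs_zero]
  refine max_le (abs_nonneg _) ?_
  have h : (1 - |x|) - (1 - |y|) = |y| - |x| := by ring
  rw [h, abs_sub_comm x y]
  exact abs_abs_sub_abs_le_abs_sub y x
lemma tent_eq_zero {x : ℝ} (h : 1 ≤ |x|) : tent x = 0 := by
  unfold tent; exact max_eq_left (by linarith)

lemma tent_sum (x : ℝ) : ∑ n ∈ ({⌊-x⌋, ⌊-x⌋ + 1} : Finset ℤ), tent (x + n) = 1 := by
  rw [Finset.sum_pair (by simp)]
  have h1 := Int.floor_le (-x)
  have h2 := Int.lt_floor_add_one (-x)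
  push_cast
  unfold tent
  rw [abs_of_nonpos (by linarith : x + (⌊-x⌋ : ℝ) ≤ 0),
    abs_of_nonneg (by linarith : 0 ≤ x + ((⌊-x⌋ : ℝ) + 1)), max_eq_right (by linarith),
    max_eq_right (by linarith)]
  ring

lemma tent_not_mem {x : ℝ} {n : ℤ} (h : n ∉ ({⌊-x⌋, ⌊-x⌋ + 1} : Finset ℤ)) : tent (x + n) = 0 := by
  apply tent_eq_zero
  simp only [Finset.mem_insert, Finset.mem_singleton, not_or] at h
  have h1 := Int.floor_le (-x)
  have h2 := Int.lt_floor_add_one (-x)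
  rcases lt_or_ge n ⌊-x⌋ with h3 | h3
  · have : (n : ℝ) ≤ ⌊-x⌋ - 1 := by exact_mod_cast (by omega : n ≤ ⌊-x⌋ - 1)
    rw [abs_of_nonpos (by linarith)]; linarith
  · have : (⌊-x⌋ : ℝ) + 2 ≤ n := by exact_mod_cast (by omega : ⌊-x⌋ + 2 ≤ n)
    rw [abs_of_nonneg (by linarith)]; linarith

lemma tent_prod_hasSum {r : ℕ} (x : Fin r → ℝ) :
    HasSum (fun n : Fin r → ℤ => ∏ i, tent (x i + n i)) 1 := by
  classical
  have h := hasSum_sum_of_ne_finset_zero (L := SummationFilter.unconditional _) (f := fun n : Fin r → ℤ => ∏ i, tent (x i + n i))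
    (s := Fintype.piFinset fun i => ({⌊-x i⌋, ⌊-x i⌋ + 1} : Finset ℤ)) (by
      intro n hn
      rw [Fintype.mem_piFinset] at hn
      push Not at hn
      obtain ⟨i, hi⟩ := hn
      exact Finset.prod_eq_zero (Finset.mem_univ i) (tent_not_mem hi))
  rw [← Finset.prod_univ_sum (fun i => ({⌊-x i⌋, ⌊-x i⌋ + 1} : Finset ℤ))
    (fun i (n : ℤ) => tent (x i + n))] at h
  rw [Finset.prod_congr rfl (fun i _ => tent_sum (x i)), Finset.prod_const_one] at h
  exact h

section
variable (F : Type) [Field F] [NumberField F]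
open NumberField.Units NumberField.Units.dirichletUnitTheorem NumberField.InfinitePlace Module

/-- log vector -/
noncomputable def LL (x : F) : InfinitePlace F → ℝ := fun w => Real.log (w x)

/-- projection to the log space -/
noncomputable def linP : (InfinitePlace F → ℝ) →ₗ[ℝ] logSpace F where
  toFun L := fun w => mult w.val * (L w.val - (∑ v, mult v * L v) * (finrank ℚ F : ℝ)⁻¹)
  map_add' L M := by
    ext w; simp only [Pi.add_apply, mul_add, Finset.sum_add_distrib]; ring
  map_smul' c L := by
    ext w; simp only [Pi.smul_apply, smul_eq_mul, RingHom.id_apply, mul_left_comm _ c, ← Finset.mul_sum]; ring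

open scoped Classical in
/-- coordinates -/
noncomputable def lc (i : Fin (rank F)) : (InfinitePlace F → ℝ) →ₗ[ℝ] ℝ :=
  (((basisUnitLattice F).ofZLatticeBasis ℝ (unitLattice F)).coord i).comp (linP F)

/-- weight -/
noncomputable def wt (L : InfinitePlace F → ℝ) : ℝ := ∏ i, tent (lc F i L)

lemma LL_mul {x y : F} (hx : x ≠ 0) (hy : y ≠ 0) : LL F (x * y) = LL F x + LL F y := by
  ext w
  simp only [LL, map_mul, Pi.add_apply]
  rw [Real.log_mul (by simpa using hx) (by simpa using hy)]

lemma sum_LL {x : F} (hx : x ≠ 0) : ∑ w, mult w * LL F x w = Real.log |(Algebra.norm ℚ x : ℚ)| := by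
  rw [← Rat.cast_abs, ← NumberField.InfinitePlace.prod_eq_abs_norm, Real.log_prod]
  · simp [LL]
  · intro w _; simpa using hx

lemma linP_unit (u : (𝓞 F)ˣ) : linP F (LL F (u : F)) = logEmbedding F (Additive.ofMul u) := by
  ext w
  have h := sum_LL F (x := (u : F)) (by simp)
  have h2 : |(Algebra.norm ℚ (u : F) : ℚ)| = 1 := by
    have := NumberField.isUnit_iff_norm.mp u.isUnit
    simpa using this
  rw [← Rat.cast_abs, h2] at h
  simp only [linP, LinearMap.coe_mk, AddHom.coe_mk, h]
  simp [LL]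

lemma lc_fund (i j : Fin (rank F)) : lc F i (LL F ((fundSystem F j : (𝓞 F)ˣ) : F)) = if i = j then 1 else 0 := by
  classical
  unfold lc
  rw [LinearMap.comp_apply, linP_unit, logEmbedding_fundSystem, ← Basis.ofZLatticeBasis_apply ℝ]
  rw [Basis.coord_apply, Basis.repr_self]
  simp [Finsupp.single_apply, eq_comm]

lemma lc_tors (i : Fin (rank F)) (z : (𝓞 F)ˣ) (hz : z ∈ torsion F) : lc F i (LL F (z : F)) = 0 := by
  unfold lc
  rw [LinearMap.comp_apply, linP_unit, (logEmbedding_eq_zero_iff).mpr hz, map_zero]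

lemma LL_pow (x : F) (n : ℤ) : LL F (x ^ n) = n • LL F x := by
  ext w; simp [LL]

lemma LL_prod {ι : Type} (s : Finset ι) (f : ι → F) (h : ∀ i ∈ s, f i ≠ 0) :
    LL F (∏ i ∈ s, f i) = ∑ i ∈ s, LL F (f i) := by
  ext w; simp only [LL, map_prod, Finset.sum_apply]
  rw [Real.log_prod]; intro i hi; simpa using h i hi

lemma lc_decomp (i : Fin (rank F)) (z : (𝓞 F)ˣ) (hz : z ∈ torsion F) (n : Fin (rank F) → ℤ) (x : F) (hx : x ≠ 0) :
    lc F i (LL F (((z * ∏ j, fundSystem F j ^ n j : (𝓞 F)ˣ) : F) * x)) = lc F i (LL F x) + n i := by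
  rw [LL_mul F (NumberField.Units.coe_ne_zero _) hx, map_add, add_comm]
  congr 1
  have : ((z * ∏ j, fundSystem F j ^ n j : (𝓞 F)ˣ) : F) = (z : F) * ∏ j, ((fundSystem F j : (𝓞 F)ˣ) : F) ^ n j := by
    rw [NumberField.Units.coe_mul, Units.coe_prod, map_prod]
    simp only [NumberField.Units.coe_zpow]
  rw [this, LL_mul F (by simp) (Finset.prod_ne_zero_iff.mpr (by intros; apply zpow_ne_zero; simp)), map_add, lc_tors F i z hz, zero_add,
    LL_prod F _ _ (by intros; apply zpow_ne_zero; simp), map_sum]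
  simp only [LL_pow, map_zsmul, lc_fund]
  simp

lemma units_hasSum (x : F) (hx : x ≠ 0) :
    HasSum (fun u : (𝓞 F)ˣ => wt F (LL F ((u : F) * x))) (torsionOrder F) := by
  let f : torsion F × (Fin (rank F) → ℤ) → (𝓞 F)ˣ := fun p => p.1 * ∏ i, fundSystem F i ^ p.2 i
  have hf : Function.Bijective f := by
    rw [Function.bijective_iff_existsUnique]
    intro u
    obtain ⟨p, hp, hp2⟩ := exist_unique_eq_mul_prod F u
    exact ⟨p, hp.symm, fun q hq => hp2 q hq.symm⟩
  rw [← (Equiv.ofBijective f hf).hasSum_iff]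
  have h1 : ∀ p : torsion F × (Fin (rank F) → ℤ), ((fun u : (𝓞 F)ˣ => wt F (LL F ((u : F) * x))) ∘ (Equiv.ofBijective f hf)) p =
      ∏ i, tent (lc F i (LL F x) + p.2 i) := by
    intro p
    simp only [Function.comp, Equiv.ofBijective_apply, wt, f]
    exact Finset.prod_congr rfl fun i _ => by rw [lc_decomp F i _ p.1.2 _ x hx]
  rw [funext h1]
  have h2 := tent_prod_hasSum (fun i => lc F i (LL F x))
  have := Fintype.ofFinite (torsion F)
  have h0 : HasSum (fun _ : torsion F => (1:ℝ)) (∑ _ : torsion F, (1:ℝ)) := hasSum_fintype _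
  have h4 := h0.summable.mul_of_nonneg h2.summable (by intro; simp)
    (fun n => Finset.prod_nonneg fun i _ => tent_nonneg _)
  have h3 := HasSum.mul h0 h2 h4
  simp only [one_mul, mul_one, Finset.sum_const, Finset.card_univ, nsmul_eq_mul] at h3
  rw [torsionOrder, ← Fintype.card_eq_nat_card]
  exact h3
end
end

section
section
variable (F : Type) [Field F] [NumberField F]
open NumberField.Units NumberField.Units.dirichletUnitTheorem NumberField.InfinitePlace Module

/-- total log -/
noncomputable def SS (L : InfinitePlace F → ℝ) : ℝ := ∑ v, mult v * L v

lemma sum_mult_dev (L : InfinitePlace F → ℝ) :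
    ∑ w : InfinitePlace F, (mult w : ℝ) * (L w - SS F L * (finrank ℚ F : ℝ)⁻¹) = 0 := by
  have h : (∑ w : InfinitePlace F, (mult w : ℝ)) = finrank ℚ F := by
    exact_mod_cast sum_mult_eq (K := F)
  simp only [mul_sub, Finset.sum_sub_distrib, ← Finset.sum_mul, h]
  have : (finrank ℚ F : ℝ) ≠ 0 := by exact_mod_cast finrank_pos.ne'
  unfold SS; field_simp; ring

lemma wt_bdd : ∃ C0 : ℝ, 0 < C0 ∧ ∀ L : InfinitePlace F → ℝ, (∀ i, |lc F i L| ≤ 1) →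
    ∀ w, |L w - SS F L * (finrank ℚ F : ℝ)⁻¹| ≤ C0 := by
  classical
  set b := (basisUnitLattice F).ofZLatticeBasis ℝ (unitLattice F) with hb
  set B : ℝ := ∑ i, ∑ w, |b i w| with hB
  have hB0 : 0 ≤ B := by positivity
  have key : ∀ L : InfinitePlace F → ℝ, (∀ i, |lc F i L| ≤ 1) → ∀ w, w ≠ w₀ →
      |(mult w : ℝ) * (L w - SS F L * (finrank ℚ F : ℝ)⁻¹)| ≤ B := by
    intro L hL w hw
    have h1 : (mult w : ℝ) * (L w - SS F L * (finrank ℚ F : ℝ)⁻¹) = linP F L ⟨w, hw⟩ := rfl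
    rw [h1, ← b.sum_repr (linP F L), Finset.sum_apply]
    refine (Finset.abs_sum_le_sum_abs _ _).trans ?_
    refine Finset.sum_le_sum fun i _ => ?_
    rw [Pi.smul_apply, smul_eq_mul, abs_mul]
    have h2 : |b.repr (linP F L) i| ≤ 1 := hL i
    calc _ ≤ 1 * |b i ⟨w, hw⟩| := by gcongr
      _ ≤ _ := by rw [one_mul]; exact Finset.single_le_sum (f := fun w => |b i w|) (fun _ _ => abs_nonneg _) (Finset.mem_univ _)
  clear_value B
  clear hB hb b
  have m1 : ∀ w : InfinitePlace F, (1:ℝ) ≤ mult w := fun w => by exact_mod_cast mult_pos (w := w)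
  have red : ∀ (w : InfinitePlace F) (y D : ℝ), |(mult w : ℝ) * y| ≤ D → |y| ≤ D := by
    intro w y D h
    rw [abs_mul, abs_of_nonneg (by linarith [m1 w])] at h
    nlinarith [m1 w, abs_nonneg y]
  refine ⟨(Fintype.card (InfinitePlace F) + 1) * B + B + 1, by positivity, fun L hL w => ?_⟩
  by_cases hw : w = w₀
  · apply red w
    have h := sum_mult_dev F L
    rw [← Finset.add_sum_erase _ _ (Finset.mem_univ w)] at h
    have h3 : |∑ v ∈ Finset.univ.erase w, (mult v : ℝ) * (L v - SS F L * (finrank ℚ F : ℝ)⁻¹)| ≤ Fintype.card (InfinitePlace F) * B := by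
      refine (Finset.abs_sum_le_sum_abs _ _).trans ?_
      refine (Finset.sum_le_card_nsmul _ _ B fun v hv => key L hL v ?_).trans ?_
      · rw [← hw]; exact (Finset.mem_erase.mp hv).1
      · rw [nsmul_eq_mul]; gcongr; exact Finset.card_le_univ _
    rw [eq_neg_of_add_eq_zero_left h, abs_neg]
    nlinarith
  · have := red w _ _ (key L hL w hw)
    have : 0 ≤ (Fintype.card (InfinitePlace F) + 1) * B := by positivity
    linarith

lemma prod_diff_le {ι : Type} (s : Finset ι) (a b : ι → ℝ) (ha : ∀ i, 0 ≤ a i ∧ a i ≤ 1)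
    (hb : ∀ i, 0 ≤ b i ∧ b i ≤ 1) : |∏ i ∈ s, a i - ∏ i ∈ s, b i| ≤ ∑ i ∈ s, |a i - b i| := by
  classical
  induction s using Finset.induction_on with
  | empty => simp
  | insert i s hi ih =>
    rw [Finset.prod_insert hi, Finset.prod_insert hi, Finset.sum_insert hi]
    have h1 : 0 ≤ ∏ i ∈ s, a i := Finset.prod_nonneg fun i _ => (ha i).1
    have h2 : ∏ i ∈ s, a i ≤ 1 := Finset.prod_le_one (fun i _ => (ha i).1) fun i _ => (ha i).2
    have e : a i * ∏ i ∈ s, a i - b i * ∏ i ∈ s, b i = (a i - b i) * ∏ i ∈ s, a i + b i * (∏ i ∈ s, a i - ∏ i ∈ s, b i) := by ring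
    rw [e]
    refine (abs_add_le _ _).trans ?_
    rw [abs_mul, abs_mul, abs_of_nonneg h1, abs_of_nonneg (hb i).1]
    have := abs_nonneg (a i - b i)
    have := abs_nonneg (∏ i ∈ s, a i - ∏ i ∈ s, b i)
    nlinarith [hb i]

lemma wt_nonneg (L) : 0 ≤ wt F L := Finset.prod_nonneg fun _ _ => tent_nonneg _
lemma wt_le_one (L) : wt F L ≤ 1 := Finset.prod_le_one (fun _ _ => tent_nonneg _) fun _ _ => tent_le_one _
lemma wt_supp {L} (h : wt F L ≠ 0) (i) : |lc F i L| ≤ 1 := by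
  by_contra h2
  exact h (Finset.prod_eq_zero (Finset.mem_univ i) (tent_eq_zero (by linarith)))

lemma wt_lip : ∃ C : ℝ, 0 ≤ C ∧ ∀ (L L' : InfinitePlace F → ℝ) (ε : ℝ), (∀ w, |L' w - L w| ≤ ε) →
    |wt F L' - wt F L| ≤ C * ε := by
  classical
  refine ⟨∑ i, ∑ w, |lc F i (Pi.single w 1)|, by positivity, fun L L' ε h => ?_⟩
  refine (prod_diff_le _ _ _ (fun i => ⟨tent_nonneg _, tent_le_one _⟩) (fun i => ⟨tent_nonneg _, tent_le_one _⟩)).trans ?_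
  rw [Finset.sum_mul]
  refine Finset.sum_le_sum fun i _ => (tent_lip _ _).trans ?_
  rw [← map_sub, LinearMap.pi_apply_eq_sum_univ, Finset.sum_mul]
  refine (Finset.abs_sum_le_sum_abs _ _).trans (Finset.sum_le_sum fun w _ => ?_)
  rw [smul_eq_mul, abs_mul, mul_comm, Pi.sub_apply]
  have e : (fun j => if w = j then (1:ℝ) else 0) = Pi.single w 1 := by
    ext j; simp [Pi.single_apply, eq_comm]
  rw [e]
  gcongr; exact h w

lemma SS_lip (L L' : InfinitePlace F → ℝ) (ε : ℝ) (h : ∀ w, |L' w - L w| ≤ ε) :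
    |SS F L' - SS F L| ≤ finrank ℚ F * ε := by
  have h1 : (∑ w : InfinitePlace F, (mult w : ℝ)) = finrank ℚ F := by
    exact_mod_cast sum_mult_eq (K := F)
  unfold SS
  rw [← Finset.sum_sub_distrib, ← h1, Finset.sum_mul]
  refine (Finset.abs_sum_le_sum_abs _ _).trans (Finset.sum_le_sum fun w _ => ?_)
  rw [← mul_sub, abs_mul, abs_of_nonneg (by positivity)]
  gcongr; exact h w

lemma pert : ∃ C : ℝ, 0 ≤ C ∧ ∀ (s : ℝ) (L L' : InfinitePlace F → ℝ) (ε : ℝ), 1 ≤ s → s ≤ 2 → 0 ≤ ε → ε ≤ 1 →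
    (∀ w, |L' w - L w| ≤ ε) → 0 ≤ SS F L →
    |wt F L' * Real.exp (-s * SS F L') - wt F L * Real.exp (-s * SS F L)| ≤ C * ε * Real.exp (- SS F L) := by
  obtain ⟨C, hC, h⟩ := wt_lip F
  set d : ℝ := ((finrank ℚ F : ℕ) : ℝ) with hd
  have hd0 : 0 ≤ d := by positivity
  refine ⟨C + 2 * d * Real.exp (2 * d), by positivity, fun s L L' ε hs hs2 he he1 hL hS => ?_⟩
  have h1 := h L L' ε hL
  have h2 := SS_lip F L L' ε hL
  have e : wt F L' * Real.exp (-s * SS F L') - wt F L * Real.exp (-s * SS F L) =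
      ((wt F L' - wt F L) + wt F L' * (Real.exp (-s * (SS F L' - SS F L)) - 1)) * Real.exp (-s * SS F L) := by
    have : Real.exp (-s * SS F L') = Real.exp (-s * (SS F L' - SS F L)) * Real.exp (-s * SS F L) := by
      rw [← Real.exp_add]; ring_nf
    rw [this]; ring
  rw [e, abs_mul, abs_of_pos (Real.exp_pos _)]
  have h3 : |-s * (SS F L' - SS F L)| ≤ 2 * d * ε := by
    rw [abs_mul, abs_neg, abs_of_nonneg (by linarith)]
    calc _ ≤ 2 * (d * ε) := by gcongr
      _ = _ := by ring
  have h4 : |Real.exp (-s * (SS F L' - SS F L)) - 1| ≤ 2 * d * ε * Real.exp (2 * d) := by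
    set t := -s * (SS F L' - SS F L)
    have h5 : 2 * d * ε ≤ 2 * d := by nlinarith
    have h6 := abs_le.mp h3
    have h9 : 1 ≤ Real.exp (2 * d) := Real.one_le_exp (by positivity)
    rw [abs_le]; constructor
    · have := Real.add_one_le_exp t
      nlinarith
    · have h7 := Real.add_one_le_exp (-t)
      have h8 : Real.exp t ≤ Real.exp (2 * d) := Real.exp_le_exp.mpr (by linarith)
      have h10 : Real.exp t * Real.exp (-t) = 1 := by rw [← Real.exp_add]; simp
      have h11 := Real.exp_pos t
      rcases le_or_gt t 0 with ht | ht
      · have : Real.exp t ≤ 1 := Real.exp_le_one_iff.mpr ht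
        have : 0 ≤ 2 * d * ε * Real.exp (2 * d) := by positivity
        linarith
      · have : Real.exp t - 1 ≤ t * Real.exp t := by nlinarith
        nlinarith
  have h5 : Real.exp (-s * SS F L) ≤ Real.exp (- SS F L) := Real.exp_le_exp.mpr (by nlinarith)
  have h6 : |(wt F L' - wt F L) + wt F L' * (Real.exp (-s * (SS F L' - SS F L)) - 1)| ≤ (C + 2 * d * Real.exp (2 * d)) * ε := by
    refine (abs_add_le _ _).trans ?_
    rw [abs_mul, abs_of_nonneg (wt_nonneg F L')]
    have := wt_le_one F L'
    have := wt_nonneg F L'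
    have := abs_nonneg (Real.exp (-s * (SS F L' - SS F L)) - 1)
    nlinarith
  gcongr

end
end

section
section
variable (F : Type) [Field F] [NumberField F]
open NumberField.Units NumberField.Units.dirichletUnitTheorem NumberField.InfinitePlace Module

lemma norm_one_add_pos (β : F) (h : ∀ w : InfinitePlace F, w β < 1) : 0 < Algebra.norm ℚ (1 + β) := by
  classical
  let f : ℝ → ℂ := fun t => ∏ σ : F →ₐ[ℚ] ℂ, (1 + t * σ β)
  have hs : ∀ σ : F →ₐ[ℚ] ℂ, ‖σ β‖ < 1 := fun σ => h (InfinitePlace.mk σ.toRingHom)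
  have hc : Continuous f := by fun_prop
  let e : (F →ₐ[ℚ] ℂ) → (F →ₐ[ℚ] ℂ) := fun σ => (Complex.conjAe.toAlgHom.restrictScalars ℚ).comp σ
  have he : Function.Involutive e := by
    intro σ; ext x; simp [e]
  have hre : ∀ t, (starRingEnd ℂ) (f t) = f t := by
    intro t
    simp only [f, map_prod]
    apply Fintype.prod_equiv he.toPerm
    intro σ; simp [e]
  have hne : ∀ t ∈ Set.Icc (0:ℝ) 1, f t ≠ 0 := by
    intro t ht
    rw [Finset.prod_ne_zero_iff]
    intro σ _ h0
    have h1 : ‖(t : ℂ) * σ β‖ < 1 := by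
      rw [norm_mul, Complex.norm_real, Real.norm_eq_abs, abs_of_nonneg ht.1]
      nlinarith [hs σ, ht.2, norm_nonneg (σ β), ht.1]
    have h2 : (t : ℂ) * σ β = -1 := by linear_combination h0
    rw [h2] at h1
    simp at h1
  have hre2 : ∀ t, ((f t).re : ℂ) = f t := fun t => Complex.conj_eq_iff_re.mp (hre t)
  have h1 : 0 < (f 1).re := by
    by_contra hcon
    push Not at hcon
    have h0 : (f 0).re = 1 := by simp [f]
    have := intermediate_value_Icc' (zero_le_one' ℝ) (f := fun t => (f t).re) (Complex.continuous_re.comp hc).continuousOn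
    obtain ⟨t, ht, ht0⟩ := this (show (0:ℝ) ∈ _ from ⟨hcon, by rw [h0]; norm_num⟩)
    apply hne t ht
    rw [← hre2 t]; simpa using ht0
  have h2 := Algebra.norm_eq_prod_embeddings ℚ ℂ (1 + β)
  have h3 : f 1 = ((Algebra.norm ℚ (1 + β) : ℚ) : ℂ) := by
    simp only [f]; rw [eq_comm]; simpa using h2
  rw [h3] at h1
  exact_mod_cast h1

lemma norm_sign (x ρ : F) (h : ∀ w : InfinitePlace F, w ρ < w x) : 0 < Algebra.norm ℚ (x + ρ) * Algebra.norm ℚ x := by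
  have w0 : InfinitePlace F := Classical.arbitrary _
  have hx : x ≠ 0 := by
    rintro rfl; have := h w0; rw [map_zero] at this; exact absurd (apply_nonneg w0 ρ) (by linarith)
  have h1 : x + ρ = x * (1 + ρ / x) := by field_simp
  rw [h1, map_mul]
  have h2 := norm_one_add_pos F (ρ / x) (by
    intro w; rw [map_div₀, div_lt_one (InfinitePlace.pos_iff.mpr hx)]; exact h w)
  have h3 : Algebra.norm ℚ x ≠ 0 := Algebra.norm_ne_zero_iff.mpr hx
  have : 0 < Algebra.norm ℚ x * Algebra.norm ℚ x := mul_self_pos.mpr h3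
  nlinarith

open scoped Classical in
/-- sup norm over places -/
noncomputable def nm (x : F) : ℝ := ‖mixedEmbedding F x‖

lemma nm_ge (x : F) (w : InfinitePlace F) : w x ≤ nm F x := by
  rw [nm, mixedEmbedding.norm_eq_sup'_normAtPlace, ← mixedEmbedding.normAtPlace_apply]
  exact Finset.le_sup' (fun w => mixedEmbedding.normAtPlace w (mixedEmbedding F x)) (Finset.mem_univ w)

lemma nm_ex (x : F) : ∃ w : InfinitePlace F, w x = nm F x := by
  rw [nm, mixedEmbedding.norm_eq_sup'_normAtPlace]
  obtain ⟨w, _, hw⟩ := Finset.exists_mem_eq_sup' (Finset.univ_nonempty (α := InfinitePlace F)) (fun w => mixedEmbedding.normAtPlace w (mixedEmbedding F x))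
  exact ⟨w, by rw [hw, mixedEmbedding.normAtPlace_apply]⟩

lemma log_near {a b : ℝ} (ha : 0 < a) (h : |b - a| ≤ a / 2) : |Real.log b - Real.log a| ≤ 2 * |b - a| / a := by
  have h1 := abs_le.mp h
  have hb : 0 < b := by linarith
  have hab : a / 2 ≤ b := by linarith
  have e1 : Real.log b - Real.log a = Real.log (b / a) := by rw [Real.log_div hb.ne' ha.ne']
  have e2 : Real.log a - Real.log b = Real.log (a / b) := by rw [Real.log_div ha.ne' hb.ne']
  have f1 := Real.log_le_sub_one_of_pos (div_pos hb ha)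
  have f2 := Real.log_le_sub_one_of_pos (div_pos ha hb)
  have g1 : b / a - 1 = (b - a) / a := by field_simp
  have g2 : a / b - 1 = (a - b) / b := by field_simp
  rw [abs_le]
  constructor
  · have : (a - b) / b ≤ 2 * |b - a| / a := by
      rw [div_le_div_iff₀ hb ha]
      have := neg_abs_le (b - a)
      nlinarith [abs_nonneg (b - a)]
    linarith
  · have : (b - a) / a ≤ 2 * |b - a| / a := by
      gcongr; linarith [le_abs_self (b - a), abs_nonneg (b - a)]
    linarith

lemma abs_norm_exp {x : F} (hx : x ≠ 0) (s : ℝ) : |((Algebra.norm ℚ x : ℚ) : ℝ)| ^ (-s) = Real.exp (-s * SS F (LL F x)) := by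
  have h0 : ((Algebra.norm ℚ x : ℚ) : ℝ) ≠ 0 := by exact_mod_cast Algebra.norm_ne_zero_iff.mpr hx
  rw [SS, sum_LL F hx, Real.rpow_def_of_pos (abs_pos.mpr h0), mul_comm]

lemma lemQ : ∃ K0 : ℝ, 0 ≤ K0 ∧ ∀ R : ℝ, 0 < R → ∃ C1 : ℝ, 0 < C1 ∧ ∀ x ρ : F, nm F ρ ≤ R → C1 ≤ nm F x → wt F (LL F x) ≠ 0 →
    (∀ w : InfinitePlace F, w ρ < w x) ∧ ∀ s : ℝ, 1 ≤ s → s ≤ 2 →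
      |wt F (LL F (x + ρ)) * Real.exp (-s * SS F (LL F (x + ρ))) - wt F (LL F x) * Real.exp (-s * SS F (LL F x))|
        ≤ K0 * R * (nm F x)⁻¹ ^ (finrank ℚ F + 1) := by
  obtain ⟨C0, hC0, hwt⟩ := wt_bdd F
  obtain ⟨C, hC, hpert⟩ := pert F
  set d := finrank ℚ F with hd
  have hd0 : 0 < (d : ℝ) := by exact_mod_cast finrank_pos
  set c := Real.exp (-(2 * C0)) with hc
  have hc0 : 0 < c := Real.exp_pos _
  refine ⟨C * (2 / c) * Real.exp (d * C0), by positivity, fun R hR => ⟨2 * R / c + Real.exp C0 + R / c, by positivity, ?_⟩⟩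
  intro x ρ hρ hx hw
  have hexp : 0 < Real.exp C0 := Real.exp_pos _
  have hRc : 0 < R / c := by positivity
  have hnm : 0 < nm F x := by
    have : 0 < 2 * R / c := by positivity
    linarith
  have hx0 : x ≠ 0 := by
    rintro rfl; obtain ⟨w, hw⟩ := nm_ex F (0:F); simp at hw; linarith
  have hb := hwt _ (wt_supp F hw)
  obtain ⟨v, hv⟩ := nm_ex F x
  have hlog : Real.log (nm F x) ≤ SS F (LL F x) * (d : ℝ)⁻¹ + C0 := by
    have := (abs_le.mp (hb v)).2
    simp only [LL, hv] at this ⊢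
    linarith
  have hwx : ∀ w : InfinitePlace F, c * nm F x ≤ w x := by
    intro w
    have h1 := (abs_le.mp (hb w)).1
    have h2 : Real.log (nm F x) - 2 * C0 ≤ Real.log (w x) := by
      simp only [LL] at h1 hlog ⊢
      linarith
    have h3 : 0 < w x := InfinitePlace.pos_iff.mpr hx0
    rw [← Real.log_le_log_iff (by positivity) h3, Real.log_mul hc0.ne' hnm.ne', hc, Real.log_exp]
    linarith
  have hrw : ∀ w : InfinitePlace F, w ρ ≤ R := fun w => (nm_ge F ρ w).trans hρ
  have h2R : 2 * R ≤ c * nm F x := by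
    have : 2 * R / c ≤ nm F x := by linarith
    rw [div_le_iff₀ hc0] at this; linarith
  refine ⟨fun w => by linarith [hrw w, hwx w], fun s hs hs2 => ?_⟩
  have hS : 0 ≤ SS F (LL F x) := by
    have h1 : C0 ≤ Real.log (nm F x) := by
      rw [Real.le_log_iff_exp_le hnm]
      have : 0 < 2 * R / c := by positivity
      linarith
    have : 0 ≤ SS F (LL F x) * (d : ℝ)⁻¹ := by linarith
    exact nonneg_of_mul_nonneg_left this (by positivity)
  have hε : ∀ w : InfinitePlace F, |LL F (x + ρ) w - LL F x w| ≤ 2 / c * R * (nm F x)⁻¹ := by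
    intro w
    have h3 : 0 < w x := InfinitePlace.pos_iff.mpr hx0
    have h4 : |w (x + ρ) - w x| ≤ w ρ := by
      have h5 := w.1.abs_abv_sub_le_abv_sub (x + ρ) x
      rw [add_sub_cancel_left] at h5; exact h5
    refine (log_near h3 (by linarith [hrw w, hwx w])).trans ?_
    rw [div_le_iff₀ h3]
    have e : 2 / c * R * (nm F x)⁻¹ * (c * nm F x) = 2 * R := by field_simp
    calc 2 * |w (x + ρ) - w x| ≤ 2 * R := by linarith [hrw w]
      _ = 2 / c * R * (nm F x)⁻¹ * (c * nm F x) := e.symm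
      _ ≤ _ := by gcongr; exact hwx w
  have he1 : 2 / c * R * (nm F x)⁻¹ ≤ 1 := by
    rw [← div_eq_mul_inv, div_le_one hnm, div_mul_eq_mul_div, div_le_iff₀ hc0]; linarith
  refine (hpert s _ _ _ hs hs2 (by positivity) he1 hε hS).trans ?_
  have h7 : Real.exp (-SS F (LL F x)) ≤ Real.exp (d * C0) * (nm F x)⁻¹ ^ d := by
    have : (nm F x)⁻¹ ^ d = Real.exp (-(d * Real.log (nm F x))) := by
      rw [Real.exp_neg, mul_comm, ← Real.rpow_def_of_pos hnm, Real.rpow_natCast, inv_pow]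
    rw [this, ← Real.exp_add]
    apply Real.exp_le_exp.mpr
    have h8 : d * Real.log (nm F x) ≤ d * (SS F (LL F x) * (d : ℝ)⁻¹ + C0) := by gcongr
    have h9 : d * (SS F (LL F x) * (d : ℝ)⁻¹ + C0) = SS F (LL F x) + d * C0 := by field_simp
    linarith
  calc C * (2 / c * R * (nm F x)⁻¹) * Real.exp (-SS F (LL F x))
      ≤ C * (2 / c * R * (nm F x)⁻¹) * (Real.exp (d * C0) * (nm F x)⁻¹ ^ d) := by gcongr
    _ = _ := by rw [pow_succ]; ring

open scoped Classical in
/-- weighted norm power -/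
noncomputable def gg (s : ℝ) (x : F) : ℝ := if x = 0 then 0 else wt F (LL F x) * |((Algebra.norm ℚ x : ℚ) : ℝ)| ^ (-s)

open scoped Classical in
lemma nm_add (x y : F) : nm F (x + y) ≤ nm F x + nm F y := by
  unfold nm; rw [map_add]; exact norm_add_le (mixedEmbedding F x) (mixedEmbedding F y)
open scoped Classical in
lemma nm_neg (x : F) : nm F (-x) = nm F x := by
  unfold nm; rw [map_neg]; exact norm_neg (mixedEmbedding F x)
open scoped Classical in
lemma nm_nonneg (x : F) : 0 ≤ nm F x := by
  unfold nm; exact norm_nonneg (mixedEmbedding F x)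

lemma arith1 {K R X Y : ℝ} (n : ℕ) (hK : 0 ≤ K) (hR : 0 ≤ R) (hX : 0 < X) (hY : X / 2 ≤ Y) :
    K * R * Y⁻¹ ^ n ≤ K * R * 2 ^ n * X⁻¹ ^ n := by
  have hY0 : 0 < Y := by linarith
  have : Y⁻¹ ≤ 2 * X⁻¹ := by
    rw [← div_eq_mul_inv, inv_le_comm₀ hY0 (by positivity), inv_div]; exact hY
  calc _ ≤ K * R * (2 * X⁻¹) ^ n := by gcongr
    _ = _ := by rw [mul_pow]; ring

lemma nm_pos {x : F} (h : x ≠ 0) : 0 < nm F x := by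
  obtain ⟨w, hw⟩ := nm_ex F x
  rw [← hw]; exact InfinitePlace.pos_iff.mpr h

lemma gg_pert (ρ : F) : ∃ C C1 : ℝ, 0 < C1 ∧ 0 ≤ C ∧ ∀ x : F, C1 ≤ nm F x → ∀ s : ℝ, 1 ≤ s → s ≤ 2 →
    |gg F s (x + ρ) - gg F s x| ≤ C * (nm F x)⁻¹ ^ (finrank ℚ F + 1) ∧
    ((gg F s x ≠ 0 ∨ gg F s (x + ρ) ≠ 0) → 0 < Algebra.norm ℚ (x + ρ) * Algebra.norm ℚ x) := by
  obtain ⟨K0, hK0, h⟩ := lemQ F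
  set R := nm F ρ + 1 with hR
  have hρ0 : 0 ≤ nm F ρ := nm_nonneg F ρ
  have hR0 : 0 < R := by linarith
  obtain ⟨C1, hC1, h⟩ := h R hR0
  set d := finrank ℚ F with hd
  refine ⟨K0 * R * 2 ^ (d + 1), 2 * R + 2 * C1, by linarith, by positivity, fun x hx s hs hs2 => ?_⟩
  have hxpos : 0 < nm F x := by linarith
  have hx0 : x ≠ 0 := by
    rintro rfl; obtain ⟨w, hw⟩ := nm_ex F (0:F); simp at hw; linarith
  have htri : nm F x ≤ nm F (x + ρ) + nm F ρ := by
    have := nm_add F (x + ρ) (-ρ); rw [nm_neg] at this; simpa using this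
  have hxr : nm F x / 2 ≤ nm F (x + ρ) := by linarith
  have hxρ0 : x + ρ ≠ 0 := by
    intro h0; obtain ⟨w, hw⟩ := nm_ex F (x + ρ); rw [h0] at hw; simp at hw; rw [h0] at hxr; linarith
  simp only [gg, hx0, hxρ0, if_false, abs_norm_exp F hx0, abs_norm_exp F hxρ0]
  by_cases h1 : wt F (LL F x) = 0
  · by_cases h2 : wt F (LL F (x + ρ)) = 0
    · rw [h1, h2]; simp; positivity
    · have h3 := h (x + ρ) (-ρ) (by rw [nm_neg]; linarith) (by linarith) h2
      rw [add_neg_cancel_right] at h3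
      refine ⟨?_, fun _ => ?_⟩
      · rw [abs_sub_comm]
        refine (h3.2 s hs hs2).trans ?_
        exact arith1 _ hK0 hR0.le hxpos hxr
      · have := norm_sign F (x + ρ) (-ρ) h3.1
        rwa [add_neg_cancel_right, mul_comm] at this
  · have h3 := h x ρ (by linarith) (by linarith) h1
    exact ⟨(h3.2 s hs hs2).trans (arith1 _ hK0 hR0.le hxpos (by linarith)), fun _ => norm_sign F x ρ h3.1⟩

end
end

section
section
variable (F : Type) [Field F] [NumberField F]
open NumberField.InfinitePlace Module

open scoped Classical in
lemma nm_summable : Summable (fun x : 𝓞 F => (nm F (x : F))⁻¹ ^ (finrank ℚ F + 1)) := by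
  have h := ZLattice.summable_norm_zpow (mixedEmbedding.integerLattice F) (-(finrank ℚ F + 1 : ℕ)) (by
    rw [ZLattice.rank ℝ, mixedEmbedding.finrank]; push_cast; linarith)
  let e : 𝓞 F → mixedEmbedding.integerLattice F := fun x => ⟨mixedEmbedding F (x : F), by
    exact ⟨x, by simp⟩⟩
  have he : Function.Injective e := by
    intro x y hxy
    have := congrArg Subtype.val hxy
    exact RingOfIntegers.ext ((mixedEmbedding_injective F) this)
  refine (h.comp_injective he).congr fun x => ?_
  simp only [Function.comp, e, nm]
  rw [zpow_neg, zpow_natCast, inv_pow]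
  rfl

lemma norm_factor (J : Ideal (𝓞 F)) (hJ : J ≠ ⊥) (q : ℕ) : ∃ (f : J → ℤ) (D : ℤ), D.natAbs = Ideal.absNorm J ∧
    (∀ x : J, Algebra.norm ℤ (x : 𝓞 F) = D * f x) ∧ ∀ x β : J, (f (x + q • β) : ZMod q) = f x := by
  classical
  let b := RingOfIntegers.basis F
  let bJ := Ideal.selfBasis b J hJ
  let A : J → Matrix _ _ ℤ := fun x => Matrix.of fun i j => bJ.repr (⟨x * b j, J.mul_mem_right _ x.2⟩ : J) i
  refine ⟨fun x => (A x).det, b.det ((↑) ∘ bJ), Ideal.natAbs_det_basis_change b J bJ, fun x => ?_, fun x β => ?_⟩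
  · rw [Algebra.norm_eq_matrix_det b, Basis.det_apply, ← Matrix.det_mul]
    congr 1
    ext i j
    rw [Algebra.leftMulMatrix_eq_repr_mul, Matrix.mul_apply]
    have h1 : (x : 𝓞 F) * b j = ∑ l, A x l j • ((bJ l : J) : 𝓞 F) := by
      have := bJ.sum_repr (⟨x * b j, J.mul_mem_right _ x.2⟩ : J)
      have := congrArg (Subtype.val) this
      simp only [AddSubmonoidClass.coe_finsetSum] at this
      rw [← this]; rfl
    rw [h1, map_sum, Finsupp.finsetSum_apply]
    refine Finset.sum_congr rfl fun l _ => ?_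
    rw [map_zsmul, Finsupp.smul_apply, smul_eq_mul, mul_comm]; rfl
  · have h2 : ∀ y : J, ((A y).det : ZMod q) = ((A y).map (Int.cast : ℤ → ZMod q)).det := by
      intro y
      exact Int.cast_det (A y)
    rw [h2, h2]
    congr 1
    ext i j
    simp only [A, Matrix.map_apply, Matrix.of_apply]
    have : (⟨((x + q • β : J) : 𝓞 F) * b j, J.mul_mem_right _ (x + q • β).2⟩ : J) = ⟨x * b j, J.mul_mem_right _ x.2⟩ + q • ⟨β * b j, J.mul_mem_right _ β.2⟩ := by
      apply Subtype.ext
      simp [add_mul, mul_assoc]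
    rw [this, map_add, map_nsmul, Finsupp.add_apply, Finsupp.smul_apply, nsmul_eq_mul]
    push_cast
    rw [ZMod.natCast_self, zero_mul, add_zero]

lemma norm_cast_congr (J : Ideal (𝓞 F)) (hJ : J ≠ ⊥) (q : ℕ) (x β : J)
    (h : 0 < Algebra.norm ℚ (((x : 𝓞 F) + q • (β : 𝓞 F) : 𝓞 F) : F) * Algebra.norm ℚ ((x : 𝓞 F) : F)) :
    (((Algebra.norm ℤ ((x : 𝓞 F) + q • (β : 𝓞 F) : 𝓞 F)).natAbs / Ideal.absNorm J : ℕ) : ZMod q) =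
      (((Algebra.norm ℤ (x : 𝓞 F)).natAbs / Ideal.absNorm J : ℕ) : ZMod q) := by
  obtain ⟨f, D, hD, hf, hc⟩ := norm_factor F J hJ q
  have hpos : 0 < Ideal.absNorm J := Nat.pos_of_ne_zero (by rwa [Ne, Ideal.absNorm_eq_zero_iff])
  have h1 : Algebra.norm ℤ ((x : 𝓞 F) + q • (β : 𝓞 F) : 𝓞 F) = D * f (x + q • β) := by
    rw [← hf]; simp
  have hs := hc x β
  rw [← Algebra.coe_norm_int, ← Algebra.coe_norm_int, h1, hf] at h
  have h3 : 0 < (D * f (x + q • β)) * (D * f x) := by exact_mod_cast h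
  rw [h1, hf, Int.natAbs_mul, Int.natAbs_mul, hD, Nat.mul_div_cancel_left _ hpos, Nat.mul_div_cancel_left _ hpos]
  have h4 : 0 < f (x + q • β) * f x := by
    have : (D * f (x + q • β)) * (D * f x) = D^2 * (f (x + q • β) * f x) := by ring
    rw [this] at h3
    exact pos_of_mul_pos_right h3 (sq_nonneg D)
  rcases mul_pos_iff.mp h4 with ⟨ha, hb⟩ | ⟨ha, hb⟩
  · have e1 : ((f (x + q • β)).natAbs : ℤ) = f (x + q • β) := Int.natAbs_of_nonneg ha.le
    have e2 : ((f x).natAbs : ℤ) = f x := Int.natAbs_of_nonneg hb.le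
    rw [← Int.cast_natCast, e1, ← Int.cast_natCast (f x).natAbs, e2, hs]
  · have e1 : ((f (x + q • β)).natAbs : ℤ) = -f (x + q • β) := by omega
    have e2 : ((f x).natAbs : ℤ) = -f x := by omega
    rw [← Int.cast_natCast, e1, ← Int.cast_natCast (f x).natAbs, e2, Int.cast_neg, Int.cast_neg, hs]

variable {q : ℕ} (χ : DirichletCharacter ℂ q) (J : Ideal (𝓞 F))

noncomputable def GG (s : ℝ) (x : 𝓞 F) : ℂ :=
  ((gg F s (x : F) * (Ideal.absNorm J : ℝ) ^ s : ℝ) : ℂ) * χ (((Algebra.norm ℤ x).natAbs / Ideal.absNorm J : ℕ) : ZMod q)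

lemma gg_nonneg (s : ℝ) (x : F) : 0 ≤ gg F s x := by
  unfold gg; split_ifs
  · rfl
  · exact mul_nonneg (wt_nonneg F _) (Real.rpow_nonneg (abs_nonneg _) _)

lemma gg_le_one (s : ℝ) (hs : 0 ≤ s) (x : 𝓞 F) : gg F s (x : F) ≤ 1 := by
  unfold gg; split_ifs with h
  · norm_num
  · refine mul_le_one₀ (wt_le_one F _) (Real.rpow_nonneg (abs_nonneg _) _) ?_
    apply Real.rpow_le_one_of_one_le_of_nonpos _ (by linarith)
    rw [← Algebra.coe_norm_int]
    have : Algebra.norm ℤ x ≠ 0 := by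
      rw [Ne, Algebra.norm_eq_zero_iff]; exact fun h' => h (by simp [h'])
    have := Int.one_le_abs this
    exact_mod_cast this

lemma GG_bound (hJ : J ≠ ⊥) (s : ℝ) (hs : 0 ≤ s) (hs2 : s ≤ 2) (x : 𝓞 F) : ‖GG F χ J s x‖ ≤ (Ideal.absNorm J : ℝ) ^ 2 := by
  have hpos : 0 < Ideal.absNorm J := Nat.pos_of_ne_zero (by rwa [Ne, Ideal.absNorm_eq_zero_iff])
  have h1 : (1:ℝ) ≤ Ideal.absNorm J := by exact_mod_cast hpos
  unfold GG
  rw [norm_mul, Complex.norm_real, Real.norm_eq_abs, abs_of_nonneg (mul_nonneg (gg_nonneg F _ _) (by positivity))]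
  have h2 : (Ideal.absNorm J : ℝ) ^ s ≤ (Ideal.absNorm J : ℝ) ^ 2 := by
    rw [← Real.rpow_natCast]; exact Real.rpow_le_rpow_of_exponent_le h1 (by exact_mod_cast hs2)
  calc _ ≤ 1 * (Ideal.absNorm J : ℝ) ^ 2 * 1 := by
        gcongr
        · exact gg_le_one F s hs x
        · exact χ.norm_le_one _
    _ = _ := by ring

lemma GG_zero (s) : GG F χ J s 0 = 0 := by simp [GG, gg]

lemma GG_pert (hJ : J ≠ ⊥) (β : J) : ∃ C : ℝ, 0 ≤ C ∧ ∀ x : J, (x : 𝓞 F) ≠ 0 → ∀ s : ℝ, 1 ≤ s → s ≤ 2 →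
    ‖GG F χ J s ((x : 𝓞 F) + q • (β : 𝓞 F)) - GG F χ J s (x : 𝓞 F)‖ ≤ C * (nm F ((x : 𝓞 F) : F))⁻¹ ^ (finrank ℚ F + 1) := by
  obtain ⟨C, C1, hC1, hC, h⟩ := gg_pert F (((q • (β : 𝓞 F) : 𝓞 F)) : F)
  have hpos : 0 < Ideal.absNorm J := Nat.pos_of_ne_zero (by rwa [Ne, Ideal.absNorm_eq_zero_iff])
  have hN1 : (1:ℝ) ≤ Ideal.absNorm J := by exact_mod_cast hpos
  refine ⟨C * (Ideal.absNorm J : ℝ) ^ 2 + 2 * (Ideal.absNorm J : ℝ) ^ 2 * C1 ^ (finrank ℚ F + 1), by positivity, fun x hx s hs hs2 => ?_⟩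
  have hx0 : ((x : 𝓞 F) : F) ≠ 0 := by simpa using hx
  have hnp := nm_pos F hx0
  rcases le_or_gt C1 (nm F ((x : 𝓞 F) : F)) with h1 | h1
  · obtain ⟨h2, h3⟩ := h _ h1 s hs hs2
    have key : ‖GG F χ J s ((x : 𝓞 F) + q • (β : 𝓞 F)) - GG F χ J s (x : 𝓞 F)‖ ≤
        |gg F s (((x : 𝓞 F) : F) + (((q • (β : 𝓞 F) : 𝓞 F)) : F)) - gg F s ((x : 𝓞 F) : F)| * (Ideal.absNorm J : ℝ) ^ 2 := by
      have hcast : (((x : 𝓞 F) + q • (β : 𝓞 F) : 𝓞 F) : F) = ((x : 𝓞 F) : F) + (((q • (β : 𝓞 F) : 𝓞 F)) : F) := by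
        exact map_add (algebraMap (𝓞 F) F) _ _
      by_cases h4 : gg F s ((x : 𝓞 F) : F) ≠ 0 ∨ gg F s (((x : 𝓞 F) : F) + (((q • (β : 𝓞 F) : 𝓞 F)) : F)) ≠ 0
      · have h5 := norm_cast_congr F J hJ q x β (by rw [hcast]; exact h3 h4)
        unfold GG
        rw [h5, hcast, ← sub_mul, norm_mul, ← Complex.ofReal_sub, Complex.norm_real, ← sub_mul, Real.norm_eq_abs, abs_mul]
        have h2 : (Ideal.absNorm J : ℝ) ^ s ≤ (Ideal.absNorm J : ℝ) ^ 2 := by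
          rw [← Real.rpow_natCast]; exact Real.rpow_le_rpow_of_exponent_le hN1 (by exact_mod_cast hs2)
        rw [abs_of_nonneg (by positivity : (0:ℝ) ≤ (Ideal.absNorm J : ℝ) ^ s)]
        refine (mul_le_of_le_one_right (by positivity) (χ.norm_le_one _)).trans ?_
        gcongr
      · push Not at h4
        unfold GG
        rw [hcast, h4.1, h4.2]; simp
    refine key.trans ?_
    calc _ ≤ (C * (nm F ((x : 𝓞 F) : F))⁻¹ ^ (finrank ℚ F + 1)) * (Ideal.absNorm J : ℝ) ^ 2 := by gcongr
      _ = C * (Ideal.absNorm J : ℝ) ^ 2 * (nm F ((x : 𝓞 F) : F))⁻¹ ^ (finrank ℚ F + 1) := by ring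
      _ ≤ _ := by gcongr; linarith [show 0 ≤ 2 * (Ideal.absNorm J : ℝ) ^ 2 * C1 ^ (finrank ℚ F + 1) by positivity]
  · have b1 := GG_bound F χ J hJ s (by linarith) hs2 ((x : 𝓞 F) + q • (β : 𝓞 F))
    have b2 := GG_bound F χ J hJ s (by linarith) hs2 (x : 𝓞 F)
    have b3 : 1 ≤ C1 ^ (finrank ℚ F + 1) * (nm F ((x : 𝓞 F) : F))⁻¹ ^ (finrank ℚ F + 1) := by
      rw [← mul_pow]; apply one_le_pow₀
      rw [← div_eq_mul_inv, le_div_iff₀ hnp]; linarith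
    calc _ ≤ 2 * (Ideal.absNorm J : ℝ) ^ 2 := by
          refine (norm_sub_le _ _).trans ?_; linarith
      _ ≤ 2 * (Ideal.absNorm J : ℝ) ^ 2 * (C1 ^ (finrank ℚ F + 1) * (nm F ((x : 𝓞 F) : F))⁻¹ ^ (finrank ℚ F + 1)) :=
          le_mul_of_one_le_right (by positivity) b3
      _ = 2 * (Ideal.absNorm J : ℝ) ^ 2 * C1 ^ (finrank ℚ F + 1) * (nm F ((x : 𝓞 F) : F))⁻¹ ^ (finrank ℚ F + 1) := by ring
      _ ≤ _ := by gcongr; linarith [show 0 ≤ C * (Ideal.absNorm J : ℝ) ^ 2 by positivity]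

lemma GG_cont (hJ : J ≠ ⊥) (x : 𝓞 F) : Continuous (fun s => GG F χ J s x) := by
  have hpos : 0 < Ideal.absNorm J := Nat.pos_of_ne_zero (by rwa [Ne, Ideal.absNorm_eq_zero_iff])
  have hN1 : (0:ℝ) < Ideal.absNorm J := by exact_mod_cast hpos
  unfold GG gg
  by_cases hx : (x : F) = 0
  · simp only [hx, if_true, zero_mul, Complex.ofReal_zero]; exact continuous_const
  · simp only [hx, if_false]
    have : |((Algebra.norm ℚ (x : F) : ℚ) : ℝ)| ≠ 0 := by
      rw [abs_ne_zero]; exact_mod_cast (Algebra.norm_ne_zero_iff.mpr hx)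
    refine Continuous.mul (Complex.continuous_ofReal.comp ?_) continuous_const
    refine Continuous.mul (Continuous.mul continuous_const ?_) ?_
    · exact Continuous.rpow continuous_const continuous_neg (fun _ => Or.inl this)
    · exact Continuous.rpow continuous_const continuous_id (fun _ => Or.inl hN1.ne')

lemma GG_diff_tendsto (hJ : J ≠ ⊥) (β : J) (J' : Ideal (𝓞 F)) (hJ' : J' ≤ J) : ∃ ℓ : ℂ,
    Filter.Tendsto (fun s => ∑' x : J', (GG F χ J s ((x : 𝓞 F) + q • (β : 𝓞 F)) - GG F χ J s (x : 𝓞 F)))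
      (nhdsWithin 1 (Set.Ioi 1)) (nhds ℓ) := by
  obtain ⟨C, hC, h⟩ := GG_pert F χ J hJ β
  classical
  refine ⟨∑' x : J', (GG F χ J 1 ((x : 𝓞 F) + q • (β : 𝓞 F)) - GG F χ J 1 (x : 𝓞 F)), ?_⟩
  apply tendsto_tsum_of_dominated_convergence
    (bound := fun x : J' => C * (nm F ((x : 𝓞 F) : F))⁻¹ ^ (finrank ℚ F + 1) + if x = 0 then 2 * (Ideal.absNorm J : ℝ) ^ 2 else 0)
  · apply Summable.add
    · exact ((nm_summable F).comp_injective Subtype.val_injective).mul_left C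
    · exact (hasSum_ite_eq (0 : J') _).summable
  · intro x
    have := (((GG_cont F χ J hJ ((x : 𝓞 F) + q • (β : 𝓞 F))).sub (GG_cont F χ J hJ (x : 𝓞 F))).tendsto 1)
    exact this.mono_left nhdsWithin_le_nhds
  · have : Set.Ioc (1:ℝ) 2 ∈ nhdsWithin (1:ℝ) (Set.Ioi 1) := Ioc_mem_nhdsGT (by norm_num)
    filter_upwards [this] with s hs x
    by_cases hx : x = 0
    · have b1 := GG_bound F χ J hJ s (by linarith [hs.1]) hs.2 ((x : 𝓞 F) + q • (β : 𝓞 F))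
      have b2 := GG_bound F χ J hJ s (by linarith [hs.1]) hs.2 (x : 𝓞 F)
      rw [if_pos hx]
      have := nm_nonneg F ((x : 𝓞 F) : F)
      have h3 : 0 ≤ C * (nm F ((x : 𝓞 F) : F))⁻¹ ^ (finrank ℚ F + 1) := by positivity
      refine (norm_sub_le _ _).trans ?_
      linarith
    · rw [if_neg hx, add_zero]
      exact h ⟨x, hJ' x.2⟩ (by simpa using hx) s hs.1.le hs.2

end
end

section
section
variable (F : Type) [Field F] [NumberField F]
open NumberField.Units Module nonZeroDivisors Ideal

noncomputable def aF (n : ℕ) : ℕ := Nat.card {I : Ideal (𝓞 F) // absNorm I = n}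

lemma aF_LS {s : ℝ} (hs : 1 < s) : LSeriesSummable (fun n => (aF F n : ℂ)) (s : ℂ) := by
  have h := (Ideal.tendsto_norm_le_div_atTop₀ F).comp tendsto_natCast_atTop_atTop
  have hO : (fun n ↦ ∑ k ∈ Finset.Icc 1 n, (aF F k : ℝ)) =O[Filter.atTop] fun n ↦ (n : ℝ) ^ (1:ℝ) := by
    have h2 : (fun n : ℕ => (∑ k ∈ Finset.Icc 1 n, (aF F k : ℝ)) / n) =O[Filter.atTop] fun _ => (1:ℝ) := by
      refine Filter.Tendsto.isBigO_one ℝ (c := _) (h.congr fun n => ?_)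
      simp only [Function.comp_apply, Nat.cast_le, ← Nat.cast_sum]
      congr
      unfold aF
      rw [← add_left_inj 1, ← card_norm_le_eq_card_norm_le_add_one,
        show Finset.Icc 1 n = Finset.Ioc 0 n from Finset.Icc_succ_left_eq_Ioc _ _,
        show 1 = Nat.card {I : Ideal (𝓞 F) // absNorm I = 0} by simp [Ideal.absNorm_eq_zero_iff],
        Finset.sum_Ioc_add_eq_sum_Icc (n.zero_le),
        ← Finset.card_preimage_eq_sum_card_image_eq (fun k _ ↦ finite_setOfPred_absNorm_eq k)]
      simp [Set.coe_eq_subtype]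
    have h3 := h2.mul (Asymptotics.isBigO_refl (fun n : ℕ => (n:ℝ)) Filter.atTop)
    refine (h3.congr' ?_ ?_)
    · filter_upwards [Filter.eventually_gt_atTop 0] with n hn
      field_simp
    · filter_upwards with n; simp
  have := LSeriesSummable_of_sum_norm_bigO_and_nonneg (s := (s:ℂ)) hO (fun n => by positivity) zero_le_one (by simpa using hs)
  simpa using this

lemma aF_summable {s : ℝ} (hs : 1 < s) : Summable (fun n : ℕ => (aF F n : ℝ) * (n : ℝ) ^ (-s)) := by
  have h := (aF_LS F hs).norm
  refine (summable_nat_add_iff 1).mp (((summable_nat_add_iff 1).mpr h).congr fun n => ?_)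
  rw [LSeries.norm_term_eq]
  simp only [Nat.add_eq_zero_iff, one_ne_zero, and_false, if_false, Complex.ofReal_re, Complex.norm_natCast]
  rw [Real.rpow_neg (by positivity), div_eq_mul_inv]

instance fibFin (n : ℕ) : Finite {I : (Ideal (𝓞 F))⁰ // absNorm (I : Ideal (𝓞 F)) = n} := by
  have : Finite {I : Ideal (𝓞 F) // absNorm I = n} := finite_setOfPred_absNorm_eq n
  exact Finite.of_injective (fun I => (⟨I.1.1, I.2⟩ : {I : Ideal (𝓞 F) // absNorm I = n})) (by
    intro a b hab
    apply Subtype.ext; apply Subtype.ext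
    simpa using hab)

lemma fib_card {n : ℕ} (hn : n ≠ 0) : Nat.card {I : (Ideal (𝓞 F))⁰ // absNorm (I : Ideal (𝓞 F)) = n} = aF F n := by
  refine Nat.card_congr ⟨fun I => ⟨I.1.1, I.2⟩, fun I => ⟨⟨I.1, ?_⟩, I.2⟩, fun _ => rfl, fun _ => rfl⟩
  rw [mem_nonZeroDivisors_iff_ne_zero]
  intro h
  have := I.2; rw [h] at this; simp at this; exact hn this.symm

/-- sums over ideals versus sums over norms -/
lemma ideal_hasSum (f : ℕ → ℂ) (h0 : f 0 = 0) (h : Summable (fun n => (aF F n : ℝ) * ‖f n‖)) :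
    Summable (fun I : (Ideal (𝓞 F))⁰ => ‖f (absNorm (I : Ideal (𝓞 F)))‖) ∧
    ∑' I : (Ideal (𝓞 F))⁰, f (absNorm (I : Ideal (𝓞 F))) = ∑' n, (aF F n : ℂ) * f n := by
  let e := Equiv.sigmaFiberEquiv (fun I : (Ideal (𝓞 F))⁰ => absNorm (I : Ideal (𝓞 F)))
  have hE : ∀ p, absNorm ((e p : (Ideal (𝓞 F))⁰) : Ideal (𝓞 F)) = p.1 := fun p => p.2.2
  have hs : Summable (fun p => ‖f (absNorm ((e p : (Ideal (𝓞 F))⁰) : Ideal (𝓞 F)))‖) := by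
    simp only [hE]
    rw [summable_sigma_of_nonneg (fun _ => norm_nonneg _)]
    refine ⟨fun n => Summable.of_finite, ?_⟩
    refine h.congr fun n => ?_
    dsimp only
    have := Fintype.ofFinite {I : (Ideal (𝓞 F))⁰ // absNorm (I : Ideal (𝓞 F)) = n}
    rw [tsum_fintype, Finset.sum_const, Finset.card_univ, nsmul_eq_mul, ← Nat.card_eq_fintype_card]
    by_cases hn : n = 0
    · rw [hn, h0]; simp
    · rw [fib_card F hn]
  refine ⟨e.summable_iff.mp hs, ?_⟩
  rw [← e.tsum_eq]
  have hs2 := hs.of_norm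
  simp only [hE] at hs2 ⊢
  rw [hs2.tsum_sigma]
  refine tsum_congr fun n => ?_
  dsimp only
  have := Fintype.ofFinite {I : (Ideal (𝓞 F))⁰ // absNorm (I : Ideal (𝓞 F)) = n}
  rw [tsum_fintype, Finset.sum_const, Finset.card_univ, nsmul_eq_mul, ← Nat.card_eq_fintype_card]
  by_cases hn : n = 0
  · rw [hn, h0]; simp
  · rw [fib_card F hn]

lemma ideal_summable {s : ℝ} (hs : 1 < s) : Summable (fun I : (Ideal (𝓞 F))⁰ => (absNorm (I : Ideal (𝓞 F)) : ℝ) ^ (-s)) := by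
  have h := (ideal_hasSum F (fun n => (((n : ℝ) ^ (-s) : ℝ) : ℂ)) (by
      rw [Nat.cast_zero, Real.zero_rpow (by linarith)]; rfl) (by
    refine (aF_summable F hs).congr fun n => ?_
    rw [Complex.norm_real, Real.norm_of_nonneg (by positivity)])).1
  refine h.congr fun I => ?_
  rw [Complex.norm_real, Real.norm_of_nonneg (by positivity)]

variable {q : ℕ} (χ : DirichletCharacter ℂ q)

noncomputable def psi (s : ℝ) (I : (Ideal (𝓞 F))⁰) : ℂ :=
  χ ((absNorm (I : Ideal (𝓞 F)) : ℕ) : ZMod q) * (((absNorm (I : Ideal (𝓞 F)) : ℝ) ^ (-s) : ℝ) : ℂ)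

lemma psi_norm (s : ℝ) (I) : ‖psi F χ s I‖ ≤ (absNorm (I : Ideal (𝓞 F)) : ℝ) ^ (-s) := by
  unfold psi
  rw [norm_mul, Complex.norm_real, Real.norm_of_nonneg (by positivity)]
  exact mul_le_of_le_one_left (by positivity) (χ.norm_le_one _)

lemma psi_summable {s : ℝ} (hs : 1 < s) : Summable (psi F χ s) :=
  Summable.of_norm_bounded (ideal_summable F hs) (psi_norm F χ s)

noncomputable def ZZ (c : ClassGroup (𝓞 F)) (s : ℝ) : ℂ :=
  ∑' I : {I : (Ideal (𝓞 F))⁰ // ClassGroup.mk0 I = c}, psi F χ s I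

lemma sum_ZZ {s : ℝ} (hs : 1 < s) : ∑ c, ZZ F χ c s = ∑' I, psi F χ s I := by
  let e := Equiv.sigmaFiberEquiv (fun I : (Ideal (𝓞 F))⁰ => ClassGroup.mk0 I)
  rw [← e.tsum_eq, Summable.tsum_sigma, tsum_fintype]
  · rfl
  · exact e.summable_iff.mpr (psi_summable F χ hs)

lemma gen_prod_sum {S U : Type} (ψ : S → ℂ) (B : S → ℝ) (w : S → U → ℝ) (t : ℝ) (h1 : ∀ I, ‖ψ I‖ ≤ B I) (hB : Summable B)
    (hw : ∀ I u, 0 ≤ w I u) (h2 : ∀ I, HasSum (w I) t) :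
    HasSum (fun p : S × U => ψ p.1 * ((w p.1 p.2 : ℝ) : ℂ)) (t * ∑' I, ψ I) := by
  have hB0 : ∀ I, 0 ≤ B I := fun I => (norm_nonneg _).trans (h1 I)
  have hsum : Summable (fun p : S × U => ψ p.1 * ((w p.1 p.2 : ℝ) : ℂ)) := by
    have : Summable (fun p : S × U => B p.1 * w p.1 p.2) := by
      rw [summable_prod_of_nonneg (fun p => mul_nonneg (hB0 _) (hw _ _))]
      refine ⟨fun I => Summable.mul_left (f := w I) (B I) (h2 I).summable, ?_⟩
      have : ∀ I : S, ∑' u : U, B I * w I u = B I * t := fun I => (HasSum.mul_left (f := w I) (B I) (h2 I)).tsum_eq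
      simp only [this]
      exact hB.mul_right _
    refine Summable.of_norm_bounded this fun p => ?_
    rw [norm_mul, Complex.norm_real, Real.norm_of_nonneg (hw _ _)]
    exact mul_le_mul_of_nonneg_right (h1 _) (hw _ _)
  have htot := hsum.hasSum
  have : ∑' p : S × U, ψ p.1 * ((w p.1 p.2 : ℝ) : ℂ) = t * ∑' I, ψ I := by
    rw [hsum.tsum_prod]
    have h12 : ∀ I : S, ∑' u : U, ψ I * ((w I u : ℝ) : ℂ) = ψ I * (t : ℂ) := by
      intro I
      exact (HasSum.mul_left (f := fun u => ((w I u : ℝ) : ℂ)) (ψ I) (Complex.hasSum_ofReal.mpr (h2 I))).tsum_eq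
    simp only [h12]
    rw [tsum_mul_right, mul_comm]
  rw [← this]; exact htot

lemma gen_ex (I J : (Ideal (𝓞 F))⁰) (h : ClassGroup.mk0 I = (ClassGroup.mk0 J)⁻¹) :
    ∃ x : 𝓞 F, Ideal.span {x} = (I : Ideal (𝓞 F)) * J ∧ x ≠ 0 ∧ x ∈ (J : Ideal (𝓞 F)) := by
  have h1 : ClassGroup.mk0 (I * J) = 1 := by rw [map_mul, h, inv_mul_cancel]
  obtain ⟨x, hx⟩ := (ClassGroup.mk0_eq_one_iff (I * J).2).mp h1
  have h2 : Ideal.span {x} = (I : Ideal (𝓞 F)) * J := by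
    rw [← Ideal.submodule_span_eq, ← hx]; rfl
  refine ⟨x, h2, ?_, ?_⟩
  · rintro rfl
    rw [Ideal.span_singleton_zero] at h2
    exact nonZeroDivisors.coe_ne_zero (I * J) h2.symm
  · have : x ∈ (I : Ideal (𝓞 F)) * J := by rw [← h2]; exact Ideal.mem_span_singleton_self _
    exact (Ideal.mul_le_right : (I : Ideal (𝓞 F)) * (J : Ideal (𝓞 F)) ≤ J) this

lemma GG_val (I J : (Ideal (𝓞 F))⁰) (y : 𝓞 F) (hy0 : y ≠ 0) (hy : Ideal.span {y} = (I : Ideal (𝓞 F)) * J) (s : ℝ) (u : (𝓞 F)ˣ) :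
    GG F χ J s ((u : 𝓞 F) * y) = psi F χ s I * ((wt F (LL F (((u : 𝓞 F) : F) * (y : F))) : ℝ) : ℂ) := by
  have hJ0 : (J : Ideal (𝓞 F)) ≠ ⊥ := nonZeroDivisors.coe_ne_zero J
  have hNJ : 0 < absNorm (J : Ideal (𝓞 F)) := Nat.pos_of_ne_zero (by rwa [Ne, Ideal.absNorm_eq_zero_iff])
  have hne : ((u : 𝓞 F) : F) * (y : F) ≠ 0 := mul_ne_zero (by simp) (by simpa using hy0)
  have h6 : (Algebra.norm ℤ ((u : 𝓞 F) * y)).natAbs = absNorm (I : Ideal (𝓞 F)) * absNorm (J : Ideal (𝓞 F)) := by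
    rw [← Ideal.absNorm_span_singleton, ← map_mul, ← hy]
    congr 1
    rw [Ideal.span_singleton_eq_span_singleton, mul_comm]
    exact associated_mul_unit_left _ _ u.isUnit
  have h9 : (((u : 𝓞 F) * y : 𝓞 F) : F) = ((u : 𝓞 F) : F) * (y : F) := map_mul (algebraMap (𝓞 F) F) _ _
  have h7 : |((Algebra.norm ℚ (((u : 𝓞 F) : F) * (y : F)) : ℚ) : ℝ)| = (absNorm (I : Ideal (𝓞 F)) : ℝ) * absNorm (J : Ideal (𝓞 F)) := by
    rw [← h9, ← Algebra.coe_norm_int]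
    have h8 : |((Algebra.norm ℤ ((u : 𝓞 F) * y) : ℤ) : ℝ)| = ((Algebra.norm ℤ ((u : 𝓞 F) * y)).natAbs : ℝ) := by
      rw [Nat.cast_natAbs]; push_cast; rfl
    rw [Rat.cast_intCast, h8, h6]; push_cast; rfl
  unfold GG gg psi
  rw [h6, Nat.mul_div_cancel _ hNJ]
  rw [h9, if_neg hne, h7, Real.mul_rpow (by positivity) (by positivity)]
  have h10 : (absNorm (J : Ideal (𝓞 F)) : ℝ) ^ (-s) * (absNorm (J : Ideal (𝓞 F)) : ℝ) ^ s = 1 := by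
    rw [← Real.rpow_add (by exact_mod_cast hNJ)]; simp
  have h11 : ∀ a b c d : ℝ, c * d = 1 → a * (b * c) * d = a * b := by
    intro a b c d h; rw [mul_assoc, mul_assoc, h, mul_one]
  rw [h11 _ _ _ _ h10]
  push_cast; ring

set_option maxHeartbeats 400000 in
lemma GG_hasSum (J : (Ideal (𝓞 F))⁰) {s : ℝ} (hs : 1 < s) :
    HasSum (fun x : (J : Ideal (𝓞 F)) => GG F χ J s x) (torsionOrder F * ZZ F χ (ClassGroup.mk0 J)⁻¹ s) := by
  classical
  have hJ0 : (J : Ideal (𝓞 F)) ≠ ⊥ := nonZeroDivisors.coe_ne_zero J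
  have hNJ : 0 < absNorm (J : Ideal (𝓞 F)) := Nat.pos_of_ne_zero (by rwa [Ne, Ideal.absNorm_eq_zero_iff])
  let S := {I : (Ideal (𝓞 F))⁰ // ClassGroup.mk0 I = (ClassGroup.mk0 J)⁻¹}
  have hgen : ∀ I : S, ∃ x : 𝓞 F, Ideal.span {x} = (I.1 : Ideal (𝓞 F)) * J ∧ x ≠ 0 ∧ x ∈ (J : Ideal (𝓞 F)) :=
    fun I => gen_ex F I.1 J I.2
  choose y hy hy0 hyJ using hgen
  let g : S × (𝓞 F)ˣ → (J : Ideal (𝓞 F)) := fun p => ⟨p.2 * y p.1, Ideal.mul_mem_left _ _ (hyJ p.1)⟩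
  have hginj : Function.Injective g := by
    rintro ⟨I, u⟩ ⟨I', u'⟩ h
    have h1 : (u : 𝓞 F) * y I = u' * y I' := congrArg Subtype.val h
    have h2 : Ideal.span {y I} = Ideal.span {y I'} := by
      rw [Ideal.span_singleton_eq_span_singleton]
      refine ⟨u * u'⁻¹, ?_⟩
      have : (u : 𝓞 F) * y I * (u'⁻¹ : (𝓞 F)ˣ) = y I' := by
        rw [h1, mul_comm (u' : 𝓞 F), mul_assoc, Units.mul_inv, mul_one]
      rw [← this]; push_cast; ring
    rw [hy, hy] at h2
    have h3 : I = I' := by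
      apply Subtype.ext; apply Subtype.ext
      exact mul_right_cancel₀ hJ0 h2
    subst h3
    have h4 := mul_right_cancel₀ (hy0 I) h1
    rw [Units.val_inj] at h4
    rw [h4]
  have hrange : ∀ x ∉ Set.range g, GG F χ J s (x : 𝓞 F) = 0 := by
    intro x hx
    by_contra hne
    have hx0 : (x : 𝓞 F) ≠ 0 := fun h0 => hne (by rw [h0, GG_zero])
    apply hx
    obtain ⟨I, hI⟩ : (J : Ideal (𝓞 F)) ∣ Ideal.span {(x : 𝓞 F)} := by
      rw [Ideal.dvd_span_singleton]; exact x.2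
    have hI0 : I ≠ 0 := by
      rintro rfl
      rw [mul_zero] at hI
      exact hx0 (Ideal.span_singleton_eq_bot.mp hI)
    let I' : (Ideal (𝓞 F))⁰ := ⟨I, mem_nonZeroDivisors_iff_ne_zero.mpr hI0⟩
    have hc : ClassGroup.mk0 I' = (ClassGroup.mk0 J)⁻¹ := by
      rw [eq_inv_iff_mul_eq_one, ← map_mul]
      rw [ClassGroup.mk0_eq_one_iff]
      refine ⟨x, ?_⟩
      rw [Ideal.submodule_span_eq, hI, mul_comm]; rfl
    have h5 : Ideal.span {y ⟨I', hc⟩} = Ideal.span {(x : 𝓞 F)} := by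
      rw [hy, hI, mul_comm]
    obtain ⟨u, hu⟩ := Ideal.span_singleton_eq_span_singleton.mp h5
    refine ⟨(⟨I', hc⟩, u), ?_⟩
    apply Subtype.ext
    change (u : 𝓞 F) * y ⟨I', hc⟩ = x
    rw [mul_comm, hu]
  rw [← hginj.hasSum_iff hrange]
  have hval : ∀ p : S × (𝓞 F)ˣ, GG F χ J s (g p : 𝓞 F) = psi F χ s p.1 * ((wt F (LL F (((p.2 : 𝓞 F) : F) * (y p.1 : F))) : ℝ) : ℂ) := by
    rintro ⟨I, u⟩
    exact GG_val F χ I.1 J (y I) (hy0 I) (hy I) s u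
  have hfib : ∀ I : S, HasSum (fun u : (𝓞 F)ˣ => wt F (LL F (((u : 𝓞 F) : F) * (y I : F)))) (torsionOrder F) :=
    fun I => units_hasSum F (y I) (by simpa using hy0 I)
  have hfin := gen_prod_sum (fun I : S => psi F χ s I) (fun I : S => (absNorm (I.1 : Ideal (𝓞 F)) : ℝ) ^ (-s)) (fun (I : S) (u : (𝓞 F)ˣ) => wt F (LL F (((u : 𝓞 F) : F) * (y I : F)))) _
    (fun I => psi_norm F χ s I.1) ((ideal_summable F hs).comp_injective Subtype.val_injective) (fun I u => wt_nonneg F _) hfib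
  have hfun : (fun x : (J : Ideal (𝓞 F)) => GG F χ J s x) ∘ g = fun p : S × (𝓞 F)ˣ => psi F χ s p.1 * ((wt F (LL F (((p.2 : 𝓞 F) : F) * (y p.1 : F))) : ℝ) : ℂ) :=
    funext hval
  rw [hfun]
  convert hfin using 1
  push_cast; rfl

end
end

section
section

/-- abstract coset decomposition with representatives in `q A` -/
lemma coset_decomp {M : Type} [AddCommGroup M] (A B : AddSubgroup M) (hBA : B ≤ A) (q m : ℕ) (hm : B.relIndex A = m) (hm0 : m ≠ 0)
    (hq : m.Coprime q) : ∃ β : Fin m → A, Function.Bijective (fun p : Fin m × B => (⟨(p.2 : M) + q • (β p.1 : M),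
      A.add_mem (hBA p.2.2) (A.nsmul_mem (β p.1).2 q)⟩ : A)) := by
  classical
  let B' := B.addSubgroupOf A
  have hcard : Nat.card (A ⧸ B') = m := hm
  have : Finite (A ⧸ B') := Nat.finite_of_card_ne_zero (by rw [hcard]; exact hm0)
  let e : Fin m ≃ A ⧸ B' := (Finite.equivFinOfCardEq hcard).symm
  let n := nsmulCoprime (G := A ⧸ B') (n := q) (by rw [hcard]; exact hq)
  have hβ : ∀ i : Fin m, ∃ b : A, (QuotientAddGroup.mk (q • b) : A ⧸ B') = e i := by
    intro i
    obtain ⟨b, hb⟩ := QuotientAddGroup.mk_surjective (n.symm (e i))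
    refine ⟨b, ?_⟩
    have h1 : n (QuotientAddGroup.mk b) = e i := by rw [hb, Equiv.apply_symm_apply]
    rw [← h1]; rfl
  choose β hβ using hβ
  refine ⟨β, ?_, ?_⟩
  · rintro ⟨i, x⟩ ⟨j, y⟩ h
    have h1 : (x : M) + q • (β i : M) = (y : M) + q • (β j : M) := congrArg Subtype.val h
    have h2 : e i = e j := by
      rw [← hβ, ← hβ, QuotientAddGroup.eq, AddSubgroup.mem_addSubgroupOf]
      have : ((-(q • β i) + q • β j : A) : M) = x - y := by
        push_cast
        rw [neg_add_eq_sub, sub_eq_sub_iff_add_eq_add, add_comm, ← h1]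
      rw [this]; exact B.sub_mem x.2 y.2
    have h3 := e.injective h2
    subst h3
    have h4 := add_right_cancel h1
    rw [Subtype.ext h4]
  · intro x
    let i := e.symm (QuotientAddGroup.mk x)
    have h1 : (QuotientAddGroup.mk (q • β i) : A ⧸ B') = QuotientAddGroup.mk x := by
      rw [hβ]; simp [i]
    rw [QuotientAddGroup.eq, AddSubgroup.mem_addSubgroupOf] at h1
    refine ⟨(i, ⟨_, h1⟩), ?_⟩
    apply Subtype.ext
    push_cast
    abel

variable (F : Type) [Field F] [NumberField F]
open NumberField.Units Module nonZeroDivisors Ideal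
variable {q : ℕ} (χ : DirichletCharacter ℂ q)

lemma GG_scale (J m : Ideal (𝓞 F)) (hJ : J ≠ ⊥) (hm : m ≠ ⊥) (s : ℝ) (x : 𝓞 F) (hx : x ∈ J * m) :
    GG F χ J s x = χ (absNorm m : ZMod q) * (((absNorm m : ℝ) ^ (-s) : ℝ) : ℂ) * GG F χ (J * m) s x := by
  have hNJ : 0 < absNorm J := Nat.pos_of_ne_zero (by rwa [Ne, Ideal.absNorm_eq_zero_iff])
  have hNm : 0 < absNorm m := Nat.pos_of_ne_zero (by rwa [Ne, Ideal.absNorm_eq_zero_iff])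
  obtain ⟨n, hn⟩ : absNorm J * absNorm m ∣ (Algebra.norm ℤ x).natAbs := by
    rw [← map_mul, ← Ideal.absNorm_span_singleton]
    exact map_dvd _ (Ideal.dvd_span_singleton.mpr hx)
  unfold GG
  rw [map_mul absNorm, hn, Nat.mul_div_cancel_left _ (Nat.mul_pos hNJ hNm), mul_assoc, Nat.mul_div_cancel_left _ hNJ]
  push_cast
  rw [map_mul, Real.mul_rpow (by positivity) (by positivity)]
  have h10 : (((absNorm m : ℝ) ^ (-s) : ℝ) : ℂ) * (((absNorm m : ℝ) ^ s : ℝ) : ℂ) = 1 := by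
    rw [← Complex.ofReal_mul, ← Real.rpow_add (by exact_mod_cast hNm)]; simp
  rw [Complex.ofReal_mul]
  linear_combination (-(gg F s (x:F) : ℂ) * (((absNorm J : ℝ) ^ s : ℝ) : ℂ) * χ (absNorm m : ZMod q) * χ (n : ZMod q)) * h10

lemma ZZ_rel (J m : (Ideal (𝓞 F))⁰) (hq : (absNorm (m : Ideal (𝓞 F))).Coprime q) : ∃ (h : ℝ → ℂ) (ℓ : ℂ),
    Filter.Tendsto h (nhdsWithin 1 (Set.Ioi 1)) (nhds ℓ) ∧ ∀ s, 1 < s →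
      ZZ F χ (ClassGroup.mk0 J)⁻¹ s = h s + (((absNorm (m : Ideal (𝓞 F)) : ℝ) ^ (1 - s) : ℝ) : ℂ) * χ (absNorm (m : Ideal (𝓞 F)) : ZMod q) *
        ZZ F χ (ClassGroup.mk0 (J * m))⁻¹ s := by
  obtain ⟨J, hJm⟩ := J
  obtain ⟨m, hmm⟩ := m
  have hJ0 : J ≠ ⊥ := nonZeroDivisors.ne_zero hJm
  have hm0 : m ≠ ⊥ := nonZeroDivisors.ne_zero hmm
  have hNm : 0 < absNorm m := Nat.pos_of_ne_zero (by rwa [Ne, Ideal.absNorm_eq_zero_iff])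
  have hNJ : 0 < absNorm J := Nat.pos_of_ne_zero (by rwa [Ne, Ideal.absNorm_eq_zero_iff])
  have hle : J * m ≤ J := Ideal.mul_le_left
  have hrel : (J * m).toAddSubgroup.relIndex J.toAddSubgroup = absNorm m := by
    have h1 := AddSubgroup.relIndex_mul_index (H := (J * m).toAddSubgroup) (K := J.toAddSubgroup) hle
    rw [← absNorm_eq_index, ← absNorm_eq_index, map_mul, mul_comm] at h1
    exact Nat.eq_of_mul_eq_mul_left hNJ h1
  obtain ⟨β, hβ⟩ := coset_decomp J.toAddSubgroup (J * m).toAddSubgroup hle q (absNorm m) hrel hNm.ne' hq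
  have hw : (torsionOrder F : ℂ) ≠ 0 := by exact_mod_cast (torsionOrder_pos F).ne'
  have hconv : ∀ i, ∃ ℓ : ℂ, Filter.Tendsto (fun s => ∑' x : ↥(J * m), (GG F χ J s ((x : 𝓞 F) + q • ((β i : J.toAddSubgroup) : 𝓞 F)) - GG F χ J s (x : 𝓞 F)))
      (nhdsWithin 1 (Set.Ioi 1)) (nhds ℓ) := fun i =>
    GG_diff_tendsto F χ J hJ0 (⟨(β i : 𝓞 F), (β i).2⟩ : J) (J * m) hle
  choose ℓ hℓ using hconv
  refine ⟨fun s => (torsionOrder F : ℂ)⁻¹ * ∑ i, ∑' x : ↥(J * m), (GG F χ J s ((x : 𝓞 F) + q • ((β i : J.toAddSubgroup) : 𝓞 F)) - GG F χ J s (x : 𝓞 F)), _,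
    Filter.Tendsto.const_mul _ (tendsto_finsetSum _ (fun i _ => hℓ i)), fun s hs => ?_⟩
  have H1 := GG_hasSum F χ ⟨J, hJm⟩ hs
  have H2 := GG_hasSum F χ (⟨J, hJm⟩ * ⟨m, hmm⟩) hs
  set Z1 := ZZ F χ (ClassGroup.mk0 ⟨J, hJm⟩)⁻¹ s with hZ1
  set Z2 := ZZ F χ (ClassGroup.mk0 (⟨J, hJm⟩ * ⟨m, hmm⟩))⁻¹ s with hZ2
  replace H1 : HasSum (fun x : J.toAddSubgroup => GG F χ J s (x : 𝓞 F)) (torsionOrder F * Z1) := H1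
  replace H2 : HasSum (fun x : ↥(J * m) => GG F χ (J * m) s (x : 𝓞 F)) (torsionOrder F * Z2) := H2
  have H3 : HasSum (fun x : ↥(J * m) => GG F χ J s (x : 𝓞 F)) (χ (absNorm m : ZMod q) * (((absNorm m : ℝ) ^ (-s) : ℝ) : ℂ) * (torsionOrder F * Z2)) := by
    have := H2.mul_left (χ (absNorm m : ZMod q) * (((absNorm m : ℝ) ^ (-s) : ℝ) : ℂ))
    refine this.congr_fun fun x => ?_
    exact (GG_scale F χ J m hJ0 hm0 s x x.2)
  have H4 := (Equiv.ofBijective _ hβ).hasSum_iff.mpr H1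
  have H5 : HasSum (fun p : Fin (absNorm m) × ↥(J * m) => GG F χ J s ((p.2 : 𝓞 F) + q • ((β p.1 : J.toAddSubgroup) : 𝓞 F))) (torsionOrder F * Z1) := H4
  have H6 := H5.summable.tsum_prod
  rw [H5.tsum_eq, tsum_fintype] at H6
  have hfibs : ∀ i, Summable (fun x : ↥(J * m) => GG F χ J s ((x : 𝓞 F) + q • ((β i : J.toAddSubgroup) : 𝓞 F))) := fun i =>
    H5.summable.prod_factor i
  have H7 : ∀ i, ∑' x : ↥(J * m), GG F χ J s ((x : 𝓞 F) + q • ((β i : J.toAddSubgroup) : 𝓞 F)) =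
      ∑' x : ↥(J * m), (GG F χ J s ((x : 𝓞 F) + q • ((β i : J.toAddSubgroup) : 𝓞 F)) - GG F χ J s (x : 𝓞 F)) +
        (χ (absNorm m : ZMod q) * (((absNorm m : ℝ) ^ (-s) : ℝ) : ℂ) * (torsionOrder F * Z2)) := by
    intro i
    rw [← H3.tsum_eq, (hfibs i).tsum_sub H3.summable, sub_add_cancel]
  simp only [H7] at H6
  rw [Finset.sum_add_distrib, Finset.sum_const, Finset.card_univ, Fintype.card_fin, nsmul_eq_mul] at H6
  have h10 : (((absNorm m : ℝ) ^ (1 - s) : ℝ) : ℂ) = (absNorm m : ℂ) * (((absNorm m : ℝ) ^ (-s) : ℝ) : ℂ) := by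
    rw [sub_eq_add_neg, Real.rpow_add (by exact_mod_cast hNm), Real.rpow_one]; push_cast; rfl
  change Z1 = _ + (((absNorm m : ℝ) ^ (1 - s) : ℝ) : ℂ) * χ (absNorm m : ZMod q) * Z2
  rw [h10]
  apply mul_left_cancel₀ hw
  rw [H6, mul_add]
  dsimp only
  rw [mul_inv_cancel_left₀ hw]
  ring

/-- Main output of part A1 -/
theorem L_limit (m : (Ideal (𝓞 F))⁰) (hq : (absNorm (m : Ideal (𝓞 F))).Coprime q) (hχ : χ (absNorm (m : Ideal (𝓞 F)) : ZMod q) ≠ 1) :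
    ∃ ℓ : ℂ, Filter.Tendsto (fun s : ℝ => ∑' I, psi F χ s I) (nhdsWithin 1 (Set.Ioi 1)) (nhds ℓ) := by
  have hNm : (0:ℝ) < absNorm (m : Ideal (𝓞 F)) := by
    exact_mod_cast Nat.pos_of_ne_zero (by rw [Ne, Ideal.absNorm_eq_zero_iff]; exact nonZeroDivisors.coe_ne_zero m)
  have hJ : ∀ c : ClassGroup (𝓞 F), ∃ J : (Ideal (𝓞 F))⁰, (ClassGroup.mk0 J)⁻¹ = c := by
    intro c
    obtain ⟨J, hJ⟩ := ClassGroup.mk0_surjective c⁻¹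
    exact ⟨J, by rw [hJ, inv_inv]⟩
  choose J hJ using hJ
  choose h ℓ hl hrel using fun c => ZZ_rel F χ (J c) m hq
  let t : ℝ → ℂ := fun s => (((absNorm (m : Ideal (𝓞 F)) : ℝ) ^ (1 - s) : ℝ) : ℂ) * χ (absNorm (m : Ideal (𝓞 F)) : ZMod q)
  have ht : Filter.Tendsto t (nhdsWithin 1 (Set.Ioi 1)) (nhds (χ (absNorm (m : Ideal (𝓞 F)) : ZMod q))) := by
    have : Continuous t := by
      refine Continuous.mul (Complex.continuous_ofReal.comp ?_) continuous_const
      exact Continuous.rpow continuous_const (by fun_prop) (fun _ => Or.inl hNm.ne')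
    have h2 := this.tendsto 1
    simp only [t, sub_self, Real.rpow_zero, Complex.ofReal_one, one_mul] at h2
    exact h2.mono_left nhdsWithin_le_nhds
  have hsum : Filter.Tendsto (fun s => ∑ c, h c s) (nhdsWithin 1 (Set.Ioi 1)) (nhds (∑ c, ℓ c)) :=
    tendsto_finsetSum _ fun c _ => hl c
  have hlim := hsum.div (tendsto_const_nhds (x := (1:ℂ)) |>.sub ht) (sub_ne_zero.mpr (Ne.symm hχ))
  refine ⟨_, hlim.congr' ?_⟩
  have hne : ∀ᶠ s in nhdsWithin (1:ℝ) (Set.Ioi 1), (1 - t s) ≠ 0 :=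
    (tendsto_const_nhds (x := (1:ℂ)) |>.sub ht).eventually_ne (sub_ne_zero.mpr (Ne.symm hχ))
  filter_upwards [hne, self_mem_nhdsWithin] with s hs hs1
  rw [Set.mem_Ioi] at hs1
  rw [Pi.div_apply, div_eq_iff hs, ← sum_ZZ F χ hs1]
  have e1 : ∑ c, ZZ F χ c s = ∑ c, h c s + t s * ∑ c, ZZ F χ c s := by
    conv_lhs => 
      arg 2; ext c; rw [← hJ c, hrel c s hs1, map_mul, mul_inv, hJ c]
    rw [Finset.sum_add_distrib, ← Finset.mul_sum]
    congr 2
    exact Fintype.sum_equiv (Equiv.mulRight (ClassGroup.mk0 m)⁻¹) _ _ (fun c => rfl)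
  linear_combination -e1

end
end

section
section
variable (F : Type) [Field F] [NumberField F]
open NumberField.Units Module nonZeroDivisors Ideal

lemma aF_one : aF F 1 = 1 := by
  unfold aF
  rw [Nat.card_eq_one_iff_unique]
  constructor
  · constructor
    intro a b
    apply Subtype.ext
    rw [absNorm_eq_one_iff.mp a.2, absNorm_eq_one_iff.mp b.2]
  · exact ⟨⟨⊤, absNorm_top⟩⟩

lemma absNorm_mem_of {I : Ideal (𝓞 F)} {m : ℕ} (h : absNorm I = m) : (m : 𝓞 F) ∈ I := by
  rw [← h]; exact absNorm_mem I

lemma sup_span_eq {A B : Ideal (𝓞 F)} {m n : ℕ} (hc : m.Coprime n) (hA : absNorm A = m) (hB : absNorm B = n) :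
    A * B ⊔ span {(m : 𝓞 F)} = A := by
  apply le_antisymm
  · refine sup_le Ideal.mul_le_left ?_
    rw [span_singleton_le_iff_mem]; exact absNorm_mem_of F hA
  · have h1 : B ⊔ span {(m : 𝓞 F)} = ⊤ := by
      rw [eq_top_iff_one]
      have := Nat.isCoprime_iff_coprime.mpr hc
      obtain ⟨a, b, hab⟩ := this
      have h2 : (1 : 𝓞 F) = (b : 𝓞 F) * (n : 𝓞 F) + (a : 𝓞 F) * (m : 𝓞 F) := by
        have := congrArg (fun x : ℤ => (x : 𝓞 F)) hab
        push_cast at this; rw [← this]; ring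
      rw [h2]
      exact Submodule.add_mem_sup (mul_mem_left _ _ (absNorm_mem_of F hB)) (mul_mem_left _ _ (mem_span_singleton_self _))
    calc A = A * (B ⊔ span {(m : 𝓞 F)}) := by rw [h1, mul_top]
      _ = A * B ⊔ A * span {(m : 𝓞 F)} := Ideal.mul_sup _ _ _
      _ ≤ _ := sup_le_sup le_rfl Ideal.mul_le_right

lemma norm_dvd_of {I : Ideal (𝓞 F)} {m n : ℕ} (hc : m.Coprime n) (hI : absNorm I = m * n) :
    absNorm (I ⊔ span {(m : 𝓞 F)}) ∣ m := by
  have h1 : absNorm (I ⊔ span {(m : 𝓞 F)}) ∣ m * n := by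
    rw [← hI]; exact absNorm_dvd_absNorm_of_le le_sup_left
  have h2 : absNorm (I ⊔ span {(m : 𝓞 F)}) ∣ m ^ Module.finrank ℤ (𝓞 F) := by
    rw [← absNorm_span_natCast]; exact absNorm_dvd_absNorm_of_le le_sup_right
  refine Nat.Coprime.dvd_of_dvd_mul_right ?_ h1
  exact Nat.Coprime.coprime_dvd_left h2 (Nat.Coprime.pow_left _ hc)

lemma aF_mul {m n : ℕ} (hc : m.Coprime n) (hm : m ≠ 0) (hn : n ≠ 0) : aF F (m * n) = aF F m * aF F n := by
  unfold aF
  rw [← Nat.card_prod]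
  symm
  refine Nat.card_eq_of_bijective (fun p => ⟨p.1.1 * p.2.1, by rw [map_mul, p.1.2, p.2.2]⟩) ⟨?_, ?_⟩
  · rintro ⟨⟨A, hA⟩, ⟨B, hB⟩⟩ ⟨⟨A', hA'⟩, ⟨B', hB'⟩⟩ h
    have h : A * B = A' * B' := congrArg Subtype.val h
    have e1 : A = A' := by rw [← sup_span_eq F hc hA hB, h, sup_span_eq F hc hA' hB']
    have e2 : B = B' := by
      rw [← sup_span_eq F hc.symm hB hA, mul_comm B A, h, mul_comm A' B', sup_span_eq F hc.symm hB' hA']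
    subst e1 e2; rfl
  · rintro ⟨I, hI⟩
    have hAB : (I ⊔ span {(m : 𝓞 F)}) * (I ⊔ span {(n : 𝓞 F)}) = I := by
      apply le_antisymm
      · rw [Ideal.mul_sup, Ideal.sup_mul, Ideal.sup_mul]
        refine sup_le (sup_le Ideal.mul_le_left Ideal.mul_le_right) (sup_le Ideal.mul_le_left ?_)
        rw [span_singleton_mul_span_singleton, span_singleton_le_iff_mem, ← Nat.cast_mul]
        exact absNorm_mem_of F hI
      · have h1 : span {(m : 𝓞 F)} ⊔ span {(n : 𝓞 F)} = ⊤ := by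
          rw [eq_top_iff_one]
          have := Nat.isCoprime_iff_coprime.mpr hc
          obtain ⟨a, b, hab⟩ := this
          have h2 : (1 : 𝓞 F) = (a : 𝓞 F) * (m : 𝓞 F) + (b : 𝓞 F) * (n : 𝓞 F) := by
            have := congrArg (fun x : ℤ => (x : 𝓞 F)) hab
            push_cast at this; rw [← this]
          rw [h2]
          exact Submodule.add_mem_sup (mul_mem_left _ _ (mem_span_singleton_self _)) (mul_mem_left _ _ (mem_span_singleton_self _))
        calc I = (span {(m : 𝓞 F)} ⊔ span {(n : 𝓞 F)}) * I := by rw [h1, top_mul]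
          _ = span {(m : 𝓞 F)} * I ⊔ I * span {(n : 𝓞 F)} := by rw [Ideal.sup_mul, mul_comm I]
          _ ≤ _ := sup_le (Ideal.mul_mono le_sup_right le_sup_left) (Ideal.mul_mono le_sup_left le_sup_right)
    have d1 := norm_dvd_of F hc hI
    have d2 := norm_dvd_of F hc.symm ((mul_comm m n) ▸ hI)
    have hN : absNorm (I ⊔ span {(m : 𝓞 F)}) * absNorm (I ⊔ span {(n : 𝓞 F)}) = m * n := by
      rw [← map_mul, hAB, hI]
    have l1 := Nat.le_of_dvd (Nat.pos_of_ne_zero hm) d1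
    have l2 := Nat.le_of_dvd (Nat.pos_of_ne_zero hn) d2
    have hm' := Nat.pos_of_ne_zero hm
    have hn' := Nat.pos_of_ne_zero hn
    have e1 : absNorm (I ⊔ span {(m : 𝓞 F)}) = m := by nlinarith
    have e2 : absNorm (I ⊔ span {(n : 𝓞 F)}) = n := by nlinarith
    exact ⟨⟨⟨_, e1⟩, ⟨_, e2⟩⟩, Subtype.ext hAB⟩

/-- primes above `p` -/
def PP (p : ℕ) : Set (Ideal (𝓞 F)) := {P | P.IsPrime ∧ (p : 𝓞 F) ∈ P}

lemma PP_card {p : ℕ} (hp : p.Prime) : (PP F p).Finite ∧ (PP F p).ncard ≤ finrank ℚ F := by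
  have hp0 : span {(p : ℤ)} ≠ ⊥ := by simpa using hp.ne_zero
  have hmax : (span {(p : ℤ)}).IsMaximal := by
    exact PrincipalIdealRing.isMaximal_of_irreducible (Nat.prime_iff_prime_int.mp hp).irreducible
  have h1 := card_primesOverFinset_le_finrank (𝓞 F) ℚ F (p := span {(p : ℤ)}) hp0
  have h2 := IsDedekindDomain.coe_primesOverFinset hp0 (𝓞 F)
  have h3 : PP F p = ((span {(p : ℤ)}).primesOver (𝓞 F)) := by
    ext P
    constructor
    · rintro ⟨h, h'⟩
      refine ⟨h, ⟨?_⟩⟩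
      refine (hmax.eq_of_le (comap_ne_top _ h.ne_top) ?_)
      rw [span_singleton_le_iff_mem, mem_comap]; simpa using h'
    · rintro ⟨h, h'⟩
      refine ⟨h, ?_⟩
      have : (p : ℤ) ∈ P.under ℤ := by rw [← h'.over]; exact mem_span_singleton_self _
      simpa [under_def] using this
  rw [h3, ← h2, Set.ncard_coe_finset]
  exact ⟨Finset.finite_toSet _, h1⟩

open UniqueFactorizationMonoid in
lemma aF_pow_le {p : ℕ} (hp : p.Prime) (e : ℕ) : aF F (p ^ e) ≤ (e + 1) ^ finrank ℚ F := by
  classical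
  obtain ⟨hfin, hcard⟩ := PP_card F hp
  have := hfin.to_subtype
  have := Fintype.ofFinite (PP F p)
  have key : ∀ I : Ideal (𝓞 F), absNorm I = p ^ e → I ≠ 0 ∧ ∀ P ∈ normalizedFactors I, P ∈ PP F p ∧ p ∣ absNorm P := by
    intro I hI
    have hI0 : I ≠ 0 := by
      rintro rfl
      rw [map_zero] at hI
      exact pow_ne_zero e hp.ne_zero hI.symm
    refine ⟨hI0, fun P hP => ?_⟩
    have hPp := prime_of_normalized_factor P hP
    have hPP : P.IsPrime := isPrime_of_prime hPp
    have hPI := dvd_of_mem_normalizedFactors hP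
    refine ⟨⟨hPP, ?_⟩, ?_⟩
    · have := (le_of_dvd hPI) (absNorm_mem_of F hI)
      push_cast at this
      exact hPP.mem_of_pow_mem _ this
    · have h1 : absNorm P ∣ p ^ e := by rw [← hI]; exact map_dvd absNorm hPI
      obtain ⟨j, -, hj⟩ := (Nat.dvd_prime_pow hp).mp h1
      rw [hj]
      refine dvd_pow_self _ ?_
      rintro rfl
      rw [pow_zero, absNorm_eq_one_iff] at hj
      exact hPP.ne_top hj
  have hc : ∀ I : Ideal (𝓞 F), absNorm I = p ^ e → ∀ P, (normalizedFactors I).count P < e + 1 := by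
    intro I hI P
    obtain ⟨h0, h1⟩ := key I hI
    refine Nat.lt_succ_of_le ((Multiset.count_le_card _ _).trans ?_)
    have h2 : p ^ (normalizedFactors I).card ∣ absNorm I := by
      have h3 : absNorm I = ((normalizedFactors I).map absNorm).prod := by
        conv_lhs => rw [← associated_iff_eq.mp (prod_normalizedFactors h0)]
        rw [map_multiset_prod]
      have h4 : ∀ s : Multiset (Ideal (𝓞 F)), (∀ P ∈ s, p ∣ absNorm P) → p ^ s.card ∣ (s.map absNorm).prod := by
        intro s
        induction s using Multiset.induction with
        | empty => simp
        | cons a s ih =>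
          intro h
          rw [Multiset.card_cons, Multiset.map_cons, Multiset.prod_cons, pow_succ, mul_comm]
          exact mul_dvd_mul (h a (Multiset.mem_cons_self _ _)) (ih fun P hP => h P (Multiset.mem_cons_of_mem hP))
      rw [h3]
      exact h4 _ fun P hP => (h1 P hP).2
    rw [hI] at h2
    exact (Nat.pow_dvd_pow_iff_le_right hp.one_lt).mp h2
  let φ : {I : Ideal (𝓞 F) // absNorm I = p ^ e} → (PP F p → Fin (e + 1)) :=
    fun I P => ⟨(normalizedFactors I.1).count P.1, hc I.1 I.2 P.1⟩
  have hφ : Function.Injective φ := by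
    intro I J hIJ
    apply Subtype.ext
    obtain ⟨hI0, hI1⟩ := key I.1 I.2
    obtain ⟨hJ0, hJ1⟩ := key J.1 J.2
    rw [← associated_iff_eq, associated_iff_normalizedFactors_eq_normalizedFactors hI0 hJ0]
    ext P
    by_cases hP : P ∈ PP F p
    · have := congrFun hIJ ⟨P, hP⟩
      exact congrArg Fin.val this
    · rw [Multiset.count_eq_zero_of_notMem (fun h => hP (hI1 P h).1), Multiset.count_eq_zero_of_notMem (fun h => hP (hJ1 P h).1)]
  have h5 := Nat.card_le_card_of_injective φ hφ
  rw [Nat.card_fun, Nat.card_fin, Nat.card_coe_set_eq] at h5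
  exact h5.trans (Nat.pow_le_pow_right (Nat.succ_pos _) hcard)

end
end

section
section
variable (F : Type) [Field F] [NumberField F]
open NumberField.Units Module nonZeroDivisors Ideal
variable {q : ℕ} (χ : DirichletCharacter ℂ q)

noncomputable def ff (s : ℝ) (n : ℕ) : ℂ := (aF F n : ℂ) * (χ (n : ZMod q) * (((n : ℝ) ^ (-s) : ℝ) : ℂ))

lemma ff_norm (s : ℝ) (n : ℕ) : ‖ff F χ s n‖ ≤ (aF F n : ℝ) * (n : ℝ) ^ (-s) := by
  unfold ff
  rw [norm_mul, norm_mul, Complex.norm_real, Real.norm_of_nonneg (by positivity), Complex.norm_natCast]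
  gcongr
  exact mul_le_of_le_one_left (by positivity) (χ.norm_le_one _)

lemma ff_summable {s : ℝ} (hs : 1 < s) : Summable (fun n => ‖ff F χ s n‖) :=
  Summable.of_nonneg_of_le (fun _ => norm_nonneg _) (ff_norm F χ s) (aF_summable F hs)

lemma ff_zero {s : ℝ} (hs : 1 < s) : ff F χ s 0 = 0 := by
  unfold ff
  simp only [Nat.cast_zero]; rw [Real.zero_rpow (by linarith)]; simp

lemma ff_one (s : ℝ) : ff F χ s 1 = 1 := by
  unfold ff; simp [aF_one]

lemma ff_mul {s : ℝ} (hs : 1 < s) {m n : ℕ} (h : m.Coprime n) : ff F χ s (m * n) = ff F χ s m * ff F χ s n := by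
  by_cases hm : m = 0
  · subst hm; simp [ff_zero F χ hs]
  by_cases hn : n = 0
  · subst hn; simp [ff_zero F χ hs]
  unfold ff
  rw [aF_mul F h hm hn]
  push_cast
  rw [map_mul, Real.mul_rpow (by positivity) (by positivity)]
  push_cast; ring

lemma psi_eq_ff {s : ℝ} (hs : 1 < s) : ∑' I, psi F χ s I = ∑' n, ff F χ s n := by
  have := (ideal_hasSum F (fun n => χ (n : ZMod q) * (((n : ℝ) ^ (-s) : ℝ) : ℂ)) (by
    simp only [Nat.cast_zero]; rw [Real.zero_rpow (by linarith)]; simp) (by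
    refine (ff_summable F χ hs).congr fun n => ?_
    unfold ff; rw [norm_mul (aF F n : ℂ), Complex.norm_natCast])).2
  exact this

noncomputable def EE (s : ℝ) (p : ℕ) : ℂ := ∑' e : ℕ, ff F χ s (p ^ e)

lemma euler {s : ℝ} (hs : 1 < s) : HasProd (fun p : Nat.Primes => EE F χ s p) (∑' I, psi F χ s I) := by
  rw [psi_eq_ff F χ hs]
  exact EulerProduct.eulerProduct_hasProd (ff_one F χ s) (fun h => ff_mul F χ hs h) (ff_summable F χ hs) (ff_zero F χ hs)

lemma ff_pow_norm {s : ℝ} (hs : 1 < s) {p : ℕ} (hp : p.Prime) (e : ℕ) :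
    ‖ff F χ s (p ^ e)‖ ≤ ((e : ℝ) + 1) ^ finrank ℚ F * ((p : ℝ)⁻¹) ^ e := by
  refine (ff_norm F χ s _).trans ?_
  have h1 : (aF F (p ^ e) : ℝ) ≤ ((e : ℝ) + 1) ^ finrank ℚ F := by exact_mod_cast aF_pow_le F hp e
  have hp1 : (1 : ℝ) ≤ p := by exact_mod_cast hp.one_le
  have h2 : (((p ^ e : ℕ) : ℝ)) ^ (-s) ≤ ((p : ℝ)⁻¹) ^ e := by
    calc (((p ^ e : ℕ) : ℝ)) ^ (-s) ≤ (((p ^ e : ℕ) : ℝ)) ^ (-1 : ℝ) := by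
          apply Real.rpow_le_rpow_of_exponent_le _ (by linarith)
          push_cast; exact one_le_pow₀ hp1
      _ = _ := by rw [Real.rpow_neg_one]; push_cast; rw [inv_pow]
  gcongr

noncomputable def AA : ℝ := ∑' e : ℕ, ((e : ℝ) + 3) ^ finrank ℚ F * (1 / 2 : ℝ) ^ e

lemma AA_summable (j : ℕ) : Summable (fun e : ℕ => ((e : ℝ) + j) ^ finrank ℚ F * (1 / 2 : ℝ) ^ e) := by
  have h := summable_pow_mul_geometric_of_norm_lt_one (R := ℝ) (finrank ℚ F) (r := 1 / 2) (by norm_num)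
  have h2 := ((summable_nat_add_iff j).mpr h).mul_left ((2 : ℝ) ^ j)
  refine h2.congr fun e => ?_
  push_cast
  rw [pow_add]
  have : (2 : ℝ) ^ j * (1 / 2) ^ j = 1 := by rw [← mul_pow]; norm_num
  linear_combination (((e : ℝ) + j) ^ finrank ℚ F * (1 / 2) ^ e) * this

lemma AA_nonneg : 0 ≤ AA F := tsum_nonneg fun e => by positivity

lemma EE_summable {s : ℝ} (hs : 1 < s) {p : ℕ} (hp : p.Prime) : Summable (fun e => ff F χ s (p ^ e)) := by
  refine Summable.of_norm_bounded (AA_summable F 1) fun e => (ff_pow_norm F χ hs hp e).trans ?_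
  push_cast
  gcongr
  rw [one_div]
  gcongr
  exact_mod_cast hp.two_le

lemma EE_rem {s : ℝ} (hs : 1 < s) {p : ℕ} (hp : p.Prime) : ‖EE F χ s p - 1 - ff F χ s p‖ ≤ AA F / (p : ℝ) ^ 2 := by
  have h := (EE_summable F χ hs hp).sum_add_tsum_nat_add 2
  rw [Finset.sum_range_succ, Finset.sum_range_one, pow_zero, pow_one, ff_one] at h
  unfold EE
  rw [← h]
  rw [show ∀ a b c : ℂ, a + b + c - a - b = c by intros; ring]
  unfold AA
  rw [← tsum_div_const]
  have hS := (AA_summable F 3)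
  push_cast at hS
  refine tsum_of_norm_bounded (hS.div_const _).hasSum fun e => (ff_pow_norm F χ hs hp _).trans ?_
  push_cast
  rw [pow_add, show ((e : ℝ) + 2 + 1) = e + 3 by ring, ← mul_assoc, div_eq_mul_inv, inv_pow _ 2]
  have hp2 : (2 : ℝ) ≤ p := by exact_mod_cast hp.two_le
  gcongr
  rw [one_div]
  gcongr

lemma ff_p_norm {s : ℝ} (hs : 1 < s) {p : ℕ} (hp : p.Prime) : ‖ff F χ s p‖ ≤ 2 ^ finrank ℚ F * (p : ℝ) ^ (-s) := by
  refine (ff_norm F χ s p).trans ?_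
  gcongr
  have := aF_pow_le F hp 1
  rw [pow_one] at this
  exact_mod_cast this

lemma ff_p_norm' {s : ℝ} (hs : 1 < s) {p : ℕ} (hp : p.Prime) : ‖ff F χ s p‖ ≤ 2 ^ finrank ℚ F / (p : ℝ) := by
  refine (ff_p_norm F χ hs hp).trans ?_
  rw [div_eq_mul_inv, ← Real.rpow_neg_one]
  gcongr
  · exact_mod_cast hp.one_le

noncomputable def BB : ℝ := 2 ^ finrank ℚ F + AA F

lemma BB_pos : 0 < BB F := by unfold BB; have := AA_nonneg F; positivity

lemma EE_sub_one {s : ℝ} (hs : 1 < s) {p : ℕ} (hp : p.Prime) : ‖EE F χ s p - 1‖ ≤ BB F / p := by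
  have h1 := EE_rem F χ hs hp
  have h2 := ff_p_norm' F χ hs hp
  have h3 : EE F χ s p - 1 = (EE F χ s p - 1 - ff F χ s p) + ff F χ s p := by ring
  rw [h3]
  refine (norm_add_le _ _).trans ((add_le_add h1 h2).trans ?_)
  unfold BB
  rw [add_div, add_comm]
  gcongr
  · exact AA_nonneg F
  · exact_mod_cast hp.pos
  · have : (1 : ℝ) ≤ p := by exact_mod_cast hp.one_le
    nlinarith

noncomputable def CC : ℝ := BB F ^ 2 + AA F
lemma CC_nonneg : 0 ≤ CC F := by unfold CC; have := AA_nonneg F; positivity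

/-- goodness of local factors -/
def GoodChar : Prop := ∀ s : ℝ, 1 < s → ∀ p : ℕ, p.Prime →
  EE F χ s p ∈ Complex.slitPlane ∧ ‖Complex.log (EE F χ s p) - ff F χ s p‖ ≤ CC F / (p : ℝ) ^ 2

lemma good_of_zero {s : ℝ} (hs : 1 < s) {p : ℕ} (hp : p.Prime) (h0 : χ (p : ZMod q) = 0) :
    EE F χ s p = 1 ∧ ff F χ s p = 0 := by
  have h1 : ff F χ s p = 0 := by unfold ff; rw [h0]; simp
  refine ⟨?_, h1⟩
  unfold EE
  rw [tsum_eq_single 0]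
  · simp [ff_one]
  · intro e he
    unfold ff; push_cast; rw [map_pow, h0, zero_pow he]; simp

lemma goodChar_of (hq : ∀ p : ℕ, p.Prime → (p : ℝ) < 2 * BB F → p ∣ q) : GoodChar F χ := by
  intro s hs p hp
  by_cases h : (p : ℝ) < 2 * BB F
  · have hd := hq p hp h
    have h0 : χ (p : ZMod q) = 0 := by
      apply χ.map_nonunit
      rw [ZMod.isUnit_iff_coprime]
      intro hc
      have := Nat.Coprime.eq_one_of_dvd hc hd
      exact hp.one_lt.ne' this
    obtain ⟨h1, h2⟩ := good_of_zero F χ hs hp h0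
    rw [h1, h2]
    refine ⟨Complex.one_mem_slitPlane, ?_⟩
    simp; exact div_nonneg (CC_nonneg F) (by positivity)
  · push Not at h
    have hp0 : (0 : ℝ) < p := by exact_mod_cast hp.pos
    have h1 := EE_sub_one F χ hs hp
    have h2 : ‖EE F χ s p - 1‖ ≤ 1 / 2 := h1.trans (by rw [div_le_iff₀ hp0]; linarith)
    have h3 : EE F χ s p = 1 + (EE F χ s p - 1) := by ring
    refine ⟨by rw [h3]; exact Complex.mem_slitPlane_of_norm_lt_one (by linarith), ?_⟩
    have h4 := Complex.norm_log_one_add_sub_self_le (z := EE F χ s p - 1) (by linarith)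
    rw [← h3] at h4
    have h5 : ‖EE F χ s p - 1‖ ^ 2 * (1 - ‖EE F χ s p - 1‖)⁻¹ / 2 ≤ ‖EE F χ s p - 1‖ ^ 2 := by
      have : (1 - ‖EE F χ s p - 1‖)⁻¹ ≤ 2 := by
        rw [inv_le_comm₀ (by linarith) (by norm_num)]; linarith
      have := mul_le_mul_of_nonneg_left this (sq_nonneg ‖EE F χ s p - 1‖)
      linarith
    have h6 : ‖EE F χ s p - 1‖ ^ 2 ≤ BB F ^ 2 / p ^ 2 := by rw [← div_pow]; gcongr
    have h7 := EE_rem F χ hs hp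
    have h8 : Complex.log (EE F χ s p) - ff F χ s p = (Complex.log (EE F χ s p) - (EE F χ s p - 1)) + (EE F χ s p - 1 - ff F χ s p) := by ring
    rw [h8]
    refine (norm_add_le _ _).trans ?_
    unfold CC; rw [add_div]; linarith

/-- principal character mod 1 -/
lemma goodChar_one : GoodChar F (1 : DirichletCharacter ℂ 1) := by
  intro s hs p hp
  have hreal : ∀ n : ℕ, ff F (1 : DirichletCharacter ℂ 1) s n = (((aF F n : ℝ) * (n : ℝ) ^ (-s) : ℝ) : ℂ) := by
    intro n
    unfold ff
    have : (1 : DirichletCharacter ℂ 1) (n : ZMod 1) = 1 := MulChar.one_apply (by rw [ZMod.isUnit_iff_coprime]; exact Nat.coprime_one_right n)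
    rw [this]; push_cast; ring
  set e : ℝ := ∑' j : ℕ, (aF F (p ^ j) : ℝ) * ((p ^ j : ℕ) : ℝ) ^ (-s) with he
  have hE : EE F (1 : DirichletCharacter ℂ 1) s p = (e : ℂ) := by
    unfold EE; simp only [hreal]; rw [he, Complex.ofReal_tsum]
  set x : ℝ := (aF F p : ℝ) * (p : ℝ) ^ (-s) with hx
  have hx0 : 0 ≤ x := by positivity
  have hff : ff F (1 : DirichletCharacter ℂ 1) s p = (x : ℂ) := hreal p
  have hsum : Summable (fun j : ℕ => (aF F (p ^ j) : ℝ) * ((p ^ j : ℕ) : ℝ) ^ (-s)) := by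
    have := EE_summable F (1 : DirichletCharacter ℂ 1) hs hp
    simp only [hreal] at this
    exact_mod_cast this
  have hge : 1 + x ≤ e := by
    have := hsum.sum_le_tsum (Finset.range 2) (fun j _ => by positivity)
    rw [Finset.sum_range_succ, Finset.sum_range_one] at this
    simp only [pow_zero, pow_one, aF_one, Nat.cast_one, Real.one_rpow, mul_one] at this
    exact this
  have hrem := EE_rem F (1 : DirichletCharacter ℂ 1) hs hp
  have hxb := ff_p_norm' F (1 : DirichletCharacter ℂ 1) hs hp
  rw [hff, Complex.norm_real, Real.norm_of_nonneg hx0] at hxb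
  rw [hE, hff] at hrem ⊢
  have hrem2 : e - 1 - x ≤ AA F / p ^ 2 := by
    have h1 : ((e : ℂ) - 1 - x) = ((e - 1 - x : ℝ) : ℂ) := by push_cast; rfl
    rw [h1, Complex.norm_real] at hrem
    exact (le_abs_self _).trans hrem
  have he0 : 0 < e := by linarith
  refine ⟨Complex.ofReal_mem_slitPlane.mpr he0, ?_⟩
  rw [← Complex.ofReal_log he0.le, ← Complex.ofReal_sub, Complex.norm_real, Real.norm_eq_abs, abs_le]
  have hp0 : (0 : ℝ) < p := by exact_mod_cast hp.pos
  have hA := AA_nonneg F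
  have hx2 : x ^ 2 ≤ BB F ^ 2 / p ^ 2 := by
    rw [← div_pow]
    have : x ≤ BB F / p := hxb.trans (by unfold BB; gcongr; linarith)
    gcongr
  unfold CC
  rw [add_div]
  have hA2 : 0 ≤ AA F / (p : ℝ) ^ 2 := by positivity
  have hB2 : 0 ≤ BB F ^ 2 / (p : ℝ) ^ 2 := by positivity
  constructor
  · have h1 : Real.log (1 + x) ≤ Real.log e := Real.log_le_log (by linarith) hge
    have h2 := Real.one_sub_inv_le_log_of_pos (show 0 < 1 + x by linarith)
    have h3 : x - x ^ 2 ≤ 1 - (1 + x)⁻¹ := by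
      rw [show 1 - (1 + x)⁻¹ = x / (1 + x) by field_simp; ring, le_div_iff₀ (by linarith)]
      nlinarith [pow_nonneg hx0 3]
    linarith
  · have := Real.log_le_sub_one_of_pos he0
    linarith

end
end

section
section
variable (F : Type) [Field F] [NumberField F]
open NumberField.Units Module nonZeroDivisors Ideal
variable {q : ℕ} (χ : DirichletCharacter ℂ q)

/-- prime sum -/
noncomputable def TT (s : ℝ) : ℂ := ∑' p : Nat.Primes, ff F χ s p
noncomputable def TR (s : ℝ) : ℝ := ∑' p : Nat.Primes, (aF F p : ℝ) * ((p : ℕ) : ℝ) ^ (-s)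

noncomputable def UU (s : ℝ) : ℂ := ∑' p : Nat.Primes, Complex.log (EE F χ s p)

lemma ff_continuousOn (n : ℕ) (hn : n ≠ 0) : Continuous (fun s => ff F χ s n) := by
  unfold ff
  refine continuous_const.mul (continuous_const.mul (Complex.continuous_ofReal.comp ?_))
  exact Continuous.rpow continuous_const (by fun_prop) (fun _ => Or.inl (by exact_mod_cast hn))

lemma EE_continuousOn {p : ℕ} (hp : p.Prime) : ContinuousOn (fun s => EE F χ s p) (Set.Ioi 1) := by
  unfold EE
  refine continuousOn_tsum (fun e => (ff_continuousOn F χ _ (pow_ne_zero e hp.ne_zero)).continuousOn) (AA_summable F 1) ?_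
  intro e s hs
  refine (ff_pow_norm F χ hs hp e).trans ?_
  push_cast
  gcongr
  rw [one_div]
  gcongr
  exact_mod_cast hp.two_le

lemma primes_sq : Summable (fun p : Nat.Primes => (((p : ℕ) : ℝ) ^ 2)⁻¹) := by
  have := Nat.Primes.summable_rpow.mpr (show (-2 : ℝ) < -1 by norm_num)
  refine this.congr fun p => ?_
  rw [Real.rpow_neg (by positivity)]; norm_cast

lemma logE_bound (hg : GoodChar F χ) {s0 s : ℝ} (h0 : 1 < s0) (hs : s0 ≤ s) (p : Nat.Primes) :
    ‖Complex.log (EE F χ s p)‖ ≤ CC F * (((p : ℕ) : ℝ) ^ 2)⁻¹ + 2 ^ finrank ℚ F * ((p : ℕ) : ℝ) ^ (-s0) := by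
  have h1 := (hg s (h0.trans_le hs) p p.2).2
  have h2 := ff_p_norm F χ (h0.trans_le hs) p.2
  have h3 : ((p : ℕ) : ℝ) ^ (-s) ≤ ((p : ℕ) : ℝ) ^ (-s0) :=
    Real.rpow_le_rpow_of_exponent_le (by exact_mod_cast p.2.one_le) (by linarith)
  have h4 : Complex.log (EE F χ s p) = (Complex.log (EE F χ s p) - ff F χ s p) + ff F χ s p := by ring
  rw [h4]
  refine (norm_add_le _ _).trans (add_le_add (by rw [← div_eq_mul_inv]; exact h1) (h2.trans ?_))
  gcongr

lemma logE_bound_summable {s0 : ℝ} (h0 : 1 < s0) : Summable (fun p : Nat.Primes =>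
    CC F * (((p : ℕ) : ℝ) ^ 2)⁻¹ + 2 ^ finrank ℚ F * ((p : ℕ) : ℝ) ^ (-s0)) :=
  (primes_sq.mul_left _).add ((Nat.Primes.summable_rpow.mpr (by linarith)).mul_left _)

lemma UU_continuousOn (hg : GoodChar F χ) : ContinuousOn (UU F χ) (Set.Ioi 1) := by
  intro s hs
  rw [Set.mem_Ioi] at hs
  have h0 : 1 < (1 + s) / 2 := by linarith
  have : ContinuousOn (UU F χ) (Set.Ioi ((1 + s) / 2)) := by
    unfold UU
    refine continuousOn_tsum (fun p => ?_) (logE_bound_summable F h0) (fun p x hx => logE_bound F χ hg h0 (le_of_lt hx) p)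
    exact ((EE_continuousOn F χ p.2).mono (Set.Ioi_subset_Ioi h0.le)).clog (fun x hx => (hg x (h0.trans hx) p p.2).1)
  exact (this.continuousAt (Ioi_mem_nhds (by linarith))).continuousWithinAt

lemma UU_exp (hg : GoodChar F χ) {s : ℝ} (hs : 1 < s) : Complex.exp (UU F χ s) = ∑' I, psi F χ s I := by
  have h1 : Summable (fun p : Nat.Primes => Complex.log (EE F χ s p)) :=
    Summable.of_norm_bounded (logE_bound_summable F hs) (fun p => logE_bound F χ hg hs le_rfl p)
  have h2 := h1.hasSum.cexp
  refine h2.unique ?_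
  convert euler F χ hs using 1
  funext p
  exact Complex.exp_log (Complex.slitPlane_ne_zero (hg s hs p p.2).1)

noncomputable def DD : ℝ := CC F * ∑' p : Nat.Primes, (((p : ℕ) : ℝ) ^ 2)⁻¹

lemma ffp_summable {s : ℝ} (hs : 1 < s) : Summable (fun p : Nat.Primes => ff F χ s p) :=
  Summable.of_norm_bounded ((Nat.Primes.summable_rpow.mpr (show -s < -1 by linarith)).mul_left (2 ^ finrank ℚ F)) (fun p => ff_p_norm F χ hs p.2)

lemma aFp_summable {s : ℝ} (hs : 1 < s) : Summable (fun p : Nat.Primes => (aF F p : ℝ) * ((p : ℕ) : ℝ) ^ (-s)) :=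
  (aF_summable F hs).comp_injective (i := fun p : Nat.Primes => (p : ℕ)) Subtype.val_injective

lemma UU_sub (hg : GoodChar F χ) {s : ℝ} (hs : 1 < s) : ‖UU F χ s - TT F χ s‖ ≤ DD F := by
  have h1 : Summable (fun p : Nat.Primes => Complex.log (EE F χ s p)) :=
    Summable.of_norm_bounded (logE_bound_summable F hs) (fun p => logE_bound F χ hg hs le_rfl p)
  unfold UU TT DD
  rw [← h1.tsum_sub (ffp_summable F χ hs)]
  exact tsum_of_norm_bounded (primes_sq.hasSum.mul_left (CC F)) (fun p => by have := (hg s hs p p.2).2; rwa [div_eq_mul_inv] at this)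

lemma TT_one {s : ℝ} (hs : 1 < s) : TT F (1 : DirichletCharacter ℂ 1) s = TR F s := by
  unfold TT TR
  rw [Complex.ofReal_tsum]
  refine tsum_congr fun p => ?_
  unfold ff
  have : (1 : DirichletCharacter ℂ 1) ((p : ℕ) : ZMod 1) = 1 := MulChar.one_apply (by rw [ZMod.isUnit_iff_coprime]; exact Nat.coprime_one_right _)
  rw [this]; push_cast; ring

lemma psi_one_eq_zeta {s : ℝ} (hs : 1 < s) : ∑' I, psi F (1 : DirichletCharacter ℂ 1) s I = dedekindZeta F s := by
  rw [psi_eq_ff F _ hs]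
  unfold dedekindZeta LSeries
  refine tsum_congr fun n => ?_
  by_cases hn : n = 0
  · subst hn; rw [ff_zero F _ hs]; simp
  rw [LSeries.term_of_ne_zero hn]
  unfold ff
  have : (1 : DirichletCharacter ℂ 1) (n : ZMod 1) = 1 := MulChar.one_apply (by rw [ZMod.isUnit_iff_coprime]; exact Nat.coprime_one_right _)
  rw [this, one_mul, Complex.ofReal_cpow (by positivity), div_eq_mul_inv, ← Complex.cpow_neg]
  push_cast
  rfl

/-- `T_F(s) = log(1/(s-1)) + O(1)` -/
theorem TR_asymp : ∃ C : ℝ, ∀ᶠ s in nhdsWithin (1 : ℝ) (Set.Ioi 1), |TR F s - Real.log (1 / (s - 1))| ≤ C := by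
  have h := NumberField.tendsto_sub_one_mul_dedekindZeta_nhdsGT F
  have hpos := NumberField.dedekindZeta_residue_pos F
  have h2 := h.norm
  set ρ := dedekindZeta_residue F
  have hn : ‖((ρ : ℝ) : ℂ)‖ = ρ := by rw [Complex.norm_real, Real.norm_of_nonneg hpos.le]
  rw [hn] at h2
  have h3 := (h2.log hpos.ne')
  have h4 := h3.eventually (Metric.ball_mem_nhds _ one_pos)
  refine ⟨DD F + (|Real.log ρ| + 1), ?_⟩
  filter_upwards [h4, self_mem_nhdsWithin] with s hs hs1
  rw [Set.mem_Ioi] at hs1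
  have hg := goodChar_one F
  have e1 := UU_exp F _ hg hs1
  have e2 := UU_sub F _ hg hs1
  rw [psi_one_eq_zeta F hs1] at e1
  rw [TT_one F hs1] at e2
  have e3 := (Complex.abs_re_le_norm _).trans e2
  rw [Complex.sub_re, Complex.ofReal_re] at e3
  rw [← e1, norm_mul, Complex.norm_exp, Real.log_mul, Real.log_exp, Real.dist_eq] at hs
  · have e4 : ‖(s : ℂ) - 1‖ = s - 1 := by
      rw [← Complex.ofReal_one, ← Complex.ofReal_sub, Complex.norm_real, Real.norm_of_nonneg (by linarith)]
    rw [e4] at hs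
    rw [one_div, Real.log_inv]
    rw [abs_le] at e3 ⊢
    rw [abs_lt] at hs
    have := abs_le.mp (le_refl |Real.log ρ|)
    constructor <;> linarith [this.1, this.2]
  · rw [norm_ne_zero_iff, sub_ne_zero]; exact_mod_cast hs1.ne'
  · exact (Real.exp_pos _).ne'

lemma log_branch_bounded (u : ℝ → ℂ) (hu : ContinuousOn u (Set.Ioi 1)) (ℓ : ℂ) (hℓ : ℓ ≠ 0)
    (h : Filter.Tendsto (fun s => Complex.exp (u s)) (nhdsWithin 1 (Set.Ioi 1)) (nhds ℓ)) :
    ∃ C : ℝ, ∀ᶠ s in nhdsWithin (1 : ℝ) (Set.Ioi 1), ‖u s‖ ≤ C := by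
  have h1 : Filter.Tendsto (fun s => Complex.exp (u s) / ℓ) (nhdsWithin 1 (Set.Ioi 1)) (nhds 1) := by
    have := h.div_const ℓ
    rwa [div_self hℓ] at this
  have h2 := h1.eventually (Metric.ball_mem_nhds (1:ℂ) (show (0:ℝ) < 1/2 by norm_num))
  obtain ⟨b, hb, hb2⟩ := mem_nhdsGT_iff_exists_Ioo_subset.mp h2
  rw [Set.mem_Ioi] at hb
  -- v(s) = u s - log (exp (u s)/ℓ) is constant
  let v : ℝ → ℂ := fun s => u s - Complex.log (Complex.exp (u s) / ℓ)
  have hball : ∀ s ∈ Set.Ioo 1 b, ‖Complex.exp (u s) / ℓ - 1‖ < 1 / 2 := fun s hs => by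
    have := hb2 hs; simpa [dist_eq_norm] using this
  have hslit : ∀ s ∈ Set.Ioo 1 b, Complex.exp (u s) / ℓ ∈ Complex.slitPlane := fun s hs => by
    have := Complex.mem_slitPlane_of_norm_lt_one (z := Complex.exp (u s) / ℓ - 1) (by linarith [hball s hs])
    simpa using this
  have hv : ContinuousOn v (Set.Ioo 1 b) := by
    have hu' : ContinuousOn u (Set.Ioo 1 b) := hu.mono Set.Ioo_subset_Ioi_self
    exact hu'.sub ((hu'.cexp.div_const ℓ).clog hslit)
  have hexp : ∀ s ∈ Set.Ioo 1 b, Complex.exp (v s) = ℓ := fun s hs => by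
    have h0 : Complex.exp (u s) / ℓ ≠ 0 := Complex.slitPlane_ne_zero (hslit s hs)
    change Complex.exp (u s - _) = ℓ
    rw [Complex.exp_sub, Complex.exp_log h0]
    field_simp
  have hconst : ∀ s ∈ Set.Ioo 1 b, ∀ t ∈ Set.Ioo 1 b, v s = v t := by
    intro s hs t ht
    have hpc : IsPreconnected (Set.Ioo (1:ℝ) b) := isPreconnected_Ioo
    have hd : ∀ x ∈ Set.Ioo 1 b, ∃ n : ℤ, v x = v s + n * (2 * Real.pi * Complex.I) := fun x hx =>
      Complex.exp_eq_exp_iff_exists_int.mp ((hexp x hx).trans (hexp s hs).symm)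
    let g : ℝ → ℝ := fun x => ((v x - v s) / (2 * Real.pi * Complex.I)).re
    have hgc : ContinuousOn g (Set.Ioo 1 b) := Complex.continuous_re.comp_continuousOn ((hv.sub continuousOn_const).div_const _)
    have hg : ∀ x ∈ Set.Ioo 1 b, ∃ n : ℤ, g x = n ∧ v x = v s + n * (2 * Real.pi * Complex.I) := fun x hx => by
      obtain ⟨n, hn⟩ := hd x hx
      refine ⟨n, ?_, hn⟩
      simp only [g]
      rw [hn, add_sub_cancel_left, mul_div_assoc, div_self, mul_one, Complex.intCast_re]
      exact Complex.two_pi_I_ne_zero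
    obtain ⟨n, hn, hvn⟩ := hg t ht
    have hgs : g s = 0 := by simp [g]
    have hn0 : n = 0 := by
      by_contra hne
      have hmem : ∀ y ∈ Set.uIcc (g s) (g t), y ∈ g '' Set.Ioo 1 b := by
        intro y hy
        have hoc := (hpc.image g hgc).ordConnected
        exact hoc.uIcc_subset (Set.mem_image_of_mem _ hs) (Set.mem_image_of_mem _ ht) hy
      have hy : ((n : ℝ) / (2 * |(n : ℝ)|)) ∈ Set.uIcc (g s) (g t) := by
        rw [hgs, hn]
        have hn1 : (1 : ℝ) ≤ |(n : ℝ)| := by exact_mod_cast Int.one_le_abs hne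
        rcases lt_or_gt_of_ne hne with h | h
        · have h' : (n : ℝ) < 0 := by exact_mod_cast h
          rw [abs_of_neg h'] at hn1 ⊢
          rw [Set.mem_uIcc]; right
          rw [show (n : ℝ) / (2 * -n) = -(1/2) by field_simp]
          constructor <;> linarith
        · have h' : (0 : ℝ) < n := by exact_mod_cast h
          rw [abs_of_pos h'] at hn1 ⊢
          rw [Set.mem_uIcc]; left
          rw [show (n : ℝ) / (2 * n) = (1/2) by field_simp]
          constructor <;> linarith
      obtain ⟨x, hx, hxy⟩ := hmem _ hy
      obtain ⟨m, hm, -⟩ := hg x hx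
      rw [hm] at hxy
      have h2m : |2 * (m : ℝ)| = 1 := by
        rw [hxy]
        have : (n : ℝ) ≠ 0 := by exact_mod_cast hne
        rw [abs_mul, abs_div, abs_mul, abs_abs]
        have h0 : |(n : ℝ)| ≠ 0 := abs_ne_zero.mpr this
        rw [abs_two]; field_simp
      have h2m' : |2 * m| = 1 := by exact_mod_cast h2m
      rcases abs_eq (zero_le_one) |>.mp h2m' with h | h <;> omega
    rw [hvn, hn0]; simp
  have hmid : (1 + b) / 2 ∈ Set.Ioo 1 b := ⟨by linarith, by linarith⟩
  refine ⟨‖v ((1 + b) / 2)‖ + 1, ?_⟩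
  filter_upwards [Ioo_mem_nhdsGT hb] with s hs
  have e1 : u s = v ((1 + b) / 2) + Complex.log (Complex.exp (u s) / ℓ) := by
    rw [hconst _ hmid s hs]; simp [v]
  rw [e1]
  refine (norm_add_le _ _).trans ?_
  gcongr
  have h5 := Complex.norm_log_one_add_half_le_self (z := Complex.exp (u s) / ℓ - 1) (hball s hs).le
  rw [add_sub_cancel] at h5
  linarith [hball s hs]

end
end

section
section
variable (E : Type) [Field E] [NumberField E]
open Module nonZeroDivisors Ideal Pointwise

lemma PP_dvd {p : ℕ} (hp : p.Prime) {P : Ideal (𝓞 E)} (hP : P ∈ PP E p) : p ∣ absNorm P := by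
  have h2 : absNorm P ∣ p ^ Module.finrank ℤ (𝓞 E) := by
    rw [← absNorm_span_natCast]
    exact absNorm_dvd_absNorm_of_le ((span_singleton_le_iff_mem _).2 hP.2)
  obtain ⟨j, -, hj⟩ := (Nat.dvd_prime_pow hp).1 h2
  rcases j with _ | j
  · exact absurd (absNorm_eq_one_iff.1 (by simpa using hj)) hP.1.ne_top
  · rw [hj, pow_succ]; exact dvd_mul_left _ _

lemma PP_ne_bot {p : ℕ} (hp : p.Prime) {P : Ideal (𝓞 E)} (hP : P ∈ PP E p) : P ≠ ⊥ := by
  rintro rfl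
  have := hP.2
  simp at this
  exact hp.ne_zero this

lemma PP_max {p : ℕ} (hp : p.Prime) {P : Ideal (𝓞 E)} (hP : P ∈ PP E p) : P.IsMaximal :=
  hP.1.isMaximal (PP_ne_bot E hp hP)

lemma PP_of_norm {p : ℕ} (hp : p.Prime) {P : Ideal (𝓞 E)} (h : absNorm P = p) : P ∈ PP E p := by
  refine ⟨isPrime_of_irreducible_absNorm (by rw [h]; exact hp), absNorm_mem_of E h⟩

/-- Frobenius relation -/
def Fr (p : ℕ) (P : Ideal (𝓞 E)) (τ : E ≃ₐ[ℚ] E) : Prop := ∀ x : 𝓞 E, τ • x - x ^ p ∈ P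

/-- good prime -/
def Good (p : ℕ) : Prop := ∀ P ∈ PP E p, ∀ τ : E ≃ₐ[ℚ] E, (∀ x : 𝓞 E, τ • x - x ∈ P) → τ = 1

lemma smul_coe (u : E ≃ₐ[ℚ] E) (x : 𝓞 E) : ((u • x : 𝓞 E) : E) = u (x:E) := rfl

lemma exists_moved (τ : E ≃ₐ[ℚ] E) (h : τ ≠ 1) : ∃ x : 𝓞 E, τ • x - x ≠ 0 := by
  by_contra hc
  push Not at hc
  apply h
  ext y
  obtain ⟨a, b, hb, rfl⟩ := IsFractionRing.div_surjective (A := 𝓞 E) y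
  have h1 : ∀ x : 𝓞 E, τ (algebraMap (𝓞 E) E x) = algebraMap (𝓞 E) E x := by
    intro x
    have := sub_eq_zero.1 (hc x)
    exact congrArg (algebraMap (𝓞 E) E) this
  rw [map_div₀, h1, h1]; rfl

lemma exists_good : ∃ B : ℕ, B ≠ 0 ∧ ∀ p : ℕ, p.Prime → ¬ p ∣ B → Good E p := by
  classical
  have : ∀ τ : E ≃ₐ[ℚ] E, ∃ n : ℕ, n ≠ 0 ∧ (τ ≠ 1 → ∃ x : 𝓞 E, ∀ p, p.Prime → ∀ P ∈ PP E p, τ • x - x ∈ P → p ∣ n) := by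
    intro τ
    by_cases h : τ = 1
    · exact ⟨1, one_ne_zero, fun h' => absurd h h'⟩
    · obtain ⟨x, hx⟩ := exists_moved E τ h
      refine ⟨absNorm (span {τ • x - x}), ?_, fun _ => ⟨x, fun p hp P hP hm => ?_⟩⟩
      · rw [Ne, absNorm_eq_zero_iff, span_singleton_eq_bot]; exact hx
      · exact (PP_dvd E hp hP).trans (absNorm_dvd_absNorm_of_le ((span_singleton_le_iff_mem _).2 hm))
  choose n hn h using this
  refine ⟨∏ τ, n τ, Finset.prod_ne_zero_iff.2 fun τ _ => hn τ, fun p hp hB P hP τ hτ => ?_⟩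
  by_contra hne
  obtain ⟨x, hx⟩ := h τ hne
  exact hB ((hx p hp P hP (hτ x)).trans (Finset.dvd_prod_of_mem _ (Finset.mem_univ τ)))

variable [IsGalois ℚ E]
abbrev FU (U : Subgroup (E ≃ₐ[ℚ] E)) := IntermediateField.fixedField U

instance instGU (U : Subgroup (E ≃ₐ[ℚ] E)) : IsGaloisGroup U (FU E U) E :=
  IsGaloisGroup.subgroup (E ≃ₐ[ℚ] E) ℚ E U

instance instGUO (U : Subgroup (E ≃ₐ[ℚ] E)) : IsGaloisGroup U (𝓞 (FU E U)) (𝓞 E) :=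
  IsGaloisGroup.of_isFractionRing U (𝓞 (FU E U)) (𝓞 E) (FU E U) E

variable {E}
lemma Fr_unique {p : ℕ} (hg : Good E p) {P : Ideal (𝓞 E)} (hP : P ∈ PP E p) {τ τ' : E ≃ₐ[ℚ] E} (h : Fr E p P τ) (h' : Fr E p P τ') :
    τ = τ' := by
  have := hg P hP (τ * τ'⁻¹) (fun x => ?_)
  · exact mul_inv_eq_one.1 this
  · have h1 := h (τ'⁻¹ • x)
    have h2 := h' (τ'⁻¹ • x)
    have := P.sub_mem h1 h2
    rw [smul_inv_smul] at this
    rw [mul_smul]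
    convert this using 1; ring

lemma finite_quot {p : ℕ} (hp : p.Prime) {P : Ideal (𝓞 E)} (hP : P ∈ PP E p) : Finite (𝓞 E ⧸ P) :=
  Ideal.finiteQuotientOfFreeOfNeBot P (PP_ne_bot E hp hP)

lemma Fr_of_norm (U : Subgroup (E ≃ₐ[ℚ] E)) {p : ℕ} (hp : p.Prime) {P : Ideal (𝓞 E)} (hP : P ∈ PP E p)
    (h : absNorm (P.under (𝓞 (FU E U))) = p) : ∃ τ ∈ U, Fr E p P τ := by
  have := finite_quot hp hP
  have := hP.1
  obtain ⟨σ, hσ⟩ := IsArithFrobAt.exists_of_isInvariant (𝓞 (FU E U)) U P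
  refine ⟨σ, σ.2, fun x => ?_⟩
  have := hσ x
  have h2 : Nat.card (𝓞 (FU E U) ⧸ P.under (𝓞 (FU E U))) = p := by rw [← h]; rfl
  rw [h2] at this
  exact this

lemma under_PP (U : Subgroup (E ≃ₐ[ℚ] E)) {p : ℕ} {P : Ideal (𝓞 E)} (hP : P ∈ PP E p) : P.under (𝓞 (FU E U)) ∈ PP (FU E U) p := by
  have := hP.1
  refine ⟨inferInstance, ?_⟩
  rw [Ideal.under_def, Ideal.mem_comap, map_natCast]
  exact hP.2

lemma norm_of_Fr (U : Subgroup (E ≃ₐ[ℚ] E)) {p : ℕ} (hp : p.Prime) {P : Ideal (𝓞 E)} (hP : P ∈ PP E p) {τ : E ≃ₐ[ℚ] E}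
    (hτ : τ ∈ U) (h : Fr E p P τ) : absNorm (P.under (𝓞 (FU E U))) = p := by
  have hq := under_PP U hP
  set Q := P.under (𝓞 (FU E U)) with hQ
  have h1 := PP_dvd _ hp hq
  have := hq.1
  have : Finite (𝓞 (FU E U) ⧸ Q) := Ideal.finiteQuotientOfFreeOfNeBot Q (PP_ne_bot _ hp hq)
  haveI := Fintype.ofFinite (𝓞 (FU E U) ⧸ Q)
  have : Q.IsMaximal := PP_max _ hp hq
  letI := Ideal.Quotient.field Q
  have h2 : absNorm Q = Fintype.card (𝓞 (FU E U) ⧸ Q) := by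
    rw [← Nat.card_eq_fintype_card]; rfl
  have h3 : Fintype.card (𝓞 (FU E U) ⧸ Q) ≤ p := by
    classical
    have hne := FiniteField.X_pow_card_sub_X_ne_zero (𝓞 (FU E U) ⧸ Q) hp.one_lt
    have hdeg := FiniteField.X_pow_card_sub_X_natDegree_eq (𝓞 (FU E U) ⧸ Q) hp.one_lt
    rw [← hdeg]
    refine le_trans ?_ (Polynomial.card_roots' _)
    refine le_trans ?_ (Multiset.toFinset_card_le _)
    rw [← Finset.card_univ]
    refine Finset.card_le_card fun y _ => ?_
    rw [Multiset.mem_toFinset, Polynomial.mem_roots hne]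
    obtain ⟨x, rfl⟩ := Ideal.Quotient.mk_surjective y
    have hx := h (algebraMap (𝓞 (FU E U)) (𝓞 E) x)
    have hx2 : τ • (algebraMap (𝓞 (FU E U)) (𝓞 E) x) = algebraMap (𝓞 (FU E U)) (𝓞 E) x :=
      smul_algebraMap (⟨τ, hτ⟩ : U) x
    rw [hx2, ← map_pow, ← map_sub] at hx
    have hx3 : x - x ^ p ∈ Q := hx
    simp only [Polynomial.IsRoot, Polynomial.eval_sub, Polynomial.eval_pow, Polynomial.eval_X]
    rw [← map_pow, ← map_sub, Ideal.Quotient.eq_zero_iff_mem, ← neg_sub]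
    exact Q.neg_mem hx3
  rw [h2] at h1 ⊢
  exact le_antisymm h3 (Nat.le_of_dvd Fintype.card_pos h1)

end
end

section
section
variable {E : Type} [Field E] [NumberField E] [IsGalois ℚ E]
open Module nonZeroDivisors Ideal Pointwise

lemma under_int {p : ℕ} (hp : p.Prime) {P : Ideal (𝓞 E)} (hP : P ∈ PP E p) : P.under ℤ = span {(p : ℤ)} := by
  have := hP.1
  have hm : (span {(p : ℤ)}).IsMaximal :=
    PrincipalIdealRing.isMaximal_of_irreducible (Nat.prime_iff_prime_int.1 hp).irreducible
  refine (hm.eq_of_le (Ideal.IsPrime.ne_top inferInstance) ?_).symm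
  rw [span_singleton_le_iff_mem, Ideal.under_def, Ideal.mem_comap, map_natCast]
  exact hP.2

lemma Fr_exists {p : ℕ} (hp : p.Prime) {P : Ideal (𝓞 E)} (hP : P ∈ PP E p) : ∃ τ, Fr E p P τ := by
  have := finite_quot hp hP
  have := hP.1
  obtain ⟨σ, hσ⟩ := IsArithFrobAt.exists_of_isInvariant ℤ (E ≃ₐ[ℚ] E) P
  refine ⟨σ, fun x => ?_⟩
  have := hσ x
  have h2 : Nat.card (ℤ ⧸ P.under ℤ) = p := by
    have h3 : absNorm (P.under ℤ) = p := by
      rw [under_int hp hP, absNorm_span_singleton]; simp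
    rw [← h3]; rfl
  rw [h2] at this
  exact this

lemma PP_trans {p : ℕ} (hp : p.Prime) {P Q : Ideal (𝓞 E)} (hP : P ∈ PP E p) (hQ : Q ∈ PP E p) :
    ∃ g : E ≃ₐ[ℚ] E, Q = g • P := by
  have := hP.1
  have := hQ.1
  exact Algebra.IsInvariant.exists_smul_of_under_eq ℤ (𝓞 E) (E ≃ₐ[ℚ] E) P Q (by rw [under_int hp hP, under_int hp hQ])

lemma Fr_pow {p : ℕ} {P : Ideal (𝓞 E)} {σ : E ≃ₐ[ℚ] E} (h : Fr E p P σ) (j : ℕ) (x : 𝓞 E) :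
    (σ ^ j) • x - x ^ (p ^ j) ∈ P := by
  induction j with
  | zero => simp
  | succ j ih =>
    rw [pow_succ', mul_smul]
    have h1 := h ((σ ^ j) • x)
    have h2 : ((σ ^ j) • x) ^ p - (x ^ (p ^ j)) ^ p ∈ P := by
      obtain ⟨c, hc⟩ := sub_dvd_pow_sub_pow ((σ ^ j) • x) (x ^ (p ^ j)) p
      rw [hc]; exact P.mul_mem_right _ ih
    rw [pow_succ, pow_mul]
    convert P.add_mem h1 h2 using 1; ring

lemma smul_PP {p : ℕ} {P : Ideal (𝓞 E)} (hP : P ∈ PP E p) (u : E ≃ₐ[ℚ] E) : u • P ∈ PP E p := by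
  have := hP.1
  refine ⟨inferInstance, ?_⟩
  have h1 := Ideal.smul_mem_pointwise_smul u _ P hP.2
  have h2 : u • ((p : ℕ) : 𝓞 E) = (p : 𝓞 E) := map_natCast (MulSemiringAction.toRingHom _ (𝓞 E) u) p
  rwa [h2] at h1

lemma Fr_stab {p : ℕ} (hp : p.Prime) {P : Ideal (𝓞 E)} (hP : P ∈ PP E p) {σ : E ≃ₐ[ℚ] E} (h : Fr E p P σ) :
    σ ∈ MulAction.stabilizer (E ≃ₐ[ℚ] E) P := by
  rw [MulAction.mem_stabilizer_iff]
  have h1 : σ • P ≤ P := by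
    intro x hx
    have h2 : σ⁻¹ • x ∈ P := Ideal.mem_pointwise_smul_iff_inv_smul_mem.1 hx
    have h3 := h (σ⁻¹ • x)
    rw [smul_inv_smul] at h3
    have := P.add_mem h3 (P.pow_mem_of_mem h2 p hp.pos)
    simpa using this
  have hn : (σ • P).IsMaximal := PP_max E hp (smul_PP hP σ)
  exact hn.eq_of_le (PP_max E hp hP).ne_top h1

lemma stab_le {p : ℕ} (hp : p.Prime) (hg : Good E p) {P : Ideal (𝓞 E)} (hP : P ∈ PP E p) {σ τ : E ≃ₐ[ℚ] E} (h : Fr E p P σ)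
    (hτ : τ ∈ MulAction.stabilizer (E ≃ₐ[ℚ] E) P) : ∃ j : ℕ, τ = σ ^ j := by
  have := finite_quot hp hP
  have := PP_max E hp hP
  letI := Ideal.Quotient.field P
  haveI : Fact p.Prime := ⟨hp⟩
  haveI : CharP (𝓞 E ⧸ P) p := by
    refine (CharP.charP_iff_prime_eq_zero hp).2 ?_
    have := Ideal.Quotient.eq_zero_iff_mem.2 hP.2
    simpa using this
  letI : Algebra (ZMod p) (𝓞 E ⧸ P) := ZMod.algebra _ p
  have hτ' : P = P.map (MulSemiringAction.toRingEquiv (E ≃ₐ[ℚ] E) (𝓞 E) τ : 𝓞 E →+* 𝓞 E) := by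
    rw [MulAction.mem_stabilizer_iff] at hτ
    conv_lhs => rw [← hτ]
    rfl
  let e : (𝓞 E ⧸ P) ≃+* (𝓞 E ⧸ P) := Ideal.quotientEquiv P P (MulSemiringAction.toRingEquiv (E ≃ₐ[ℚ] E) (𝓞 E) τ) hτ'
  let e' : (𝓞 E ⧸ P) ≃ₐ[ZMod p] (𝓞 E ⧸ P) := AlgEquiv.ofRingEquiv (f := e) (fun r =>
    DFunLike.congr_fun (Subsingleton.elim ((e : (𝓞 E ⧸ P) →+* (𝓞 E ⧸ P)).comp (algebraMap (ZMod p) (𝓞 E ⧸ P))) (algebraMap (ZMod p) (𝓞 E ⧸ P))) r)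
  obtain ⟨j, hj⟩ := (FiniteField.bijective_frobeniusAlgEquivOfAlgebraic_pow (ZMod p) (𝓞 E ⧸ P)).2 e'
  refine ⟨j, ?_⟩
  have key : ∀ x : 𝓞 E, τ • x - x ^ (p ^ (j : ℕ)) ∈ P := by
    intro x
    rw [← Ideal.Quotient.eq]
    have h1 : e' (Ideal.Quotient.mk P x) = Ideal.Quotient.mk P (τ • x) := rfl
    rw [← h1, ← hj]
    simp [FiniteField.coe_frobeniusAlgEquivOfAlgebraic_iterate, AlgEquiv.coe_pow, ZMod.card]
  have := hg P hP (τ * (σ ^ (j : ℕ))⁻¹) (fun x => ?_)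
  · exact mul_inv_eq_one.1 this
  · have h1 := key ((σ ^ (j : ℕ))⁻¹ • x)
    have h2 := Fr_pow h j ((σ ^ (j : ℕ))⁻¹ • x)
    have := P.sub_mem h1 h2
    rw [smul_inv_smul] at this
    rw [mul_smul]
    convert this using 1; ring

lemma stab_eq {p : ℕ} (hp : p.Prime) (hg : Good E p) {P : Ideal (𝓞 E)} (hP : P ∈ PP E p) {σ : E ≃ₐ[ℚ] E} (h : Fr E p P σ) :
    MulAction.stabilizer (E ≃ₐ[ℚ] E) P = Subgroup.zpowers σ := by
  apply le_antisymm
  · intro τ hτ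
    obtain ⟨j, rfl⟩ := stab_le hp hg hP h hτ
    exact Subgroup.npow_mem_zpowers σ j
  · rw [Subgroup.zpowers_le]; exact Fr_stab hp hP h

/-- primes with Frobenius in U -/
def XU (p : ℕ) (U : Subgroup (E ≃ₐ[ℚ] E)) : Set (Ideal (𝓞 E)) := {P | P ∈ PP E p ∧ ∃ τ ∈ U, Fr E p P τ}

lemma fiber_eq (U : Subgroup (E ≃ₐ[ℚ] E)) {p : ℕ} (hp : p.Prime) {P : Ideal (𝓞 E)} (hP : P ∈ PP E p)
    (hn : absNorm (P.under (𝓞 (FU E U))) = p) :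
    {Q | Q ∈ XU p U ∧ Q.under (𝓞 (FU E U)) = P.under (𝓞 (FU E U))} = MulAction.orbit U P := by
  have := hP.1
  ext Q
  constructor
  · rintro ⟨⟨hQ, -⟩, hu⟩
    have := hQ.1
    obtain ⟨g, hg⟩ := Algebra.IsInvariant.exists_smul_of_under_eq (𝓞 (FU E U)) (𝓞 E) U P Q hu.symm
    exact ⟨g, hg.symm⟩
  · rintro ⟨g, rfl⟩
    have h1 : (g • P).under (𝓞 (FU E U)) = P.under (𝓞 (FU E U)) := Ideal.under_smul _ P g
    have h2 : g • P ∈ PP E p := smul_PP hP (g : E ≃ₐ[ℚ] E)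
    exact ⟨⟨h2, Fr_of_norm U hp h2 (by rw [h1, hn])⟩, h1⟩

lemma orbit_card (U : Subgroup (E ≃ₐ[ℚ] E)) {p : ℕ} (hp : p.Prime) (hg : Good E p) {P : Ideal (𝓞 E)} (hP : P ∈ PP E p)
    {τ : E ≃ₐ[ℚ] E} (hτ : τ ∈ U) (h : Fr E p P τ) :
    Nat.card (MulAction.orbit U P) * Nat.card (MulAction.stabilizer (E ≃ₐ[ℚ] E) P) = Nat.card U := by
  have h1 : Nat.card (MulAction.stabilizer U P) = Nat.card (MulAction.stabilizer (E ≃ₐ[ℚ] E) P) := by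
    have hle : MulAction.stabilizer (E ≃ₐ[ℚ] E) P ≤ U := by
      rw [stab_eq hp hg hP h, Subgroup.zpowers_le]; exact hτ
    have h2 : MulAction.stabilizer U P = (MulAction.stabilizer (E ≃ₐ[ℚ] E) P).subgroupOf U := by
      ext u; rfl
    rw [h2]
    exact Nat.card_congr (Subgroup.subgroupOfEquivOfLe hle).toEquiv
  rw [← h1, ← Nat.card_prod]
  exact Nat.card_congr (MulAction.orbitProdStabilizerEquivGroup U P)

theorem counting {p : ℕ} (hp : p.Prime) (hg : Good E p) {P0 : Ideal (𝓞 E)} (hP0 : P0 ∈ PP E p) (U : Subgroup (E ≃ₐ[ℚ] E)) :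
    Nat.card U * aF (FU E U) p = (XU p U).ncard * Nat.card (MulAction.stabilizer (E ≃ₐ[ℚ] E) P0) := by
  let f : XU p U → {I : Ideal (𝓞 (FU E U)) // absNorm I = p} := fun P =>
    ⟨(P : Ideal (𝓞 E)).under (𝓞 (FU E U)), by
      obtain ⟨τ, hτ, h⟩ := P.2.2
      exact norm_of_Fr U hp P.2.1 hτ h⟩
  have hfin : Finite (XU p U) := Set.Finite.to_subtype ((PP_card E hp).1.subset fun P h => h.1)
  have hfin2 : Finite {I : Ideal (𝓞 (FU E U)) // absNorm I = p} := Set.Finite.to_subtype (Ideal.finite_setOfPred_absNorm_eq p)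
  haveI := Fintype.ofFinite {I : Ideal (𝓞 (FU E U)) // absNorm I = p}
  have h1 : Nat.card (XU p U) = ∑ I, Nat.card {x // f x = I} := by
    rw [← Nat.card_sigma]
    exact Nat.card_congr (Equiv.sigmaFiberEquiv f).symm
  have h2 : ∀ I, Nat.card {x // f x = I} * Nat.card (MulAction.stabilizer (E ≃ₐ[ℚ] E) P0) = Nat.card U := by
    intro I
    have hI := (PP_of_norm _ hp I.2)
    have := hI.1
    obtain ⟨P, hPp, hPl⟩ := (Ideal.nonempty_primesOver (S := 𝓞 E) (P := I.1))
    have hu : P.under (𝓞 (FU E U)) = I.1 := hPl.over.symm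
    have hP : P ∈ PP E p := by
      refine ⟨hPp, ?_⟩
      have h3 := hI.2
      rw [← hu, Ideal.under_def, Ideal.mem_comap, map_natCast] at h3
      exact h3
    obtain ⟨τ, hτ, h⟩ := Fr_of_norm U hp hP (by rw [hu, I.2])
    have h4 := orbit_card U hp hg hP hτ h
    have h5 : Nat.card (MulAction.stabilizer (E ≃ₐ[ℚ] E) P) = Nat.card (MulAction.stabilizer (E ≃ₐ[ℚ] E) P0) := by
      obtain ⟨g, rfl⟩ := PP_trans hp hP0 hP
      exact Nat.card_congr (MulAction.stabilizerEquivStabilizerOfOrbitRel ⟨g, rfl⟩).toEquiv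
    rw [← h5, ← h4]
    congr 1
    have h6 := fiber_eq U hp hP (by rw [hu, I.2])
    rw [← h6]
    refine Nat.card_congr ⟨fun x => ⟨x.1.1, x.1.2, ?_⟩, fun x => ⟨⟨x.1, x.2.1⟩, ?_⟩, fun x => rfl, fun x => rfl⟩
    · rw [hu]; exact congrArg Subtype.val x.2
    · apply Subtype.ext; rw [← hu]; exact x.2.2
  rw [← Nat.card_coe_set_eq, h1, Finset.sum_mul, Finset.sum_congr rfl (fun I _ => h2 I), Finset.sum_const, Finset.card_univ,
    ← Nat.card_eq_fintype_card, smul_eq_mul, mul_comm]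
  rfl

end
end

section
section
open Module nonZeroDivisors Ideal Pointwise Filter Topology

lemma tsum_finite_diff (a b : ℕ → ℝ) (T : ℕ) (h : ∀ p : ℕ, p.Prime → T < p → a p = b p)
    (ha : ∀ s : ℝ, 1 < s → Summable (fun p : Nat.Primes => a p * ((p : ℕ) : ℝ) ^ (-s)))
    (hb : ∀ s : ℝ, 1 < s → Summable (fun p : Nat.Primes => b p * ((p : ℕ) : ℝ) ^ (-s))) :
    ∃ C : ℝ, ∀ s : ℝ, 1 < s → |∑' p : Nat.Primes, a p * ((p : ℕ) : ℝ) ^ (-s) - ∑' p : Nat.Primes, b p * ((p : ℕ) : ℝ) ^ (-s)| ≤ C := by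
  classical
  have hfin : {p : Nat.Primes | (p : ℕ) ≤ T}.Finite := by
    apply Set.Finite.of_finite_image (f := fun p : Nat.Primes => (p : ℕ))
    · exact (Set.finite_Iic T).subset (by rintro _ ⟨p, hp, rfl⟩; exact hp)
    · exact fun a _ b _ h => Subtype.ext h
  refine ⟨∑ p ∈ hfin.toFinset, |a p - b p|, fun s hs => ?_⟩
  rw [← (ha s hs).tsum_sub (hb s hs), tsum_eq_sum (s := hfin.toFinset)]
  · refine (Finset.abs_sum_le_sum_abs _ _).trans (Finset.sum_le_sum fun p _ => ?_)
    rw [← sub_mul, abs_mul]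
    have h1 : ((p : ℕ) : ℝ) ^ (-s) ≤ 1 :=
      Real.rpow_le_one_of_one_le_of_nonpos (by exact_mod_cast p.2.one_lt.le) (by linarith)
    have h0 : 0 ≤ ((p : ℕ) : ℝ) ^ (-s) := Real.rpow_nonneg (Nat.cast_nonneg _) _
    rw [abs_of_nonneg h0]
    exact mul_le_of_le_one_right (abs_nonneg _) h1
  · intro p hp
    have : T < (p : ℕ) := by simpa using hp
    rw [h p p.2 this, sub_self]

variable {E : Type} [Field E] [NumberField E] [IsGalois ℚ E]

lemma PP_nonempty {p : ℕ} (hp : p.Prime) : ∃ P, P ∈ PP E p := by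
  have hm : (span {(p : ℤ)}).IsPrime := by
    rw [Ideal.span_singleton_prime (by exact_mod_cast hp.ne_zero)]
    exact Nat.prime_iff_prime_int.1 hp
  obtain ⟨P, hPp, hPl⟩ := (Ideal.nonempty_primesOver (S := 𝓞 E) (P := span {(p : ℤ)}))
  refine ⟨P, hPp, ?_⟩
  have h1 : (p : ℤ) ∈ P.under ℤ := by rw [← hPl.over]; exact mem_span_singleton_self _
  rw [Ideal.under_def, Ideal.mem_comap, map_natCast] at h1
  exact h1

variable (q : ℕ) [Fact q.Prime] (cyc : (E ≃ₐ[ℚ] E) →* (ZMod q)ˣ) (g : E ≃ₐ[ℚ] E)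

structure Setup (B : ℕ) : Prop where
  hB0 : B ≠ 0
  good : ∀ p : ℕ, p.Prime → ¬ p ∣ B → Good E p
  frob : ∀ p : ℕ, p.Prime → ¬ p ∣ B → ∀ P ∈ PP E p, ∀ τ, Fr E p P τ → ((cyc τ : (ZMod q)ˣ) : ZMod q) = p
  gen : ∀ u : (ZMod q)ˣ, u ∈ Subgroup.zpowers (cyc g)
  ord : orderOf g = q - 1

def UZ (Z : Subgroup (ZMod q)ˣ) : Subgroup (E ≃ₐ[ℚ] E) := Subgroup.zpowers g ⊓ Z.comap cyc

variable {q cyc g}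
lemma Setup.inj {B : ℕ} (S : Setup q cyc g B) : Set.InjOn cyc (Subgroup.zpowers g) := by
  have hs : Function.Surjective (cyc.comp (Subgroup.zpowers g).subtype) := by
    intro u
    obtain ⟨j, hj⟩ := Subgroup.mem_zpowers_iff.1 (S.gen u)
    exact ⟨⟨g ^ j, j, rfl⟩, by simpa using hj⟩
  have hc : Nat.card (Subgroup.zpowers g) = Nat.card (ZMod q)ˣ := by
    rw [Nat.card_zpowers, S.ord, Nat.card_eq_fintype_card, ZMod.card_units_eq_totient, Nat.totient_prime Fact.out]
  have := hs.bijective_of_nat_card_le hc.le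
  intro x hx y hy hxy
  exact congrArg Subtype.val (this.1 (a₁ := ⟨x, hx⟩) (a₂ := ⟨y, hy⟩) hxy)

lemma Setup.card_UZ {B : ℕ} (S : Setup q cyc g B) (Z : Subgroup (ZMod q)ˣ) : Nat.card (UZ q cyc g Z) = Nat.card Z := by
  refine Nat.card_eq_of_bijective (fun u => ⟨cyc u.1, u.2.2⟩) ⟨?_, ?_⟩
  · rintro ⟨x, hx⟩ ⟨y, hy⟩ h
    exact Subtype.ext (S.inj hx.1 hy.1 (congrArg Subtype.val h))
  · rintro ⟨z, hz⟩
    obtain ⟨j, hj⟩ := Subgroup.mem_zpowers_iff.1 (S.gen z)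
    refine ⟨⟨g ^ j, ⟨j, rfl⟩, ?_⟩, Subtype.ext ?_⟩
    · change cyc (g ^ j) ∈ Z
      rw [map_zpow, hj]; exact hz
    · simpa using hj

open Classical in
lemma Setup.XU_UZ {B : ℕ} (S : Setup q cyc g B) (Z : Subgroup (ZMod q)ˣ) {p : ℕ} (hp : p.Prime) (hpB : ¬ p ∣ B) :
    XU p (UZ q cyc g Z) = if ∃ u ∈ Z, (u : ZMod q) = p then XU p (Subgroup.zpowers g) else ∅ := by
  split_ifs with h
  · obtain ⟨u, hu, hup⟩ := h
    ext P
    constructor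
    · rintro ⟨hP, τ, hτ, h⟩; exact ⟨hP, τ, hτ.1, h⟩
    · rintro ⟨hP, τ, hτ, h⟩
      refine ⟨hP, τ, ⟨hτ, ?_⟩, h⟩
      have h1 := S.frob p hp hpB P hP τ h
      rw [← hup] at h1
      change cyc τ ∈ Z
      rw [Units.ext h1]; exact hu
  · ext P
    simp only [Set.mem_empty_iff_false, iff_false]
    rintro ⟨hP, τ, hτ, h'⟩
    exact h ⟨cyc τ, hτ.2, S.frob p hp hpB P hP τ h'⟩

open Classical in
lemma Setup.aF_UZ {B : ℕ} (S : Setup q cyc g B) (Z : Subgroup (ZMod q)ˣ) {p : ℕ} (hp : p.Prime) (hpB : ¬ p ∣ B) :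
    Nat.card Z * aF (FU E (UZ q cyc g Z)) p = (q - 1) * (if ∃ u ∈ Z, (u : ZMod q) = p then aF (FU E (Subgroup.zpowers g)) p else 0) := by
  obtain ⟨P, hP⟩ := PP_nonempty (E := E) hp
  rw [← S.card_UZ, counting hp (S.good p hp hpB) hP, S.XU_UZ Z hp hpB]
  split_ifs with h
  · rw [← counting hp (S.good p hp hpB) hP, Nat.card_zpowers, S.ord]
  · simp

open Classical in
noncomputable def DZ (g : E ≃ₐ[ℚ] E) (Z : Set (ZMod q)ˣ) (s : ℝ) : ℝ := ∑' p : Nat.Primes,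
  (if ∃ u ∈ Z, (u : ZMod q) = ((p : ℕ) : ZMod q) then (aF (FU E (Subgroup.zpowers g)) p : ℝ) else 0) * ((p : ℕ) : ℝ) ^ (-s)

open Classical in
lemma DZ_summable (g : E ≃ₐ[ℚ] E) (Z : Set (ZMod q)ˣ) {s : ℝ} (hs : 1 < s) : Summable fun p : Nat.Primes =>
  (if ∃ u ∈ Z, (u : ZMod q) = ((p : ℕ) : ZMod q) then (aF (FU E (Subgroup.zpowers g)) p : ℝ) else 0) * ((p : ℕ) : ℝ) ^ (-s) := by
  refine Summable.of_nonneg_of_le (fun p => ?_) (fun p => ?_) (aFp_summable (FU E (Subgroup.zpowers g)) hs)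
  · have : 0 ≤ ((p : ℕ) : ℝ) ^ (-s) := Real.rpow_nonneg (Nat.cast_nonneg _) _
    split_ifs <;> positivity
  · have : 0 ≤ ((p : ℕ) : ℝ) ^ (-s) := Real.rpow_nonneg (Nat.cast_nonneg _) _
    refine mul_le_mul_of_nonneg_right ?_ this
    split_ifs
    · exact le_rfl
    · positivity

lemma Setup.DZ_asymp {B : ℕ} (S : Setup q cyc g B) (Z : Subgroup (ZMod q)ˣ) :
    ∃ C : ℝ, ∀ᶠ s in 𝓝[>] (1 : ℝ), |((q : ℝ) - 1) * DZ g (Z : Set (ZMod q)ˣ) s - Nat.card Z * Real.log (1 / (s - 1))| ≤ C := by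
  classical
  have hq1 : 1 ≤ q := (Fact.out : q.Prime).one_lt.le
  obtain ⟨C1, h1⟩ := TR_asymp (FU E (UZ q cyc g Z))
  obtain ⟨C2, h2⟩ := tsum_finite_diff (fun p => ((q : ℝ) - 1) * (if ∃ u ∈ Z, (u : ZMod q) = ((p : ℕ) : ZMod q) then (aF (FU E (Subgroup.zpowers g)) p : ℝ) else 0))
    (fun p => Nat.card Z * (aF (FU E (UZ q cyc g Z)) p : ℝ)) B (fun p hp hpB => by
      have h := S.aF_UZ Z hp (fun hd => absurd (Nat.le_of_dvd (Nat.pos_of_ne_zero S.hB0) hd) (by omega))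
      have h' := congrArg (fun n : ℕ => (n : ℝ)) h
      push_cast [Nat.cast_sub hq1] at h'
      simpa using h'.symm) (fun s hs => by
        simp_rw [mul_assoc]
        exact (DZ_summable g (Z : Set (ZMod q)ˣ) hs).mul_left _) (fun s hs => by
        simp_rw [mul_assoc]
        exact (aFp_summable _ hs).mul_left _)
  refine ⟨C2 + Nat.card Z * C1, ?_⟩
  filter_upwards [h1, self_mem_nhdsWithin] with s hs1 hs
  have h3 := h2 s hs
  simp_rw [mul_assoc] at h3
  rw [tsum_mul_left, tsum_mul_left] at h3
  change |((q : ℝ) - 1) * DZ g (Z : Set (ZMod q)ˣ) s - Nat.card Z * TR (FU E (UZ q cyc g Z)) s| ≤ C2 at h3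
  have h4 : |(Nat.card Z : ℝ) * TR (FU E (UZ q cyc g Z)) s - Nat.card Z * Real.log (1 / (s - 1))| ≤ Nat.card Z * C1 := by
    rw [← mul_sub, abs_mul, abs_of_nonneg (Nat.cast_nonneg _)]
    gcongr
  exact (abs_sub_le _ _ _).trans (add_le_add h3 h4)

lemma log_tendsto : Tendsto (fun s : ℝ => Real.log (1 / (s - 1))) (𝓝[>] 1) atTop := by
  apply Real.tendsto_log_atTop.comp
  simp_rw [one_div]
  apply tendsto_inv_nhdsGT_zero.comp
  rw [tendsto_nhdsWithin_iff]
  constructor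
  · have : Tendsto (fun s : ℝ => s - 1) (𝓝 1) (𝓝 (1 - 1)) := (continuous_id.sub continuous_const).tendsto 1
    rw [sub_self] at this
    exact this.mono_left nhdsWithin_le_nhds
  · filter_upwards [self_mem_nhdsWithin] with s hs
    have hs : (1:ℝ) < s := hs
    exact sub_pos.2 hs

lemma Setup.nontriv {B : ℕ} (S : Setup q cyc g B) (χ : DirichletCharacter ℂ q) (hχ : χ ≠ 1) (y : ℕ) :
    ∃ p : ℕ, p.Prime ∧ y < p ∧ aF (FU E (Subgroup.zpowers g)) p ≠ 0 ∧ χ (p : ZMod q) ≠ 1 := by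
  classical
  by_contra hc
  push Not at hc
  set Z : Subgroup (ZMod q)ˣ := χ.toUnitHom.ker with hZ
  obtain ⟨C1, h1⟩ := S.DZ_asymp Z
  obtain ⟨C2, h2⟩ := TR_asymp (FU E (Subgroup.zpowers g))
  obtain ⟨C3, h3⟩ := tsum_finite_diff (fun p => (if ∃ u ∈ (Z : Set (ZMod q)ˣ), (u : ZMod q) = ((p : ℕ) : ZMod q) then (aF (FU E (Subgroup.zpowers g)) p : ℝ) else 0))
    (fun p => (aF (FU E (Subgroup.zpowers g)) p : ℝ)) y (fun p hp hpB => by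
      split_ifs with h
      · rfl
      · by_contra h0
        have h0 : aF (FU E (Subgroup.zpowers g)) p ≠ 0 := by intro h; apply h0; simp [h]
        have h5 := hc p hp hpB h0
        apply h
        have hu : IsUnit (p : ZMod q) := by
          by_contra hn
          rw [χ.map_nonunit hn] at h5
          exact zero_ne_one h5
        obtain ⟨u, hu⟩ := hu
        refine ⟨u, ?_, hu⟩
        rw [SetLike.mem_coe, hZ, MonoidHom.mem_ker]
        apply Units.ext
        rw [MulChar.coe_toUnitHom, hu, h5]; rfl) (fun s hs => DZ_summable g _ hs) (fun s hs => aFp_summable _ hs)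
  have hlt : Nat.card Z < q - 1 := by
    have hc : q - 1 = Nat.card (ZMod q)ˣ := by
      rw [Nat.card_eq_fintype_card, ZMod.card_units_eq_totient, Nat.totient_prime Fact.out]
    rw [hc]
    refine lt_of_le_of_ne (Subgroup.card_le_card_group Z) fun h => hχ ?_
    have hT := Subgroup.eq_top_of_card_eq _ h
    rw [hZ, MonoidHom.ker_eq_top_iff] at hT
    ext u
    rw [← MulChar.coe_toUnitHom, hT]; simp
  have hq1 : 1 ≤ q := (Fact.out : q.Prime).one_lt.le
  have hlt' : (Nat.card Z : ℝ) + 1 ≤ (q : ℝ) - 1 := by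
    have : ((Nat.card Z + 1 : ℕ) : ℝ) ≤ ((q - 1 : ℕ) : ℝ) := by exact_mod_cast hlt
    rw [Nat.cast_sub hq1] at this
    push_cast at this; linarith
  have h4 := log_tendsto.eventually_gt_atTop (C1 + ((q:ℝ) - 1) * (C2 + C3))
  obtain ⟨s, ⟨⟨hs1, hs2⟩, hs4⟩, hs⟩ := (((h1.and h2).and h4).and self_mem_nhdsWithin).exists
  have hs : (1:ℝ) < s := hs
  have hs3 := h3 s hs
  change |DZ g (Z : Set (ZMod q)ˣ) s - TR (FU E (Subgroup.zpowers g)) s| ≤ C3 at hs3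
  set L := Real.log (1 / (s - 1))
  set D := DZ g (Z : Set (ZMod q)ˣ) s
  set T := TR (FU E (Subgroup.zpowers g)) s
  have hC1 : 0 ≤ C1 := (abs_nonneg _).trans hs1
  have hC2 : 0 ≤ C2 := (abs_nonneg _).trans hs2
  have hC3 : 0 ≤ C3 := (abs_nonneg _).trans hs3
  rw [abs_le] at hs1 hs2 hs3
  have hz : (0:ℝ) ≤ Nat.card Z := Nat.cast_nonneg _
  have a1 : L - (C2 + C3) ≤ D := by linarith
  have a2 : ((q:ℝ) - 1) * (L - (C2 + C3)) ≤ ((q:ℝ) - 1) * D := mul_le_mul_of_nonneg_left a1 (by linarith)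
  have hL : 0 < L := lt_of_le_of_lt (by have : (0:ℝ) ≤ (q:ℝ) - 1 := by linarith
                                        positivity) hs4
  nlinarith [mul_le_mul_of_nonneg_right hlt' hL.le]

end
end

section
section
open Module nonZeroDivisors Ideal Pointwise Filter Topology

lemma TT_finite_diff (F : Type) [Field F] [NumberField F] {q q' : ℕ} (χ : DirichletCharacter ℂ q) (χ' : DirichletCharacter ℂ q') (T : ℕ)
    (h : ∀ p : ℕ, p.Prime → T < p → χ p = χ' p) : ∃ C : ℝ, ∀ s : ℝ, 1 < s → ‖TT F χ s - TT F χ' s‖ ≤ C := by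
  classical
  have hfin : {p : Nat.Primes | (p : ℕ) ≤ T}.Finite := by
    apply Set.Finite.of_finite_image (f := fun p : Nat.Primes => (p : ℕ))
    · exact (Set.finite_Iic T).subset (by rintro _ ⟨p, hp, rfl⟩; exact hp)
    · exact fun a _ b _ h => Subtype.ext h
  refine ⟨∑ p ∈ hfin.toFinset, 2 * (aF F p : ℝ), fun s hs => ?_⟩
  unfold TT
  rw [← (ffp_summable F χ hs).tsum_sub (ffp_summable F χ' hs), tsum_eq_sum (s := hfin.toFinset)]
  · refine (norm_sum_le _ _).trans (Finset.sum_le_sum fun p _ => ?_)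
    have h1 : ((p : ℕ) : ℝ) ^ (-s) ≤ 1 :=
      Real.rpow_le_one_of_one_le_of_nonpos (by exact_mod_cast p.2.one_lt.le) (by linarith)
    have h0 : (aF F p : ℝ) * ((p : ℕ) : ℝ) ^ (-s) ≤ aF F p := mul_le_of_le_one_right (Nat.cast_nonneg _) h1
    have h2 := ff_norm F χ s p
    have h3 := ff_norm F χ' s p
    exact (norm_sub_le _ _).trans (by linarith)
  · intro p hp
    have : T < (p : ℕ) := by simpa using hp
    unfold ff
    rw [h p p.2 this, sub_self]

variable {E : Type} [Field E] [NumberField E] [IsGalois ℚ E]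
variable {q : ℕ} [Fact q.Prime] {cyc : (E ≃ₐ[ℚ] E) →* (ZMod q)ˣ} {g : E ≃ₐ[ℚ] E}

lemma changeLevel_nat {q m : ℕ} (χ : DirichletCharacter ℂ q) (hm : q ∣ m) {p : ℕ} (hp : p.Coprime m) :
    DirichletCharacter.changeLevel hm χ (p : ZMod m) = χ (p : ZMod q) := by
  have := DirichletCharacter.changeLevel_eq_cast_of_dvd' χ hm (a := (p : ℤ)) (Nat.isCoprime_iff_coprime.2 hp)
  simpa using this

lemma Setup.char_data {B : ℕ} (S : Setup q cyc g B) (χ : DirichletCharacter ℂ q) (hχ : χ ≠ 1) :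
    ∃ (u : ℝ → ℂ) (ℓ : ℂ) (C : ℝ), ContinuousOn u (Set.Ioi 1) ∧ Tendsto (fun s => Complex.exp (u s)) (𝓝[>] 1) (𝓝 ℓ) ∧
      ∀ s, 1 < s → ‖u s - TT (FU E (Subgroup.zpowers g)) χ s‖ ≤ C := by
  set F := FU E (Subgroup.zpowers g)
  set V : ℕ := ∏ p ∈ (Finset.range (⌈2 * BB F⌉₊)).filter Nat.Prime, p with hV
  have hV0 : V ≠ 0 := Finset.prod_ne_zero_iff.2 fun p hp => (Finset.mem_filter.1 hp).2.ne_zero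
  have hq0 : q ≠ 0 := (Fact.out : q.Prime).ne_zero
  have hQ0 : q * V ≠ 0 := mul_ne_zero hq0 hV0
  set χ' := DirichletCharacter.changeLevel (dvd_mul_right q V) χ with hχ'
  have hg : GoodChar F χ' := goodChar_of F χ' (fun p hp hb => by
    refine dvd_mul_of_dvd_right (Finset.dvd_prod_of_mem _ ?_) _
    rw [Finset.mem_filter, Finset.mem_range]
    exact ⟨Nat.lt_ceil.2 hb, hp⟩)
  have hcop : ∀ p : ℕ, p.Prime → q * V < p → p.Coprime (q * V) := fun p hp hlt =>
    Nat.coprime_of_lt_prime hQ0 hlt hp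
  obtain ⟨p, hp, hpQ, hap, hne⟩ := S.nontriv χ hχ (q * V)
  have hex : ∃ I : Ideal (𝓞 F), absNorm I = p := by
    by_contra hc
    push Not at hc
    apply hap
    unfold aF
    have : IsEmpty {I : Ideal (𝓞 F) // absNorm I = p} := ⟨fun I => hc I.1 I.2⟩
    exact Nat.card_of_isEmpty
  obtain ⟨I, hI⟩ := hex
  have hI0 : I ∈ (Ideal (𝓞 F))⁰ := by
    rw [mem_nonZeroDivisors_iff_ne_zero]
    rintro rfl
    simp at hI
    exact hp.ne_zero hI.symm
  obtain ⟨ℓ, hℓ⟩ := L_limit F χ' ⟨I, hI0⟩ (by simp only [hI]; exact hcop p hp hpQ) (by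
    simp only [hI]; rw [hχ', changeLevel_nat χ _ (hcop p hp hpQ)]; exact hne)
  obtain ⟨C, hC⟩ := TT_finite_diff F χ' χ (q * V) (fun p hp hlt => changeLevel_nat χ _ (hcop p hp hlt))
  refine ⟨UU F χ', ℓ, DD F + C, UU_continuousOn F χ' hg, ?_, fun s hs => ?_⟩
  · refine hℓ.congr' ?_
    filter_upwards [self_mem_nhdsWithin] with s hs
    exact (UU_exp F χ' hg hs).symm
  · have h1 := UU_sub F χ' hg hs
    have h2 := hC s hs
    calc _ = ‖(UU F χ' s - TT F χ' s) + (TT F χ' s - TT F χ s)‖ := by congr 1; ring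
      _ ≤ _ := (norm_add_le _ _).trans (add_le_add h1 h2)

lemma exp_upper (u : ℝ → ℂ) (ℓ : ℂ) (h : Tendsto (fun s => Complex.exp (u s)) (𝓝[>] 1) (𝓝 ℓ)) :
    ∃ C : ℝ, ∀ᶠ s in 𝓝[>] (1 : ℝ), (u s).re ≤ C := by
  refine ⟨Real.log (‖ℓ‖ + 1), ?_⟩
  filter_upwards [h.norm.eventually_le_const (lt_add_one ‖ℓ‖)] with s hs
  rw [Complex.norm_exp] at hs
  exact (Real.le_log_iff_exp_le (by positivity)).2 hs

lemma exp_lower (u : ℝ → ℂ) (ℓ : ℂ) (h : Tendsto (fun s => Complex.exp (u s)) (𝓝[>] 1) (𝓝 ℓ)) (C : ℝ)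
    (hC : ∀ᶠ s in 𝓝[>] (1 : ℝ), C ≤ (u s).re) : ℓ ≠ 0 := by
  have : Real.exp C ≤ ‖ℓ‖ := by
    refine ge_of_tendsto h.norm ?_
    filter_upwards [hC] with s hs
    rw [Complex.norm_exp]; exact Real.exp_le_exp.2 hs
  intro h0
  rw [h0, norm_zero] at this
  exact absurd (Real.exp_pos C) (not_lt.2 this)

lemma orth (a : (ZMod q)ˣ) {s : ℝ} (hs : 1 < s) :
    ∑ χ : DirichletCharacter ℂ q, χ ((a : ZMod q)⁻¹) * TT (FU E (Subgroup.zpowers g)) χ s = (((q : ℝ) - 1) * DZ g {a} s : ℝ) := by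
  classical
  have hq1 : 1 ≤ q := (Fact.out : q.Prime).one_lt.le
  unfold TT DZ
  push_cast
  rw [← tsum_mul_left]
  simp_rw [← tsum_mul_left]
  rw [← Summable.tsum_finsetSum (fun χ _ => (ffp_summable _ χ hs).mul_left _)]
  congr 1
  ext p
  unfold ff
  have h1 := DirichletCharacter.sum_char_inv_mul_char_eq ℂ a.isUnit ((p : ℕ) : ZMod q)
  rw [Nat.totient_prime Fact.out, Nat.cast_sub hq1] at h1
  have h2 : (∃ u ∈ ({a} : Set (ZMod q)ˣ), (u : ZMod q) = ((p : ℕ) : ZMod q)) ↔ (a : ZMod q) = ((p : ℕ) : ZMod q) := by simp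
  simp only [h2]
  calc _ = (∑ χ : DirichletCharacter ℂ q, χ ((a : ZMod q)⁻¹) * χ ((p : ℕ) : ZMod q)) * ((aF (FU E (Subgroup.zpowers g)) p : ℂ) * ((((p : ℕ) : ℝ) ^ (-s) : ℝ) : ℂ)) := by
        rw [Finset.sum_mul]
        refine Finset.sum_congr rfl fun χ _ => by ring
    _ = _ := by
        rw [h1]
        split_ifs
        · push_cast; ring
        · simp

theorem Setup.Da_asymp {B : ℕ} (S : Setup q cyc g B) (a : (ZMod q)ˣ) :
    ∃ C : ℝ, ∀ᶠ s in 𝓝[>] (1 : ℝ), |((q : ℝ) - 1) * DZ g {a} s - Real.log (1 / (s - 1))| ≤ C := by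
  classical
  set F := FU E (Subgroup.zpowers g) with hF
  -- trivial character
  obtain ⟨C0, h0⟩ : ∃ C : ℝ, ∀ᶠ s in 𝓝[>] (1 : ℝ), ‖TT F (1 : DirichletCharacter ℂ q) s - (Real.log (1 / (s - 1)) : ℝ)‖ ≤ C := by
    obtain ⟨C1, h1⟩ := TR_asymp F
    obtain ⟨C2, h2⟩ := TT_finite_diff F (1 : DirichletCharacter ℂ q) (1 : DirichletCharacter ℂ 1) q (fun p hp hlt => by
      have hu : IsUnit (p : ZMod q) := by
        rw [ZMod.isUnit_iff_coprime]
        exact Nat.coprime_of_lt_prime (Fact.out : q.Prime).ne_zero hlt hp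
      have hu' : IsUnit (p : ZMod 1) := by
        rw [ZMod.isUnit_iff_coprime]; exact Nat.coprime_one_right p
      rw [MulChar.one_apply hu, MulChar.one_apply hu'])
    refine ⟨C2 + C1, ?_⟩
    filter_upwards [h1, self_mem_nhdsWithin] with s hs1 hs
    have h3 := h2 s hs
    rw [TT_one F hs] at h3
    have h4 : ‖((TR F s : ℝ) : ℂ) - (Real.log (1 / (s - 1)) : ℝ)‖ ≤ C1 := by
      rw [← Complex.ofReal_sub, Complex.norm_real]; exact hs1
    calc _ = ‖(TT F (1 : DirichletCharacter ℂ q) s - ((TR F s : ℝ) : ℂ)) + (((TR F s : ℝ) : ℂ) - (Real.log (1 / (s - 1)) : ℝ))‖ := by congr 1; ring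
      _ ≤ _ := (norm_add_le _ _).trans (add_le_add h3 h4)
  -- upper bound for the real parts
  have hup : ∀ χ : DirichletCharacter ℂ q, ∃ C : ℝ, χ ≠ 1 → ∀ᶠ s in 𝓝[>] (1 : ℝ), (TT F χ s).re ≤ C := by
    intro χ
    by_cases hχ : χ = 1
    · exact ⟨0, fun h => absurd hχ h⟩
    obtain ⟨u, ℓ, C, hu, hl, hd⟩ := S.char_data χ hχ
    obtain ⟨C', hC'⟩ := exp_upper u ℓ hl
    refine ⟨C' + C, fun _ => ?_⟩
    filter_upwards [hC', self_mem_nhdsWithin] with s h1 hs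
    have h2 := (Complex.abs_re_le_norm _).trans (hd s hs)
    rw [Complex.sub_re, abs_le] at h2
    linarith
  choose C1 hC1 using hup
  -- the sum
  obtain ⟨C2, h2⟩ := S.DZ_asymp ⊥
  have hbot : ((⊥ : Subgroup (ZMod q)ˣ) : Set (ZMod q)ˣ) = {1} := rfl
  have hsum : ∀ᶠ s in 𝓝[>] (1 : ℝ), |∑ χ : DirichletCharacter ℂ q, (TT F χ s).re - Real.log (1 / (s - 1))| ≤ C2 := by
    filter_upwards [h2, self_mem_nhdsWithin] with s h3 hs
    have h4 := orth (E := E) (g := g) (1 : (ZMod q)ˣ) hs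
    have h5 := congrArg Complex.re h4
    rw [Complex.ofReal_re, Complex.re_sum] at h5
    rw [hbot] at h3
    rw [← h5] at h3
    simpa using h3
  have hbd : ∀ χ : DirichletCharacter ℂ q, ∃ C : ℝ, χ ≠ 1 → ∀ᶠ s in 𝓝[>] (1 : ℝ), ‖TT F χ s‖ ≤ C := by
    intro χ
    by_cases hχ : χ = 1
    · exact ⟨0, fun h => absurd hχ h⟩
    obtain ⟨u, ℓ, C, hu, hl, hd⟩ := S.char_data χ hχ
    have hall : ∀ᶠ s in 𝓝[>] (1 : ℝ), ∀ χ' : DirichletCharacter ℂ q, χ' ≠ 1 → (TT F χ' s).re ≤ C1 χ' := by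
      rw [eventually_all]
      intro χ'
      by_cases h' : χ' = 1
      · exact Eventually.of_forall fun s hs => absurd h' hs
      · filter_upwards [hC1 χ' h'] with s hs _ using hs
    have hlow : ∀ᶠ s in 𝓝[>] (1 : ℝ), -(C2 + C0 + ∑ χ' ∈ (Finset.univ.erase 1).erase χ, C1 χ') - C ≤ (u s).re := by
      filter_upwards [hsum, h0, hall, self_mem_nhdsWithin] with s h1 h3 h4 hs
      have h5 := (Complex.abs_re_le_norm _).trans (hd s hs)
      rw [Complex.sub_re, abs_le] at h5
      have h6 := (Complex.abs_re_le_norm _).trans h3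
      rw [Complex.sub_re, abs_le, Complex.ofReal_re] at h6
      rw [← Finset.add_sum_erase _ _ (Finset.mem_univ (1 : DirichletCharacter ℂ q)),
        ← Finset.add_sum_erase _ _ (Finset.mem_erase.2 ⟨hχ, Finset.mem_univ χ⟩), abs_le] at h1
      have h7 : ∑ χ' ∈ (Finset.univ.erase 1).erase χ, (TT F χ' s).re ≤ ∑ χ' ∈ (Finset.univ.erase 1).erase χ, C1 χ' :=
        Finset.sum_le_sum fun χ' hm => h4 χ' (Finset.mem_erase.1 (Finset.mem_erase.1 hm).2).1
      linarith
    obtain ⟨C', hC'⟩ := log_branch_bounded u hu ℓ (exp_lower u ℓ hl _ hlow) hl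
    refine ⟨C + C', fun _ => ?_⟩
    filter_upwards [hC', self_mem_nhdsWithin] with s h1 hs
    have h2 := hd s hs
    rw [norm_sub_rev] at h2
    calc ‖TT F χ s‖ = ‖(TT F χ s - u s) + u s‖ := by congr 1; ring
      _ ≤ _ := (norm_add_le _ _).trans (add_le_add h2 h1)
  choose C3 hC3 using hbd
  refine ⟨C0 + ∑ χ ∈ Finset.univ.erase (1 : DirichletCharacter ℂ q), C3 χ, ?_⟩
  have hall : ∀ᶠ s in 𝓝[>] (1 : ℝ), ∀ χ' : DirichletCharacter ℂ q, χ' ≠ 1 → ‖TT F χ' s‖ ≤ C3 χ' := by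
    rw [eventually_all]
    intro χ'
    by_cases h' : χ' = 1
    · exact Eventually.of_forall fun s hs => absurd h' hs
    · filter_upwards [hC3 χ' h'] with s hs _ using hs
  filter_upwards [h0, hall, self_mem_nhdsWithin] with s h1 h3 hs
  have h4 := orth (E := E) (g := g) a hs
  have h5 : |((q : ℝ) - 1) * DZ g {a} s - Real.log (1 / (s - 1))| = ‖((((q : ℝ) - 1) * DZ g {a} s : ℝ) : ℂ) - (Real.log (1 / (s - 1)) : ℝ)‖ := by
    rw [← Complex.ofReal_sub, Complex.norm_real]; rfl
  rw [h5, ← h4, ← Finset.add_sum_erase _ _ (Finset.mem_univ (1 : DirichletCharacter ℂ q))]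
  have hinv : IsUnit ((a : ZMod q)⁻¹) := by
    exact a.isUnit.inv
  rw [MulChar.one_apply hinv, one_mul]
  calc _ = ‖(TT F (1 : DirichletCharacter ℂ q) s - (Real.log (1 / (s - 1)) : ℝ)) + ∑ χ ∈ Finset.univ.erase (1 : DirichletCharacter ℂ q), χ ((a : ZMod q)⁻¹) * TT F χ s‖ := by
        congr 1; ring
    _ ≤ _ := (norm_add_le _ _).trans (add_le_add h1 ((norm_sum_le _ _).trans (Finset.sum_le_sum fun χ hm => ?_)))
  rw [norm_mul]
  have h6 := h3 χ (Finset.mem_erase.1 hm).1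
  exact (mul_le_of_le_one_left (norm_nonneg _) (DirichletCharacter.norm_le_one χ _)).trans h6

end
end

section
section
open Module nonZeroDivisors Ideal Pointwise Filter Topology

variable {E : Type} [Field E] [NumberField E] [IsGalois ℚ E]

lemma Fr_conj {p : ℕ} {P : Ideal (𝓞 E)} {τ : E ≃ₐ[ℚ] E} (h : Fr E p P τ) (u : E ≃ₐ[ℚ] E) :
    Fr E p (u • P) (u * τ * u⁻¹) := by
  intro x
  have h1 := Ideal.smul_mem_pointwise_smul u _ P (h (u⁻¹ • x))
  rwa [smul_sub, smul_pow', smul_inv_smul, smul_smul, smul_smul] at h1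

variable {q : ℕ} [Fact q.Prime] {cyc : (E ≃ₐ[ℚ] E) →* (ZMod q)ˣ} {g : E ≃ₐ[ℚ] E}

lemma Setup.aF_le {B : ℕ} (S : Setup q cyc g B) {p : ℕ} (hp : p.Prime) (hpB : ¬ p ∣ B)
    (hpg : ((cyc g : (ZMod q)ˣ) : ZMod q) = p) :
    aF (FU E (Subgroup.zpowers g)) p * (q - 1) ≤ Nat.card (Subgroup.centralizer ({g} : Set (E ≃ₐ[ℚ] E))) ∧
      (aF (FU E (Subgroup.zpowers g)) p ≠ 0 → ∃ P ∈ PP E p, Fr E p P g) := by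
  have hq1 : 0 < q - 1 := Nat.sub_pos_of_lt (Fact.out : q.Prime).one_lt
  have hg := S.good p hp hpB
  have hgX : ∀ P ∈ XU p (Subgroup.zpowers g), Fr E p P g := by
    rintro P ⟨hP, τ, hτ, h⟩
    have h1 := S.frob p hp hpB P hP τ h
    rw [← hpg] at h1
    have : τ = g := S.inj hτ (Subgroup.mem_zpowers g) (Units.ext h1)
    rwa [this] at h
  by_cases hX : (XU p (Subgroup.zpowers g)).Nonempty
  · obtain ⟨P, hP⟩ := hX
    have hPg := hgX P hP
    have h1 := counting hp hg hP.1 (Subgroup.zpowers g)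
    rw [stab_eq hp hg hP.1 hPg, Nat.card_zpowers, S.ord, mul_comm] at h1
    have h2 := Nat.eq_of_mul_eq_mul_right hq1 h1
    have hcg : g ∈ Subgroup.centralizer ({g} : Set (E ≃ₐ[ℚ] E)) := by
      rw [Subgroup.mem_centralizer_singleton_iff]
    have h3 := orbit_card (Subgroup.centralizer ({g} : Set (E ≃ₐ[ℚ] E))) hp hg hP.1 hcg hPg
    rw [stab_eq hp hg hP.1 hPg, Nat.card_zpowers, S.ord] at h3
    refine ⟨?_, fun _ => ⟨P, hP.1, hPg⟩⟩
    rw [h2, ← h3]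
    apply Nat.mul_le_mul_right
    change _ ≤ Set.ncard (MulAction.orbit (Subgroup.centralizer ({g} : Set (E ≃ₐ[ℚ] E))) P)
    apply Set.ncard_le_ncard
    · intro Q hQ
      obtain ⟨u, hu⟩ := PP_trans hp hP.1 hQ.1
      have h4 := Fr_conj hPg u
      rw [← hu] at h4
      have h5 := Fr_unique hg hQ.1 h4 (hgX Q hQ)
      refine ⟨⟨u, ?_⟩, hu.symm⟩
      rw [Subgroup.mem_centralizer_singleton_iff]
      exact mul_inv_eq_iff_eq_mul.1 h5
    · exact Set.finite_range _
  · obtain ⟨P, hP⟩ := PP_nonempty (E := E) hp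
    have h1 := counting hp hg hP (Subgroup.zpowers g)
    rw [Set.not_nonempty_iff_eq_empty.1 hX, Set.ncard_empty, zero_mul, Nat.card_zpowers, S.ord] at h1
    have h2 : aF (FU E (Subgroup.zpowers g)) p = 0 := by
      rcases Nat.mul_eq_zero.1 h1 with h | h
      · omega
      · exact h
    rw [h2]; simp
end
end

section
section
open Module nonZeroDivisors Ideal Pointwise Filter Topology

variable {K : Type} [Field K] [NumberField K] [IsGalois ℚ K]

lemma galRestrict_smul (u : K ≃ₐ[ℚ] K) (x : 𝓞 K) : galRestrict ℤ ℚ K (𝓞 K) u x = u • x := by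
  apply RingOfIntegers.ext
  rw [smul_coe]
  exact algebraMap_galRestrict_apply ℤ u x

lemma isFrob_iff {p : ℕ} (hp : p.Prime) (τ : K ≃ₐ[ℚ] K) : IsFrobeniusAt K p τ ↔ ∃ P ∈ PP K p, Fr K p P τ := by
  constructor
  · rintro ⟨P, hP, hpP, h⟩
    exact ⟨P, ⟨hP.isPrime, hpP⟩, fun x => by rw [← galRestrict_smul]; exact h x⟩
  · rintro ⟨P, hP, h⟩
    exact ⟨P, PP_max K hp hP, hP.2, fun x => by rw [galRestrict_smul]; exact h x⟩

lemma mem_cheb (C : ConjClasses (K ≃ₐ[ℚ] K)) {p : ℕ} (hp : p.Prime) (hd : ¬ p ∣ (discr K).natAbs) (hg : Good K p)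
    {P : Ideal (𝓞 K)} (hP : P ∈ PP K p) {σ : K ≃ₐ[ℚ] K} (h : Fr K p P σ) (hσ : σ ∈ C.carrier) : p ∈ chebotarevSet K C := by
  refine ⟨hp, hd, ?_⟩
  rw [ConjClasses.mem_carrier_iff_mk_eq] at hσ
  subst hσ
  ext τ
  rw [Set.mem_setOf_eq, isFrob_iff hp, ConjClasses.mem_carrier_iff_mk_eq, ConjClasses.mk_eq_mk_iff_isConj, isConj_comm, isConj_iff]
  constructor
  · rintro ⟨Q, hQ, hτ⟩
    obtain ⟨u, rfl⟩ := PP_trans hp hP hQ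
    exact ⟨u, Fr_unique hg hQ (Fr_conj h u) hτ⟩
  · rintro ⟨u, rfl⟩
    exact ⟨u • P, smul_PP hP u, Fr_conj h u⟩

variable {E : Type} [Field E] [NumberField E] [IsGalois ℚ E] [Algebra K E]

lemma Fr_restrict {p : ℕ} {P : Ideal (𝓞 E)} (hP : P ∈ PP E p) {σ : K ≃ₐ[ℚ] K} {g : E ≃ₐ[ℚ] E}
    (hgσ : ∀ x : K, g (algebraMap K E x) = algebraMap K E (σ x)) (h : Fr E p P g) : ∃ Q ∈ PP K p, Fr K p Q σ := by
  have := hP.1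
  refine ⟨P.under (𝓞 K), ⟨inferInstance, ?_⟩, fun x => ?_⟩
  · rw [Ideal.under_def, Ideal.mem_comap, map_natCast]
    exact hP.2
  · rw [Ideal.under_def, Ideal.mem_comap, map_sub, map_pow]
    have h1 := h (algebraMap (𝓞 K) (𝓞 E) x)
    have h2 : g • (algebraMap (𝓞 K) (𝓞 E) x) = algebraMap (𝓞 K) (𝓞 E) (σ • x) := by
      apply RingOfIntegers.ext
      rw [smul_coe]
      exact hgσ x
    rwa [h2] at h1
end
end

section
section
open Module nonZeroDivisors Ideal Pointwise Filter Topology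

variable (K : Type) [Field K] [NumberField K] [IsGalois ℚ K] (q : ℕ) [Fact q.Prime]

lemma cyc_fields (L : Type) [Field L] [NumberField L] [Algebra K L] [IsCyclotomicExtension {q} K L] {ζ : L} (hζ : IsPrimitiveRoot ζ q) :
    IsGalois ℚ L ∧ (¬ q ∣ (discr K).natAbs → Module.finrank ℚ L = Module.finrank ℚ K * (q - 1)) := by
  have hq : q.Prime := Fact.out
  have : NeZero q := ⟨hq.ne_zero⟩
  let f : K →ₐ[ℚ] L := IsScalarTower.toAlgHom ℚ K L
  let e : K ≃ₐ[ℚ] f.fieldRange := f.equivFieldRange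
  set A : IntermediateField ℚ L := f.fieldRange with hA
  set Z : IntermediateField ℚ L := IntermediateField.adjoin ℚ {ζ} with hZ
  have hcy : IsCyclotomicExtension {q} ℚ Z := hζ.intermediateField_adjoin_isCyclotomicExtension ℚ
  have hgA : IsGalois ℚ A := IsGalois.of_algEquiv e
  have hgZ : IsGalois ℚ Z := IsCyclotomicExtension.isGalois {q} ℚ Z
  have htop : A ⊔ Z = ⊤ := by
    rw [eq_top_iff]
    intro x _
    have h1 := IsCyclotomicExtension.adjoin_primitive_root_eq_top (A := K) (B := L) hζ
    have hx : x ∈ Algebra.adjoin K {ζ} := by rw [h1]; exact Algebra.mem_top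
    induction hx using Algebra.adjoin_induction with
    | mem x hx =>
      rw [Set.mem_singleton_iff] at hx
      subst hx
      exact (le_sup_right : Z ≤ A ⊔ Z) (IntermediateField.mem_adjoin_simple_self ℚ _)
    | algebraMap r => exact (le_sup_left : A ≤ A ⊔ Z) ⟨r, rfl⟩
    | add x y _ _ hx hy => exact add_mem (hx trivial) (hy trivial)
    | mul x y _ _ hx hy => exact mul_mem (hx trivial) (hy trivial)
  have hgS : IsGalois ℚ (A ⊔ Z : IntermediateField ℚ L) := by
    have hnA : @Normal ℚ A _ _ A.algebra' := by convert hgA.to_normal; exact Subsingleton.elim _ _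
    have hnZ : @Normal ℚ Z _ _ Z.algebra' := by convert hgZ.to_normal; exact Subsingleton.elim _ _
    have hn := @IntermediateField.normal_sup ℚ L _ _ _ A Z hnA hnZ
    exact @IsGalois.mk _ _ _ _ _ inferInstance (by convert hn; exact Subsingleton.elim _ _)
  refine ⟨?_, fun hd => ?_⟩
  · rw [htop] at hgS
    have hgS' : @IsGalois ℚ _ (⊤ : IntermediateField ℚ L) _ (⊤ : IntermediateField ℚ L).algebra' := by convert hgS; exact Subsingleton.elim _ _
    have := @IsGalois.of_algEquiv _ _ _ _ _ _ _ _ hgS' (IntermediateField.topEquiv (F := ℚ) (E := L))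
    convert this
  · have hdA : discr A = discr K := (discr_eq_discr_of_algEquiv K e).symm
    have hcop : IsCoprime (discr A) (discr Z) := by
      rw [hdA, IsCyclotomicExtension.Rat.discr_prime q Z]
      have : IsCoprime (discr K) (q : ℤ) := by
        rw [isCoprime_comm, (Nat.prime_iff_prime_int.1 hq).coprime_iff_not_dvd]
        rwa [Int.natCast_dvd]
      refine IsCoprime.mul_right ?_ this.pow_right
      exact (isCoprime_one_right.neg_right).pow_right
    have h1 := (linearDisjoint_of_isGalois_isCoprime_discr L A Z hcop).finrank_sup
    rw [htop, IntermediateField.finrank_top'] at h1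
    rw [h1, IsCyclotomicExtension.Rat.finrank q Z, Nat.totient_prime hq, e.toLinearEquiv.finrank_eq]

lemma autToPow_iff (L : Type) [Field L] [NumberField L] [NeZero q] {ζ : L} (hζ : IsPrimitiveRoot ζ q) (u : L ≃ₐ[ℚ] L) (p : ℕ) :
    ((hζ.autToPow ℚ u : (ZMod q)ˣ) : ZMod q) = p ↔ u ζ = ζ ^ p := by
  rw [← hζ.autToPow_spec ℚ u]
  generalize hζ.autToPow ℚ u = w
  have hz : ζ ≠ 0 := hζ.ne_zero (NeZero.ne q)
  have key : ∀ m n : ℕ, ζ ^ m = ζ ^ n ↔ m % q = n % q := by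
    intro m n
    have h1 : orderOf (Units.mk0 ζ hz) = q := by rw [← orderOf_units, Units.val_mk0, ← hζ.eq_orderOf]
    have h2 := pow_inj_mod (x := Units.mk0 ζ hz) (n := m) (m := n)
    rw [h1, Units.ext_iff] at h2
    simpa using h2
  rw [key]
  constructor
  · intro h
    rw [h, ZMod.val_natCast, Nat.mod_mod]
  · intro h
    have := (ZMod.natCast_eq_natCast_iff' _ _ q).2 h
    rwa [ZMod.natCast_zmod_val] at this

lemma res_bij (L : Type) [Field L] [NumberField L] [Algebra K L] [IsCyclotomicExtension {q} K L] [NeZero q] {ζ : L} (hζ : IsPrimitiveRoot ζ q)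
    (hd : ¬ q ∣ (discr K).natAbs) : Function.Bijective (fun u : L ≃ₐ[ℚ] L => (AlgEquiv.restrictNormalHom K u, hζ.autToPow ℚ u)) := by
  have hq : q.Prime := Fact.out
  obtain ⟨h1, h2⟩ := cyc_fields K q L hζ
  apply Function.Injective.bijective_of_nat_card_le
  · intro u v huv
    have ha := congrArg Prod.fst huv
    have hb := congrArg Prod.snd huv
    simp only at ha hb
    have h3 : u ζ = v ζ := by rw [← hζ.autToPow_spec ℚ u, hb, hζ.autToPow_spec ℚ v]
    have h4 : ∀ x : K, u (algebraMap K L x) = v (algebraMap K L x) := by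
      intro x
      rw [← AlgEquiv.restrictNormal_commutes, ← AlgEquiv.restrictNormal_commutes]
      exact congrArg (algebraMap K L) (DFunLike.congr_fun ha x)
    ext x
    have hx : x ∈ Algebra.adjoin K {ζ} := by
      rw [IsCyclotomicExtension.adjoin_primitive_root_eq_top (A := K) (B := L) hζ]; exact Algebra.mem_top
    induction hx using Algebra.adjoin_induction with
    | mem x hx =>
      rw [Set.mem_singleton_iff] at hx
      subst hx
      exact h3
    | algebraMap r => exact h4 r
    | add x y _ _ hx hy => rw [map_add, map_add, hx, hy]
    | mul x y _ _ hx hy => rw [map_mul, map_mul, hx, hy]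
  · rw [Nat.card_prod, IsGalois.card_aut_eq_finrank, IsGalois.card_aut_eq_finrank, h2 hd, Nat.card_eq_fintype_card (α := (ZMod q)ˣ),
      ZMod.card_units_eq_totient, Nat.totient_prime hq]
end
end

section
section
open Module nonZeroDivisors Ideal Pointwise Filter Topology

lemma frob_cyc (L : Type) [Field L] [NumberField L] (q : ℕ) [Fact q.Prime] [NeZero q] {ζ : L} (hζ : IsPrimitiveRoot ζ q) :
    ∃ B : ℕ, B ≠ 0 ∧ ∀ p : ℕ, p.Prime → ¬ p ∣ B → ∀ P ∈ PP L p, ∀ τ, Fr L p P τ → ((hζ.autToPow ℚ τ : (ZMod q)ˣ) : ZMod q) = p := by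
  classical
  have hq : q.Prime := Fact.out
  set z : 𝓞 L := hζ.toInteger with hz
  have hzp : IsPrimitiveRoot z q := hζ.toInteger_isPrimitiveRoot
  refine ⟨∏ i ∈ Finset.range q, ∏ j ∈ Finset.range q, (if i = j then 1 else absNorm (span {z ^ i - z ^ j})), ?_, ?_⟩
  · rw [Finset.prod_ne_zero_iff]
    intro i hi
    rw [Finset.prod_ne_zero_iff]
    intro j hj
    split_ifs with h
    · exact one_ne_zero
    · rw [Ne, absNorm_eq_zero_iff, Ideal.span_singleton_eq_bot, sub_eq_zero]
      intro h'
      exact h (hzp.pow_inj (Finset.mem_range.1 hi) (Finset.mem_range.1 hj) h')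
  · intro p hp hpB P hP τ hτ
    rw [autToPow_iff]
    by_contra hc
    apply hpB
    set m := ((hζ.autToPow ℚ τ : (ZMod q)ˣ) : ZMod q).val with hm
    have hτz : τ • z = z ^ m := by
      apply RingOfIntegers.ext
      rw [smul_coe]
      change τ ζ = _
      rw [← hζ.autToPow_spec ℚ τ]
      exact (map_pow (algebraMap (𝓞 L) L) z m).symm
    have hpz : z ^ p = z ^ (p % q) := by
      conv_lhs => rw [← Nat.mod_add_div p q, pow_add, pow_mul, hzp.pow_eq_one, one_pow, mul_one]
    have h1 := hτ z
    rw [hτz, hpz] at h1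
    have hmq : m < q := ZMod.val_lt _
    have hpq : p % q < q := Nat.mod_lt _ hq.pos
    have hne : m ≠ p % q := by
      intro h
      apply hc
      have h2 : τ • z = z ^ p := by rw [hτz, hpz, h]
      have h3 := congrArg (fun x : 𝓞 L => (algebraMap (𝓞 L) L x)) h2
      simp only [map_pow] at h3
      exact h3
    have h2 : p ∣ absNorm (span {z ^ m - z ^ (p % q)}) :=
      (PP_dvd L hp hP).trans (absNorm_dvd_absNorm_of_le ((span_singleton_le_iff_mem _).2 h1))
    refine h2.trans ?_
    refine Dvd.dvd.trans ?_ (Finset.dvd_prod_of_mem _ (Finset.mem_range.2 hmq))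
    refine Dvd.dvd.trans ?_ (Finset.dvd_prod_of_mem _ (Finset.mem_range.2 hpq))
    rw [if_neg hne]

variable (K : Type) [Field K] [NumberField K] [IsGalois ℚ K] (q : ℕ) [Fact q.Prime]

lemma setup_exists [NeZero q] (L : Type) [Field L] [NumberField L] [IsGalois ℚ L] [Algebra K L] [IsCyclotomicExtension {q} K L] {ζ : L} (hζ : IsPrimitiveRoot ζ q)
    (hd : ¬ q ∣ (discr K).natAbs) (σ : K ≃ₐ[ℚ] K) (hσ : orderOf σ ∣ q - 1) :
    ∃ (g : L ≃ₐ[ℚ] L) (B : ℕ), Setup q (hζ.autToPow ℚ) g B ∧ AlgEquiv.restrictNormalHom K g = σ := by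
  have hq : q.Prime := Fact.out
  have hb := res_bij K q L hζ hd
  obtain ⟨a, ha⟩ := IsCyclic.exists_generator (α := (ZMod q)ˣ)
  obtain ⟨g, hg⟩ := hb.2 (σ, a)
  have hg1 : AlgEquiv.restrictNormalHom K g = σ := congrArg Prod.fst hg
  have hg2 : hζ.autToPow ℚ g = a := congrArg Prod.snd hg
  obtain ⟨B1, hB1, h1⟩ := exists_good L
  obtain ⟨B2, hB2, h2⟩ := frob_cyc L q hζ
  have hcard : Nat.card (ZMod q)ˣ = q - 1 := by
    rw [Nat.card_eq_fintype_card, ZMod.card_units_eq_totient, Nat.totient_prime hq]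
  have hoa : orderOf a = q - 1 := by rw [orderOf_eq_card_of_forall_mem_zpowers ha, hcard]
  refine ⟨g, B1 * B2, ⟨mul_ne_zero hB1 hB2, fun p hp hpB => h1 p hp fun h => hpB (h.mul_right _),
    fun p hp hpB => h2 p hp fun h => hpB (h.mul_left _), ?_, ?_⟩, hg1⟩
  · rw [hg2]; exact ha
  · apply Nat.dvd_antisymm
    · rw [orderOf_dvd_iff_pow_eq_one]
      apply hb.1
      simp only [map_pow, map_one, hg1, hg2]
      rw [orderOf_dvd_iff_pow_eq_one.1 hσ, ← hoa, pow_orderOf_eq_one]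
    · rw [← hoa, ← hg2]
      exact orderOf_map_dvd (hζ.autToPow ℚ) g

lemma card_centralizer [NeZero q] (L : Type) [Field L] [NumberField L] [IsGalois ℚ L] [Algebra K L] [IsCyclotomicExtension {q} K L] {ζ : L} (hζ : IsPrimitiveRoot ζ q)
    (hd : ¬ q ∣ (discr K).natAbs) (g : L ≃ₐ[ℚ] L) :
    Nat.card (Subgroup.centralizer ({g} : Set (L ≃ₐ[ℚ] L))) ≤
      Nat.card (Subgroup.centralizer ({AlgEquiv.restrictNormalHom K g} : Set (K ≃ₐ[ℚ] K))) * (q - 1) := by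
  have hq : q.Prime := Fact.out
  have hb := res_bij K q L hζ hd
  have hcard : Nat.card (ZMod q)ˣ = q - 1 := by
    rw [Nat.card_eq_fintype_card, ZMod.card_units_eq_totient, Nat.totient_prime hq]
  rw [← hcard, ← Nat.card_prod]
  refine Nat.card_le_card_of_injective (fun u => (⟨AlgEquiv.restrictNormalHom K u.1, ?_⟩, hζ.autToPow ℚ u.1)) ?_
  · have := Subgroup.mem_centralizer_singleton_iff.1 u.2
    rw [Subgroup.mem_centralizer_singleton_iff, ← map_mul, this, map_mul]
  · intro u v huv
    apply Subtype.ext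
    apply hb.1
    have h1 := congrArg Prod.fst huv
    have h2 := congrArg Prod.snd huv
    exact Prod.ext (congrArg Subtype.val h1) h2

lemma card_conj {G : Type} [Group G] [Finite G] (C : ConjClasses G) {σ : G} (h : σ ∈ C.carrier) :
    Nat.card C.carrier * Nat.card (Subgroup.centralizer ({σ} : Set G)) = Nat.card G := by
  rw [ConjClasses.mem_carrier_iff_mk_eq] at h
  subst h
  rw [Subgroup.nat_card_centralizer_nat_card_stabilizer, ← ConjAct.orbit_eq_carrier_conjClasses]
  rw [← Nat.card_prod]
  have := Nat.card_congr (MulAction.orbitProdStabilizerEquivGroup (ConjAct G) σ)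
  rw [this]
  exact Nat.card_congr ConjAct.ofConjAct.toEquiv
end
end

section
section
open Module nonZeroDivisors Ideal Pointwise Filter Topology

variable (K : Type) [Field K] [NumberField K] [IsGalois ℚ K]

section
variable {E : Type} [Field E] [NumberField E] [IsGalois ℚ E] {q : ℕ} [Fact q.Prime]
open Classical in
noncomputable def DAt (g : E ≃ₐ[ℚ] E) (w : (ZMod q)ˣ) (p : ℕ) : ℝ :=
  if ∃ u ∈ ({w} : Set (ZMod q)ˣ), (u : ZMod q) = (p : ZMod q) then (aF (FU E (Subgroup.zpowers g)) p : ℝ) else 0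

lemma DAt_nonneg (g : E ≃ₐ[ℚ] E) (w : (ZMod q)ˣ) (p : ℕ) : 0 ≤ DAt g w p := by
  unfold DAt; split_ifs <;> positivity

lemma DAt_pos (g : E ≃ₐ[ℚ] E) (w : (ZMod q)ˣ) (p : ℕ) (h : (w : ZMod q) = p) : DAt g w p = (aF (FU E (Subgroup.zpowers g)) p : ℝ) := by
  unfold DAt; rw [if_pos ⟨w, rfl, h⟩]

lemma DAt_neg (g : E ≃ₐ[ℚ] E) (w : (ZMod q)ˣ) (p : ℕ) (h : ¬ (w : ZMod q) = p) : DAt g w p = 0 := by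
  unfold DAt; rw [if_neg]
  rintro ⟨u, hu, hup⟩
  rw [Set.mem_singleton_iff] at hu
  exact h (hu ▸ hup)

lemma DAt_summable (g : E ≃ₐ[ℚ] E) (w : (ZMod q)ˣ) (s : ℝ) (hs : 1 < s) : Summable (fun p : Nat.Primes => DAt g w p * ((p : ℕ) : ℝ) ^ (-s)) := by
  unfold DAt
  convert DZ_summable g {w} hs

lemma DAt_tsum (g : E ≃ₐ[ℚ] E) (w : (ZMod q)ˣ) (s : ℝ) : DZ g {w} s = ∑' p : Nat.Primes, DAt g w p * ((p : ℕ) : ℝ) ^ (-s) := by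
  unfold DAt DZ
  congr! 4
end

set_option maxHeartbeats 400000 in
open Classical in
theorem cheb_dir_aux (C : ConjClasses (K ≃ₐ[ℚ] K)) (q : ℕ) (hq : q.Prime) [Fact q.Prime] [NeZero q] (hd : ¬ q ∣ (discr K).natAbs)
    (L : Type) [Field L] [NumberField L] [IsGalois ℚ L] [Algebra K L] [IsCyclotomicExtension {q} K L] {ζ : L} (hζ : IsPrimitiveRoot ζ q)
    (σ : K ≃ₐ[ℚ] K) (hσC : σ ∈ C.carrier) (hof : orderOf σ ∣ q - 1) :
    ∃ a : ℕ, a.Coprime q ∧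
    ∃ c : ℝ, ∀ᶠ s in 𝓝[>] (1:ℝ), (Nat.card C.carrier : ℝ) / (Nat.card (K ≃ₐ[ℚ] K) : ℝ) / ((q:ℝ) - 1) * Real.log (1 / (s - 1)) - c ≤
      ∑' p : Nat.Primes, (if (p : ℕ) ∈ chebotarevSet K C ∧ (p : ℕ) % q = a % q then (1:ℝ) else 0) * ((p : ℕ) : ℝ) ^ (-s) := by
  have hq1 : (0:ℝ) < (q:ℝ) - 1 := by
    have : (1:ℝ) < q := by exact_mod_cast hq.one_lt
    linarith
  have hd0 : (discr K).natAbs ≠ 0 := Int.natAbs_ne_zero.2 (discr_ne_zero K)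
  obtain ⟨g, B, S, hgσ⟩ := setup_exists K q L hζ hd σ hof
  set cyc := hζ.autToPow ℚ with hcyc
  obtain ⟨BK, hBK0, hBK⟩ := exists_good K
  set a : ℕ := ((cyc g : (ZMod q)ˣ) : ZMod q).val with ha
  have haq : ((cyc g : (ZMod q)ˣ) : ZMod q) = a := (ZMod.natCast_zmod_val _).symm
  refine ⟨a, ?_, ?_⟩
  · exact ZMod.val_coe_unit_coprime _
  obtain ⟨C0, hC0⟩ := S.Da_asymp (cyc g)
  set T := B * BK * (discr K).natAbs with hT
  have hT0 : T ≠ 0 := mul_ne_zero (mul_ne_zero S.hB0 hBK0) hd0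
  obtain ⟨A, hA⟩ : ∃ A : ℕ → ℝ, A = DAt g (cyc g) := ⟨_, rfl⟩
  have hA0 : ∀ p, 0 ≤ A p := by intro p; rw [hA]; exact DAt_nonneg _ _ _
  let b : ℕ → ℝ := fun p => if p ∣ T then 0 else A p
  have hAs : ∀ s : ℝ, 1 < s → Summable (fun p : Nat.Primes => A p * ((p : ℕ) : ℝ) ^ (-s)) := by rw [hA]; exact DAt_summable g (cyc g)
  have hpos : ∀ (s : ℝ) (p : Nat.Primes), 0 ≤ ((p : ℕ) : ℝ) ^ (-s) := fun s p => Real.rpow_nonneg (Nat.cast_nonneg _) _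
  have hbs : ∀ s : ℝ, 1 < s → Summable (fun p : Nat.Primes => b p * ((p : ℕ) : ℝ) ^ (-s)) := by
    intro s hs
    refine Summable.of_nonneg_of_le (fun p => ?_) (fun p => ?_) (hAs s hs)
    · simp only [b]; split_ifs
      · simp
      · exact mul_nonneg (hA0 _) (hpos _ _)
    · apply mul_le_mul_of_nonneg_right _ (hpos _ _)
      simp only [b]; split_ifs
      · exact hA0 _
      · exact le_rfl
  obtain ⟨C1, hC1⟩ := tsum_finite_diff A b T (fun p hp hpT => by
    simp only [b]; rw [if_neg]; exact Nat.not_dvd_of_pos_of_lt (Nat.pos_of_ne_zero hT0) hpT) hAs hbs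
  set cG : ℝ := (Nat.card (Subgroup.centralizer ({σ} : Set (K ≃ₐ[ℚ] K))) : ℝ) with hcG
  have hcard := card_conj C hσC
  have hcG0 : 0 < cG := by
    rw [hcG]; exact_mod_cast Nat.card_pos
  have hCc : (0:ℝ) < Nat.card C.carrier := by
    have : Nonempty C.carrier := ⟨⟨σ, hσC⟩⟩
    exact_mod_cast Nat.card_pos
  have hδ : (Nat.card C.carrier : ℝ) / (Nat.card (K ≃ₐ[ℚ] K) : ℝ) = 1 / cG := by
    rw [← hcard, Nat.cast_mul, ← hcG]
    field_simp
  let e : ℕ → ℝ := fun p => if p ∈ chebotarevSet K C ∧ p % q = a % q then 1 else 0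
  have hbe : ∀ p : ℕ, p.Prime → b p ≤ cG * e p := by
    intro p hp
    have he0 : 0 ≤ cG * e p := by
      apply mul_nonneg hcG0.le
      simp only [e]; split_ifs <;> norm_num
    by_cases hpT : p ∣ T
    · simp only [b, if_pos hpT]; exact he0
    by_cases hpa : ((cyc g : (ZMod q)ˣ) : ZMod q) = p
    swap
    · have : b p = 0 := by
        simp only [b, if_neg hpT]
        rw [hA, DAt_neg _ _ _ hpa]
      rw [this]; exact he0
    have hb : b p = (aF (FU L (Subgroup.zpowers g)) p : ℝ) := by
      simp only [b, if_neg hpT]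
      rw [hA, DAt_pos _ _ _ hpa]
    have hpB : ¬ p ∣ B := fun h => hpT (by rw [hT]; exact (h.mul_right _).mul_right _)
    have hpBK : ¬ p ∣ BK := fun h => hpT (by rw [hT]; exact (h.mul_left _).mul_right _)
    have hpd : ¬ p ∣ (discr K).natAbs := fun h => hpT (by rw [hT]; exact h.mul_left _)
    obtain ⟨h1, h2⟩ := S.aF_le hp hpB hpa
    by_cases haF : aF (FU L (Subgroup.zpowers g)) p = 0
    · rw [hb, haF]; simpa using he0
    obtain ⟨P, hP, hPg⟩ := h2 haF
    have hres : ∀ x : K, g (algebraMap K L x) = algebraMap K L (σ x) := by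
      intro x
      rw [← hgσ]
      exact (AlgEquiv.restrictNormal_commutes g K x).symm
    obtain ⟨Q, hQ, hQσ⟩ := Fr_restrict hP hres hPg
    have hmem := mem_cheb C hp hpd (hBK p hp hpBK) hQ hQσ hσC
    have he : e p = 1 := by
      have h5 : p % q = a % q := ((ZMod.natCast_eq_natCast_iff' _ _ q).1 (haq.symm.trans hpa)).symm
      exact if_pos ⟨hmem, h5⟩
    rw [he, mul_one, hb, hcG]
    have h3 := card_centralizer K q L hζ hd g
    rw [hgσ] at h3
    have h4 := h1.trans h3
    exact_mod_cast Nat.le_of_mul_le_mul_right h4 (Nat.sub_pos_of_lt hq.one_lt)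
  have hes : ∀ s : ℝ, 1 < s → Summable (fun p : Nat.Primes => e p * ((p : ℕ) : ℝ) ^ (-s)) := by
    intro s hs
    refine Summable.of_nonneg_of_le (fun p => ?_) (fun p => ?_) ((Nat.Primes.summable_rpow (r := -s)).2 (by linarith))
    · apply mul_nonneg _ (hpos _ _)
      simp only [e]; split_ifs <;> norm_num
    · apply mul_le_of_le_one_left (hpos _ _)
      simp only [e]; split_ifs <;> norm_num
  refine ⟨(C0 / ((q:ℝ) - 1) + C1) / cG, ?_⟩
  filter_upwards [hC0, self_mem_nhdsWithin] with s hs hs1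
  have hs1 : 1 < s := hs1
  have h1 := (abs_le.1 hs).1
  have h2 := (abs_le.1 (hC1 s hs1)).2
  have h3 : ∑' p : Nat.Primes, b p * ((p : ℕ) : ℝ) ^ (-s) ≤ cG * ∑' p : Nat.Primes, e p * ((p : ℕ) : ℝ) ^ (-s) := by
    rw [← tsum_mul_left]
    refine (hbs s hs1).tsum_le_tsum (fun p => ?_) ((hes s hs1).mul_left _)
    rw [← mul_assoc]
    exact mul_le_mul_of_nonneg_right (hbe p p.2) (hpos _ _)
  have h4 : DZ g {cyc g} s = ∑' p : Nat.Primes, A p * ((p : ℕ) : ℝ) ^ (-s) := by rw [hA]; exact DAt_tsum g (cyc g) s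
  rw [hδ]
  change _ ≤ ∑' p : Nat.Primes, e p * ((p : ℕ) : ℝ) ^ (-s)
  rw [h4] at h1
  set X := ∑' p : Nat.Primes, A p * ((p : ℕ) : ℝ) ^ (-s)
  set Y := ∑' p : Nat.Primes, b p * ((p : ℕ) : ℝ) ^ (-s)
  set Z := ∑' p : Nat.Primes, e p * ((p : ℕ) : ℝ) ^ (-s)
  set l := Real.log (1 / (s - 1))
  have h5 : (l - C0) / ((q:ℝ) - 1) ≤ X := by
    rw [div_le_iff₀ hq1]; linarith
  have h6 : ((l - C0) / ((q:ℝ) - 1) - C1) / cG ≤ Z := by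
    rw [div_le_iff₀ hcG0]; linarith
  refine le_trans (le_of_eq ?_) h6
  field_simp
  ring

open Classical in
theorem cheb_dirichlet (C : ConjClasses (K ≃ₐ[ℚ] K)) : ∃ q : ℕ, q.Prime ∧ ¬ q ∣ (discr K).natAbs ∧ ∃ a : ℕ, a.Coprime q ∧
    ∃ c : ℝ, ∀ᶠ s in 𝓝[>] (1:ℝ), (Nat.card C.carrier : ℝ) / (Nat.card (K ≃ₐ[ℚ] K) : ℝ) / ((q:ℝ) - 1) * Real.log (1 / (s - 1)) - c ≤
      ∑' p : Nat.Primes, (if (p : ℕ) ∈ chebotarevSet K C ∧ (p : ℕ) % q = a % q then (1:ℝ) else 0) * ((p : ℕ) : ℝ) ^ (-s) := by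
  obtain ⟨σ, hσ⟩ := ConjClasses.exists_rep C
  have hσC : σ ∈ C.carrier := by rw [ConjClasses.mem_carrier_iff_mk_eq]; exact hσ
  obtain ⟨q, hq, hqd, hqf⟩ := Nat.exists_prime_gt_modEq_one (k := orderOf σ) (discr K).natAbs (orderOf_pos σ).ne'
  have : Fact q.Prime := ⟨hq⟩
  have : NeZero q := ⟨hq.ne_zero⟩
  have hq1 : (0:ℝ) < (q:ℝ) - 1 := by
    have : (1:ℝ) < q := by exact_mod_cast hq.one_lt
    linarith
  have hd0 : (discr K).natAbs ≠ 0 := Int.natAbs_ne_zero.2 (discr_ne_zero K)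
  have hd : ¬ q ∣ (discr K).natAbs := Nat.not_dvd_of_pos_of_lt (Nat.pos_of_ne_zero hd0) hqd
  let L := CyclotomicField q K
  have hζ := IsCyclotomicExtension.zeta_spec q K L
  have hL : IsGalois ℚ L := (cyc_fields K q L hζ).1
  have hof : orderOf σ ∣ q - 1 := (Nat.modEq_iff_dvd' hq.one_lt.le).1 hqf.symm
  exact ⟨q, hq, hd, cheb_dir_aux K C q hq hd L hζ σ hσC hof⟩
end
end

section
section
open Module nonZeroDivisors Ideal Pointwise Filter Topology

lemma loglog_step {N : ℕ} (hN : 3 ≤ N) : 1 / ((N:ℝ) * Real.log N) ≤ Real.log (Real.log N) - Real.log (Real.log ((N:ℝ) - 1)) := by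
  have hN' : (3:ℝ) ≤ N := by exact_mod_cast hN
  have h1 : 0 < Real.log ((N:ℝ) - 1) := Real.log_pos (by linarith)
  have h2 : 0 < Real.log (N:ℝ) := Real.log_pos (by linarith)
  have h3 : Real.log (Real.log ((N:ℝ) - 1) / Real.log N) ≤ Real.log ((N:ℝ) - 1) / Real.log N - 1 := Real.log_le_sub_one_of_pos (by positivity)
  rw [Real.log_div h1.ne' h2.ne'] at h3
  have h4 : Real.log (((N:ℝ) - 1) / N) ≤ ((N:ℝ) - 1) / N - 1 := Real.log_le_sub_one_of_pos (div_pos (by linarith) (by linarith))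
  rw [Real.log_div (by linarith) (by linarith)] at h4
  have h5 : 1 / ((N:ℝ) * Real.log N) ≤ 1 - Real.log ((N:ℝ) - 1) / Real.log N := by
    rw [one_sub_div h2.ne', ← div_div]
    apply div_le_div_of_nonneg_right _ h2.le
    have : ((N:ℝ) - 1) / N - 1 = - (1 / N) := by field_simp; ring
    linarith
  linarith

lemma loglog_sum (X : ℕ) (hX : 2 ≤ X) : ∑ N ∈ Finset.Icc 3 X, 1 / ((N:ℝ) * Real.log N) ≤ Real.log (Real.log X) - Real.log (Real.log 2) := by
  induction X, hX using Nat.le_induction with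
  | base => simp
  | succ n hn ih =>
    rw [Finset.sum_Icc_succ_top (by omega)]
    have := loglog_step (N := n + 1) (by omega)
    push_cast at this ⊢
    rw [add_sub_cancel_right] at this
    linarith

lemma U_bound : ∃ C : ℝ, ∀ᶠ s in 𝓝[>] (1:ℝ), ∀ F : Finset ℕ, (∀ N ∈ F, 3 ≤ N) →
    ∑ N ∈ F, (N:ℝ) ^ (-s) / Real.log N ≤ Real.log (1 / (s - 1)) + C := by
  have hz := tendsto_sub_mul_tsum_nat_rpow
  refine ⟨- Real.log (Real.log 2) + 2, ?_⟩
  have h1 := hz.eventually (gt_mem_nhds (show (1:ℝ) < 2 by norm_num))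
  have h2 : ∀ᶠ s in 𝓝[>] (1:ℝ), s < 2 := by
    filter_upwards [Ioo_mem_nhdsGT (show (1:ℝ) < 2 by norm_num)] with s hs using hs.2
  filter_upwards [h1, h2, self_mem_nhdsWithin] with s hs hs2 hs1 F hF
  have hs1 : 1 < s := hs1
  have hs0 : 0 < s - 1 := by linarith
  set X0 := ⌊Real.exp (1 / (s - 1))⌋₊ with hX0
  have hX2 : 2 ≤ X0 := by
    apply Nat.le_floor
    have : 1 ≤ 1 / (s - 1) := by rw [le_div_iff₀ hs0]; linarith
    have := Real.add_one_le_exp (1 / (s - 1))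
    push_cast
    linarith
  have hterm : ∀ N ∈ F, (N:ℝ) ^ (-s) / Real.log N ≤ (if N ≤ X0 then 1 / ((N:ℝ) * Real.log N) else 0) + (s - 1) * (1 / (N:ℝ) ^ s) := by
    intro N hN
    have hN3 : (3:ℝ) ≤ N := by exact_mod_cast hF N hN
    have hl : 0 < Real.log (N:ℝ) := Real.log_pos (by linarith)
    have hp : 0 < (N:ℝ) ^ s := by positivity
    rw [Real.rpow_neg (by linarith)]
    split_ifs with h
    · have : (((N:ℝ) ^ s)⁻¹) / Real.log N ≤ 1 / ((N:ℝ) * Real.log N) := by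
        rw [← div_div, one_div]
        apply div_le_div_of_nonneg_right _ hl.le
        apply inv_anti₀ (by linarith)
        conv_lhs => rw [← Real.rpow_one (N:ℝ)]
        exact Real.rpow_le_rpow_of_exponent_le (by linarith) hs1.le
      have h0 : 0 ≤ (s - 1) * (1 / (N:ℝ) ^ s) := by positivity
      linarith
    · rw [zero_add, div_eq_mul_inv, mul_comm, one_div]
      apply mul_le_mul_of_nonneg_right _ (by positivity)
      have h3 : Real.exp (1 / (s - 1)) < N := by
        push Not at h
        exact (Nat.floor_lt (Real.exp_pos _).le).1 h
      have h4 : 1 / (s - 1) < Real.log N := (Real.lt_log_iff_exp_lt (by linarith)).2 h3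
      rw [inv_le_comm₀ hl hs0, ← one_div]
      exact h4.le
  refine (Finset.sum_le_sum hterm).trans ?_
  rw [Finset.sum_add_distrib, ← Finset.mul_sum]
  have hA : ∑ N ∈ F, (if N ≤ X0 then 1 / ((N:ℝ) * Real.log N) else 0) ≤ Real.log (1 / (s - 1)) - Real.log (Real.log 2) := by
    rw [← Finset.sum_filter]
    have hnn : ∀ N : ℕ, 0 ≤ 1 / ((N:ℝ) * Real.log N) := fun N => by
      have := Real.log_natCast_nonneg N
      positivity
    refine (Finset.sum_le_sum_of_subset_of_nonneg (t := Finset.Icc 3 X0) ?_ (fun N _ _ => hnn N)).trans ((loglog_sum X0 hX2).trans ?_)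
    · intro N hN
      rw [Finset.mem_filter] at hN
      exact Finset.mem_Icc.2 ⟨hF N hN.1, hN.2⟩
    · have hX2' : (2:ℝ) ≤ X0 := by exact_mod_cast hX2
      have h5 : Real.log X0 ≤ 1 / (s - 1) := by
        rw [Real.log_le_iff_le_exp (by linarith)]
        exact Nat.floor_le (Real.exp_pos _).le
      have := Real.log_le_log (Real.log_pos (by linarith)) h5
      linarith
  have hB : (s - 1) * ∑ N ∈ F, 1 / (N:ℝ) ^ s ≤ 2 := by
    refine le_trans (mul_le_mul_of_nonneg_left ?_ hs0.le) hs.le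
    exact (Real.summable_one_div_nat_rpow.2 hs1).sum_le_tsum F (fun N _ => by positivity)
  linarith
end
end

section
section
open Module nonZeroDivisors Ideal Pointwise Filter Topology

lemma step_rpow {N : ℕ} (hN : 1 ≤ N) {s : ℝ} (hs : 1 ≤ s) : (N:ℝ) ^ (-s) * (1 - s / ((N:ℝ) + 1)) ≤ ((N:ℝ) + 1) ^ (-s) := by
  have hN' : (1:ℝ) ≤ N := by exact_mod_cast hN
  have h1 : 1 + s * (-(1 / ((N:ℝ) + 1))) ≤ (1 + (-(1 / ((N:ℝ) + 1)))) ^ s := by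
    apply one_add_mul_self_le_rpow_one_add _ hs
    have : 1 / ((N:ℝ) + 1) ≤ 1 := by rw [div_le_one (by linarith)]; linarith
    linarith
  have h2 : 1 + (-(1 / ((N:ℝ) + 1))) = N / ((N:ℝ) + 1) := by field_simp; ring
  rw [h2, Real.div_rpow (by linarith) (by linarith)] at h1
  have h3 : 1 - s / ((N:ℝ) + 1) ≤ (N:ℝ) ^ s / ((N:ℝ) + 1) ^ s := by
    refine le_trans (le_of_eq ?_) h1
    ring
  rw [Real.rpow_neg (by linarith), Real.rpow_neg (by linarith)]
  have hp : 0 < (N:ℝ) ^ s := by positivity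
  have hp' : 0 < ((N:ℝ) + 1) ^ s := by positivity
  calc ((N:ℝ) ^ s)⁻¹ * (1 - s / ((N:ℝ) + 1)) ≤ ((N:ℝ) ^ s)⁻¹ * ((N:ℝ) ^ s / ((N:ℝ) + 1) ^ s) :=
        mul_le_mul_of_nonneg_left h3 (by positivity)
    _ = (((N:ℝ) + 1) ^ s)⁻¹ := by field_simp

lemma step_rpow' {N : ℕ} (hN : 1 ≤ N) {s : ℝ} (hs : 1 ≤ s) : (N:ℝ) ^ (-s) - ((N:ℝ) + 1) ^ (-s) ≤ s * (N:ℝ) ^ (-s - 1) := by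
  have hN' : (1:ℝ) ≤ N := by exact_mod_cast hN
  have h1 := step_rpow hN hs
  have h2 : (N:ℝ) ^ (-s - 1) = (N:ℝ) ^ (-s) / N := by rw [Real.rpow_sub_one (by linarith)]
  have hp : 0 < (N:ℝ) ^ (-s) := by positivity
  rw [h2]
  have h3 : (N:ℝ) ^ (-s) * (s / ((N:ℝ) + 1)) ≤ (N:ℝ) ^ (-s) * (s / N) :=
    mul_le_mul_of_nonneg_left (div_le_div_of_nonneg_left (by linarith) (by linarith) (by linarith)) hp.le
  have h4 : s * ((N:ℝ) ^ (-s) / N) = (N:ℝ) ^ (-s) * (s / N) := by ring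
  rw [h4]
  linarith

lemma tele_rpow {m : ℕ} (hm : 1 ≤ m) {s : ℝ} (hs : 1 ≤ s) (n : ℕ) (hn : m ≤ n) :
    (m:ℝ) ^ (-s) - ((n:ℝ) + 1) ^ (-s) ≤ s * ∑ N ∈ Finset.Icc m n, (N:ℝ) ^ (-s - 1) := by
  induction n, hn using Nat.le_induction with
  | base => simpa using step_rpow' hm hs
  | succ n hn ih =>
    rw [Finset.sum_Icc_succ_top (by omega), mul_add]
    have := step_rpow' (N := n + 1) (by omega) hs
    push_cast at this ⊢
    linarith

lemma w_bound {p : ℕ} (hp : p.Prime) (h2 : p ≠ 2) {s : ℝ} (hs : 1 ≤ s) (hs2 : s ≤ 2) :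
    (p:ℝ) ^ (-s) ≤ ∑ N ∈ Finset.Icc (p / 2 + 1) p, (N:ℝ) ^ (-s - 1) + 2 * ((p:ℝ) ^ 2)⁻¹ := by
  have hp2 := hp.two_le
  have hp1 : (2:ℝ) ≤ p := by exact_mod_cast hp2
  have hodd : p % 2 = 1 := hp.eq_two_or_odd.resolve_left h2
  have h1 := tele_rpow (m := p / 2 + 1) (by omega) hs p (by omega)
  have h3 : ((p / 2 + 1 : ℕ) : ℝ) = ((p:ℝ) + 1) / 2 := by
    have : 2 * (p / 2 + 1) = p + 1 := by omega
    have : (2:ℝ) * ((p / 2 + 1 : ℕ) : ℝ) = (p:ℝ) + 1 := by exact_mod_cast this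
    linarith
  rw [h3, Real.div_rpow (by linarith) (by norm_num)] at h1
  have h4 : 1 + s * 1 ≤ (1 + 1 : ℝ) ^ s := one_add_mul_self_le_rpow_one_add (by norm_num) hs
  have h5 : ((p:ℝ) + 1) ^ (-s) / 2 ^ (-s) = ((p:ℝ) + 1) ^ (-s) * 2 ^ s := by
    rw [Real.rpow_neg (by norm_num : (0:ℝ) ≤ 2), div_inv_eq_mul]
  rw [h5] at h1
  have hpp : 0 < ((p:ℝ) + 1) ^ (-s) := by positivity
  have h6 : ((p:ℝ) + 1) ^ (-s) * s ≤ s * ∑ N ∈ Finset.Icc (p / 2 + 1) p, (N:ℝ) ^ (-s - 1) := by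
    refine le_trans ?_ h1
    have : (2:ℝ) ^ s = (1 + 1 : ℝ) ^ s := by norm_num
    nlinarith
  have h7 : ((p:ℝ) + 1) ^ (-s) ≤ ∑ N ∈ Finset.Icc (p / 2 + 1) p, (N:ℝ) ^ (-s - 1) := by
    rw [mul_comm] at h6
    exact le_of_mul_le_mul_left h6 (by linarith)
  have h8 := step_rpow (N := p) (by omega) hs
  have h9 : (p:ℝ) ^ (-s) ≤ (p:ℝ)⁻¹ := by
    rw [← Real.rpow_neg_one]
    exact Real.rpow_le_rpow_of_exponent_le (by linarith) (by linarith)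
  have h10 : (p:ℝ) ^ (-s) * (s / ((p:ℝ) + 1)) ≤ 2 * ((p:ℝ) ^ 2)⁻¹ := by
    have : s / ((p:ℝ) + 1) ≤ 2 / p := by
      rw [div_le_div_iff₀ (by linarith) (by linarith)]; nlinarith
    calc (p:ℝ) ^ (-s) * (s / ((p:ℝ) + 1)) ≤ (p:ℝ)⁻¹ * (2 / p) := by
          apply mul_le_mul h9 this (by positivity) (by positivity)
      _ = 2 * ((p:ℝ) ^ 2)⁻¹ := by field_simp
  linarith

open Classical in
theorem count_of_dirichlet (S : Set ℕ) (κ c κ' : ℝ) (hκ : 0 ≤ κ') (hκκ : κ' < κ)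
    (h : ∀ᶠ s in 𝓝[>] (1:ℝ), κ * Real.log (1 / (s - 1)) - c ≤ ∑' p : Nat.Primes, (if (p:ℕ) ∈ S then (1:ℝ) else 0) * ((p:ℕ):ℝ) ^ (-s)) (N0 : ℕ) :
    ∃ N ≥ N0, κ' * N / Real.log N ≤ ({p | p ∈ S ∧ N ≤ p ∧ p < 2 * N}.ncard : ℝ) := by
  by_contra hc
  push Not at hc
  obtain ⟨N1, hN10, hN13⟩ : ∃ N1, N0 ≤ N1 ∧ 3 ≤ N1 := ⟨max N0 3, le_max_left _ _, le_max_right _ _⟩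
  obtain ⟨C, hC⟩ := U_bound
  set Z : ℝ := ∑' n : ℕ, ((n:ℝ) ^ 2)⁻¹ with hZ
  have hZs : Summable (fun n : ℕ => ((n:ℝ) ^ 2)⁻¹) := Real.summable_nat_pow_inv.2 (by norm_num)
  have key : ∀ᶠ s in 𝓝[>] (1:ℝ), κ * Real.log (1 / (s - 1)) - c ≤ 2 * N1 + (κ' * (Real.log (1 / (s - 1)) + C) + 2 * Z) := by
    have h2 : ∀ᶠ s in 𝓝[>] (1:ℝ), s < 2 := by
      filter_upwards [Ioo_mem_nhdsGT (show (1:ℝ) < 2 by norm_num)] with s hs using hs.2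
    filter_upwards [h, hC, h2, self_mem_nhdsWithin] with s hs hCs hs2 hs1
    have hs1 : 1 < s := hs1
    refine hs.trans ?_
    apply Real.tsum_le_of_sum_le
    · intro p
      change (0:ℝ) ≤ (if (p:ℕ) ∈ S then (1:ℝ) else 0) * ((p:ℕ):ℝ) ^ (-s)
      split_ifs
      · rw [one_mul]; positivity
      · simp
    intro F
    set G : Finset ℕ := (F.image (fun p : Nat.Primes => (p:ℕ))).filter (· ∈ S) with hG
    have hGp : ∀ p ∈ G, p.Prime ∧ p ∈ S := by
      intro p hp
      rw [hG, Finset.mem_filter, Finset.mem_image] at hp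
      obtain ⟨⟨x, -, rfl⟩, hx⟩ := hp
      exact ⟨x.2, hx⟩
    have e1 : ∑ p ∈ F, (if (p:ℕ) ∈ S then (1:ℝ) else 0) * ((p:ℕ):ℝ) ^ (-s) = ∑ p ∈ G, (p:ℝ) ^ (-s) := by
      have hinj : Set.InjOn (fun p : Nat.Primes => (p:ℕ)) (F : Set Nat.Primes) := by
        intro a _ b _ h
        exact Subtype.ext h
      rw [hG, Finset.sum_filter, Finset.sum_image hinj]
      apply Finset.sum_congr rfl
      intro p _
      split_ifs <;> simp
    rw [e1, ← Finset.sum_filter_add_sum_filter_not G (fun p => p < 2 * N1)]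
    apply add_le_add
    · calc ∑ p ∈ G.filter (fun p => p < 2 * N1), (p:ℝ) ^ (-s) ≤ ∑ p ∈ G.filter (fun p => p < 2 * N1), 1 := by
            apply Finset.sum_le_sum
            intro p hp
            exact Real.rpow_le_one_of_one_le_of_nonpos (by exact_mod_cast (hGp p (Finset.mem_filter.1 hp).1).1.one_lt.le) (by linarith)
        _ = ((G.filter (fun p => p < 2 * N1)).card : ℝ) := by simp
        _ ≤ ((Finset.range (2 * N1)).card : ℝ) := by
            exact_mod_cast Finset.card_le_card (fun p hp => Finset.mem_range.2 (Finset.mem_filter.1 hp).2)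
        _ = 2 * N1 := by simp
    set G' := G.filter (fun p => ¬ p < 2 * N1) with hG'
    have hG'p : ∀ p ∈ G', p.Prime ∧ p ∈ S ∧ 2 * N1 ≤ p := by
      intro p hp
      rw [hG', Finset.mem_filter] at hp
      exact ⟨(hGp p hp.1).1, (hGp p hp.1).2, not_lt.1 hp.2⟩
    have e2 : ∑ p ∈ G', (p:ℝ) ^ (-s) ≤ ∑ p ∈ G', (∑ N ∈ Finset.Icc (p / 2 + 1) p, (N:ℝ) ^ (-s - 1)) + 2 * ∑ p ∈ G', ((p:ℝ) ^ 2)⁻¹ := by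
      rw [Finset.mul_sum, ← Finset.sum_add_distrib]
      apply Finset.sum_le_sum
      intro p hp
      obtain ⟨h1, -, h3⟩ := hG'p p hp
      exact w_bound h1 (by omega) hs1.le hs2.le
    refine e2.trans (add_le_add ?_ (mul_le_mul_of_nonneg_left (hZs.sum_le_tsum _ (fun n _ => by positivity)) (by norm_num)))
    set X := G'.sup id with hX
    have e3 : ∑ p ∈ G', (∑ N ∈ Finset.Icc (p / 2 + 1) p, (N:ℝ) ^ (-s - 1)) =
        ∑ N ∈ Finset.Icc N1 X, ∑ p ∈ G'.filter (fun p => N ≤ p ∧ p < 2 * N), (N:ℝ) ^ (-s - 1) := by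
      apply Finset.sum_comm'
      intro p N
      simp only [Finset.mem_Icc, Finset.mem_filter]
      constructor
      · rintro ⟨hp, h1, h2⟩
        have h3 := (hG'p p hp).2.2
        have h4 : p ≤ X := Finset.le_sup (f := id) hp
        refine ⟨⟨hp, by omega, by omega⟩, by omega, by omega⟩
      · rintro ⟨⟨hp, h1, h2⟩, h3, h4⟩
        exact ⟨hp, by omega, by omega⟩
    rw [e3]
    calc ∑ N ∈ Finset.Icc N1 X, ∑ p ∈ G'.filter (fun p => N ≤ p ∧ p < 2 * N), (N:ℝ) ^ (-s - 1)
        ≤ ∑ N ∈ Finset.Icc N1 X, κ' * ((N:ℝ) ^ (-s) / Real.log N) := by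
          apply Finset.sum_le_sum
          intro N hN
          rw [Finset.mem_Icc] at hN
          have hN0 : (0:ℝ) < N := by
            have : 0 < N := by omega
            exact_mod_cast this
          rw [Finset.sum_const, nsmul_eq_mul]
          have h3 : ((G'.filter (fun p => N ≤ p ∧ p < 2 * N)).card : ℝ) ≤ ({p | p ∈ S ∧ N ≤ p ∧ p < 2 * N}.ncard : ℝ) := by
            have h3' : (G'.filter (fun p => N ≤ p ∧ p < 2 * N)).card ≤ {p | p ∈ S ∧ N ≤ p ∧ p < 2 * N}.ncard := by
              rw [← Set.ncard_coe_finset]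
              apply Set.ncard_le_ncard
              · intro p hp
                rw [Finset.mem_coe, Finset.mem_filter] at hp
                exact ⟨(hG'p p hp.1).2.1, hp.2⟩
              · exact (Set.finite_lt_nat (2 * N)).subset (fun p hp => hp.2.2)
            exact_mod_cast h3'
          have h4 := hc N (by omega)
          have h5 : (N:ℝ) ^ (-s - 1) = (N:ℝ) ^ (-s) / N := by rw [Real.rpow_sub_one hN0.ne']
          calc _ ≤ (κ' * N / Real.log N) * (N:ℝ) ^ (-s - 1) := mul_le_mul_of_nonneg_right (h3.trans h4.le) (by positivity)
            _ = κ' * ((N:ℝ) ^ (-s) / Real.log N) := by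
              rw [h5]; field_simp
      _ = κ' * ∑ N ∈ Finset.Icc N1 X, ((N:ℝ) ^ (-s) / Real.log N) := by rw [Finset.mul_sum]
      _ ≤ κ' * (Real.log (1 / (s - 1)) + C) := by
          apply mul_le_mul_of_nonneg_left _ hκ
          exact hCs _ (fun N hN => by rw [Finset.mem_Icc] at hN; omega)
  have h3 := log_tendsto.eventually_gt_atTop ((2 * N1 + κ' * C + 2 * Z + c) / (κ - κ'))
  obtain ⟨s, hs1, hs2⟩ := (key.and h3).exists
  rw [div_lt_iff₀ (by linarith)] at hs2
  nlinarith
end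
end

section
section
open Module nonZeroDivisors Ideal Pointwise Filter Topology

lemma chebCount_le (P : Set ℕ) (N : ℕ) : chebCount P N ≤ N := by
  unfold chebCount
  have : {p | p ∈ P ∧ N ≤ p ∧ p < 2 * N} ⊆ (Finset.Ico N (2 * N) : Set ℕ) := by
    intro p hp
    simp only [Finset.coe_Ico, Set.mem_Ico]
    exact hp.2
  have h := Set.ncard_le_ncard this (Finset.finite_toSet _)
  rw [Set.ncard_coe_finset, Nat.card_Ico] at h
  omega

lemma count_mod_Ico (y q a : ℕ) (hq : 0 < q) : ((Finset.Ico y (2 * y)).filter (fun p => p % q = a % q)).card ≤ y / q + 1 := by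
  have h := Nat.Ico_filter_modEq_card y (2 * y) hq a
  have e : (Finset.Ico y (2 * y)).filter (fun p => p % q = a % q) = (Finset.Ico y (2 * y)).filter (fun p => p ≡ a [MOD q]) := by
    apply Finset.filter_congr; intro p _; rfl
  rw [e]
  zify
  rw [h]
  apply max_le _ (by positivity)
  have hq' : (0:ℚ) < q := by exact_mod_cast hq
  have h1 : (((2 * y : ℕ):ℚ) - a) / q = (y - a) / q + y / q := by push_cast; field_simp; ring
  rw [h1]
  have h3 := Int.ceil_add_le (((y:ℚ) - a) / q) ((y:ℚ) / q)
  have h2 : ⌈(y:ℚ) / q⌉ ≤ (y / q : ℕ) + 1 := by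
    rw [Int.ceil_le]
    push_cast
    rw [div_le_iff₀ hq']
    have := Nat.lt_div_mul_add hq (a := y)
    have h5 : y < (y / q + 1) * q := by linarith [Nat.lt_div_mul_add hq (a := y)]
    exact_mod_cast h5.le
  push_cast at h2 ⊢
  linarith

lemma chebCountMod_le (P : Set ℕ) (y q a : ℕ) (hq : 0 < q) : chebCountMod P y q a ≤ y / q + 1 := by
  unfold chebCountMod
  have : {p | p ∈ P ∧ y ≤ p ∧ p < 2 * y ∧ p % q = a % q} ⊆ ((Finset.Ico y (2 * y)).filter (fun p => p % q = a % q) : Set ℕ) := by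
    intro p hp
    simp only [Finset.coe_filter, Finset.mem_Ico]
    exact ⟨⟨hp.2.1, hp.2.2.1⟩, hp.2.2.2⟩
  have h := Set.ncard_le_ncard this (Finset.finite_toSet _)
  rw [Set.ncard_coe_finset] at h
  exact h.trans (count_mod_Ico y q a hq)

lemma chebTerm_le (P : Set ℕ) (y q a : ℕ) (hq : 0 < q) :
    |(chebCountMod P y q a : ℝ) - (chebCount P y : ℝ) / (Nat.totient q : ℝ)| ≤ 2 * y / Nat.totient q + 1 := by
  have h1 : (chebCountMod P y q a : ℝ) ≤ y / q + 1 := by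
    have := chebCountMod_le P y q a hq
    have h2 : (chebCountMod P y q a : ℝ) ≤ ((y / q : ℕ) : ℝ) + 1 := by exact_mod_cast this
    exact h2.trans (by gcongr; exact Nat.cast_div_le)
  have h3 : (chebCount P y : ℝ) ≤ y := by exact_mod_cast chebCount_le P y
  have h4 : (0:ℝ) < Nat.totient q := by exact_mod_cast Nat.totient_pos.2 hq
  have h5 : (y:ℝ) / q ≤ y / Nat.totient q := by
    apply div_le_div_of_nonneg_left (by positivity) h4
    exact_mod_cast Nat.totient_le q
  have h6 : (chebCount P y : ℝ) / (Nat.totient q : ℝ) ≤ y / Nat.totient q := by gcongr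
  have h7 : (0:ℝ) ≤ (chebCount P y : ℝ) / (Nat.totient q : ℝ) := by positivity
  have h8 : (0:ℝ) ≤ (y : ℝ) / (Nat.totient q : ℝ) := by positivity
  have h9 : (0:ℝ) ≤ chebCountMod P y q a := by positivity
  rw [abs_le, mul_div_assoc]
  constructor <;> linarith

lemma chebTerm_le' (P : Set ℕ) {y N : ℕ} (q a : ℕ) (hq : 0 < q) (hy : y ≤ N) :
    |(chebCountMod P y q a : ℝ) - (chebCount P y : ℝ) / (Nat.totient q : ℝ)| ≤ 2 * N / Nat.totient q + 1 := by
  refine (chebTerm_le P y q a hq).trans ?_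
  gcongr

lemma chebErr_ge (P : Set ℕ) (N q a : ℕ) (hq : 0 < q) (ha : Nat.Coprime a q) :
    |(chebCountMod P N q a : ℝ) - (chebCount P N : ℝ) / (Nat.totient q : ℝ)| ≤ chebErr P N q := by
  unfold chebErr
  apply le_csSup
  · refine ⟨2 * N / Nat.totient q + 1, ?_⟩
    rintro x ⟨y, hy, b, -, rfl⟩
    exact chebTerm_le' P q b hq hy
  · exact ⟨N, le_rfl, a, ha, rfl⟩

lemma chebErr_le (P : Set ℕ) (N q : ℕ) (hq : 0 < q) : chebErr P N q ≤ 2 * N / Nat.totient q + 1 := by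
  unfold chebErr
  apply Real.sSup_le
  · rintro x ⟨y, hy, b, -, rfl⟩
    exact chebTerm_le' P q b hq hy
  · positivity

lemma chebErr_nonneg (P : Set ℕ) (N q : ℕ) : 0 ≤ chebErr P N q := by
  unfold chebErr
  apply Real.sSup_nonneg
  rintro x ⟨y, hy, b, -, rfl⟩
  positivity

theorem cheb_count_lower (K : Type) [Field K] [NumberField K] [IsGalois ℚ K] (C : ConjClasses (K ≃ₐ[ℚ] K)) (θ : ℝ)
    (hlod : HasLevelOfDistribution (chebotarevSet K C) θ (discr K).natAbs) (d : ℝ) (hd0 : 0 ≤ d)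
    (hd : d < (Nat.card C.carrier : ℝ) / (Nat.card (K ≃ₐ[ℚ] K) : ℝ)) (N0 : ℕ) :
    ∃ N ≥ N0, d * N / Real.log N ≤ chebCount (chebotarevSet K C) N := by
  classical
  obtain ⟨q, hq, hqd, a, haq, c, hc⟩ := cheb_dirichlet K C
  set P := chebotarevSet K C with hP
  set δ : ℝ := (Nat.card C.carrier : ℝ) / (Nat.card (K ≃ₐ[ℚ] K) : ℝ) with hδ
  have hq1 : (0:ℝ) < (q:ℝ) - 1 := by
    have : (1:ℝ) < q := by exact_mod_cast hq.one_lt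
    linarith
  obtain ⟨d', hd1, hd2⟩ := exists_between hd
  obtain ⟨hθ, hA⟩ := hlod
  obtain ⟨c2, hc2⟩ := hA 2 (by norm_num)
  have hq' : (Nat.totient q : ℝ) = (q:ℝ) - 1 := by
    rw [Nat.totient_prime hq, Nat.cast_sub hq.one_lt.le]; simp
  -- eventually the error is small
  have ev1 : ∀ᶠ N : ℕ in atTop, |c2| * ((q:ℝ) - 1) / Real.log N ≤ d' - d := by
    have : Tendsto (fun N : ℕ => |c2| * ((q:ℝ) - 1) / Real.log N) atTop (𝓝 0) :=
      (Real.tendsto_log_atTop.comp tendsto_natCast_atTop_atTop).const_div_atTop _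
    exact this.eventually_le_const (by linarith)
  have ev2 : ∀ᶠ N : ℕ in atTop, (q:ℝ) ≤ (N:ℝ) ^ θ :=
    ((tendsto_rpow_atTop hθ).comp tendsto_natCast_atTop_atTop).eventually_ge_atTop _
  obtain ⟨N1, hN1⟩ := eventually_atTop.1 (ev1.and (ev2.and (eventually_ge_atTop 3)))
  have hfin := count_of_dirichlet {p | p ∈ P ∧ p % q = a % q} (δ / ((q:ℝ) - 1)) c (d' / ((q:ℝ) - 1)) (div_nonneg (hd0.trans hd1.le) hq1.le)
    (div_lt_div_of_pos_right hd2 hq1) (by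
      filter_upwards [hc] with s hs
      refine hs.trans (le_of_eq ?_)
      apply tsum_congr; intro p
      congr!) (max N0 N1)
  obtain ⟨N, hN, hcount⟩ := hfin
  refine ⟨N, (le_max_left _ _).trans hN, ?_⟩
  obtain ⟨h1, h2, h3⟩ := hN1 N ((le_max_right _ _).trans hN)
  have hset : {p | p ∈ {p | p ∈ P ∧ p % q = a % q} ∧ N ≤ p ∧ p < 2 * N}.ncard = chebCountMod P N q a := by
    unfold chebCountMod
    congr 1
    ext p
    simp only [Set.mem_setOf_eq]
    tauto
  rw [hset] at hcount
  have h4 : chebErr P N q ≤ c2 * N / Real.log N ^ (2:ℝ) := by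
    refine le_trans ?_ (hc2 N (by omega))
    apply Finset.single_le_sum (f := fun q => chebErr P N q) (fun i _ => chebErr_nonneg P N i)
    rw [Finset.mem_filter, Finset.mem_Icc]
    exact ⟨⟨hq.pos, Nat.le_floor h2⟩, (Nat.Prime.coprime_iff_not_dvd hq).2 hqd⟩
  have h5 := (le_abs_self _).trans ((chebErr_ge P N q a hq.pos haq).trans h4)
  have hlog : 0 < Real.log N := Real.log_pos (by exact_mod_cast (by omega : 1 < N))
  have h6 : c2 * N / Real.log N ^ (2:ℝ) ≤ (d' - d) / ((q:ℝ) - 1) * (N / Real.log N) := by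
    have : |c2| / Real.log N ≤ (d' - d) / ((q:ℝ) - 1) := by
      rw [le_div_iff₀ hq1]; calc _ = _ := by ring
        _ ≤ _ := h1
    calc c2 * N / Real.log N ^ (2:ℝ) ≤ |c2| * N / Real.log N ^ (2:ℝ) := by
          gcongr; exact le_abs_self _
      _ = |c2| / Real.log N * (N / Real.log N) := by
          rw [Real.rpow_two]; field_simp
      _ ≤ _ := by gcongr
  rw [hq'] at h5
  have h7 : d / ((q:ℝ) - 1) * (N / Real.log N) ≤ chebCount P N / ((q:ℝ) - 1) := by
    have e1 : d' / ((q:ℝ) - 1) * N / Real.log N = d' / ((q:ℝ) - 1) * (N / Real.log N) := by ring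
    have e2 : (d' - d) / ((q:ℝ) - 1) * (N / Real.log N) = d' / ((q:ℝ) - 1) * (N / Real.log N) - d / ((q:ℝ) - 1) * (N / Real.log N) := by ring
    rw [e1] at hcount
    rw [e2] at h6
    linarith
  rw [le_div_iff₀ hq1] at h7
  calc d * N / Real.log N = d / ((q:ℝ) - 1) * (N / Real.log N) * ((q:ℝ) - 1) := by field_simp
    _ ≤ _ := h7
end
end

section
section
open Module nonZeroDivisors Ideal Pointwise Filter Topology

/-- coprime harmonic sum -/
noncomputable def hsum (V x : ℕ) : ℝ := ∑ n ∈ (Finset.Icc 1 x).filter (fun n => Nat.Coprime n V), (1:ℝ) / n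

noncomputable def cV (V : ℕ) : ℝ := (Nat.totient V : ℝ) / V

noncomputable def eV (V x : ℕ) : ℝ := ∑ n ∈ Finset.Icc 1 x, ((if Nat.Coprime n V then (1:ℝ) else 0) - cV V)

lemma eV_add (V x : ℕ) (hV : 0 < V) : eV V (x + V) = eV V x := by
  unfold eV
  have e : Finset.Icc 1 (x + V) = Finset.Icc 1 x ∪ Finset.Ico (x + 1) (x + 1 + V) := by
    ext n; simp only [Finset.mem_Icc, Finset.mem_union, Finset.mem_Ico]; omega
  have hd : Disjoint (Finset.Icc 1 x) (Finset.Ico (x + 1) (x + 1 + V)) := by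
    rw [Finset.disjoint_left]; intro n h1 h2
    simp only [Finset.mem_Icc, Finset.mem_Ico] at h1 h2; omega
  rw [e, Finset.sum_union hd, add_eq_left, Finset.sum_sub_distrib, Finset.sum_boole, Finset.sum_const, Nat.card_Ico]
  have h2 : (Finset.Ico (x + 1) (x + 1 + V)).filter (fun n => Nat.Coprime n V) = (Finset.Ico (x + 1) (x + 1 + V)).filter (fun n => Nat.Coprime V n) := by
    apply Finset.filter_congr; intro n _; exact Nat.coprime_comm
  rw [h2, Nat.filter_coprime_Ico_eq_totient]
  have : (0:ℝ) < V := by exact_mod_cast hV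
  unfold cV
  simp only [add_tsub_cancel_left, nsmul_eq_mul]
  field_simp
  ring

lemma cV_mem (V : ℕ) : 0 ≤ cV V ∧ cV V ≤ 1 := by
  unfold cV
  refine ⟨by positivity, div_le_one_of_le₀ (by exact_mod_cast Nat.totient_le V) (by positivity)⟩

lemma eV_bound (V : ℕ) (hV : 0 < V) (x : ℕ) : |eV V x| ≤ V := by
  induction x using Nat.strong_induction_on with
  | _ x ih =>
    by_cases hx : x < V
    · unfold eV
      refine (Finset.abs_sum_le_sum_abs _ _).trans ?_
      have : ∀ n ∈ Finset.Icc 1 x, |(if Nat.Coprime n V then (1:ℝ) else 0) - cV V| ≤ 1 := by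
        intro n _
        have := cV_mem V
        rw [abs_le]; split_ifs <;> constructor <;> linarith
      refine (Finset.sum_le_sum this).trans ?_
      simp
      exact_mod_cast hx.le
    · have := eV_add V (x - V) hV
      rw [Nat.sub_add_cancel (by omega)] at this
      rw [this]
      exact ih _ (by omega)

lemma hsum_abel (V x : ℕ) : hsum V x - cV V * ∑ n ∈ Finset.Icc 1 x, (1:ℝ) / n =
    eV V x / (x + 1) + ∑ n ∈ Finset.Icc 1 x, eV V n / (n * (n + 1)) := by
  have h0 : hsum V x = ∑ n ∈ Finset.Icc 1 x, (if Nat.Coprime n V then (1:ℝ) else 0) / n := by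
    unfold hsum
    rw [Finset.sum_filter]
    apply Finset.sum_congr rfl; intro n _; split_ifs <;> simp
  rw [h0, Finset.mul_sum, ← Finset.sum_sub_distrib]
  induction x with
  | zero => simp [eV]
  | succ x ih =>
    rw [Finset.sum_Icc_succ_top (by omega), Finset.sum_Icc_succ_top (by omega)]
    have h1 : eV V (x + 1) = eV V x + ((if Nat.Coprime (x + 1) V then (1:ℝ) else 0) - cV V) := by
      unfold eV; rw [Finset.sum_Icc_succ_top (by omega)]
    have ih' := ih (by unfold hsum; rw [Finset.sum_filter]; apply Finset.sum_congr rfl; intro n _; split_ifs <;> simp)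
    rw [ih', h1]
    push_cast
    have : (x:ℝ) + 1 ≠ 0 := by positivity
    have : (x:ℝ) + 1 + 1 ≠ 0 := by positivity
    field_simp
    ring

lemma sum_inv_mul (x : ℕ) : ∑ n ∈ Finset.Icc 1 x, (1:ℝ) / (n * (n + 1)) = 1 - 1 / (x + 1) := by
  induction x with
  | zero => simp
  | succ x ih =>
    rw [Finset.sum_Icc_succ_top (by omega), ih]
    push_cast
    have : (x:ℝ) + 1 ≠ 0 := by positivity
    have : (x:ℝ) + 1 + 1 ≠ 0 := by positivity
    field_simp
    ring

lemma harm_bounds (x : ℕ) (hx : 1 ≤ x) : Real.log x ≤ ∑ n ∈ Finset.Icc 1 x, (1:ℝ) / n ∧ ∑ n ∈ Finset.Icc 1 x, (1:ℝ) / n ≤ 1 + Real.log x := by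
  have e : ((harmonic x : ℚ) : ℝ) = ∑ n ∈ Finset.Icc 1 x, (1:ℝ) / n := by
    rw [harmonic_eq_sum_Icc]; push_cast; simp
  rw [← e]
  refine ⟨?_, harmonic_le_one_add_log x⟩
  refine le_trans ?_ (log_add_one_le_harmonic x)
  apply Real.log_le_log (by exact_mod_cast hx)
  simp

lemma hsum_bound (V : ℕ) (hV : 0 < V) (x : ℕ) (hx : 1 ≤ x) : |hsum V x - cV V * Real.log x| ≤ 2 * V + 1 := by
  have h1 := hsum_abel V x
  have h2 : |eV V x / (x + 1) + ∑ n ∈ Finset.Icc 1 x, eV V n / (n * (n + 1))| ≤ 2 * V := by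
    refine (abs_add_le _ _).trans ?_
    have a1 : |eV V x / (x + 1)| ≤ V := by
      rw [abs_div]
      have := eV_bound V hV x
      have h3 : (1:ℝ) ≤ |(x:ℝ) + 1| := by rw [abs_of_nonneg (by positivity)]; simp
      rw [div_le_iff₀ (by linarith)]
      nlinarith [show (0:ℝ) ≤ V by positivity]
    have a2 : |∑ n ∈ Finset.Icc 1 x, eV V n / (n * (n + 1))| ≤ V := by
      refine (Finset.abs_sum_le_sum_abs _ _).trans ?_
      calc ∑ n ∈ Finset.Icc 1 x, |eV V n / (n * (n + 1))| ≤ ∑ n ∈ Finset.Icc 1 x, V * ((1:ℝ) / (n * (n + 1))) := by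
            apply Finset.sum_le_sum; intro n _
            rw [abs_div, mul_one_div, abs_of_nonneg (show (0:ℝ) ≤ n * (n + 1) by positivity)]
            gcongr
            exact eV_bound V hV n
        _ = V * (1 - 1 / (x + 1)) := by rw [← Finset.mul_sum, sum_inv_mul]
        _ ≤ V := by
            have : (0:ℝ) ≤ 1 / ((x:ℝ) + 1) := by positivity
            nlinarith [show (0:ℝ) ≤ V by positivity]
    linarith
  rw [← h1] at h2
  have h3 := harm_bounds x hx
  have h4 := cV_mem V
  have h5 : |cV V * ∑ n ∈ Finset.Icc 1 x, (1:ℝ) / n - cV V * Real.log x| ≤ 1 := by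
    rw [← mul_sub, abs_mul, abs_of_nonneg h4.1, abs_of_nonneg (by linarith)]
    nlinarith
  have h6 := abs_add_le (hsum V x - cV V * ∑ n ∈ Finset.Icc 1 x, (1:ℝ) / n) (cV V * ∑ n ∈ Finset.Icc 1 x, (1:ℝ) / n - cV V * Real.log x)
  rw [sub_add_sub_cancel] at h6
  linarith

lemma cV_pos (V : ℕ) (hV : 0 < V) : 0 < cV V := by
  unfold cV
  have := Nat.totient_pos.2 hV
  positivity

/-- mass of `n ≤ R^x`. -/
lemma hsum_tendsto (V : ℕ) (hV : 0 < V) (x : ℝ) (hx : 0 ≤ x) :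
    Tendsto (fun R : ℕ => hsum V ⌊(R:ℝ) ^ x⌋₊ / (cV V * Real.log R)) atTop (𝓝 x) := by
  have hc := cV_pos V hV
  have hlog : Tendsto (fun R : ℕ => Real.log R) atTop atTop := Real.tendsto_log_atTop.comp tendsto_natCast_atTop_atTop
  have key : ∀ᶠ R : ℕ in atTop, |hsum V ⌊(R:ℝ) ^ x⌋₊ / (cV V * Real.log R) - x| ≤ ((2 * V + 1 + cV V * Real.log 2) / cV V) / Real.log R := by
    filter_upwards [eventually_ge_atTop 2] with R hR
    have hR1 : (1:ℝ) < R := by exact_mod_cast hR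
    have hl : 0 < Real.log R := Real.log_pos hR1
    have hpow : (1:ℝ) ≤ (R:ℝ) ^ x := Real.one_le_rpow hR1.le hx
    have hf1 : 1 ≤ ⌊(R:ℝ) ^ x⌋₊ := Nat.le_floor (by simpa using hpow)
    have h1 := hsum_bound V hV _ hf1
    have hfl : (⌊(R:ℝ) ^ x⌋₊ : ℝ) ≤ (R:ℝ) ^ x := Nat.floor_le (by positivity)
    have hfu : (R:ℝ) ^ x < ⌊(R:ℝ) ^ x⌋₊ + 1 := Nat.lt_floor_add_one _
    have hf1' : (1:ℝ) ≤ (⌊(R:ℝ) ^ x⌋₊ : ℝ) := by exact_mod_cast hf1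
    have h2 : Real.log ⌊(R:ℝ) ^ x⌋₊ ≤ x * Real.log R := by
      rw [← Real.log_rpow (by linarith)]
      exact Real.log_le_log (by linarith) hfl
    have h3 : x * Real.log R - Real.log 2 ≤ Real.log ⌊(R:ℝ) ^ x⌋₊ := by
      rw [← Real.log_rpow (by linarith), ← Real.log_div (by positivity) (by norm_num)]
      apply Real.log_le_log (by positivity)
      linarith
    have h4 : |hsum V ⌊(R:ℝ) ^ x⌋₊ - x * (cV V * Real.log R)| ≤ 2 * V + 1 + cV V * Real.log 2 := by
      rw [abs_le] at h1 ⊢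
      constructor <;> nlinarith [Real.log_pos (show (1:ℝ) < 2 by norm_num)]
    have h5 : hsum V ⌊(R:ℝ) ^ x⌋₊ / (cV V * Real.log R) - x = (hsum V ⌊(R:ℝ) ^ x⌋₊ - x * (cV V * Real.log R)) / (cV V * Real.log R) := by
      field_simp
    rw [h5, abs_div, abs_of_pos (by positivity : 0 < cV V * Real.log R), div_div]
    gcongr
  rw [tendsto_iff_norm_sub_tendsto_zero]
  refine squeeze_zero' (Eventually.of_forall fun _ => norm_nonneg _) key ?_
  exact hlog.const_div_atTop _
end
end

section
section
open Module nonZeroDivisors Ideal Pointwise Filter Topology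

noncomputable def cell (L : ℕ) (x : ℝ) : ℕ := ⌈L * x⌉₊ - 1

lemma cell_lt {L : ℕ} (hL : 0 < L) {x : ℝ} (h1 : x ≤ 1) : cell L x < L := by
  unfold cell
  have : ⌈L * x⌉₊ ≤ L := by
    rw [Nat.ceil_le]; nlinarith [show (0:ℝ) < L by exact_mod_cast hL]
  omega

lemma cell_dist {L : ℕ} (hL : 0 < L) {x : ℝ} (h0 : 0 ≤ x) : |x - cell L x / L| ≤ 1 / L := by
  have hL' : (0:ℝ) < L := by exact_mod_cast hL
  unfold cell
  have e : x - ((⌈L * x⌉₊ - 1 : ℕ) : ℝ) / L = (L * x - ((⌈L * x⌉₊ - 1 : ℕ) : ℝ)) / L := by field_simp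
  rw [e, abs_div, abs_of_pos hL']
  gcongr
  rcases Nat.eq_zero_or_pos ⌈L * x⌉₊ with h | h
  · have h2 := Nat.ceil_eq_zero.1 h
    have : (0:ℝ) ≤ L * x := by positivity
    have h3 : L * x = 0 := le_antisymm h2 this
    rw [h3]; simp
  · rw [Nat.cast_sub h]
    have h3 := Nat.ceil_lt_add_one (show (0:ℝ) ≤ L * x by positivity)
    have h4 := Nat.le_ceil ((L:ℝ) * x)
    rw [abs_le]; push_cast; constructor <;> linarith

lemma cell_eq_iff {L : ℕ} (hL : 0 < L) {x : ℝ} {j : ℕ} : cell L x = j ∧ 0 < x ↔ x ∈ Set.Ioc ((j:ℝ) / L) ((j + 1) / L) := by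
  have hL' : (0:ℝ) < L := by exact_mod_cast hL
  unfold cell
  rw [Set.mem_Ioc, div_lt_iff₀ hL', le_div_iff₀ hL']
  constructor
  · rintro ⟨h, hx⟩
    have h1 : 0 < ⌈L * x⌉₊ := Nat.ceil_pos.2 (by positivity)
    have h2 : ⌈L * x⌉₊ = j + 1 := by omega
    rw [Nat.ceil_eq_iff (by omega)] at h2
    push_cast at h2
    constructor <;> linarith
  · rintro ⟨h1, h2⟩
    have hx : 0 < x := by
      by_contra hx
      have : (0:ℝ) ≤ j := by positivity
      nlinarith
    have h3 : ⌈L * x⌉₊ = j + 1 := by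
      rw [Nat.ceil_eq_iff (by omega)]
      push_cast
      constructor <;> linarith
    exact ⟨by omega, hx⟩

variable {ι : Type} [Fintype ι] [DecidableEq ι]

def IsMod (H : (ι → ℝ) → ℝ) (L : ℕ) (ε : ℝ) : Prop :=
  ∀ t u : ι → ℝ, (∀ i, t i ∈ Set.Icc (0:ℝ) 1) → (∀ i, u i ∈ Set.Icc (0:ℝ) 1) → (∀ i, |t i - u i| ≤ 1 / L) → |H t - H u| ≤ ε

lemma exists_mod (H : (ι → ℝ) → ℝ) (hH : Continuous H) (ε : ℝ) (hε : 0 < ε) : ∃ L : ℕ, 0 < L ∧ IsMod H L ε := by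
  have hcomp : IsCompact (Set.univ.pi fun _ : ι => Set.Icc (0:ℝ) 1) := isCompact_univ_pi fun _ => isCompact_Icc
  have huc := hcomp.uniformContinuousOn_of_continuous hH.continuousOn
  rw [Metric.uniformContinuousOn_iff] at huc
  obtain ⟨δ, hδ, h⟩ := huc ε hε
  obtain ⟨L, hL⟩ := exists_nat_one_div_lt hδ
  refine ⟨L + 1, by omega, ?_⟩
  intro t u ht hu htu
  have := h t (fun i _ => ht i) u (fun i _ => hu i) (by
    rw [dist_pi_lt_iff hδ]
    intro i
    rw [Real.dist_eq]
    refine (htu i).trans_lt ?_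
    push_cast; exact hL)
  rw [Real.dist_eq] at this
  exact this.le

lemma cell_corner {L : ℕ} (hL : 0 < L) {x : ℝ} (h1 : x ≤ 1) : ((cell L x : ℝ) / L) ∈ Set.Icc (0:ℝ) 1 := by
  refine ⟨by positivity, div_le_one_of_le₀ ?_ (by positivity)⟩
  exact_mod_cast (cell_lt hL h1).le

lemma disc_sum {α : Type} [DecidableEq α] (S : Finset α) (w : α → ℝ) (hw : ∀ a, 0 ≤ w a) (x : α → ℝ) (hx : ∀ a ∈ S, x a ∈ Set.Icc (0:ℝ) 1)
    (H : (ι → ℝ) → ℝ) {L : ℕ} (hL : 0 < L) {ε : ℝ} (hH : IsMod H L ε) :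
    |∑ τ ∈ Fintype.piFinset (fun _ : ι => S), (∏ i, w (τ i)) * H (fun i => x (τ i)) -
      ∑ c ∈ Fintype.piFinset (fun _ : ι => Finset.range L), H (fun i => (c i : ℝ) / L) * ∏ i, ∑ a ∈ S.filter (fun a => cell L (x a) = c i), w a|
      ≤ ε * (∑ a ∈ S, w a) ^ Fintype.card ι := by
  have h1 : ∑ c ∈ Fintype.piFinset (fun _ : ι => Finset.range L), H (fun i => (c i : ℝ) / L) * ∏ i, ∑ a ∈ S.filter (fun a => cell L (x a) = c i), w a =
      ∑ τ ∈ Fintype.piFinset (fun _ : ι => S), (∏ i, w (τ i)) * H (fun i => (cell L (x (τ i)) : ℝ) / L) := by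
    rw [← Finset.sum_fiberwise_of_maps_to (g := fun τ : ι → α => fun i => cell L (x (τ i))) (t := Fintype.piFinset (fun _ : ι => Finset.range L))]
    · apply Finset.sum_congr rfl
      intro c _
      rw [Finset.prod_univ_sum, Finset.mul_sum]
      have e : Fintype.piFinset (fun i => S.filter (fun a => cell L (x a) = c i)) = (Fintype.piFinset (fun _ : ι => S)).filter (fun τ => (fun i => cell L (x (τ i))) = c) := by
        ext τ
        simp only [Fintype.mem_piFinset, Finset.mem_filter, funext_iff]
        exact forall_and
      rw [e]
      apply Finset.sum_congr rfl
      intro τ hτ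
      rw [Finset.mem_filter] at hτ
      rw [mul_comm, ← hτ.2]
    · intro τ hτ
      rw [Fintype.mem_piFinset] at hτ ⊢
      intro i
      exact Finset.mem_range.2 (cell_lt hL (hx _ (hτ i)).2)
  rw [h1, ← Finset.sum_sub_distrib]
  refine (Finset.abs_sum_le_sum_abs _ _).trans ?_
  have h2 : (∑ a ∈ S, w a) ^ Fintype.card ι = ∑ τ ∈ Fintype.piFinset (fun _ : ι => S), ∏ i, w (τ i) := by
    rw [← Finset.prod_univ_sum, Finset.prod_const, Finset.card_univ]
  rw [h2, Finset.mul_sum]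
  apply Finset.sum_le_sum
  intro τ hτ
  rw [Fintype.mem_piFinset] at hτ
  rw [← mul_sub, abs_mul, abs_of_nonneg (Finset.prod_nonneg fun i _ => hw _), mul_comm]
  apply mul_le_mul_of_nonneg_right _ (Finset.prod_nonneg fun i _ => hw _)
  exact hH _ _ (fun i => hx _ (hτ i)) (fun i => cell_corner hL (hx _ (hτ i)).2) (fun i => cell_dist hL (hx _ (hτ i)).1)

lemma disc_int (H : (ι → ℝ) → ℝ) (hc : Continuous H) {L : ℕ} (hL : 0 < L) {ε : ℝ} (hH : IsMod H L ε) :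
    |(∫ t in Set.univ.pi fun _ : ι => Set.Icc (0:ℝ) 1, H t) -
      ∑ c ∈ Fintype.piFinset (fun _ : ι => Finset.range L), H (fun i => (c i : ℝ) / L) * (1 / (L:ℝ)) ^ Fintype.card ι| ≤ ε := by
  have hL' : (0:ℝ) < L := by exact_mod_cast hL
  set cs : (ι → ℕ) → Set (ι → ℝ) := fun c => Set.univ.pi fun i => Set.Ioc ((c i : ℝ) / L) ((c i + 1) / L) with hcs
  have hmeas : ∀ c, MeasurableSet (cs c) := fun c => MeasurableSet.univ_pi fun i => measurableSet_Ioc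
  have hvol : ∀ c, volume.real (cs c) = (1 / (L:ℝ)) ^ Fintype.card ι := by
    intro c
    rw [hcs, Measure.real, volume_pi, Measure.pi_pi]
    simp only [Real.volume_Ioc]
    rw [ENNReal.toReal_prod]
    have : ∀ i : ι, (ENNReal.ofReal (((c i : ℝ) + 1) / L - (c i : ℝ) / L)).toReal = 1 / L := by
      intro i
      rw [← sub_div, add_sub_cancel_left, ENNReal.toReal_ofReal (by positivity)]
    rw [Finset.prod_congr rfl (fun i _ => this i), Finset.prod_const, Finset.card_univ]
  have hcube : (Set.univ.pi fun _ : ι => Set.Icc (0:ℝ) 1) =ᵐ[volume] ⋃ c ∈ Fintype.piFinset (fun _ : ι => Finset.range L), cs c := by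
    have e1 : (⋃ c ∈ Fintype.piFinset (fun _ : ι => Finset.range L), cs c) = Set.univ.pi fun _ : ι => Set.Ioc (0:ℝ) 1 := by
      ext t
      simp only [Set.mem_iUnion, Fintype.mem_piFinset, Finset.mem_range, hcs, Set.mem_pi, Set.mem_univ, true_imp_iff, exists_prop]
      constructor
      · rintro ⟨c, hcL, h⟩ i
        have h1 := (cell_eq_iff hL).2 (h i)
        refine ⟨h1.2, (h i).2.trans ?_⟩
        rw [div_le_one hL']
        exact_mod_cast hcL i
      · intro h
        refine ⟨fun i => cell L (t i), fun i => cell_lt hL (h i).2, fun i => ?_⟩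
        exact (cell_eq_iff hL).1 ⟨rfl, (h i).1⟩
    rw [e1, Set.pi_univ_Icc, volume_pi]
    exact (Measure.univ_pi_Ioc_ae_eq_Icc (μ := fun _ : ι => (volume : Measure ℝ)) (f := fun _ => 0) (g := fun _ => 1)).symm
  have hcsub : ∀ c ∈ Fintype.piFinset (fun _ : ι => Finset.range L), cs c ⊆ Set.univ.pi fun _ : ι => Set.Icc (0:ℝ) 1 := by
    intro c hc t ht i _
    rw [Fintype.mem_piFinset] at hc
    have h1 := ht i trivial
    have h2 := (cell_eq_iff hL).2 h1
    refine ⟨h2.2.le, h1.2.trans ?_⟩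
    rw [div_le_one hL']
    exact_mod_cast Finset.mem_range.1 (hc i)
  have hIntg : IntegrableOn H (Set.univ.pi fun _ : ι => Set.Icc (0:ℝ) 1) :=
    hc.continuousOn.integrableOn_compact (isCompact_univ_pi fun _ => isCompact_Icc)
  rw [setIntegral_congr_set hcube, integral_biUnion_finset _ (fun c _ => hmeas c)]
  · rw [← Finset.sum_sub_distrib]
    refine (Finset.abs_sum_le_sum_abs _ _).trans ?_
    have : ∀ c ∈ Fintype.piFinset (fun _ : ι => Finset.range L), |(∫ t in cs c, H t) - H (fun i => (c i : ℝ) / L) * (1 / (L:ℝ)) ^ Fintype.card ι| ≤ ε * (1 / (L:ℝ)) ^ Fintype.card ι := by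
      intro c hc'
      have hfin : volume (cs c) < ⊤ := lt_of_le_of_lt (measure_mono (hcsub c hc')) (isCompact_univ_pi fun _ => isCompact_Icc).measure_lt_top
      have e : (∫ t in cs c, H t) - H (fun i => (c i : ℝ) / L) * (1 / (L:ℝ)) ^ Fintype.card ι = ∫ t in cs c, (H t - H (fun i => (c i : ℝ) / L)) := by
        rw [integral_sub (hIntg.mono_set (hcsub c hc')) (integrableOn_const hfin.ne), setIntegral_const, hvol, smul_eq_mul, mul_comm]
      rw [e, ← Real.norm_eq_abs, ← hvol c]
      apply norm_setIntegral_le_of_norm_le_const hfin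
      intro t ht
      have h3 := hcsub c hc' ht
      have h4 : ∀ i, cell L (t i) = c i := fun i => ((cell_eq_iff hL).2 (ht i trivial)).1
      have h5 : (fun i => (c i : ℝ) / L) = fun i => (cell L (t i) : ℝ) / L := by
        funext i; rw [h4 i]
      rw [Real.norm_eq_abs, h5]
      exact hH _ _ (fun i => h3 i trivial) (fun i => cell_corner hL (h3 i trivial).2) (fun i => cell_dist hL (h3 i trivial).1)
    refine (Finset.sum_le_sum this).trans (le_of_eq ?_)
    rw [Finset.sum_const, Fintype.card_piFinset, Finset.prod_const, Finset.card_univ, nsmul_eq_mul, Finset.card_range]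
    push_cast
    rw [one_div, inv_pow]
    field_simp
  · intro c _ c' _ hne
    rw [Function.onFun, Set.disjoint_left]
    intro t h1 h2
    apply hne
    funext i
    rw [← ((cell_eq_iff hL).2 (h1 i trivial)).1, ← ((cell_eq_iff hL).2 (h2 i trivial)).1]
  · intro c hc'
    exact hIntg.mono_set (hcsub c hc')
end
end

section
section
open Module nonZeroDivisors Ideal Pointwise Filter Topology

def SV (V R : ℕ) : Finset ℕ := (Finset.Icc 1 R).filter (fun n => Nat.Coprime n V)

lemma SV_x {V R n : ℕ} (hR : 2 ≤ R) (hn : n ∈ SV V R) : Real.log n / Real.log R ∈ Set.Icc (0:ℝ) 1 := by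
  unfold SV at hn
  rw [Finset.mem_filter, Finset.mem_Icc] at hn
  have hl : 0 < Real.log R := Real.log_pos (by exact_mod_cast hR)
  refine ⟨div_nonneg (Real.log_natCast_nonneg n) hl.le, ?_⟩
  rw [div_le_one hl]
  exact Real.log_le_log (by exact_mod_cast hn.1.1) (by exact_mod_cast hn.1.2)

lemma cum_eq (V : ℕ) {R : ℕ} (hR : 2 ≤ R) {L j : ℕ} (hL : 0 < L) (hj : j < L) :
    ∑ n ∈ (SV V R).filter (fun n : ℕ => cell L (Real.log n / Real.log R) ≤ j), (1:ℝ) / n = hsum V ⌊(R:ℝ) ^ (((j:ℝ) + 1) / L)⌋₊ := by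
  unfold hsum
  have hL' : (0:ℝ) < L := by exact_mod_cast hL
  have hR1 : (1:ℝ) < R := by exact_mod_cast hR
  have hl : 0 < Real.log R := Real.log_pos hR1
  congr 1
  ext n
  unfold SV
  simp only [Finset.mem_filter, Finset.mem_Icc]
  have key : 1 ≤ n → (cell L (Real.log n / Real.log R) ≤ j ↔ n ≤ ⌊(R:ℝ) ^ (((j:ℝ) + 1) / L)⌋₊) := by
    intro hn
    have hn0 : (0:ℝ) < n := by exact_mod_cast hn
    rw [Nat.le_floor_iff (by positivity), ← Real.log_le_log_iff hn0 (by positivity), Real.log_rpow (by linarith)]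
    unfold cell
    rw [Nat.sub_le_iff_le_add, Nat.ceil_le]
    push_cast
    rw [← mul_div_assoc, div_le_iff₀ hl, div_mul_eq_mul_div, le_div_iff₀ hL', mul_comm (L:ℝ)]
  constructor
  · rintro ⟨⟨⟨h1, h2⟩, h3⟩, h4⟩
    exact ⟨⟨h1, (key h1).1 h4⟩, h3⟩
  · rintro ⟨⟨h1, h2⟩, h3⟩
    refine ⟨⟨⟨h1, ?_⟩, h3⟩, (key h1).2 h2⟩
    have h4 : (R:ℝ) ^ (((j:ℝ) + 1) / L) ≤ R := by
      conv_rhs => rw [← Real.rpow_one (R:ℝ)]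
      apply Real.rpow_le_rpow_of_exponent_le hR1.le
      rw [div_le_one hL']
      exact_mod_cast hj
    have h5 := (Nat.le_floor_iff (by positivity)).1 h2
    exact_mod_cast h5.trans h4

lemma cellmass_tendsto (V : ℕ) (hV : 0 < V) {L : ℕ} (hL : 0 < L) {j : ℕ} (hj : j < L) :
    Tendsto (fun R : ℕ => ∑ n ∈ (SV V R).filter (fun n : ℕ => cell L (Real.log n / Real.log R) = j), (1:ℝ) / n / (cV V * Real.log R)) atTop (𝓝 (1 / L)) := by
  have hL' : (0:ℝ) < L := by exact_mod_cast hL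
  have hcum : ∀ i, i < L → Tendsto (fun R : ℕ => ∑ n ∈ (SV V R).filter (fun n : ℕ => cell L (Real.log n / Real.log R) ≤ i), (1:ℝ) / n / (cV V * Real.log R)) atTop (𝓝 (((i:ℝ) + 1) / L)) := by
    intro i hi
    refine (hsum_tendsto V hV (((i:ℝ) + 1) / L) (by positivity)).congr' ?_
    filter_upwards [eventually_ge_atTop 2] with R hR
    rw [← Finset.sum_div, cum_eq V hR hL hi]
  rcases Nat.eq_zero_or_pos j with h0 | h0
  · subst h0
    have := hcum 0 hj
    simp only [Nat.cast_zero, zero_add, nonpos_iff_eq_zero] at this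
    exact this
  · have := (hcum j hj).sub (hcum (j - 1) (by omega))
    have e : ((j:ℝ) + 1) / L - (((j - 1 : ℕ):ℝ) + 1) / L = 1 / L := by
      rw [Nat.cast_sub h0]; push_cast; ring
    rw [e] at this
    refine this.congr ?_
    intro R
    rw [sub_eq_iff_eq_add, ← Finset.sum_union]
    · congr 1
      ext n
      simp only [Finset.mem_filter, Finset.mem_union]
      rw [← and_or_left]
      apply and_congr_right
      intro _
      omega
    · rw [Finset.disjoint_left]
      intro n h1 h2
      rw [Finset.mem_filter] at h1 h2
      have := h1.2
      have := h2.2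
      omega

variable {ι : Type} [Fintype ι] [DecidableEq ι]

theorem EQ (V : ℕ) (hV : 0 < V) (H : (ι → ℝ) → ℝ) (hH : Continuous H) :
    Tendsto (fun R : ℕ => (∑ τ ∈ Fintype.piFinset (fun _ : ι => SV V R), (∏ i, (1:ℝ) / (τ i : ℕ)) * H (fun i => Real.log (τ i : ℕ) / Real.log R)) /
      (cV V * Real.log R) ^ Fintype.card ι) atTop (𝓝 (∫ t in Set.univ.pi fun _ : ι => Set.Icc (0:ℝ) 1, H t)) := by
  rw [Metric.tendsto_atTop']
  intro ε hε
  obtain ⟨L, hL, hmod⟩ := exists_mod H hH (ε / 8) (by positivity)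
  have hIntg := disc_int H hH hL hmod
  set K := Fintype.card ι
  have hmass : Tendsto (fun R : ℕ => ∑ n ∈ SV V R, (1:ℝ) / n / (cV V * Real.log R)) atTop (𝓝 1) := by
    refine (hsum_tendsto V hV 1 (by norm_num)).congr ?_
    intro R
    rw [Real.rpow_one, Nat.floor_natCast, ← Finset.sum_div]
    rfl
  have hmass' : ∀ᶠ R : ℕ in atTop, (∑ n ∈ SV V R, (1:ℝ) / n / (cV V * Real.log R)) ^ K < 2 :=
    ((hmass.pow K).eventually_lt_const (by rw [one_pow]; norm_num))
  have hcells : Tendsto (fun R : ℕ => ∑ c ∈ Fintype.piFinset (fun _ : ι => Finset.range L), H (fun i => (c i : ℝ) / L) *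
      ∏ i, ∑ n ∈ (SV V R).filter (fun n : ℕ => cell L (Real.log n / Real.log R) = c i), (1:ℝ) / n / (cV V * Real.log R)) atTop
      (𝓝 (∑ c ∈ Fintype.piFinset (fun _ : ι => Finset.range L), H (fun i => (c i : ℝ) / L) * (1 / (L:ℝ)) ^ K)) := by
    apply tendsto_finsetSum
    intro c hc
    rw [Fintype.mem_piFinset] at hc
    apply Tendsto.const_mul
    have e : (1 / (L:ℝ)) ^ K = ∏ i : ι, (1 / (L:ℝ)) := by rw [Finset.prod_const, Finset.card_univ]
    rw [e]
    exact tendsto_finsetProd _ (fun i _ => cellmass_tendsto V hV hL (Finset.mem_range.1 (hc i)))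
  have hcells' := (Metric.tendsto_nhds.1 hcells) (ε / 8) (by positivity)
  obtain ⟨R0, hR0⟩ := eventually_atTop.1 (hmass'.and (hcells'.and (eventually_ge_atTop 2)))
  refine ⟨R0, fun R hR => ?_⟩
  obtain ⟨h1, h2, h3⟩ := hR0 R hR.le
  have hc := cV_pos V hV
  have hl : 0 < Real.log R := Real.log_pos (by exact_mod_cast h3)
  have hd := disc_sum (SV V R) (fun n : ℕ => (1:ℝ) / n / (cV V * Real.log R)) (fun n => by positivity) (fun n : ℕ => Real.log n / Real.log R)
    (fun n hn => SV_x h3 hn) H hL hmod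
  have e : (∑ τ ∈ Fintype.piFinset (fun _ : ι => SV V R), (∏ i, (1:ℝ) / (τ i : ℕ)) * H (fun i => Real.log (τ i : ℕ) / Real.log R)) /
      (cV V * Real.log R) ^ K = ∑ τ ∈ Fintype.piFinset (fun _ : ι => SV V R), (∏ i, (1:ℝ) / (τ i : ℕ) / (cV V * Real.log R)) * H (fun i => Real.log (τ i : ℕ) / Real.log R) := by
    rw [Finset.sum_div]
    apply Finset.sum_congr rfl
    intro τ _
    have e1 : ∏ i, (1:ℝ) / (τ i : ℕ) / (cV V * Real.log R) = (∏ i, (1:ℝ) / (τ i : ℕ)) / (cV V * Real.log R) ^ K := by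
      rw [Finset.prod_div_distrib (fun i => (1:ℝ) / (τ i : ℕ)), Finset.prod_const, Finset.card_univ]
    rw [e1, div_mul_eq_mul_div]
  rw [e]
  rw [Real.dist_eq] at h2 ⊢
  have h4 : ε / 8 * (∑ n ∈ SV V R, (1:ℝ) / n / (cV V * Real.log R)) ^ K ≤ ε / 8 * 2 := by gcongr
  have h5 := hd.trans h4
  rw [abs_lt] at h2 ⊢
  rw [abs_le] at h5 hIntg
  constructor <;> linarith
end
end

section
section
open Module nonZeroDivisors Ideal Pointwise Filter Topology

lemma sum_cons {n : ℕ} {Ω : Type} [Fintype Ω] (f : (Fin (n + 1) → Ω) → ℝ) :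
    ∑ ω, f ω = ∑ a, ∑ ω : Fin n → Ω, f (Fin.cons a ω) := by
  rw [← Equiv.sum_comp (Fin.consEquiv (fun _ : Fin (n + 1) => Ω)), Fintype.sum_prod_type]
  rfl

theorem tensor_mono {β Ω Ω' : Type} [Fintype β] [Fintype Ω] [Fintype Ω'] : ∀ (n : ℕ) (μ : Fin n → Ω → ℝ) (A : Fin n → Ω → β → ℝ)
    (μ' : Fin n → Ω' → ℝ) (A' : Fin n → Ω' → β → ℝ) (_ : ∀ p ω, 0 ≤ μ p ω) (_ : ∀ p ω, 0 ≤ μ' p ω)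
    (_ : ∀ p (y : β → ℝ), ∑ ω, μ p ω * (∑ b, A p ω b * y b) ^ 2 ≤ ∑ ω, μ' p ω * (∑ b, A' p ω b * y b) ^ 2)
    (x : (Fin n → β) → ℝ),
    ∑ ω : Fin n → Ω, (∏ p, μ p (ω p)) * (∑ s : Fin n → β, (∏ p, A p (ω p) (s p)) * x s) ^ 2 ≤
    ∑ ω : Fin n → Ω', (∏ p, μ' p (ω p)) * (∑ s : Fin n → β, (∏ p, A' p (ω p) (s p)) * x s) ^ 2 := by
  intro n
  induction n with
  | zero => intro μ A μ' A' _ _ _ x; simp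
  | succ n ih =>
    intro μ A μ' A' hμ hμ' hloc x
    have lhs : ∑ ω : Fin (n + 1) → Ω, (∏ p, μ p (ω p)) * (∑ s : Fin (n + 1) → β, (∏ p, A p (ω p) (s p)) * x s) ^ 2 =
        ∑ a : Ω, μ 0 a * ∑ ω : Fin n → Ω, (∏ p, μ p.succ (ω p)) * (∑ s : Fin n → β, (∏ p, A p.succ (ω p) (s p)) * ∑ b, A 0 a b * x (Fin.cons b s)) ^ 2 := by
      rw [sum_cons]
      apply Finset.sum_congr rfl; intro a _
      rw [Finset.mul_sum]
      apply Finset.sum_congr rfl; intro ω _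
      rw [Fin.prod_univ_succ, sum_cons, Finset.sum_comm]
      simp only [Fin.cons_zero, Fin.cons_succ, mul_assoc]
      congr 3
      congr 1
      funext s
      rw [Finset.mul_sum]
      apply Finset.sum_congr rfl; intro b _
      rw [Fin.prod_univ_succ]
      simp only [Fin.cons_zero, Fin.cons_succ]
      ring
    have rhs : ∑ ω : Fin (n + 1) → Ω', (∏ p, μ' p (ω p)) * (∑ s : Fin (n + 1) → β, (∏ p, A' p (ω p) (s p)) * x s) ^ 2 =
        ∑ ω : Fin n → Ω', (∏ p, μ' p.succ (ω p)) * ∑ a : Ω', μ' 0 a * (∑ b, A' 0 a b * ∑ s : Fin n → β, (∏ p, A' p.succ (ω p) (s p)) * x (Fin.cons b s)) ^ 2 := by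
      rw [sum_cons, Finset.sum_comm]
      apply Finset.sum_congr rfl; intro ω _
      rw [Finset.mul_sum]
      apply Finset.sum_congr rfl; intro a _
      rw [Fin.prod_univ_succ, sum_cons]
      simp only [Fin.cons_zero, Fin.cons_succ]
      rw [mul_comm (μ' 0 a), mul_assoc]
      congr 3
      congr 1
      funext b
      rw [Finset.mul_sum]
      apply Finset.sum_congr rfl; intro s _
      rw [Fin.prod_univ_succ]
      simp only [Fin.cons_zero, Fin.cons_succ]
      ring
    rw [lhs, rhs]
    calc _ ≤ ∑ a : Ω, μ 0 a * ∑ ω : Fin n → Ω', (∏ p, μ' p.succ (ω p)) * (∑ s : Fin n → β, (∏ p, A' p.succ (ω p) (s p)) * ∑ b, A 0 a b * x (Fin.cons b s)) ^ 2 := by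
          apply Finset.sum_le_sum; intro a _
          apply mul_le_mul_of_nonneg_left _ (hμ 0 a)
          exact ih (fun p => μ p.succ) (fun p => A p.succ) (fun p => μ' p.succ) (fun p => A' p.succ) (fun p => hμ p.succ) (fun p => hμ' p.succ)
            (fun p => hloc p.succ) (fun s => ∑ b, A 0 a b * x (Fin.cons b s))
      _ = ∑ ω : Fin n → Ω', (∏ p, μ' p.succ (ω p)) * ∑ a : Ω, μ 0 a * (∑ b, A 0 a b * ∑ s : Fin n → β, (∏ p, A' p.succ (ω p) (s p)) * x (Fin.cons b s)) ^ 2 := by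
          simp only [Finset.mul_sum]
          rw [Finset.sum_comm]
          apply Finset.sum_congr rfl; intro ω _
          apply Finset.sum_congr rfl; intro a _
          rw [← mul_assoc, ← mul_assoc, mul_comm (μ 0 a), Finset.sum_comm]
          congr 2
          apply Finset.sum_congr rfl; intro b _
          apply Finset.sum_congr rfl; intro s _
          ring
      _ ≤ _ := by
          apply Finset.sum_le_sum; intro ω _
          apply mul_le_mul_of_nonneg_left _ (Finset.prod_nonneg fun p _ => hμ' _ _)
          exact hloc 0 _

/-- local evaluation functional on the `y` variables -/
noncomputable def SA {k : ℕ} (p : ℝ) (ω b : Option (Fin k)) : ℝ :=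
  match b with
  | none => 1
  | some j => 1 / (p - 1) - (if ω = some j then 1 else 0)

noncomputable def mu1 {k : ℕ} (p : ℝ) (ω : Option (Fin k)) : ℝ := match ω with
  | none => 1 - k / p
  | some _ => 1 / p

noncomputable def wt1 {k : ℕ} (p : ℝ) (ω : Option (Fin k)) : ℝ := match ω with
  | none => 1
  | some _ => 1 / p

noncomputable def mu2 {k : ℕ} (m : Fin k) (p : ℝ) (ω : Option (Fin k)) : ℝ := match ω with
  | none => 1 - (k - 1) / (p - 1)
  | some i => if i = m then 0 else 1 / (p - 1)

noncomputable def wt2 {k : ℕ} (m : Fin k) (p : ℝ) (ω : Option (Fin k)) : ℝ := match ω with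
  | none => 1
  | some i => if i = m then 0 else 1 / p * (1 - k / p)

/-- lower bound functional: none ↦ y_0 + y_m/(p-1), some i ↦ y_i -/
noncomputable def SB {k : ℕ} (m : Fin k) (p : ℝ) (ω b : Option (Fin k)) : ℝ := match ω with
  | none => (match b with
    | none => 1
    | some j => if j = m then 1 / (p - 1) else 0)
  | some i => if b = some i then 1 else 0

lemma SA_none {k : ℕ} (p : ℝ) (y : Option (Fin k) → ℝ) : ∑ b, SA p none b * y b = y none + (∑ i, y (some i)) / (p - 1) := by
  rw [Fintype.sum_option]
  simp only [SA, one_mul]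
  simp only [reduceCtorEq, if_false, sub_zero]
  rw [← Finset.mul_sum]; ring

lemma SA_some {k : ℕ} (p : ℝ) (y : Option (Fin k) → ℝ) (j : Fin k) : ∑ b, SA p (some j) b * y b = y none + (∑ i, y (some i)) / (p - 1) - y (some j) := by
  rw [Fintype.sum_option]
  simp only [SA, one_mul, sub_mul, Finset.sum_sub_distrib]
  rw [← Finset.mul_sum]
  simp only [Option.some.injEq, ite_mul, one_mul, zero_mul, Finset.sum_ite_eq, Finset.mem_univ, if_true]
  ring

lemma local1 {k : ℕ} (hk : 0 < k) (p : ℝ) (hp : 2 ≤ p) (y : Option (Fin k) → ℝ) :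
    ∑ ω, mu1 p ω * (∑ b, SA p ω b * y b) ^ 2 ≤ ∑ ω, ((1 + 8 * k / p ^ 2) * wt1 p ω) * (∑ b, (if ω = b then 1 else 0) * y b) ^ 2 := by
  have hk' : (1:ℝ) ≤ k := by exact_mod_cast hk
  have hR : ∀ ω, ∑ b, (if ω = b then (1:ℝ) else 0) * y b = y ω := by intro ω; simp
  simp only [hR]
  rw [Fintype.sum_option (fun ω => mu1 p ω * (∑ b, SA p ω b * y b) ^ 2), Fintype.sum_option (fun ω => ((1 + 8 * k / p ^ 2) * wt1 p ω) * y ω ^ 2)]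
  simp only [SA_none, SA_some, mu1, wt1]
  set Y := ∑ i, y (some i) with hY
  set Z := ∑ i, y (some i) ^ 2 with hZ
  set y0 := y none
  have hCS : Y ^ 2 ≤ k * Z := by
    have := sq_sum_le_card_mul_sum_sq (s := Finset.univ) (f := fun i => y (some i))
    simpa using this
  have hZ0 : 0 ≤ Z := Finset.sum_nonneg fun i _ => sq_nonneg _
  have e1 : ∑ i, 1 / p * (y0 + Y / (p - 1) - y (some i)) ^ 2 = 1 / p * (k * (y0 + Y / (p - 1)) ^ 2 - 2 * (y0 + Y / (p - 1)) * Y + Z) := by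
    rw [← Finset.mul_sum]
    congr 1
    simp only [sub_sq, Finset.sum_add_distrib, Finset.sum_sub_distrib]
    rw [← Finset.mul_sum]
    simp [hY, hZ]
  have e2 : ∑ i, (1 + 8 * k / p ^ 2) * (1 / p) * y (some i) ^ 2 = (1 + 8 * k / p ^ 2) * (1 / p) * Z := by
    rw [← Finset.mul_sum]
  rw [e1, e2]
  have hp0 : 0 < p := by linarith
  have hp1 : 0 < p - 1 := by linarith
  have id1 : (1 - k / p) * (y0 + Y / (p - 1)) ^ 2 + 1 / p * (k * (y0 + Y / (p - 1)) ^ 2 - 2 * (y0 + Y / (p - 1)) * Y + Z) =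
      (1 + 1 / p ^ 2) * y0 ^ 2 + 2 / (p * (p - 1) ^ 2) * Y ^ 2 + Z / p - (y0 / p - Y / (p - 1)) ^ 2 := by
    field_simp
    ring
  rw [id1]
  have b1 : 2 / (p * (p - 1) ^ 2) * Y ^ 2 ≤ 8 * k / p ^ 3 * Z := by
    calc 2 / (p * (p - 1) ^ 2) * Y ^ 2 ≤ 2 / (p * (p / 2) ^ 2) * (k * Z) := by
          apply mul_le_mul _ hCS (sq_nonneg _) (by positivity)
          gcongr
          linarith
      _ = 8 * k / p ^ 3 * Z := by field_simp; ring
  have b2 : 1 / p ^ 2 * y0 ^ 2 ≤ 8 * k / p ^ 2 * y0 ^ 2 := by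
    gcongr; linarith
  have e3 : (1 + 8 * k / p ^ 2) * (1 / p) * Z = Z / p + 8 * k / p ^ 3 * Z := by field_simp
  rw [e3]
  nlinarith [sq_nonneg (y0 / p - Y / (p - 1))]

lemma local2 {k : ℕ} (m : Fin k) (p : ℝ) (hp : (k:ℝ) + 1 ≤ p) (y : Option (Fin k) → ℝ) :
    ∑ ω, wt2 m p ω * (∑ b, SB m p ω b * y b) ^ 2 ≤ ∑ ω, mu2 m p ω * (∑ b, SA p ω b * y b) ^ 2 := by
  have hk : 1 ≤ k := by have := m.2; omega
  have hk' : (1:ℝ) ≤ k := by exact_mod_cast hk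
  have hL0 : ∑ b, SB m p none b * y b = y none + y (some m) / (p - 1) := by
    rw [Fintype.sum_option]
    simp only [SB, one_mul, ite_mul, zero_mul, Finset.sum_ite_eq', Finset.mem_univ, if_true]
    ring
  have hL1 : ∀ i, ∑ b, SB m p (some i) b * y b = y (some i) := by
    intro i
    simp only [SB, one_mul, ite_mul, zero_mul, Finset.sum_ite_eq', Finset.mem_univ, if_true]
  rw [Fintype.sum_option (fun ω => wt2 m p ω * (∑ b, SB m p ω b * y b) ^ 2), Fintype.sum_option (fun ω => mu2 m p ω * (∑ b, SA p ω b * y b) ^ 2)]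
  simp only [hL0, hL1, SA_none, SA_some, mu2, wt2, ite_mul, zero_mul]
  have hsplit : ∀ f : Fin k → ℝ, ∑ i, (if i = m then 0 else f i) = ∑ i ∈ Finset.univ.erase m, f i := by
    intro f
    rw [← Finset.add_sum_erase _ _ (Finset.mem_univ m)]
    simp only [if_true, zero_add]
    apply Finset.sum_congr rfl
    intro i hi
    rw [if_neg (Finset.ne_of_mem_erase hi)]
  rw [hsplit, hsplit, ← Finset.add_sum_erase _ (fun i => y (some i)) (Finset.mem_univ m)]
  set Y := ∑ i ∈ Finset.univ.erase m, y (some i) with hY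
  set Z := ∑ i ∈ Finset.univ.erase m, y (some i) ^ 2 with hZ
  set y0 := y none
  set ym := y (some m)
  have hcard : ((Finset.univ.erase m).card : ℝ) = k - 1 := by
    rw [Finset.card_erase_of_mem (Finset.mem_univ m), Finset.card_univ, Fintype.card_fin, Nat.cast_sub hk]; simp
  have hCS : Y ^ 2 ≤ (k - 1) * Z := by
    have := sq_sum_le_card_mul_sum_sq (s := Finset.univ.erase m) (f := fun i => y (some i))
    rw [hcard] at this
    exact this
  have hZ0 : 0 ≤ Z := Finset.sum_nonneg fun i _ => sq_nonneg _
  have e1 : ∑ i ∈ Finset.univ.erase m, 1 / (p - 1) * (y0 + (ym + Y) / (p - 1) - y (some i)) ^ 2 = 1 / (p - 1) * ((k - 1) * (y0 + (ym + Y) / (p - 1)) ^ 2 - 2 * (y0 + (ym + Y) / (p - 1)) * Y + Z) := by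
    rw [← Finset.mul_sum]
    congr 1
    simp only [sub_sq, Finset.sum_add_distrib, Finset.sum_sub_distrib]
    rw [← Finset.mul_sum, Finset.sum_const, nsmul_eq_mul, hcard]
  have e2 : ∑ i ∈ Finset.univ.erase m, 1 / p * (1 - k / p) * y (some i) ^ 2 = 1 / p * (1 - k / p) * Z := by
    rw [← Finset.mul_sum]
  rw [e1, e2]
  have hp0 : 0 < p := by linarith
  have hp1 : 0 < p - 1 := by linarith
  have id1 : (1 - (k - 1) / (p - 1)) * (y0 + (ym + Y) / (p - 1)) ^ 2 + 1 / (p - 1) * ((k - 1) * (y0 + (ym + Y) / (p - 1)) ^ 2 - 2 * (y0 + (ym + Y) / (p - 1)) * Y + Z) =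
      (y0 + ym / (p - 1)) ^ 2 + (Z / (p - 1) - Y ^ 2 / (p - 1) ^ 2) := by
    field_simp
    ring
  rw [id1, one_mul]
  have b1 : 1 / p * (1 - k / p) * Z ≤ Z / (p - 1) - Y ^ 2 / (p - 1) ^ 2 := by
    have h1 : Y ^ 2 / (p - 1) ^ 2 ≤ (k - 1) * Z / (p - 1) ^ 2 := by gcongr
    have h2 : Z / (p - 1) - (k - 1) * Z / (p - 1) ^ 2 = (p - k) * Z / (p - 1) ^ 2 := by field_simp; ring
    have h3 : 1 / p * (1 - k / p) * Z = (p - k) * Z / p ^ 2 := by field_simp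
    have h4 : (p - k) * Z / p ^ 2 ≤ (p - k) * Z / (p - 1) ^ 2 := by
      apply div_le_div_of_nonneg_left (mul_nonneg (by linarith) hZ0) (by positivity)
      gcongr
      linarith
    linarith
  linarith
end
end

section
section
open Module nonZeroDivisors Ideal Pointwise Filter Topology

/-- enumeration of the sieving primes -/
structure PEnum (V R D0 : ℕ) {n : ℕ} (pp : Fin n → ℕ) : Prop where
  inj : Function.Injective pp
  prime : ∀ p, (pp p).Prime
  cop : ∀ p, Nat.Coprime (pp p) V
  big : ∀ p, D0 < pp p
  le : ∀ p, pp p ≤ R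
  all : ∀ q : ℕ, q.Prime → q ≤ R → Nat.Coprime q V → ∃ p, pp p = q

lemma exists_PEnum (V R D0 : ℕ) (hV : ∀ q : ℕ, q.Prime → q ≤ D0 → ¬ Nat.Coprime q V) : ∃ (n : ℕ) (pp : Fin n → ℕ), PEnum V R D0 pp := by
  classical
  set s : Finset ℕ := (Finset.range (R + 1)).filter (fun q => q.Prime ∧ Nat.Coprime q V) with hs
  refine ⟨s.card, fun i => (s.equivFin.symm i : ℕ), ?_⟩
  have hm : ∀ i : Fin s.card, (s.equivFin.symm i : ℕ) ∈ s := fun i => (s.equivFin.symm i).2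
  refine ⟨?_, ?_, ?_, ?_, ?_, ?_⟩
  · intro i j hij
    exact s.equivFin.symm.injective (Subtype.ext hij)
  · intro i; have := Finset.mem_filter.mp (hm i); exact this.2.1
  · intro i; have := Finset.mem_filter.mp (hm i); exact this.2.2
  · intro i; have := Finset.mem_filter.mp (hm i)
    by_contra hc
    exact hV _ this.2.1 (by omega) this.2.2
  · intro i; have := Finset.mem_filter.mp (hm i); rw [Finset.mem_range] at this; omega
  · intro q hq hR hc
    have : q ∈ s := by rw [hs, Finset.mem_filter, Finset.mem_range]; exact ⟨by omega, hq, hc⟩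
    exact ⟨s.equivFin ⟨q, this⟩, by simp⟩

section rv
variable {n : ℕ} {J : Type} [DecidableEq J] 

def rv (pp : Fin n → ℕ) (s : Fin n → Option J) (j : J) : ℕ := ∏ p, if s p = some j then pp p else 1

def nrm (pp : Fin n → ℕ) (s : Fin n → Option J) : ℕ := ∏ p, if s p = none then 1 else pp p

lemma prod_rv [Fintype J] (pp : Fin n → ℕ) (s : Fin n → Option J) : ∏ j, rv pp s j = nrm pp s := by
  unfold rv nrm
  rw [Finset.prod_comm]
  apply Finset.prod_congr rfl
  intro p _
  cases h : s p with
  | none => simp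
  | some i => simp

variable {V R D0 : ℕ} {pp : Fin n → ℕ}

lemma rv_pos (hP : PEnum V R D0 pp) (s : Fin n → Option J) (j : J) : 0 < rv pp s j := by
  apply Finset.prod_pos; intro p _; split_ifs
  · exact (hP.prime p).pos
  · exact one_pos

lemma nrm_pos (hP : PEnum V R D0 pp) (s : Fin n → Option J) : 0 < nrm pp s := by
  apply Finset.prod_pos; intro p _; split_ifs
  · exact one_pos
  · exact (hP.prime p).pos

lemma rv_cop (hP : PEnum V R D0 pp) (s : Fin n → Option J) (j : J) : Nat.Coprime (rv pp s j) V := by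
  apply Nat.Coprime.prod_left; intro p _; split_ifs
  · exact hP.cop p
  · exact Nat.coprime_one_left V

lemma rv_dvd (hP : PEnum V R D0 pp) (s : Fin n → Option J) (j : J) (p : Fin n) : pp p ∣ rv pp s j ↔ s p = some j := by
  unfold rv
  rw [Prime.dvd_finsetProd_iff (hP.prime p).prime]
  constructor
  · rintro ⟨q, _, hq⟩
    split_ifs at hq with h
    · rw [Nat.prime_dvd_prime_iff_eq (hP.prime p) (hP.prime q)] at hq
      rw [hP.inj hq]; exact h
    · exact absurd (Nat.dvd_one.mp hq) (hP.prime p).one_lt.ne'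
  · intro h
    exact ⟨p, Finset.mem_univ _, by rw [if_pos h]⟩

lemma rv_inj (hP : PEnum V R D0 pp) {s s' : Fin n → Option J} (h : ∀ j, rv pp s j = rv pp s' j) : s = s' := by
  funext p
  have : ∀ j, s p = some j ↔ s' p = some j := by
    intro j; rw [← rv_dvd hP, ← rv_dvd hP, h]
  cases h1 : s p with
  | none =>
    cases h2 : s' p with
    | none => rfl
    | some j => exact absurd ((this j).mpr h2) (by simp [h1])
  | some j => exact ((this j).mp h1).symm

lemma rv_le_nrm (hP : PEnum V R D0 pp) [Fintype J] (s : Fin n → Option J) (j : J) : rv pp s j ≤ nrm pp s := by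
  rw [← prod_rv]
  exact Nat.le_of_dvd (Finset.prod_pos fun j _ => rv_pos hP s j) (Finset.dvd_prod_of_mem _ (Finset.mem_univ j))

lemma states_le_tuples (hP : PEnum V R D0 pp) [Fintype J] (f : (J → ℕ) → ℝ) (hf : ∀ τ, 0 ≤ f τ) (hsupp : ∀ τ, (∀ j, 0 < τ j) → f τ ≠ 0 → ∀ j, τ j ≤ R) :
    ∑ s : Fin n → Option J, f (rv pp s) ≤ ∑ τ ∈ Fintype.piFinset (fun _ : J => SV V R), f τ := by
  classical
  rw [← Finset.sum_filter_of_ne (p := fun s => f (rv pp s) ≠ 0) (fun s _ h => h)]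
  rw [← Finset.sum_image (s := Finset.univ.filter (fun s : Fin n → Option J => f (rv pp s) ≠ 0)) (g := rv pp) (f := f)]
  · apply Finset.sum_le_sum_of_subset_of_nonneg
    · intro τ hτ
      rw [Finset.mem_image] at hτ
      obtain ⟨s, hs, rfl⟩ := hτ
      rw [Finset.mem_filter] at hs
      rw [Fintype.mem_piFinset]
      intro j
      rw [SV, Finset.mem_filter, Finset.mem_Icc]
      exact ⟨⟨rv_pos hP s j, hsupp _ (fun j => rv_pos hP s j) hs.2 j⟩, rv_cop hP s j⟩
    · intro τ _ _; exact hf τ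
  · intro s _ s' _ h
    exact rv_inj hP (fun j => congrFun h j)

lemma sum_inv_sq (hP : PEnum V R D0 pp) (hD : 0 < D0) : ∑ p, 1 / (pp p : ℝ) ^ 2 ≤ 1 / (D0:ℝ) := by
  have h1 : ∑ p, 1 / (pp p : ℝ) ^ 2 = ∑ q ∈ Finset.univ.image pp, 1 / (q : ℝ) ^ 2 := by
    rw [Finset.sum_image]; intro a _ b _ h; exact hP.inj h
  rw [h1]
  calc _ ≤ ∑ q ∈ Finset.Ioc D0 (max D0 R + 1), 1 / (q : ℝ) ^ 2 := by
        apply Finset.sum_le_sum_of_subset_of_nonneg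
        · intro q hq
          rw [Finset.mem_image] at hq
          obtain ⟨p, _, rfl⟩ := hq
          rw [Finset.mem_Ioc]
          have := hP.big p; have := hP.le p; omega
        · intro q _ _; positivity
    _ ≤ 1 / (D0:ℝ) := by
        have := sum_Ioc_inv_sq_le_sub (α := ℝ) hD.ne' (show D0 ≤ max D0 R + 1 by omega)
        simp only [one_div]
        have h2 : (0:ℝ) ≤ ((max D0 R + 1 : ℕ) : ℝ)⁻¹ := by positivity
        linarith

end rv
end
end

section
section
open Module nonZeroDivisors Ideal Pointwise Filter Topology

section
variable {n k : ℕ} {V R D0 : ℕ} {pp : Fin n → ℕ}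

/-- the coefficients `y_s` -/
noncomputable def yF (F : (Fin k → ℝ) → ℝ) (R : ℕ) (pp : Fin n → ℕ) (s : Fin n → Option (Fin k)) : ℝ :=
  F (fun i => Real.log (rv pp s i) / Real.log R)

lemma prod_delta {β : Type} [DecidableEq β] (ω s : Fin n → β) : (∏ p, (if ω p = s p then (1:ℝ) else 0)) = if ω = s then 1 else 0 := by
  split_ifs with h
  · subst h; simp
  · have : ∃ p, ω p ≠ s p := by by_contra hc; push Not at hc; exact h (funext hc)
    obtain ⟨p, hp⟩ := this
    exact Finset.prod_eq_zero (Finset.mem_univ p) (if_neg hp)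

lemma log_simplex (hR : 2 ≤ R) {F : (Fin k → ℝ) → ℝ} (hF : Function.support F ⊆ maynardSimplex k) (τ : Fin k → ℕ) (hτ : ∀ j, 0 < τ j)
    (h : F (fun i => Real.log (τ i) / Real.log R) ≠ 0) : ∏ j, τ j ≤ R := by
  have h1 := (hF h).2
  have hl : 0 < Real.log R := Real.log_pos (by exact_mod_cast hR)
  rw [← Finset.sum_div, div_le_one hl, ← Real.log_prod (fun i _ => by have := hτ i; positivity)] at h1
  have h2 := (Real.log_le_log_iff (Finset.prod_pos fun i _ => by have := hτ i; positivity) (by positivity)).mp h1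
  exact_mod_cast h2

lemma le_of_prod_le {J : Type} [Fintype J] {τ : J → ℕ} (hτ : ∀ j, 0 < τ j) (h : ∏ j, τ j ≤ R) (j : J) : τ j ≤ R :=
  (Nat.le_of_dvd (Finset.prod_pos fun j _ => hτ j) (Finset.dvd_prod_of_mem _ (Finset.mem_univ j))).trans h

lemma yF_nrm (hP : PEnum V R D0 pp) (hR : 2 ≤ R) {F : (Fin k → ℝ) → ℝ} (hF : Function.support F ⊆ maynardSimplex k) {s : Fin n → Option (Fin k)}
    (h : yF F R pp s ≠ 0) : nrm pp s ≤ R := by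
  rw [← prod_rv]
  exact log_simplex hR hF _ (fun j => rv_pos hP s j) h

noncomputable def Q1 (F : (Fin k → ℝ) → ℝ) (R : ℕ) (pp : Fin n → ℕ) : ℝ :=
  ∑ ω : Fin n → Option (Fin k), (∏ p, mu1 (pp p) (ω p)) * (∑ s : Fin n → Option (Fin k), (∏ p, SA (pp p) (ω p) (s p)) * yF F R pp s) ^ 2

noncomputable def Q2 (m : Fin k) (F : (Fin k → ℝ) → ℝ) (R : ℕ) (pp : Fin n → ℕ) : ℝ :=
  ∑ ω : Fin n → Option (Fin k), (∏ p, mu2 m (pp p) (ω p)) * (∑ s : Fin n → Option (Fin k), (∏ p, SA (pp p) (ω p) (s p)) * yF F R pp s) ^ 2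

lemma mu1_nonneg {p : ℝ} (hp : (k:ℝ) ≤ p) (hp0 : 0 < p) (ω : Option (Fin k)) : 0 ≤ mu1 p ω := by
  cases ω with
  | none => simp only [mu1]; rw [sub_nonneg, div_le_one hp0]; exact hp
  | some i => simp only [mu1]; positivity

theorem Q1_le (hP : PEnum V R D0 pp) (hk : 0 < k) (hD : k ≤ D0) (hR : 2 ≤ R) {F : (Fin k → ℝ) → ℝ} (hF : Function.support F ⊆ maynardSimplex k) :
    Q1 F R pp ≤ Real.exp (8 * k / D0) * ∑ τ ∈ Fintype.piFinset (fun _ : Fin k => SV V R), (∏ i, (1:ℝ) / (τ i : ℕ)) * F (fun i => Real.log (τ i : ℕ) / Real.log R) ^ 2 := by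
  have hD0 : 0 < D0 := by omega
  have hpk : ∀ p, (k:ℝ) ≤ pp p := fun p => by have := hP.big p; exact_mod_cast (by omega : k ≤ pp p)
  have hp2 : ∀ p, (2:ℝ) ≤ pp p := fun p => by exact_mod_cast (hP.prime p).two_le
  have hp0 : ∀ p, (0:ℝ) < pp p := fun p => by linarith [hp2 p]
  have hmu' : ∀ p (ω : Option (Fin k)), 0 ≤ (1 + 8 * k / (pp p : ℝ) ^ 2) * wt1 (pp p : ℝ) ω := by
    intro p ω
    apply mul_nonneg (by positivity)
    cases ω <;> simp only [wt1] <;> positivity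
  have h1 := tensor_mono n (fun p ω => mu1 (k := k) (pp p) ω) (fun p ω b => SA (pp p) ω b) (fun p ω => (1 + 8 * k / (pp p : ℝ) ^ 2) * wt1 (k := k) (pp p) ω)
    (fun p ω b => if ω = b then 1 else 0) (fun p ω => mu1_nonneg (hpk p) (hp0 p) ω) hmu' (fun p y => local1 hk (pp p) (hp2 p) y) (yF F R pp)
  refine (show Q1 F R pp ≤ _ from h1).trans ?_
  simp only [prod_delta, ite_mul, one_mul, zero_mul, Finset.sum_ite_eq, Finset.mem_univ, if_true, Finset.prod_mul_distrib]
  simp only [mul_assoc]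
  rw [← Finset.mul_sum]
  apply mul_le_mul
  · calc ∏ p, (1 + 8 * k / (pp p : ℝ) ^ 2) ≤ ∏ p, Real.exp (8 * k / (pp p : ℝ) ^ 2) := by
          apply Finset.prod_le_prod
          · intro p _; positivity
          · intro p _; rw [add_comm]; exact Real.add_one_le_exp _
      _ = Real.exp (8 * k * ∑ p, 1 / (pp p : ℝ) ^ 2) := by
          rw [← Real.exp_sum, Finset.mul_sum]; congr 2; funext p; ring
      _ ≤ _ := by
          apply Real.exp_le_exp.mpr
          rw [show (8:ℝ) * k / D0 = 8 * k * (1 / D0) by ring]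
          exact mul_le_mul_of_nonneg_left (sum_inv_sq hP hD0) (by positivity)
  · have := states_le_tuples hP (fun τ : Fin k → ℕ => (∏ i, (1:ℝ) / (τ i : ℕ)) * F (fun i => Real.log (τ i : ℕ) / Real.log R) ^ 2)
      (fun τ => by positivity) (by
        intro τ hτ h j
        apply le_of_prod_le hτ
        apply log_simplex hR hF τ hτ
        intro h0
        apply h
        simp only [h0]; simp)
    refine le_trans (le_of_eq ?_) this
    apply Finset.sum_congr rfl
    intro s _
    unfold yF
    congr 1
    rw [Finset.prod_div_distrib, Finset.prod_const_one, ← Nat.cast_prod, prod_rv, nrm]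
    push_cast
    rw [one_div, ← Finset.prod_inv_distrib]
    apply Finset.prod_congr rfl
    intro p _
    cases h : s p with
    | none => simp [wt1]
    | some i => simp [wt1]
  · apply Finset.sum_nonneg; intro s _
    apply mul_nonneg _ (sq_nonneg _)
    apply Finset.prod_nonneg; intro p _
    cases s p <;> simp only [wt1] <;> positivity
  · positivity

end
end
end

section
section
open Module nonZeroDivisors Ideal Pointwise Filter Topology

section
variable {n : ℕ} {J : Type} [DecidableEq J] [Fintype J] {V R D0 : ℕ} {pp : Fin n → ℕ}

noncomputable def mass (V R : ℕ) : ℝ := ∑ d ∈ SV V R, (1:ℝ) / d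

lemma mass_nonneg : 0 ≤ mass V R := Finset.sum_nonneg fun d _ => by positivity

lemma mass_dvd (q : ℕ) (hq : 0 < q) : ∑ d ∈ SV V R, (1:ℝ) / d * (if q ∣ d then 1 else 0) ≤ mass V R * (1 / q) := by
  classical
  simp only [mul_ite, mul_one, mul_zero]
  rw [← Finset.sum_filter, mass, Finset.sum_mul]
  have h1 : ∀ d ∈ (SV V R).filter (fun d => q ∣ d), (1:ℝ) / d = 1 / ((d / q : ℕ) : ℝ) * (1 / q) := by
    intro d hd
    obtain ⟨e, rfl⟩ := (Finset.mem_filter.mp hd).2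
    rw [Nat.mul_div_cancel_left _ hq]; push_cast; rw [one_div_mul_one_div, mul_comm]
  rw [Finset.sum_congr rfl h1]
  rw [← Finset.sum_image (s := (SV V R).filter (fun d => q ∣ d)) (g := fun d => d / q) (f := fun e : ℕ => (1:ℝ) / (e : ℝ) * (1 / q))]
  · apply Finset.sum_le_sum_of_subset_of_nonneg
    · intro e he
      rw [Finset.mem_image] at he
      obtain ⟨d, hd, rfl⟩ := he
      rw [Finset.mem_filter] at hd
      obtain ⟨hd, e, rfl⟩ := hd
      rw [Nat.mul_div_cancel_left _ hq]
      rw [SV, Finset.mem_filter, Finset.mem_Icc] at hd ⊢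
      refine ⟨⟨Nat.pos_of_ne_zero (by rintro rfl; simp at hd), ?_⟩, Nat.Coprime.coprime_mul_left hd.2⟩
      exact (Nat.le_mul_of_pos_left e hq).trans hd.1.2
    · intro e _ _; positivity
  · intro a ha b hb hab
    obtain ⟨e, rfl⟩ := (Finset.mem_filter.mp ha).2
    obtain ⟨f, rfl⟩ := (Finset.mem_filter.mp hb).2
    simp only [Nat.mul_div_cancel_left _ hq] at hab
    rw [hab]

open Classical in
noncomputable def dvdInd (q τ : J → ℕ) : ℝ := if ∀ j, q j ∣ τ j then 1 else 0

lemma dvdInd_nonneg (q τ : J → ℕ) : 0 ≤ dvdInd q τ := by unfold dvdInd; split_ifs <;> norm_num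

lemma tdvd (q : J → ℕ) (hq : ∀ j, 0 < q j) :
    ∑ τ ∈ Fintype.piFinset (fun _ : J => SV V R), (∏ j, (1:ℝ) / (τ j : ℕ)) * dvdInd q τ ≤
      mass V R ^ Fintype.card J * ∏ j, (1:ℝ) / q j := by
  have h1 : ∀ τ : J → ℕ, (∏ j, (1:ℝ) / (τ j : ℕ)) * dvdInd q τ = ∏ j, ((1:ℝ) / (τ j : ℕ) * (if q j ∣ τ j then 1 else 0)) := by
    intro τ
    rw [Finset.prod_mul_distrib]
    congr 1
    unfold dvdInd
    split_ifs with h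
    · rw [Finset.prod_eq_one]; intro j _; rw [if_pos (h j)]
    · push Not at h
      obtain ⟨j, hj⟩ := h
      exact (Finset.prod_eq_zero (Finset.mem_univ j) (if_neg hj)).symm
  simp only [h1]
  rw [← Finset.prod_univ_sum (fun _ : J => SV V R) (fun j d => (1:ℝ) / (d : ℕ) * (if q j ∣ d then 1 else 0))]
  calc _ ≤ ∏ j : J, (mass V R * (1 / (q j : ℝ))) := by
        apply Finset.prod_le_prod
        · intro j _; apply Finset.sum_nonneg; intro d _; positivity
        · intro j _; exact mass_dvd (q j) (hq j)
    _ = _ := by rw [Finset.prod_mul_distrib, Finset.prod_const, Finset.card_univ]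

noncomputable def eP (κ : ℝ) (p : ℕ) (τ : J → ℕ) : ℝ :=
  (∑ x, ∑ y, dvdInd (Pi.mulSingle x p * Pi.mulSingle y p) τ) +
    κ / p * ∑ x, dvdInd (Pi.mulSingle x p) τ

lemma eP_nonneg {κ : ℝ} (hκ : 0 ≤ κ) (p : ℕ) (τ : J → ℕ) : 0 ≤ eP κ p τ := by
  have h1 : 0 ≤ ∑ x, ∑ y, dvdInd (Pi.mulSingle x p * Pi.mulSingle y p) τ := Finset.sum_nonneg fun x _ => Finset.sum_nonneg fun y _ => dvdInd_nonneg _ _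
  have h2 : 0 ≤ ∑ x, dvdInd (Pi.mulSingle x p) τ := Finset.sum_nonneg fun x _ => dvdInd_nonneg _ _
  unfold eP; positivity

lemma eP_sum {κ : ℝ} (hκ : 0 ≤ κ) (p : ℕ) (hp : 0 < p) :
    ∑ τ ∈ Fintype.piFinset (fun _ : J => SV V R), (∏ j, (1:ℝ) / (τ j : ℕ)) * eP κ p τ ≤
      mass V R ^ Fintype.card J * ((Fintype.card J ^ 2 + κ * Fintype.card J) * (1 / (p:ℝ) ^ 2)) := by
  have hs : ∀ x j, 0 < (Pi.mulSingle x p : J → ℕ) j := by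
    intro x j; rw [Pi.mulSingle_apply]; split_ifs <;> omega
  have hpr : ∀ x, ∏ j, (1:ℝ) / ((Pi.mulSingle x p : J → ℕ) j : ℕ) = 1 / p := by
    intro x
    rw [Finset.prod_div_distrib, Finset.prod_const_one, ← Nat.cast_prod]
    congr 2
    simp [Pi.mulSingle_apply]
  have e1 : ∑ τ ∈ Fintype.piFinset (fun _ : J => SV V R), (∏ j, (1:ℝ) / (τ j : ℕ)) * eP κ p τ =
      (∑ x, ∑ y, ∑ τ ∈ Fintype.piFinset (fun _ : J => SV V R), (∏ j, (1:ℝ) / (τ j : ℕ)) * dvdInd (Pi.mulSingle x p * Pi.mulSingle y p) τ) +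
      κ / p * ∑ x, ∑ τ ∈ Fintype.piFinset (fun _ : J => SV V R), (∏ j, (1:ℝ) / (τ j : ℕ)) * dvdInd (Pi.mulSingle x p) τ := by
    unfold eP
    simp only [mul_add, Finset.sum_add_distrib]
    congr 1
    · simp only [Finset.mul_sum]
      rw [Finset.sum_comm]
      apply Finset.sum_congr rfl; intro x _
      rw [Finset.sum_comm]
    · simp only [Finset.mul_sum]
      rw [Finset.sum_comm]
      apply Finset.sum_congr rfl; intro x _
      apply Finset.sum_congr rfl; intro τ _
      ring
  rw [e1]
  have b1 : ∀ x y, ∑ τ ∈ Fintype.piFinset (fun _ : J => SV V R), (∏ j, (1:ℝ) / (τ j : ℕ)) * dvdInd (Pi.mulSingle x p * Pi.mulSingle y p) τ ≤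
      mass V R ^ Fintype.card J * (1 / (p:ℝ) ^ 2) := by
    intro x y
    have hq : ∀ j, 0 < (Pi.mulSingle x p * Pi.mulSingle y p : J → ℕ) j := by
      intro j; rw [Pi.mul_apply]; exact Nat.mul_pos (hs x j) (hs y j)
    refine (tdvd (V := V) (R := R) _ hq).trans (le_of_eq ?_)
    congr 1
    simp only [Pi.mul_apply, Nat.cast_mul, ← one_div_mul_one_div]
    rw [Finset.prod_mul_distrib, hpr, hpr]; ring
  have b2 : ∀ x, ∑ τ ∈ Fintype.piFinset (fun _ : J => SV V R), (∏ j, (1:ℝ) / (τ j : ℕ)) * dvdInd (Pi.mulSingle x p) τ ≤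
      mass V R ^ Fintype.card J * (1 / (p:ℝ)) := by
    intro x
    refine (tdvd (V := V) (R := R) (Pi.mulSingle x p : J → ℕ) (fun j => hs x j)).trans (le_of_eq ?_)
    rw [hpr]
  calc _ ≤ (∑ x : J, ∑ y : J, mass V R ^ Fintype.card J * (1 / (p:ℝ) ^ 2)) + κ / p * ∑ x : J, mass V R ^ Fintype.card J * (1 / (p:ℝ)) := by
        apply add_le_add
        · exact Finset.sum_le_sum fun x _ => Finset.sum_le_sum fun y _ => b1 x y
        · exact mul_le_mul_of_nonneg_left (Finset.sum_le_sum fun x _ => b2 x) (by positivity)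
    _ = _ := by
        simp only [Finset.sum_const, Finset.card_univ, nsmul_eq_mul]
        have : (p:ℝ) ≠ 0 := by positivity
        field_simp

lemma exists_state (hP : PEnum V R D0 pp) (τ : J → ℕ) (hτ : τ ∈ Fintype.piFinset (fun _ : J => SV V R))
    (h : ∀ p x y, ¬ (∀ j, (Pi.mulSingle x (pp p) * Pi.mulSingle y (pp p) : J → ℕ) j ∣ τ j)) : ∃ u : Fin n → Option J, rv pp u = τ := by
  classical
  rw [Fintype.mem_piFinset] at hτ
  simp only [SV, Finset.mem_filter, Finset.mem_Icc] at hτ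
  -- uniqueness of the coordinate
  have huniq : ∀ p x y, pp p ∣ τ x → pp p ∣ τ y → x = y := by
    intro p x y hx hy
    by_contra hne
    apply h p x y
    intro j
    simp only [Pi.mul_apply, Pi.mulSingle_apply]
    by_cases h1 : j = x
    · subst h1
      rw [if_pos rfl, if_neg hne, mul_one]; exact hx
    · rw [if_neg h1, one_mul]
      split_ifs with h2
      · subst h2; exact hy
      · exact one_dvd _
  have hsq : ∀ x, Squarefree (τ x) := by
    intro x
    rw [Nat.squarefree_iff_prime_squarefree]
    intro q hq hd
    obtain ⟨p, rfl⟩ := hP.all q hq ((Nat.le_of_dvd (hτ x).1.1 ((dvd_mul_right _ _).trans hd)).trans (hτ x).1.2)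
      (Nat.Coprime.coprime_dvd_left ((dvd_mul_right _ _).trans hd) (hτ x).2)
    apply h p x x
    intro j
    simp only [Pi.mul_apply, Pi.mulSingle_apply]
    split_ifs with h1
    · subst h1; exact hd
    · simp
  let u : Fin n → Option J := fun p => if hx : ∃ x, pp p ∣ τ x then some hx.choose else none
  have hu : ∀ p x, u p = some x ↔ pp p ∣ τ x := by
    intro p x
    simp only [u]
    by_cases hx : ∃ x, pp p ∣ τ x
    · rw [dif_pos hx]
      constructor
      · intro h; rw [← Option.some.inj h]; exact hx.choose_spec
      · intro h; rw [huniq p _ _ hx.choose_spec h]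
    · rw [dif_neg hx]
      constructor
      · intro h; simp at h
      · intro h; exact absurd ⟨x, h⟩ hx
  refine ⟨u, funext fun x => ?_⟩
  have himg : (τ x).primeFactors = (Finset.univ.filter (fun p => u p = some x)).image pp := by
    ext q
    rw [Finset.mem_image, Nat.mem_primeFactors]
    constructor
    · rintro ⟨hq, hd, _⟩
      obtain ⟨p, rfl⟩ := hP.all q hq ((Nat.le_of_dvd (hτ x).1.1 hd).trans (hτ x).1.2) (Nat.Coprime.coprime_dvd_left hd (hτ x).2)
      exact ⟨p, by rw [Finset.mem_filter]; exact ⟨Finset.mem_univ _, (hu p x).mpr hd⟩, rfl⟩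
    · rintro ⟨p, hp, rfl⟩
      exact ⟨hP.prime p, (hu p x).mp (Finset.mem_filter.mp hp).2, (Nat.pos_iff_ne_zero.mp (hτ x).1.1)⟩
  rw [← Nat.prod_primeFactors_of_squarefree (hsq x), himg, Finset.prod_image (fun a _ b _ h => hP.inj h), Finset.prod_filter]
  rfl

end
end
end

section
section
open Module nonZeroDivisors Ideal Pointwise Filter Topology

section
variable {n : ℕ} {J : Type} [DecidableEq J] [Fintype J] {V R D0 : ℕ} {pp : Fin n → ℕ}

lemma one_sub_sum_le {α : Type} (s : Finset α) (x : α → ℝ) (h0 : ∀ a, 0 ≤ x a) (h1 : ∀ a, x a ≤ 1) : 1 - ∑ a ∈ s, x a ≤ ∏ a ∈ s, (1 - x a) := by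
  classical
  induction s using Finset.induction_on with
  | empty => simp
  | insert a s ha ih =>
    rw [Finset.sum_insert ha, Finset.prod_insert ha]
    have h3 : ∏ a ∈ s, (1 - x a) ≤ 1 := Finset.prod_le_one (fun a _ => by linarith [h1 a]) (fun a _ => by linarith [h0 a])
    nlinarith [h0 a, h1 a]

noncomputable def uwt (κ : ℝ) (pp : Fin n → ℕ) (u : Fin n → Option J) : ℝ := ∏ p, if u p = none then (1:ℝ) else 1 / pp p * (1 - κ / pp p)

lemma uwt_nonneg {κ : ℝ} (h : ∀ p, κ ≤ pp p) (u : Fin n → Option J) : 0 ≤ uwt κ pp u := by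
  apply Finset.prod_nonneg; intro p _; split_ifs
  · norm_num
  · apply mul_nonneg (by positivity)
    rw [sub_nonneg]; exact div_le_one_of_le₀ (h p) (by positivity)

lemma uwt_ge (hP : PEnum V R D0 pp) {κ : ℝ} (hκ : 0 ≤ κ) (h : ∀ p, κ ≤ pp p) (u : Fin n → Option J) :
    (∏ j, (1:ℝ) / (rv pp u j : ℕ)) * (1 - ∑ p, eP κ (pp p) (rv pp u)) ≤ uwt κ pp u := by
  have hp0 : ∀ p, (0:ℝ) < pp p := fun p => by exact_mod_cast (hP.prime p).pos
  have e1 : uwt κ pp u = (∏ j, (1:ℝ) / (rv pp u j : ℕ)) * ∏ p, (1 - (if u p = none then 0 else κ / pp p)) := by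
    rw [Finset.prod_div_distrib, Finset.prod_const_one, ← Nat.cast_prod, prod_rv, nrm]
    push_cast
    rw [one_div, ← Finset.prod_inv_distrib, ← Finset.prod_mul_distrib]
    unfold uwt
    apply Finset.prod_congr rfl
    intro p _
    split_ifs <;> simp
  rw [e1]
  apply mul_le_mul_of_nonneg_left _ (by positivity)
  refine le_trans ?_ (one_sub_sum_le _ _ ?_ ?_)
  · apply sub_le_sub_left
    apply Finset.sum_le_sum
    intro p _
    split_ifs with hu
    · exact eP_nonneg hκ _ _
    · obtain ⟨x, hx⟩ := Option.ne_none_iff_exists'.mp hu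
      unfold eP
      have h1 : (1:ℝ) ≤ ∑ x, dvdInd (Pi.mulSingle x (pp p)) (rv pp u) := by
        refine le_trans (le_of_eq ?_) (Finset.single_le_sum (f := fun x => dvdInd (Pi.mulSingle x (pp p)) (rv pp u)) (fun x _ => dvdInd_nonneg _ _) (Finset.mem_univ x))
        simp only [dvdInd]
        rw [if_pos]
        intro j
        rw [Pi.mulSingle_apply]
        split_ifs with hj
        · subst hj; rw [rv_dvd hP]; exact hx
        · exact one_dvd _
      have h2 : 0 ≤ ∑ x, ∑ y, dvdInd (Pi.mulSingle x (pp p) * Pi.mulSingle y (pp p)) (rv pp u) := Finset.sum_nonneg fun x _ => Finset.sum_nonneg fun y _ => dvdInd_nonneg _ _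
      have h3 : 0 ≤ κ / pp p := by positivity
      nlinarith
  · intro p; split_ifs
    · exact le_refl _
    · exact div_nonneg hκ (hp0 p).le
  · intro p; split_ifs
    · norm_num
    · exact div_le_one_of_le₀ (h p) (hp0 p).le

theorem good_tuples (hP : PEnum V R D0 pp) (hD : 0 < D0) {κ : ℝ} (hκ : 0 ≤ κ) (h : ∀ p, κ ≤ pp p) (H : (J → ℕ) → ℝ) (B : ℝ)
    (H0 : ∀ τ, 0 ≤ H τ) (HB : ∀ τ, H τ ≤ B) :
    ∑ τ ∈ Fintype.piFinset (fun _ : J => SV V R), (∏ j, (1:ℝ) / (τ j : ℕ)) * H τ ≤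
      (∑ u ∈ (Finset.univ : Finset (Fin n → Option J)).filter (fun u => ∀ j, rv pp u j ≤ R), uwt κ pp u * H (rv pp u)) +
      B * (mass V R ^ Fintype.card J * ((Fintype.card J ^ 2 + κ * Fintype.card J) / D0)) := by
  classical
  have hB : 0 ≤ B := (H0 0).trans (HB 0)
  set S := Fintype.piFinset (fun _ : J => SV V R) with hS
  have hmem : ∀ u : Fin n → Option J, (∀ j, rv pp u j ≤ R) ↔ rv pp u ∈ S := by
    intro u
    rw [hS, Fintype.mem_piFinset]
    apply forall_congr'; intro j
    rw [SV, Finset.mem_filter, Finset.mem_Icc]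
    exact ⟨fun h => ⟨⟨rv_pos hP u j, h⟩, rv_cop hP u j⟩, fun h => h.1.2⟩
  rw [← Finset.sum_fiberwise_of_maps_to (s := (Finset.univ : Finset (Fin n → Option J)).filter (fun u => ∀ j, rv pp u j ≤ R)) (t := S) (g := rv pp)
    (fun u hu => (hmem u).mp (Finset.mem_filter.mp hu).2)]
  have herr : ∑ τ ∈ S, (∏ j, (1:ℝ) / (τ j : ℕ)) * (B * ∑ p, eP κ (pp p) τ) ≤ B * (mass V R ^ Fintype.card J * ((Fintype.card J ^ 2 + κ * Fintype.card J) / D0)) := by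
    have e : ∑ τ ∈ S, (∏ j, (1:ℝ) / (τ j : ℕ)) * (B * ∑ p, eP κ (pp p) τ) = B * ∑ p, ∑ τ ∈ S, (∏ j, (1:ℝ) / (τ j : ℕ)) * eP κ (pp p) τ := by
      rw [Finset.sum_comm, Finset.mul_sum]
      apply Finset.sum_congr rfl; intro τ _
      rw [← Finset.mul_sum]; ring
    rw [e]
    apply mul_le_mul_of_nonneg_left _ hB
    calc _ ≤ ∑ p, mass V R ^ Fintype.card J * ((Fintype.card J ^ 2 + κ * Fintype.card J) * (1 / (pp p:ℝ) ^ 2)) :=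
          Finset.sum_le_sum fun p _ => eP_sum hκ (pp p) (hP.prime p).pos
      _ = mass V R ^ Fintype.card J * ((Fintype.card J ^ 2 + κ * Fintype.card J) * ∑ p, (1 / (pp p:ℝ) ^ 2)) := by
          rw [← Finset.mul_sum, ← Finset.mul_sum]
      _ ≤ mass V R ^ Fintype.card J * ((Fintype.card J ^ 2 + κ * Fintype.card J) * (1 / (D0:ℝ))) := by
          apply mul_le_mul_of_nonneg_left _ (pow_nonneg mass_nonneg _)
          exact mul_le_mul_of_nonneg_left (sum_inv_sq hP hD) (by positivity)
      _ = _ := by ring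
  refine le_trans ?_ (add_le_add_right herr _)
  rw [← Finset.sum_add_distrib]
  apply Finset.sum_le_sum
  intro τ hτ
  have hE : 0 ≤ ∑ p, eP κ (pp p) τ := Finset.sum_nonneg fun p _ => eP_nonneg hκ _ _
  have hw : 0 ≤ ∏ j, (1:ℝ) / (τ j : ℕ) := by positivity
  have hfib : 0 ≤ ∑ u ∈ ((Finset.univ : Finset (Fin n → Option J)).filter (fun u => ∀ j, rv pp u j ≤ R)).filter (fun u => rv pp u = τ), uwt κ pp u * H (rv pp u) :=
    Finset.sum_nonneg fun u _ => mul_nonneg (uwt_nonneg h u) (H0 _)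
  by_cases hg : ∃ u : Fin n → Option J, rv pp u = τ
  · obtain ⟨u, rfl⟩ := hg
    have h1 : uwt κ pp u * H (rv pp u) ≤ ∑ u' ∈ ((Finset.univ : Finset (Fin n → Option J)).filter (fun u => ∀ j, rv pp u j ≤ R)).filter (fun u' => rv pp u' = rv pp u), uwt κ pp u' * H (rv pp u') := by
      apply Finset.single_le_sum (f := fun u => uwt κ pp u * H (rv pp u)) (fun u _ => mul_nonneg (uwt_nonneg h u) (H0 _))
      rw [Finset.mem_filter, Finset.mem_filter]
      exact ⟨⟨Finset.mem_univ _, (hmem u).mpr hτ⟩, rfl⟩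
    refine le_trans ?_ (add_le_add_left h1 _)
    have h2 := mul_le_mul_of_nonneg_right (uwt_ge hP hκ h u) (H0 (rv pp u))
    have h3 := mul_le_mul_of_nonneg_left (mul_le_mul_of_nonneg_right (HB (rv pp u)) hE) hw
    nlinarith
  · have h1 : ¬ ∀ p x y, ¬ (∀ j, (Pi.mulSingle x (pp p) * Pi.mulSingle y (pp p) : J → ℕ) j ∣ τ j) := fun hc => hg (exists_state hP τ hτ hc)
    push Not at h1
    obtain ⟨p, x, y, hxy⟩ := h1
    have h2 : 1 ≤ ∑ p, eP κ (pp p) τ := by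
      refine le_trans ?_ (Finset.single_le_sum (f := fun p => eP κ (pp p) τ) (fun p _ => eP_nonneg hκ _ _) (Finset.mem_univ p))
      simp only [eP]
      have h3 : 0 ≤ κ / pp p * ∑ x, dvdInd (Pi.mulSingle x (pp p)) τ := mul_nonneg (by positivity) (Finset.sum_nonneg fun x _ => dvdInd_nonneg _ _)
      have h4 : 1 ≤ ∑ x, ∑ y, dvdInd (Pi.mulSingle x (pp p) * Pi.mulSingle y (pp p)) τ := by
        refine le_trans ?_ (Finset.single_le_sum (fun x _ => Finset.sum_nonneg fun y _ => dvdInd_nonneg _ _) (Finset.mem_univ x))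
        refine le_trans (le_of_eq ?_) (Finset.single_le_sum (fun y _ => dvdInd_nonneg _ _) (Finset.mem_univ y))
        simp only [dvdInd]
        rw [if_pos hxy]
      linarith
    have h5 : H τ ≤ B * ∑ p, eP κ (pp p) τ := by nlinarith [HB τ]
    have := mul_le_mul_of_nonneg_left h5 hw
    linarith

end
end
end

section
section
open Module nonZeroDivisors Ideal Pointwise Filter Topology

section
variable {n k : ℕ} {V R D0 : ℕ} {pp : Fin n → ℕ}

def toW (m : Fin k) : Option (Fin k ⊕ Bool) → Option (Fin k)
  | none => none
  | some (Sum.inl i) => if i = m then none else some i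
  | some (Sum.inr _) => none

def toS (m : Fin k) (b : Bool) : Option (Fin k ⊕ Bool) → Option (Fin k)
  | none => none
  | some (Sum.inl i) => if i = m then none else some i
  | some (Sum.inr b') => if b' = b then some m else none

lemma toS_eq (m : Fin k) (b : Bool) (x : Option (Fin k ⊕ Bool)) (i : Fin k) : toS m b x = some i ↔ x = (if i = m then some (Sum.inr b) else some (Sum.inl i)) := by
  by_cases him : i = m
  · subst him
    rw [if_pos rfl]
    rcases x with _ | (j | b') <;> simp [toS]
  · rw [if_neg him]
    rcases x with _ | (j | b')
    · simp [toS]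
    · simp only [toS, Option.some.injEq, Sum.inl.injEq]
      split_ifs with h
      · subst h; simp [Ne.symm him]
      · simp
    · simp only [toS]
      split_ifs <;> simp [Ne.symm him]

noncomputable def updC (m : Fin k) (b : Bool) (τ : Fin k ⊕ Bool → ℕ) : Fin k → ℕ := Function.update (fun i => τ (Sum.inl i)) m (τ (Sum.inr b))

noncomputable def HmF (m : Fin k) (F : (Fin k → ℝ) → ℝ) (R : ℕ) (τ : Fin k ⊕ Bool → ℕ) : ℝ :=
  F (fun i => Real.log (updC m true τ i) / Real.log R) * F (fun i => Real.log (updC m false τ i) / Real.log R)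

lemma rv_toS (m : Fin k) (b : Bool) (u : Fin n → Option (Fin k ⊕ Bool)) : rv pp (fun p => toS m b (u p)) = updC m b (rv pp u) := by
  funext i
  unfold updC
  by_cases him : i = m
  · subst him
    rw [Function.update_self]
    unfold rv
    simp only [toS_eq, if_true]
  · rw [Function.update_of_ne him]
    unfold rv
    simp only [toS_eq, if_neg him]

lemma toInj (m : Fin k) (x x' : Option (Fin k ⊕ Bool)) (h0 : x = some (Sum.inl m) ↔ x' = some (Sum.inl m))
    (ht : toS m true x = toS m true x') (hf : toS m false x = toS m false x') : x = x' := by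
  have key : ∀ b i, x = (if i = m then some (Sum.inr b) else some (Sum.inl i)) ↔ x' = (if i = m then some (Sum.inr b) else some (Sum.inl i)) := by
    intro b i
    cases b
    · rw [← toS_eq, ← toS_eq, hf]
    · rw [← toS_eq, ← toS_eq, ht]
  have key2 : ∀ y, x = some y ↔ x' = some y := by
    intro y
    rcases y with i | b
    · by_cases him : i = m
      · subst him; exact h0
      · have := key true i; rwa [if_neg him] at this
    · have := key b m; rwa [if_pos rfl] at this
  cases x with
  | none =>
    cases x' with
    | none => rfl
    | some y => exact absurd ((key2 y).mpr rfl) (by simp)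
  | some y => exact ((key2 y).mp rfl).symm

noncomputable def Q2low (m : Fin k) (F : (Fin k → ℝ) → ℝ) (R : ℕ) (pp : Fin n → ℕ) : ℝ :=
  ∑ ω : Fin n → Option (Fin k), (∏ p, wt2 m (pp p) (ω p)) * (∑ s : Fin n → Option (Fin k), (∏ p, SB m (pp p) (ω p) (s p)) * yF F R pp s) ^ 2

lemma wt2_nonneg (m : Fin k) {p : ℝ} (hp : (k:ℝ) ≤ p) (hp0 : 0 < p) (ω : Option (Fin k)) : 0 ≤ wt2 m p ω := by
  cases ω with
  | none => simp [wt2]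
  | some i =>
    simp only [wt2]; split_ifs
    · exact le_refl _
    · apply mul_nonneg (by positivity); rw [sub_nonneg, div_le_one hp0]; exact hp

lemma mu2_nonneg (m : Fin k) {p : ℝ} (hp : (k:ℝ) ≤ p) (hp0 : 1 < p) (ω : Option (Fin k)) : 0 ≤ mu2 m p ω := by
  cases ω with
  | none => simp only [mu2]; rw [sub_nonneg, div_le_one (by linarith)]; linarith
  | some i =>
    simp only [mu2]; split_ifs
    · exact le_refl _
    · have : 0 < p - 1 := by linarith
      positivity

lemma SB_nonneg (m : Fin k) {p : ℝ} (hp0 : 1 < p) (ω s : Option (Fin k)) : 0 ≤ SB m p ω s := by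
  have : 0 < p - 1 := by linarith
  cases ω with
  | none => cases s with
    | none => simp [SB]
    | some j => simp only [SB]; split_ifs <;> positivity
  | some i => simp only [SB]; split_ifs <;> norm_num

lemma Q2_ge_low (hP : PEnum V R D0 pp) (m : Fin k) (hD : k ≤ D0) (F : (Fin k → ℝ) → ℝ) : Q2low m F R pp ≤ Q2 m F R pp := by
  have hpk : ∀ p, (k:ℝ) + 1 ≤ pp p := fun p => by have := hP.big p; exact_mod_cast (by omega : k + 1 ≤ pp p)
  have hp2 : ∀ p, (2:ℝ) ≤ pp p := fun p => by exact_mod_cast (hP.prime p).two_le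
  exact tensor_mono n (fun p ω => wt2 m (pp p) ω) (fun p ω b => SB m (pp p) ω b) (fun p ω => mu2 m (pp p) ω)
    (fun p ω b => SA (pp p) ω b) (fun p ω => wt2_nonneg m (by linarith [hpk p]) (by linarith [hp2 p]) ω)
    (fun p ω => mu2_nonneg m (by linarith [hpk p]) (by linarith [hp2 p]) ω) (fun p y => local2 m (pp p) (hpk p) y) (yF F R pp)

lemma Q2low_ge (hP : PEnum V R D0 pp) (m : Fin k) (hD : k ≤ D0) (F : (Fin k → ℝ) → ℝ) (hF0 : ∀ t, 0 ≤ F t) :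
    ∑ u ∈ (Finset.univ : Finset (Fin n → Option (Fin k ⊕ Bool))).filter (fun u => ∀ j, rv pp u j ≤ R), uwt k pp u * HmF m F R (rv pp u) ≤ mass V R * Q2low m F R pp := by
  classical
  have hpk : ∀ p, (k:ℝ) + 1 ≤ pp p := fun p => by have := hP.big p; exact_mod_cast (by omega : k + 1 ≤ pp p)
  have hp2 : ∀ p, (2:ℝ) ≤ pp p := fun p => by exact_mod_cast (hP.prime p).two_le
  let f : ℕ × (Fin n → Option (Fin k)) × (Fin n → Option (Fin k)) × (Fin n → Option (Fin k)) → ℝ := fun x =>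
    (1:ℝ) / x.1 * ((∏ p, wt2 m (pp p) (x.2.1 p)) * (((∏ p, SB m (pp p) (x.2.1 p) (x.2.2.1 p)) * yF F R pp x.2.2.1) * ((∏ p, SB m (pp p) (x.2.1 p) (x.2.2.2 p)) * yF F R pp x.2.2.2)))
  have hfn : ∀ x, 0 ≤ f x := by
    intro x
    have h1 : 0 ≤ ∏ p, wt2 m (pp p) (x.2.1 p) := Finset.prod_nonneg fun p _ => wt2_nonneg m (by linarith [hpk p]) (by linarith [hp2 p]) _
    have h2 : ∀ ω s : Fin n → Option (Fin k), 0 ≤ (∏ p, SB m (pp p) (ω p) (s p)) * yF F R pp s := fun ω s =>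
      mul_nonneg (Finset.prod_nonneg fun p _ => SB_nonneg m (by linarith [hp2 p]) _ _) (hF0 _)
    exact mul_nonneg (by positivity) (mul_nonneg h1 (mul_nonneg (h2 _ _) (h2 _ _)))
  have hR : mass V R * Q2low m F R pp = ∑ x ∈ SV V R ×ˢ (Finset.univ : Finset ((Fin n → Option (Fin k)) × (Fin n → Option (Fin k)) × (Fin n → Option (Fin k)))), f x := by
    rw [Finset.sum_product, mass, Finset.sum_mul]
    apply Finset.sum_congr rfl; intro d _
    simp only [f]
    rw [← Finset.mul_sum]
    congr 1
    rw [Q2low, Fintype.sum_prod_type]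
    apply Finset.sum_congr rfl; intro ω _
    simp only []
    rw [← Finset.mul_sum, Fintype.sum_prod_type]
    congr 1
    rw [sq, Finset.sum_mul_sum]
  rw [hR]
  let e : (Fin n → Option (Fin k ⊕ Bool)) → ℕ × (Fin n → Option (Fin k)) × (Fin n → Option (Fin k)) × (Fin n → Option (Fin k)) := fun u =>
    (rv pp u (Sum.inl m), fun p => toW m (u p), fun p => toS m true (u p), fun p => toS m false (u p))
  have hinj : ∀ u u', e u = e u' → u = u' := by
    intro u u' huu
    simp only [e, Prod.mk.injEq] at huu
    funext p
    apply toInj m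
    · rw [← rv_dvd hP, ← rv_dvd hP, huu.1]
    · exact congrFun huu.2.2.1 p
    · exact congrFun huu.2.2.2 p
  calc _ ≤ ∑ u ∈ (Finset.univ : Finset (Fin n → Option (Fin k ⊕ Bool))).filter (fun u => ∀ j, rv pp u j ≤ R), f (e u) := by
        apply Finset.sum_le_sum
        intro u _
        simp only [f, e]
        have hy : ∀ b, yF F R pp (fun p => toS m b (u p)) = F (fun i => Real.log (updC m b (rv pp u) i) / Real.log R) := by
          intro b; unfold yF; rw [rv_toS]
        rw [hy, hy]
        have e2 : uwt (k:ℝ) pp u ≤ (1:ℝ) / (rv pp u (Sum.inl m) : ℕ) * ((∏ p, wt2 m (pp p) (toW m (u p))) * ((∏ p, SB m (pp p) (toW m (u p)) (toS m true (u p))) * (∏ p, SB m (pp p) (toW m (u p)) (toS m false (u p))))) := by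
          rw [rv]; push_cast
          rw [one_div, ← Finset.prod_inv_distrib, ← Finset.prod_mul_distrib, ← Finset.prod_mul_distrib, ← Finset.prod_mul_distrib, uwt]
          apply Finset.prod_le_prod
          · intro p _; split_ifs
            · norm_num
            · apply mul_nonneg (by positivity)
              rw [sub_nonneg]; exact div_le_one_of_le₀ (by linarith [hpk p]) (by positivity)
          · intro p _
            have hq0 : (0:ℝ) < pp p := by linarith [hp2 p]
            have hq1 : (0:ℝ) < (pp p:ℝ) - 1 := by linarith [hp2 p]
            have hA : 1 / (pp p:ℝ) * (1 - k / pp p) ≤ (pp p:ℝ)⁻¹ := by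
              rw [one_div]
              have : (0:ℝ) ≤ k / pp p := by positivity
              have h2 : (0:ℝ) < (pp p:ℝ)⁻¹ := by positivity
              nlinarith
            have hB : (pp p:ℝ)⁻¹ ≤ 1 / ((pp p:ℝ) - 1) := by
              rw [← one_div]; apply one_div_le_one_div_of_le hq1; linarith
            rcases u p with _ | (i | b)
            · simp [toW, toS, wt2, SB]
            · by_cases him : i = m
              · subst him
                simp only [toW, toS, wt2, SB, if_true, mul_one]
                simpa using hA
              · simp [toW, toS, wt2, SB, him]
            · cases b
              · simp only [toW, toS, wt2, SB, if_true]
                simpa using hA.trans hB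
              · simp only [toW, toS, wt2, SB, if_true]
                simpa using hA.trans hB
        have h3 : 0 ≤ HmF m F R (rv pp u) := mul_nonneg (hF0 _) (hF0 _)
        refine (mul_le_mul_of_nonneg_right e2 h3).trans (le_of_eq ?_)
        unfold HmF; ring
    _ = ∑ x ∈ ((Finset.univ : Finset (Fin n → Option (Fin k ⊕ Bool))).filter (fun u => ∀ j, rv pp u j ≤ R)).image e, f x := by
        rw [Finset.sum_image]; intro a _ b _ hab; exact hinj a b hab
    _ ≤ _ := by
        apply Finset.sum_le_sum_of_subset_of_nonneg
        · intro x hx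
          obtain ⟨u, hu, rfl⟩ := Finset.mem_image.mp hx
          rw [Finset.mem_product]
          refine ⟨?_, Finset.mem_univ _⟩
          simp only [e]
          rw [SV, Finset.mem_filter, Finset.mem_Icc]
          exact ⟨⟨rv_pos hP u _, (Finset.mem_filter.mp hu).2 _⟩, rv_cop hP u _⟩
        · intro x _ _; exact hfn x

theorem Q2_lower (hP : PEnum V R D0 pp) (m : Fin k) (hD : k ≤ D0) (F : (Fin k → ℝ) → ℝ) (hF0 : ∀ t, 0 ≤ F t) (B : ℝ) (hFB : ∀ t, F t ≤ B) :
    ∑ τ ∈ Fintype.piFinset (fun _ : Fin k ⊕ Bool => SV V R), (∏ j, (1:ℝ) / (τ j : ℕ)) * HmF m F R τ ≤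
      mass V R * Q2 m F R pp + B ^ 2 * (mass V R ^ (k + 2) * (((k + 2) ^ 2 + k * (k + 2)) / D0)) := by
  have hk : 0 < k := by have := m.2; omega
  have hpk : ∀ p, (k:ℝ) ≤ pp p := fun p => by have := hP.big p; exact_mod_cast (by omega : k ≤ pp p)
  have h1 := good_tuples hP (by omega) (Nat.cast_nonneg k) hpk (HmF m F R) (B ^ 2) (fun τ => mul_nonneg (hF0 _) (hF0 _))
    (fun τ => by rw [sq]; exact mul_le_mul (hFB _) (hFB _) (hF0 _) ((hF0 0).trans (hFB 0)))
  have h2 := Q2low_ge hP m hD F hF0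
  have h3 := mul_le_mul_of_nonneg_left (Q2_ge_low hP m hD F) (mass_nonneg (V := V) (R := R))
  have hc : Fintype.card (Fin k ⊕ Bool) = k + 2 := by simp
  rw [hc] at h1
  push_cast at h1
  linarith

end
end
end

section
section
open Module nonZeroDivisors Ideal Pointwise Filter Topology

section
variable {k : ℕ}

noncomputable def HJ (m : Fin k) (F : (Fin k → ℝ) → ℝ) (t : Fin k ⊕ Bool → ℝ) : ℝ :=
  F (Function.update (fun i => t (Sum.inl i)) m (t (Sum.inr true))) * F (Function.update (fun i => t (Sum.inl i)) m (t (Sum.inr false)))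

lemma HJ_cont (m : Fin k) (F : (Fin k → ℝ) → ℝ) (hF : Continuous F) : Continuous (HJ m F) := by
  unfold HJ
  have : ∀ b, Continuous (fun t : Fin k ⊕ Bool → ℝ => Function.update (fun i => t (Sum.inl i)) m (t (Sum.inr b))) := by
    intro b
    exact Continuous.update (by fun_prop) m (by fun_prop)
  exact (hF.comp (this true)).mul (hF.comp (this false))

lemma HmF_eq (m : Fin k) (F : (Fin k → ℝ) → ℝ) (R : ℕ) (τ : Fin k ⊕ Bool → ℕ) : HmF m F R τ = HJ m F (fun j => Real.log (τ j) / Real.log R) := by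
  unfold HmF HJ
  have : ∀ b, (fun i => Real.log (updC m b τ i) / Real.log R) = Function.update (fun i => Real.log (τ (Sum.inl i)) / Real.log R) m (Real.log (τ (Sum.inr b)) / Real.log R) := by
    intro b
    funext i
    unfold updC
    by_cases h : i = m
    · subst h; simp
    · simp [Function.update_of_ne h]
  rw [this, this]

lemma HJ_integral (m : Fin k) (F : (Fin k → ℝ) → ℝ) (hF : Continuous F) :
    ∫ t in Set.univ.pi fun _ : Fin k ⊕ Bool => Set.Icc (0:ℝ) 1, HJ m F t = maynardJ k m F := by
  let e := MeasurableEquiv.sumPiEquivProdPi (fun _ : Fin k ⊕ Bool => ℝ)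
  have hmp : MeasurePreserving e volume volume := volume_measurePreserving_sumPiEquivProdPi (fun _ : Fin k ⊕ Bool => ℝ)
  let g : (Fin k → ℝ) × (Bool → ℝ) → ℝ := fun z => F (Function.update z.1 m (z.2 true)) * F (Function.update z.1 m (z.2 false))
  have hg : Continuous g := by
    have : ∀ b, Continuous (fun z : (Fin k → ℝ) × (Bool → ℝ) => Function.update z.1 m (z.2 b)) := by
      intro b; exact Continuous.update (by fun_prop) m (by fun_prop)
    exact (hF.comp (this true)).mul (hF.comp (this false))
  have hpre : (Set.univ.pi fun _ : Fin k ⊕ Bool => Set.Icc (0:ℝ) 1) = e ⁻¹' ((Set.univ.pi fun _ : Fin k => Set.Icc (0:ℝ) 1) ×ˢ (Set.univ.pi fun _ : Bool => Set.Icc (0:ℝ) 1)) := by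
    ext t
    simp only [Set.mem_pi, Set.mem_univ, true_implies, Set.mem_preimage, Set.mem_prod]
    exact Sum.forall
  have h1 : ∫ t in Set.univ.pi fun _ : Fin k ⊕ Bool => Set.Icc (0:ℝ) 1, HJ m F t = ∫ z in (Set.univ.pi fun _ : Fin k => Set.Icc (0:ℝ) 1) ×ˢ (Set.univ.pi fun _ : Bool => Set.Icc (0:ℝ) 1), g z := by
    rw [hpre]
    exact hmp.setIntegral_preimage_emb e.measurableEmbedding g _
  rw [h1, Measure.volume_eq_prod, setIntegral_prod]
  · unfold maynardJ
    congr 1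
    funext t
    rw [intervalIntegral.integral_of_le zero_le_one, ← integral_Icc_eq_integral_Ioc]
    have h2 : ∀ x : Bool → ℝ, g (t, x) = ∏ b, F (Function.update t m (x b)) := by
      intro x; simp [g]
    simp only [h2]
    rw [volume_pi, Measure.restrict_pi_pi, integral_fintype_prod_eq_pow (fun x => F (Function.update t m x))]
    simp
  · rw [← Measure.volume_eq_prod]
    apply ContinuousOn.integrableOn_compact
    · exact (isCompact_univ_pi fun _ => isCompact_Icc).prod (isCompact_univ_pi fun _ => isCompact_Icc)
    · exact hg.continuousOn

lemma mass_tendsto (V : ℕ) (hV : 0 < V) : Tendsto (fun R : ℕ => mass V R / (cV V * Real.log R)) atTop (𝓝 1) := by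
  have := hsum_tendsto V hV 1 zero_le_one
  simp only [Real.rpow_one, Nat.floor_natCast] at this
  exact this

theorem Q1_asymp (V D0 : ℕ) (hV : 0 < V) (hk : 0 < k) (hD : k ≤ D0) (F : (Fin k → ℝ) → ℝ) (hF : Continuous F) (hS : Function.support F ⊆ maynardSimplex k) (ε : ℝ) (hε : 0 < ε) :
    ∀ᶠ R : ℕ in atTop, ∀ (n : ℕ) (pp : Fin n → ℕ), PEnum V R D0 pp → Q1 F R pp ≤ Real.exp (8 * k / D0) * ((maynardI k F + ε) * (cV V * Real.log R) ^ k) := by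
  have h1 := EQ V hV (fun t : Fin k → ℝ => F t ^ 2) (hF.pow 2)
  have h2 := h1.eventually_lt_const (show (∫ t in Set.univ.pi fun _ : Fin k => Set.Icc (0:ℝ) 1, F t ^ 2) < maynardI k F + ε by unfold maynardI; linarith)
  filter_upwards [h2, eventually_ge_atTop 2] with R hR hR2 n pp hP
  refine (Q1_le hP hk hD hR2 hS).trans ?_
  apply mul_le_mul_of_nonneg_left _ (Real.exp_pos _).le
  rw [Fintype.card_fin] at hR
  have hL : 0 < cV V * Real.log R := mul_pos (cV_pos V hV) (Real.log_pos (by exact_mod_cast hR2))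
  rw [div_lt_iff₀ (by positivity)] at hR
  exact hR.le

theorem Q2_asymp (V D0 : ℕ) (hV : 0 < V) (m : Fin k) (hD : k ≤ D0) (F : (Fin k → ℝ) → ℝ) (hF : Continuous F) (hF0 : ∀ t, 0 ≤ F t) (B : ℝ) (hFB : ∀ t, F t ≤ B)
    (ε : ℝ) (hε : 0 < ε) :
    ∀ᶠ R : ℕ in atTop, ∀ (n : ℕ) (pp : Fin n → ℕ), PEnum V R D0 pp →
      (maynardJ k m F - B ^ 2 * (((k + 2) ^ 2 + k * (k + 2)) / D0) - ε) * (cV V * Real.log R) ^ (k + 1) ≤ Q2 m F R pp := by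
  have h1 := EQ V hV (HJ m F) (HJ_cont m F hF)
  rw [HJ_integral m F hF] at h1
  have hm := mass_tendsto V hV
  have h2 := (h1.div hm one_ne_zero).sub ((hm.pow (k + 1)).const_mul (B ^ 2 * (((k + 2) ^ 2 + k * (k + 2)) / (D0:ℝ))))
  rw [div_one, one_pow, mul_one] at h2
  have h3 := h2.eventually_const_lt (show maynardJ k m F - B ^ 2 * (((k + 2) ^ 2 + k * (k + 2)) / D0) - ε < maynardJ k m F - B ^ 2 * (((k + 2) ^ 2 + k * (k + 2)) / D0) by linarith)
  have hm2 := hm.eventually_const_lt (show (0:ℝ) < 1 by norm_num)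
  filter_upwards [h3, hm2, eventually_ge_atTop 2] with R hR hRm hR2 n pp hP
  have hL : 0 < cV V * Real.log R := mul_pos (cV_pos V hV) (Real.log_pos (by exact_mod_cast hR2))
  set L := cV V * Real.log R
  have hq := Q2_lower hP m hD F hF0 B hFB
  simp only [HmF_eq] at hq
  set SS := ∑ τ ∈ Fintype.piFinset (fun _ : Fin k ⊕ Bool => SV V R), (∏ j, (1:ℝ) / (τ j : ℕ)) * HJ m F (fun j => Real.log (τ j) / Real.log R)
  have hM : 0 < mass V R := by
    have := mul_pos hRm hL
    rwa [div_mul_cancel₀ _ hL.ne'] at this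
  set M := mass V R
  have hc : Fintype.card (Fin k ⊕ Bool) = k + 2 := by simp
  simp only [hc] at hR
  rw [← le_div_iff₀ (by positivity)]
  refine hR.le.trans ?_
  have e1 : SS / L ^ (k + 2) / (M / L) = SS / (M * L ^ (k + 1)) := by field_simp; ring
  have e1' : (SS / L ^ (k + 2)) / (M / L) - B ^ 2 * (((k + 2) ^ 2 + k * (k + 2)) / (D0:ℝ)) * (M / L) ^ (k + 1) =
      (SS - B ^ 2 * (M ^ (k + 2) * (((k + 2) ^ 2 + k * (k + 2)) / D0))) / M / L ^ (k + 1) := by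
    rw [e1, div_pow]
    rw [div_div, sub_div]
    congr 1
    rw [pow_succ M (k + 1)]
    field_simp
  refine (le_of_eq e1').trans ?_
  apply div_le_div_of_nonneg_right _ (by positivity)
  rw [div_le_iff₀ hM]
  linarith

end
end
end

section
section
open Module nonZeroDivisors Ideal Pointwise Filter Topology
section
variable {n k : ℕ} {J : Type} [Fintype J] [DecidableEq J] {V R D0 : ℕ} {pp : Fin n → ℕ}

/-- support of a state -/
def spt (s : Fin n → Option J) : Finset (Fin n) := Finset.univ.filter (fun p => (s p).isSome)

/-- product of the primes of a set -/
def PD (pp : Fin n → ℕ) (D : Finset (Fin n)) : ℕ := ∏ p ∈ D, pp p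

lemma nrm_eq (pp : Fin n → ℕ) (s : Fin n → Option J) : nrm pp s = PD pp (spt s) := by
  unfold nrm PD spt
  rw [Finset.prod_filter]
  refine Finset.prod_congr rfl fun p _ => ?_
  cases h : s p <;> simp

lemma spt_card (D : Finset (Fin n)) : (Finset.univ.filter (fun s : Fin n → Option J => spt s = D)).card = Fintype.card J ^ D.card := by
  have : (Finset.univ.filter (fun s : Fin n → Option J => spt s = D)) =
      Fintype.piFinset (fun p => if p ∈ D then (Finset.univ : Finset J).map Function.Embedding.some else {none}) := by
    ext s
    simp only [Finset.mem_filter, Finset.mem_univ, true_and, Fintype.mem_piFinset, Finset.ext_iff, spt]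
    refine forall_congr' fun p => ?_
    by_cases hp : p ∈ D
    · cases h : s p <;> simp [hp]
    · cases h : s p <;> simp [hp]
  rw [this, Fintype.card_piFinset]
  have : ∀ p : Fin n, (if p ∈ D then (Finset.univ : Finset J).map Function.Embedding.some else {none}).card = if p ∈ D then Fintype.card J else 1 := by
    intro p; split_ifs <;> simp
  simp only [this]
  rw [Finset.prod_ite]
  simp

lemma spt_sum (f : Finset (Fin n) → ℝ) : ∑ s : Fin n → Option J, f (spt s) = ∑ D : Finset (Fin n), (Fintype.card J : ℝ) ^ D.card * f D := by
  rw [← Finset.sum_fiberwise (s := Finset.univ) (g := fun s : Fin n → Option J => spt s)]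
  refine Finset.sum_congr rfl fun D _ => ?_
  rw [Finset.sum_congr rfl (g := fun _ => f D) (fun s hs => by rw [(Finset.mem_filter.mp hs).2]), Finset.sum_const, spt_card]
  simp

lemma PD_pos (hP : PEnum V R D0 pp) (D : Finset (Fin n)) : 0 < PD pp D := Finset.prod_pos fun p _ => (hP.prime p).pos

/-- divisor-type sums over squarefree numbers -/
lemma divsum (hP : PEnum V R D0 pp) (m X : ℕ) (hX : 1 ≤ X) :
    ∑ D : Finset (Fin n), (m:ℝ) ^ D.card * (if PD pp D ≤ X then 1 / (PD pp D : ℝ) else 0) ≤ (1 + Real.log X) ^ m := by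
  have h0 := spt_sum (J := Fin m) (fun D : Finset (Fin n) => if PD pp D ≤ X then 1 / (PD pp D : ℝ) else 0)
  rw [Fintype.card_fin] at h0
  rw [← h0, ← Finset.sum_filter]
  have h1 : ∀ s : Fin n → Option (Fin m), 1 / (PD pp (spt s) : ℝ) = ∏ j, (1:ℝ) / (rv pp s j : ℕ) := by
    intro s
    rw [← nrm_eq, ← prod_rv]; push_cast; simp
  rw [Finset.sum_congr rfl fun s _ => h1 s, ← Finset.sum_image (s := Finset.univ.filter (fun s : Fin n → Option (Fin m) => PD pp (spt s) ≤ X)) (g := fun s => rv pp s) (f := fun τ : Fin m → ℕ => ∏ j, (1:ℝ) / (τ j : ℕ)) (fun s _ s' _ h => rv_inj hP (fun j => congrFun h j))]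
  calc _ ≤ ∑ τ ∈ Fintype.piFinset (fun _ : Fin m => Finset.Icc 1 X), ∏ j, (1:ℝ) / (τ j : ℕ) := by
        refine Finset.sum_le_sum_of_subset_of_nonneg ?_ (fun τ _ _ => by positivity)
        intro τ hτ
        obtain ⟨s, hs, rfl⟩ := Finset.mem_image.mp hτ
        rw [Fintype.mem_piFinset]
        intro j
        rw [Finset.mem_Icc]
        refine ⟨rv_pos hP s j, (rv_le_nrm hP s j).trans ?_⟩
        rw [nrm_eq]; exact (Finset.mem_filter.mp hs).2
    _ = (∑ d ∈ Finset.Icc 1 X, (1:ℝ) / d) ^ m := by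
        rw [Finset.sum_prod_piFinset (Finset.Icc 1 X) (fun (_ : Fin m) (d : ℕ) => (1:ℝ) / d)]; simp
    _ ≤ _ := by
        have := (harm_bounds X hX).2
        have h2 : (0:ℝ) ≤ ∑ d ∈ Finset.Icc 1 X, (1:ℝ) / d := by positivity
        gcongr

/-- inverse local matrix -/
noncomputable def TL (p : ℝ) (c b : Option (Fin k)) : ℝ := match c, b with
  | none, none => 1
  | none, some _ => 1 / (p - 1)
  | some i, b => if b = some i then -1 else 0

/-- compatibility indicator -/
def bb (ω c : Option (Fin k)) : ℝ := if c = none ∨ ω = c then 1 else 0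

lemma SA_eq (p : ℝ) (ω b : Option (Fin k)) : SA p ω b = ∑ c, bb ω c * TL p c b := by
  rw [Fintype.sum_option (fun c => bb ω c * TL p c b)]
  cases b with
  | none => simp [SA, bb, TL]
  | some j =>
    have : ∀ x : Fin k, (if some j = some x then (-1:ℝ) else 0) = if x = j then -1 else 0 := by
      intro x; simp only [Option.some_inj]; congr 1; exact propext eq_comm
    simp only [SA, bb, TL, this]
    simp
    split_ifs <;> ring

/-- sieve coefficients -/
noncomputable def lam (F : (Fin k → ℝ) → ℝ) (R : ℕ) (pp : Fin n → ℕ) (s : Fin n → Option (Fin k)) : ℝ :=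
  ∑ r : Fin n → Option (Fin k), (∏ p, TL (pp p) (s p) (r p)) * yF F R pp r

noncomputable def XX (F : (Fin k → ℝ) → ℝ) (R : ℕ) (pp : Fin n → ℕ) (ω : Fin n → Option (Fin k)) : ℝ :=
  ∑ s : Fin n → Option (Fin k), (∏ p, SA (pp p) (ω p) (s p)) * yF F R pp s

lemma XX_eq (F : (Fin k → ℝ) → ℝ) (R : ℕ) (pp : Fin n → ℕ) (ω : Fin n → Option (Fin k)) :
    XX F R pp ω = ∑ s, lam F R pp s * ∏ p, bb (ω p) (s p) := by
  unfold XX lam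
  simp only [SA_eq, Finset.prod_univ_sum, Fintype.piFinset_univ, Finset.sum_mul]
  rw [Finset.sum_comm]
  refine Finset.sum_congr rfl fun s _ => Finset.sum_congr rfl fun r _ => ?_
  rw [Finset.prod_mul_distrib]; ring

lemma TL_ne {p : ℝ} {c b : Option (Fin k)} (h : TL p c b ≠ 0) : c = none ∨ b = c := by
  cases c with
  | none => left; rfl
  | some i => right; by_contra hb; apply h; simp [TL, hb]

lemma PD_mono (hP : PEnum V R D0 pp) {D D' : Finset (Fin n)} (h : D ⊆ D') : PD pp D ≤ PD pp D' :=
  Nat.le_of_dvd (PD_pos hP _) (Finset.prod_dvd_prod_of_subset _ _ _ h)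

lemma lam_supp (hP : PEnum V R D0 pp) (hR : 2 ≤ R) {F : (Fin k → ℝ) → ℝ} (hF : Function.support F ⊆ maynardSimplex k) (s : Fin n → Option (Fin k))
    (h : lam F R pp s ≠ 0) : PD pp (spt s) ≤ R := by
  obtain ⟨r, -, hr⟩ := Finset.exists_ne_zero_of_sum_ne_zero h
  have h1 := yF_nrm hP hR hF (right_ne_zero_of_mul hr)
  have h2 := Finset.prod_ne_zero_iff.mp (left_ne_zero_of_mul hr)
  rw [nrm_eq] at h1
  refine (PD_mono hP fun p hp => ?_).trans h1
  simp only [spt, Finset.mem_filter, Finset.mem_univ, true_and] at hp ⊢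
  rcases TL_ne (h2 p (Finset.mem_univ _)) with h3 | h3
  · simp [h3] at hp
  · rw [h3]; exact hp

lemma lam_bound (hP : PEnum V R D0 pp) (hR : 2 ≤ R) {F : (Fin k → ℝ) → ℝ} (hF : Function.support F ⊆ maynardSimplex k) (B : ℝ) (hB : ∀ t, |F t| ≤ B)
    (s : Fin n → Option (Fin k)) : |lam F R pp s| ≤ B * (1 + Real.log R) ^ (2 * k) := by
  have hB0 : 0 ≤ B := (abs_nonneg _).trans (hB 0)
  set e : (Fin n → Option (Fin k)) → (Fin n → Option (Fin k)) := fun r p => if s p = none then r p else none with he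
  set S := Finset.univ.filter (fun r : Fin n → Option (Fin k) => PD pp (spt r) ≤ R ∧ ∀ p, s p = none ∨ r p = s p) with hS
  set g : Finset (Fin n) → ℝ := fun D => 2 ^ D.card * (if PD pp D ≤ R then 1 / (PD pp D : ℝ) else 0) with hg
  have hg0 : ∀ D, 0 ≤ g D := fun D => by simp only [hg]; split_ifs <;> positivity
  have hterm : ∀ r ∈ S, |(∏ p, TL (pp p) (s p) (r p)) * yF F R pp r| ≤ B * g (spt (e r)) := by
    intro r hr
    obtain ⟨hr1, hr2⟩ := (Finset.mem_filter.mp hr).2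
    have hle : PD pp (spt (e r)) ≤ R := by
      refine (PD_mono hP fun p hp => ?_).trans hr1
      simp only [spt, Finset.mem_filter, Finset.mem_univ, true_and, he] at hp ⊢
      split_ifs at hp with h1
      · exact hp
      · simp at hp
    rw [abs_mul, mul_comm]
    refine mul_le_mul (hB _) ?_ (abs_nonneg _) hB0
    rw [Finset.abs_prod]
    simp only [hg]
    rw [if_pos hle, PD]
    push_cast
    rw [← Finset.prod_const, one_div, ← Finset.prod_inv_distrib, ← Finset.prod_mul_distrib, spt, Finset.prod_filter]
    refine Finset.prod_le_prod (fun _ _ => abs_nonneg _) fun p _ => ?_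
    have hp2 : (2:ℝ) ≤ pp p := by exact_mod_cast (hP.prime p).two_le
    cases hs : s p with
    | none =>
      simp only [he, hs, if_true]
      cases hrp : r p with
      | none => simp [TL]
      | some j =>
        simp only [TL, Option.isSome_some, if_true]
        rw [abs_of_nonneg (by apply div_nonneg <;> linarith), ← div_eq_mul_inv, div_le_div_iff₀ (by linarith) (by linarith)]
        linarith
    | some i =>
      simp only [he, hs]
      have : r p = some i := by rcases hr2 p with h | h; · simp [hs] at h
                                · rw [h, hs]
      simp [TL, this]
  calc |lam F R pp s| ≤ ∑ r, |(∏ p, TL (pp p) (s p) (r p)) * yF F R pp r| := Finset.abs_sum_le_sum_abs _ _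
    _ = ∑ r ∈ S, |(∏ p, TL (pp p) (s p) (r p)) * yF F R pp r| := by
        symm
        refine Finset.sum_subset (Finset.subset_univ _) fun r _ hr => ?_
        by_contra hne
        rw [abs_eq_zero] at hne
        apply hr
        refine Finset.mem_filter.mpr ⟨Finset.mem_univ _, ?_, fun p => TL_ne (Finset.prod_ne_zero_iff.mp (left_ne_zero_of_mul hne) p (Finset.mem_univ _))⟩
        have := yF_nrm hP hR hF (right_ne_zero_of_mul hne)
        rwa [nrm_eq] at this
    _ ≤ ∑ r ∈ S, B * g (spt (e r)) := Finset.sum_le_sum hterm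
    _ = ∑ u ∈ S.image e, B * g (spt u) := by
        rw [Finset.sum_image]
        intro r hr r' hr' h
        funext p
        have h2 := (Finset.mem_filter.mp hr).2.2 p
        have h2' := (Finset.mem_filter.mp hr').2.2 p
        have h3 := congrFun h p
        simp only [he] at h3
        by_cases hs : s p = none
        · simpa [hs] using h3
        · rw [h2.resolve_left hs, h2'.resolve_left hs]
    _ ≤ ∑ u, B * g (spt u) := Finset.sum_le_sum_of_subset_of_nonneg (Finset.subset_univ _) (fun u _ _ => mul_nonneg hB0 (hg0 _))
    _ ≤ _ := by
        rw [← Finset.mul_sum, spt_sum g]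
        refine mul_le_mul_of_nonneg_left ?_ hB0
        refine le_trans (le_of_eq ?_) (divsum hP (2 * k) R (by omega))
        refine Finset.sum_congr rfl fun D _ => ?_
        simp only [hg, Fintype.card_fin]
        push_cast
        rw [mul_pow]; ring
end
end
end

section
section
open Module nonZeroDivisors Ideal Pointwise Filter Topology
section
variable {n k : ℕ} {V R D0 : ℕ} {pp : Fin n → ℕ}

noncomputable def bet (o t : Fin n → Option (Fin k)) : ℝ := ∏ p, bb (o p) (t p)

def jn (s s' : Fin n → Option (Fin k)) : Fin n → Option (Fin k) := fun p => if s p = none then s' p else s p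

def cmp (s s' : Fin n → Option (Fin k)) : Prop := ∀ p, s p = none ∨ s' p = none ∨ s p = s' p

open Classical in
lemma bet_mul (o s s' : Fin n → Option (Fin k)) : bet o s * bet o s' = if cmp s s' then bet o (jn s s') else 0 := by
  unfold bet
  rw [← Finset.prod_mul_distrib]
  split_ifs with h
  · refine Finset.prod_congr rfl fun p _ => ?_
    have := h p
    by_cases h1 : s p = none
    · have e : jn s s' p = s' p := by simp [jn, h1]
      simp [bb, e, h1]
    · have e : jn s s' p = s p := by simp [jn, h1]
      by_cases h2 : s' p = none
      · simp [bb, e, h2]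
      · have h3 : s' p = s p := by tauto
        by_cases h4 : o p = s p <;> simp [bb, e, h1, h3, h4]
  · simp only [cmp, not_forall, not_or] at h
    obtain ⟨p, h1, h2, h3⟩ := h
    refine Finset.prod_eq_zero (Finset.mem_univ p) ?_
    simp only [bb]
    by_cases h4 : o p = s p
    · have : o p ≠ s' p := by rw [h4]; exact h3
      simp [h2, this]
    · simp [h1, h4]

lemma mem_spt (s : Fin n → Option (Fin k)) (p : Fin n) : p ∈ spt s ↔ s p ≠ none := by
  simp only [spt, Finset.mem_filter, Finset.mem_univ, true_and]
  cases h : s p <;> simp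

lemma spt_jn (s s' : Fin n → Option (Fin k)) : spt (jn s s') = spt s ∪ spt s' := by
  ext p
  rw [Finset.mem_union, mem_spt, mem_spt, mem_spt]
  by_cases h : s p = none <;> simp [jn, h]

lemma PD_union (hP : PEnum V R D0 pp) (D D' : Finset (Fin n)) : PD pp (D ∪ D') ≤ PD pp D * PD pp D' := by
  rw [PD, PD, PD, ← Finset.prod_union_inter]
  exact Nat.le_mul_of_pos_right _ (Finset.prod_pos fun p _ => (hP.prime p).pos)

lemma sub_card (t : Fin n → Option (Fin k)) : (Fintype.piFinset (fun p => ({none, t p} : Finset (Option (Fin k))))).card ≤ 2 ^ (spt t).card := by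
  rw [Fintype.card_piFinset, ← Finset.prod_const, spt, Finset.prod_filter]
  refine Finset.prod_le_prod' fun p _ => ?_
  cases h : t p
  · simp
  · simpa using Finset.card_le_two

open Classical in
lemma pair_card (t : Fin n → Option (Fin k)) : (Finset.univ.filter (fun x : (Fin n → Option (Fin k)) × (Fin n → Option (Fin k)) => cmp x.1 x.2 ∧ jn x.1 x.2 = t)).card ≤ 4 ^ (spt t).card := by
  have h1 : (Finset.univ.filter (fun x : (Fin n → Option (Fin k)) × (Fin n → Option (Fin k)) => cmp x.1 x.2 ∧ jn x.1 x.2 = t)) ⊆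
      (Fintype.piFinset (fun p => ({none, t p} : Finset (Option (Fin k))))) ×ˢ (Fintype.piFinset (fun p => ({none, t p} : Finset (Option (Fin k))))) := by
    rintro ⟨s, s'⟩ hx
    obtain ⟨-, hc, hj⟩ := Finset.mem_filter.mp hx
    simp only [Finset.mem_product, Fintype.mem_piFinset, Finset.mem_insert, Finset.mem_singleton]
    constructor <;> intro p <;> have h1 := hc p <;> have h2 := congrFun hj p <;> simp only [jn] at h2 <;> split_ifs at h2 with h3
    · left; exact h3
    · right; exact h2
    · right; exact h2
    · rcases h1 with h1 | h1 | h1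
      · exact absurd h1 h3
      · left; exact h1
      · right; exact h1.symm.trans h2
  refine (Finset.card_le_card h1).trans ?_
  rw [Finset.card_product]
  calc _ ≤ 2 ^ (spt t).card * 2 ^ (spt t).card := Nat.mul_le_mul (sub_card t) (sub_card t)
    _ = _ := by rw [← mul_pow]; norm_num

/-- transfer of the quadratic form through a signed measure -/
theorem transfer (hP : PEnum V R D0 pp) (hR : 2 ≤ R) {F : (Fin k → ℝ) → ℝ} (hF : Function.support F ⊆ maynardSimplex k) (Λ : ℝ)
    (hΛ : ∀ s, |lam F R pp s| ≤ Λ) (m : (Fin n → Option (Fin k)) → ℝ) :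
    |∑ o, m o * XX F R pp o ^ 2| ≤ Λ ^ 2 * ∑ t : Fin n → Option (Fin k), if PD pp (spt t) ≤ R ^ 2 then 4 ^ (spt t).card * |∑ o, m o * bet o t| else 0 := by
  classical
  have hΛ0 : 0 ≤ Λ := (abs_nonneg _).trans (hΛ (fun _ => none))
  have h1 : ∑ o, m o * XX F R pp o ^ 2 = ∑ x : (Fin n → Option (Fin k)) × (Fin n → Option (Fin k)),
      lam F R pp x.1 * lam F R pp x.2 * (if cmp x.1 x.2 then ∑ o, m o * bet o (jn x.1 x.2) else 0) := by
    have e1 : ∀ o, m o * XX F R pp o ^ 2 = ∑ x : (Fin n → Option (Fin k)) × (Fin n → Option (Fin k)),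
        lam F R pp x.1 * lam F R pp x.2 * (m o * (bet o x.1 * bet o x.2)) := by
      intro o
      rw [XX_eq, pow_two, Finset.sum_mul_sum, Fintype.sum_prod_type, Finset.mul_sum]
      refine Finset.sum_congr rfl fun s _ => ?_
      rw [Finset.mul_sum]
      refine Finset.sum_congr rfl fun s' _ => ?_
      simp only [bet]; ring
    rw [Finset.sum_congr rfl fun o _ => e1 o, Finset.sum_comm]
    refine Finset.sum_congr rfl fun x _ => ?_
    rw [← Finset.mul_sum]
    congr 1
    split_ifs with hc
    · refine Finset.sum_congr rfl fun o _ => ?_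
      rw [bet_mul, if_pos hc]
    · refine Finset.sum_eq_zero fun o _ => ?_
      rw [bet_mul, if_neg hc, mul_zero]
  set g : (Fin n → Option (Fin k)) → ℝ := fun t => if PD pp (spt t) ≤ R ^ 2 then |∑ o, m o * bet o t| else 0 with hg
  have hg0 : ∀ t, 0 ≤ g t := fun t => by simp only [hg]; split_ifs <;> positivity
  rw [h1]
  calc _ ≤ ∑ x : (Fin n → Option (Fin k)) × (Fin n → Option (Fin k)), (if cmp x.1 x.2 then Λ ^ 2 * g (jn x.1 x.2) else 0) := by
        refine (Finset.abs_sum_le_sum_abs _ _).trans (Finset.sum_le_sum fun x _ => ?_)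
        split_ifs with hc
        swap
        · simp
        by_cases hz : lam F R pp x.1 * lam F R pp x.2 = 0
        · rw [hz]; simpa using mul_nonneg (sq_nonneg Λ) (hg0 _)
        have h2 := lam_supp hP hR hF _ (left_ne_zero_of_mul hz)
        have h3 := lam_supp hP hR hF _ (right_ne_zero_of_mul hz)
        have h4 : PD pp (spt (jn x.1 x.2)) ≤ R ^ 2 := by
          rw [spt_jn, pow_two]
          exact (PD_union hP _ _).trans (Nat.mul_le_mul h2 h3)
        rw [abs_mul, abs_mul]
        have e : g (jn x.1 x.2) = |∑ o, m o * bet o (jn x.1 x.2)| := if_pos h4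
        rw [e, pow_two]
        exact mul_le_mul_of_nonneg_right (mul_le_mul (hΛ _) (hΛ _) (abs_nonneg _) hΛ0) (abs_nonneg _)
    _ = ∑ t, ∑ x ∈ (Finset.univ.filter (fun x : (Fin n → Option (Fin k)) × (Fin n → Option (Fin k)) => cmp x.1 x.2)).filter (fun x => jn x.1 x.2 = t), Λ ^ 2 * g (jn x.1 x.2) := by
        rw [← Finset.sum_filter, Finset.sum_fiberwise]
    _ ≤ ∑ t, 4 ^ (spt t).card * (Λ ^ 2 * g t) := by
        refine Finset.sum_le_sum fun t _ => ?_
        rw [Finset.sum_congr rfl (g := fun _ => Λ ^ 2 * g t) (fun x hx => by rw [(Finset.mem_filter.mp hx).2]), Finset.sum_const, Finset.filter_filter, nsmul_eq_mul]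
        refine mul_le_mul_of_nonneg_right ?_ (mul_nonneg (sq_nonneg Λ) (hg0 _))
        exact_mod_cast pair_card t
    _ = _ := by
        rw [Finset.mul_sum]
        refine Finset.sum_congr rfl fun t _ => ?_
        simp only [hg]
        split_ifs <;> ring
end
end
end

section
section
open Module nonZeroDivisors Ideal Pointwise Filter Topology
section
variable {n k : ℕ} {V R D0 W : ℕ} {pp : Fin n → ℕ} {h : Fin k → ℕ}

open Classical in
/-- divisibility pattern -/
noncomputable def om (h : Fin k → ℕ) (pp : Fin n → ℕ) (a : ℕ) : Fin n → Option (Fin k) :=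
  fun p => if H : ∃ i, pp p ∣ a + h i then some H.choose else none

lemma om_uniq (hP : PEnum V R D0 pp) (hinj : Function.Injective h) (hD : ∀ i j, h i ≤ h j + D0) {p : Fin n} {a : ℕ} {i j : Fin k}
    (h1 : pp p ∣ a + h i) (h2 : pp p ∣ a + h j) : i = j := by
  have hb := hP.big p
  have h3 := Nat.dvd_sub h1 h2
  have h4 := Nat.dvd_sub h2 h1
  have e1 := hD i j
  have e2 := hD j i
  have h5 : a + h i - (a + h j) = 0 := Nat.eq_zero_of_dvd_of_lt h3 (by omega)
  have h6 : a + h j - (a + h i) = 0 := Nat.eq_zero_of_dvd_of_lt h4 (by omega)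
  exact hinj (by omega)

lemma om_iff (hP : PEnum V R D0 pp) (hinj : Function.Injective h) (hD : ∀ i j, h i ≤ h j + D0) (a : ℕ) (p : Fin n) (i : Fin k) :
    om h pp a p = some i ↔ pp p ∣ a + h i := by
  unfold om
  split_ifs with H
  · rw [Option.some_inj]
    exact ⟨fun e => e ▸ H.choose_spec, fun e => om_uniq hP hinj hD H.choose_spec e⟩
  · simp only [reduceCtorEq, false_iff]
    exact fun e => H ⟨i, e⟩

open Classical in
lemma bet_ind (o t : Fin n → Option (Fin k)) : bet o t = if ∀ p, t p = none ∨ o p = t p then 1 else 0 := by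
  unfold bet
  split_ifs with H
  · exact Finset.prod_eq_one fun p _ => by simp [bb, H p]
  · push Not at H
    obtain ⟨p, hp⟩ := H
    exact Finset.prod_eq_zero (Finset.mem_univ p) (by simp [bb, hp])

lemma bet_om (hP : PEnum V R D0 pp) (hinj : Function.Injective h) (hD : ∀ i j, h i ≤ h j + D0) (a : ℕ) (t : Fin n → Option (Fin k)) :
    (∀ p, t p = none ∨ om h pp a p = t p) ↔ ∀ p ∈ spt t, ∀ i, t p = some i → pp p ∣ a + h i := by
  refine forall_congr' fun p => ?_
  rw [mem_spt]
  cases e : t p with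
  | none => simp
  | some i => simp [om_iff hP hinj hD]

lemma PD_cop (hP : PEnum V R D0 pp) (hW : W ∣ V) (D : Finset (Fin n)) : Nat.Coprime W (PD pp D) :=
  Nat.Coprime.prod_right fun p _ => ((hP.cop p).coprime_dvd_right hW).symm

lemma crt (hP : PEnum V R D0 pp) (hW : W ∣ V) (v0 : ℕ) (t : Fin n → Option (Fin k)) (D : Finset (Fin n)) (hD : D ⊆ spt t) :
    ∃ c, ∀ a, (a ≡ v0 [MOD W] ∧ ∀ p ∈ D, ∀ i, t p = some i → pp p ∣ a + h i) ↔ a ≡ c [MOD W * PD pp D] := by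
  classical
  induction D using Finset.induction_on with
  | empty => exact ⟨v0, fun a => by simp [PD]⟩
  | insert p D hp ih =>
    obtain ⟨c, hc⟩ := ih ((Finset.subset_insert _ _).trans hD)
    have hps := (mem_spt t p).mp (hD (Finset.mem_insert_self _ _))
    obtain ⟨i, hi⟩ := Option.ne_none_iff_exists'.mp hps
    have hcop : Nat.Coprime (W * PD pp D) (pp p) := by
      refine Nat.Coprime.mul_left ((hP.cop p).coprime_dvd_right hW).symm (Nat.Coprime.prod_left fun q hq => ?_)
      exact (Nat.coprime_primes (hP.prime q) (hP.prime p)).mpr fun e => hp (hP.inj e ▸ hq)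
    have hb : ∀ a, pp p ∣ a + h i ↔ a ≡ (pp p * h i - h i) [MOD pp p] := by
      intro a
      have h1 : h i ≤ pp p * h i := Nat.le_mul_of_pos_left _ (hP.prime p).pos
      rw [← Nat.modEq_zero_iff_dvd]
      have h2 : (pp p * h i - h i) + h i ≡ 0 [MOD pp p] := by
        rw [Nat.sub_add_cancel h1, Nat.modEq_zero_iff_dvd]; exact dvd_mul_right _ _
      exact ⟨fun h3 => Nat.ModEq.add_right_cancel' (h i) (h3.trans h2.symm), fun h3 => (h3.add_right _).trans h2⟩
    refine ⟨Nat.chineseRemainder hcop c (pp p * h i - h i), fun a => ?_⟩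
    have hx := (Nat.chineseRemainder hcop c (pp p * h i - h i)).2
    rw [PD, Finset.prod_insert hp, mul_comm (pp p), ← mul_assoc]
    change _ ↔ a ≡ _ [MOD W * PD pp D * pp p]
    rw [← Nat.modEq_and_modEq_iff_modEq_mul hcop, Finset.forall_mem_insert]
    have e1 : (∀ j, t p = some j → pp p ∣ a + h j) ↔ a ≡ (pp p * h i - h i) [MOD pp p] := by
      rw [← hb, hi]; simp
    rw [e1, ← and_assoc, and_right_comm, hc a]
    exact and_congr ⟨fun h => h.trans hx.1.symm, fun h => h.trans hx.1⟩ ⟨fun h => h.trans hx.2.symm, fun h => h.trans hx.2⟩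

/-- sum of a product measure against `bet` -/
lemma mu_bet (μ : Fin n → Option (Fin k) → ℝ) (t : Fin n → Option (Fin k)) : ∑ o : Fin n → Option (Fin k), (∏ p, μ p (o p)) * bet o t = ∏ p, ∑ x, μ p x * bb x (t p) := by
  simp only [Finset.prod_univ_sum, Fintype.piFinset_univ, bet, Finset.prod_mul_distrib]

lemma mu1_bb (p : ℝ) (hp : 0 < p) (c : Option (Fin k)) : ∑ x, mu1 p x * bb x c = if c = none then 1 else 1 / p := by
  rw [Fintype.sum_option (fun x => mu1 p x * bb x c)]
  cases c with
  | none => simp [mu1, bb]; ring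
  | some i => simp [mu1, bb]

lemma mu2_bb (m : Fin k) (p : ℝ) (hp : 1 < p) (c : Option (Fin k)) : ∑ x, mu2 m p x * bb x c = if c = none then 1 else if c = some m then 0 else 1 / (p - 1) := by
  rw [Fintype.sum_option (fun x => mu2 m p x * bb x c)]
  cases c with
  | none =>
    have : ∑ x : Fin k, (if x = m then (0:ℝ) else 1 / (p - 1)) = (k - 1) / (p - 1) := by
      have e : ∀ x : Fin k, (if x = m then (0:ℝ) else 1 / (p - 1)) = 1 / (p - 1) - (if x = m then 1 / (p - 1) else 0) := by
        intro x; split_ifs <;> ring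
      simp only [e, Finset.sum_sub_distrib]
      simp; ring
    simp only [mu2, bb, true_or, if_true, mul_one, this]; ring
  | some i => simp [mu2, bb]

open Classical in
/-- the signed measure comparing a finite set with a product measure -/
noncomputable def sgm (A : Finset ℕ) (h : Fin k → ℕ) (pp : Fin n → ℕ) (c : ℝ) (μ : Fin n → Option (Fin k) → ℝ) (o : Fin n → Option (Fin k)) : ℝ :=
  ((A.filter (fun a => om h pp a = o)).card : ℝ) - c * ∏ p, μ p (o p)

lemma sgm_sum (A : Finset ℕ) (c : ℝ) (μ : Fin n → Option (Fin k) → ℝ) (f : (Fin n → Option (Fin k)) → ℝ) :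
    ∑ o, sgm A h pp c μ o * f o = ∑ a ∈ A, f (om h pp a) - c * ∑ o : Fin n → Option (Fin k), (∏ p, μ p (o p)) * f o := by
  classical
  rw [← Finset.sum_fiberwise A (fun a => om h pp a) (fun a => f (om h pp a)), Finset.mul_sum, ← Finset.sum_sub_distrib]
  refine Finset.sum_congr rfl fun o _ => ?_
  rw [Finset.sum_congr rfl (g := fun _ => f o) (fun a ha => by rw [(Finset.mem_filter.mp ha).2]), Finset.sum_const, nsmul_eq_mul, sgm]
  ring_nf

open Classical in
lemma bet_count (hP : PEnum V R D0 pp) (hinj : Function.Injective h) (hD : ∀ i j, h i ≤ h j + D0) (A : Finset ℕ) (t : Fin n → Option (Fin k)) :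
    ∑ a ∈ A, bet (om h pp a) t = ((A.filter (fun a => ∀ p ∈ spt t, ∀ i, t p = some i → pp p ∣ a + h i)).card : ℝ) := by
  rw [Finset.card_filter]
  push_cast
  refine Finset.sum_congr rfl fun a _ => ?_
  rw [bet_ind]
  congr 1
  exact propext (bet_om hP hinj hD a t)
end
end
end

section
section
open Module nonZeroDivisors Ideal Pointwise Filter Topology
section
variable {n k : ℕ} {V R D0 W : ℕ} {pp : Fin n → ℕ} {h : Fin k → ℕ}

lemma count_ap (a b q v : ℕ) (hab : a ≤ b) (hq : 0 < q) : |(((Finset.Ico a b).filter (fun x => x ≡ v [MOD q])).card : ℝ) - (b - a) / q| ≤ 1 := by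
  have h1 := Nat.Ico_filter_modEq_card a b hq v
  have hq' : (0:ℚ) < q := by exact_mod_cast hq
  have hab' : (a:ℚ) ≤ b := by exact_mod_cast hab
  have h2 : ⌈((a:ℚ) - v) / q⌉ ≤ ⌈((b:ℚ) - v) / q⌉ := Int.ceil_le_ceil (by gcongr)
  rw [max_eq_left (by omega)] at h1
  have h3 := Int.le_ceil (((a:ℚ) - v) / q)
  have h4 := Int.ceil_lt_add_one (((a:ℚ) - v) / q)
  have h5 := Int.le_ceil (((b:ℚ) - v) / q)
  have h6 := Int.ceil_lt_add_one (((b:ℚ) - v) / q)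
  have h7 : ((((Finset.Ico a b).filter (fun x => x ≡ v [MOD q])).card : ℤ) : ℚ) = (⌈((b:ℚ) - v) / q⌉ : ℚ) - ⌈((a:ℚ) - v) / q⌉ := by
    rw [h1]; push_cast; ring
  have h8 : ((b:ℚ) - a) / q = ((b:ℚ) - v) / q - ((a:ℚ) - v) / q := by ring
  have h9 : |(((Finset.Ico a b).filter (fun x => x ≡ v [MOD q])).card : ℚ) - (b - a) / q| ≤ 1 := by
    rw [h8, abs_le]; rw [Int.cast_natCast] at h7; constructor <;> linarith
  have h10 := (Rat.cast_le (K := ℝ)).mpr h9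
  push_cast at h10; exact h10

/-- the range of summation -/
def AS (N H W v0 : ℕ) : Finset ℕ := (Finset.Ico (N - H) (2 * N)).filter (fun a => a ≡ v0 [MOD W])

lemma Q1_eq (F : (Fin k → ℝ) → ℝ) : Q1 F R pp = ∑ o : Fin n → Option (Fin k), (∏ p, mu1 (pp p) (o p)) * XX F R pp o ^ 2 := rfl
lemma Q2_eq (m : Fin k) (F : (Fin k → ℝ) → ℝ) : Q2 m F R pp = ∑ o : Fin n → Option (Fin k), (∏ p, mu2 m (pp p) (o p)) * XX F R pp o ^ 2 := rfl

theorem S1_bound (hP : PEnum V R D0 pp) (hR : 2 ≤ R) (hW : W ∣ V) (hW0 : 0 < W) (hinj : Function.Injective h) (hD : ∀ i j, h i ≤ h j + D0)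
    {F : (Fin k → ℝ) → ℝ} (hF : Function.support F ⊆ maynardSimplex k) (Λ : ℝ) (hΛ : ∀ s, |lam F R pp s| ≤ Λ) (N H v0 : ℕ) (hN : H ≤ N) :
    ∑ a ∈ AS N H W v0, XX F R pp (om h pp a) ^ 2 ≤ (N + H) / W * Q1 F R pp + Λ ^ 2 * (R ^ 2 * (1 + Real.log ((R ^ 2 : ℕ):ℝ)) ^ (4 * k)) := by
  classical
  have h1 := transfer hP hR hF Λ hΛ (sgm (AS N H W v0) h pp ((N + H) / W) (fun p => mu1 (pp p)))
  rw [sgm_sum] at h1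
  have h2 : ∀ t, |∑ o, sgm (AS N H W v0) h pp ((N + H) / W) (fun p => mu1 (pp p)) o * bet o t| ≤ 1 := by
    intro t
    rw [sgm_sum _ _ _ (fun o => bet o t), bet_count hP hinj hD, mu_bet]
    obtain ⟨c, hc⟩ := crt (h := h) hP hW v0 t (spt t) subset_rfl
    have e1 : ((AS N H W v0).filter (fun a => ∀ p ∈ spt t, ∀ i, t p = some i → pp p ∣ a + h i)) = (Finset.Ico (N - H) (2 * N)).filter (fun a => a ≡ c [MOD W * PD pp (spt t)]) := by
      rw [AS, Finset.filter_filter]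
      exact Finset.filter_congr fun a _ => hc a
    have e2 : ∏ p, ∑ x, mu1 (pp p : ℝ) x * bb x (t p) = 1 / (PD pp (spt t) : ℝ) := by
      rw [← nrm_eq, nrm]
      push_cast
      rw [one_div, ← Finset.prod_inv_distrib]
      refine Finset.prod_congr rfl fun p _ => ?_
      rw [mu1_bb _ (by exact_mod_cast (hP.prime p).pos)]
      split_ifs <;> simp
    rw [e1, e2]
    have h3 := count_ap (N - H) (2 * N) (W * PD pp (spt t)) c (by omega) (Nat.mul_pos hW0 (PD_pos hP _))
    have e3 : ((2 * N : ℕ) - (N - H : ℕ) : ℝ) / ((W * PD pp (spt t) : ℕ):ℝ) = (N + H) / W * (1 / (PD pp (spt t) : ℝ)) := by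
      rw [Nat.cast_sub hN]; push_cast
      rw [div_mul_div_comm]; ring
    rwa [e3] at h3
  have h4 : (∑ t : Fin n → Option (Fin k), if PD pp (spt t) ≤ R ^ 2 then 4 ^ (spt t).card * |∑ o, sgm (AS N H W v0) h pp ((N + H) / W) (fun p => mu1 (pp p)) o * bet o t| else 0)
      ≤ R ^ 2 * (1 + Real.log ((R ^ 2 : ℕ):ℝ)) ^ (4 * k) := by
    calc _ ≤ ∑ t : Fin n → Option (Fin k), (fun D : Finset (Fin n) => (R:ℝ) ^ 2 * (4 ^ D.card * (if PD pp D ≤ R ^ 2 then 1 / (PD pp D : ℝ) else 0))) (spt t) := by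
          refine Finset.sum_le_sum fun t _ => ?_
          simp only []
          split_ifs with hc
          · have hp : (0:ℝ) < PD pp (spt t) := by exact_mod_cast PD_pos hP _
            have hc' : (PD pp (spt t) : ℝ) ≤ R ^ 2 := by exact_mod_cast hc
            have : 1 ≤ (R:ℝ) ^ 2 * (1 / (PD pp (spt t) : ℝ)) := by rw [mul_one_div, le_div_iff₀ hp]; linarith
            calc (4:ℝ) ^ (spt t).card * _ ≤ 4 ^ (spt t).card * 1 := by gcongr; exact h2 t
              _ ≤ 4 ^ (spt t).card * ((R:ℝ) ^ 2 * (1 / (PD pp (spt t) : ℝ))) := by gcongr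
              _ = _ := by ring
          · simp
      _ = R ^ 2 * ∑ D : Finset (Fin n), ((4 * k : ℕ):ℝ) ^ D.card * (if PD pp D ≤ R ^ 2 then 1 / (PD pp D : ℝ) else 0) := by
          refine (spt_sum (J := Fin k) (fun D : Finset (Fin n) => (R:ℝ) ^ 2 * (4 ^ D.card * (if PD pp D ≤ R ^ 2 then 1 / (PD pp D : ℝ) else 0)))).trans ?_
          rw [Finset.mul_sum]
          refine Finset.sum_congr rfl fun D _ => ?_
          rw [Fintype.card_fin]; push_cast; rw [mul_pow]; ring
      _ ≤ _ := by
          gcongr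
          exact divsum hP (4 * k) (R ^ 2) (Nat.one_le_pow _ _ (by omega))
  have h5 := (abs_le.mp h1).2
  rw [← Q1_eq] at h5
  have h6 := mul_le_mul_of_nonneg_left h4 (sq_nonneg Λ)
  linarith

open Classical in
noncomputable def AP (P : Set ℕ) (N hm : ℕ) (A : Finset ℕ) : Finset ℕ := A.filter (fun a => a + hm ∈ P ∧ N ≤ a + hm ∧ a + hm < 2 * N)

theorem S2_bound (P : Set ℕ) (hPp : ∀ q ∈ P, q.Prime) (hP : PEnum V R D0 pp) (hR : 2 ≤ R) (hW : W ∣ V) (hW0 : 0 < W) (hinj : Function.Injective h) (hD : ∀ i j, h i ≤ h j + D0)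
    {F : (Fin k → ℝ) → ℝ} (hF : Function.support F ⊆ maynardSimplex k) (Λ : ℝ) (hΛ : ∀ s, |lam F R pp s| ≤ Λ) (N H v0 : ℕ) (hN : H ≤ N) (hRN : R < N)
    (m : Fin k) (hH : h m ≤ H) (hv : Nat.Coprime (v0 + h m) W) :
    (chebCount P N : ℝ) / Nat.totient W * Q2 m F R pp - Λ ^ 2 * (∑ D : Finset (Fin n), ((4 * k : ℕ):ℝ) ^ D.card * (if PD pp D ≤ R ^ 2 then chebErr P N (W * PD pp D) else 0))
      ≤ ∑ a ∈ AP P N (h m) (AS N H W v0), XX F R pp (om h pp a) ^ 2 := by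
  classical
  set A := AP P N (h m) (AS N H W v0) with hA
  set cc := (chebCount P N : ℝ) / Nat.totient W with hcc
  have h1 := transfer hP hR hF Λ hΛ (sgm A h pp cc (fun p => mu2 m (pp p)))
  rw [sgm_sum] at h1
  have h2 : ∀ t, |∑ o, sgm A h pp cc (fun p => mu2 m (pp p)) o * bet o t| ≤ chebErr P N (W * PD pp (spt t)) := by
    intro t
    rw [sgm_sum _ _ _ (fun o => bet o t), bet_count hP hinj hD, mu_bet]
    have hp1 : ∀ p, (1:ℝ) < pp p := fun p => by exact_mod_cast (hP.prime p).one_lt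
    by_cases hm : ∃ p, t p = some m
    · obtain ⟨p, hp⟩ := hm
      have e1 : A.filter (fun a => ∀ p ∈ spt t, ∀ i, t p = some i → pp p ∣ a + h i) = ∅ := by
        refine Finset.filter_eq_empty_iff.mpr fun a ha hc => ?_
        have h3 := hc p (by rw [mem_spt, hp]; simp) m hp
        obtain ⟨-, h4, h5, -⟩ := Finset.mem_filter.mp ha
        have h6 := (Nat.prime_dvd_prime_iff_eq (hP.prime p) (hPp _ h4)).mp h3
        have h7 := hP.le p
        omega
      have e2 : ∏ p, ∑ x, mu2 m (pp p : ℝ) x * bb x (t p) = 0 := by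
        refine Finset.prod_eq_zero (Finset.mem_univ p) ?_
        rw [mu2_bb _ _ (hp1 p), hp]; simp
      rw [e1, e2]
      simpa using chebErr_nonneg _ _ _
    · push Not at hm
      obtain ⟨c, hc⟩ := crt (h := h) hP hW v0 t (spt t) subset_rfl
      have hcc0 := (hc c).mpr rfl
      have e2 : ∏ p, ∑ x, mu2 m (pp p : ℝ) x * bb x (t p) = 1 / (Nat.totient (PD pp (spt t)) : ℝ) := by
        have e3 : Nat.totient (PD pp (spt t)) = ∏ p ∈ spt t, (pp p - 1) := by
          have : ∀ D : Finset (Fin n), Nat.totient (PD pp D) = ∏ p ∈ D, (pp p - 1) := by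
            intro D
            induction D using Finset.induction_on with
            | empty => simp [PD]
            | insert p D hp ih =>
              rw [PD, Finset.prod_insert hp, Finset.prod_insert hp, Nat.totient_mul, Nat.totient_prime (hP.prime p), ← ih]; rfl
              refine Nat.Coprime.prod_right fun q hq => ?_
              exact (Nat.coprime_primes (hP.prime p) (hP.prime q)).mpr fun e => hp (hP.inj e ▸ hq)
          exact this _
        rw [e3, spt, Finset.prod_filter]
        push_cast
        rw [one_div, ← Finset.prod_inv_distrib]
        refine Finset.prod_congr rfl fun p _ => ?_
        rw [mu2_bb _ _ (hp1 p), if_neg (hm p)]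
        cases e : t p with
        | none => simp
        | some i => simp [Nat.cast_sub (hP.prime p).one_lt.le]
      have e1 : (A.filter (fun a => ∀ p ∈ spt t, ∀ i, t p = some i → pp p ∣ a + h i)).card = chebCountMod P N (W * PD pp (spt t)) (c + h m) := by
        rw [chebCountMod, ← Set.ncard_coe_finset]
        refine Set.ncard_congr (fun a _ => a + h m) ?_ ?_ ?_
        · intro a ha
          obtain ⟨ha1, ha2⟩ := Finset.mem_filter.mp (Finset.mem_coe.mp ha)
          obtain ⟨ha3, ha4, ha5, ha6⟩ := Finset.mem_filter.mp ha1
          have ha7 := (Finset.mem_filter.mp ha3).2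
          exact ⟨ha4, ha5, ha6, ((hc a).mp ⟨ha7, ha2⟩).add_right _⟩
        · intro a b _ _ hab; simpa using hab
        · rintro q ⟨hq1, hq2, hq3, hq4⟩
          have hq5 : h m ≤ q := by omega
          refine ⟨q - h m, ?_, by omega⟩
          have hq6 : q - h m ≡ c [MOD W * PD pp (spt t)] := by
            apply Nat.ModEq.add_right_cancel' (h m)
            rw [Nat.sub_add_cancel hq5]; exact hq4
          have hq7 := (hc _).mpr hq6
          refine Finset.mem_coe.mpr (Finset.mem_filter.mpr ⟨Finset.mem_filter.mpr ⟨Finset.mem_filter.mpr ⟨Finset.mem_Ico.mpr ⟨by omega, by omega⟩, hq7.1⟩, ?_⟩, hq7.2⟩)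
          rw [Nat.sub_add_cancel hq5]; exact ⟨hq1, hq2, hq3⟩
      have hcop : Nat.Coprime (c + h m) (W * PD pp (spt t)) := by
        refine Nat.Coprime.mul_right ?_ ?_
        · have := (hcc0.1.add_right (h m)).gcd_eq
          rw [Nat.Coprime, this]; exact hv
        · refine Nat.Coprime.prod_right fun p hp => ?_
          rw [Nat.coprime_comm, (hP.prime p).coprime_iff_not_dvd]
          intro hd
          obtain ⟨i, hi⟩ := Option.ne_none_iff_exists'.mp ((mem_spt t p).mp hp)
          have := om_uniq hP hinj hD (hcc0.2 p hp i hi) hd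
          exact hm p (this ▸ hi)
      have h3 := chebErr_ge P N (W * PD pp (spt t)) (c + h m) (Nat.mul_pos hW0 (PD_pos hP _)) hcop
      rw [Nat.totient_mul (PD_cop hP hW _)] at h3
      rw [e1, e2, hcc]
      have e4 : (chebCount P N : ℝ) / ((Nat.totient W * Nat.totient (PD pp (spt t)) : ℕ):ℝ) = (chebCount P N : ℝ) / Nat.totient W * (1 / (Nat.totient (PD pp (spt t)) : ℝ)) := by
        rw [div_mul_div_comm]; push_cast; ring
      rwa [e4] at h3
  have h4 : (∑ t : Fin n → Option (Fin k), if PD pp (spt t) ≤ R ^ 2 then 4 ^ (spt t).card * |∑ o, sgm A h pp cc (fun p => mu2 m (pp p)) o * bet o t| else 0)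
      ≤ ∑ D : Finset (Fin n), ((4 * k : ℕ):ℝ) ^ D.card * (if PD pp D ≤ R ^ 2 then chebErr P N (W * PD pp D) else 0) := by
    calc _ ≤ ∑ t : Fin n → Option (Fin k), (fun D : Finset (Fin n) => (4 ^ D.card * (if PD pp D ≤ R ^ 2 then chebErr P N (W * PD pp D) else 0))) (spt t) := by
          refine Finset.sum_le_sum fun t _ => ?_
          simp only []
          split_ifs with hc
          · gcongr; exact h2 t
          · simp
      _ = _ := by
          refine (spt_sum (J := Fin k) (fun D : Finset (Fin n) => (4 ^ D.card * (if PD pp D ≤ R ^ 2 then chebErr P N (W * PD pp D) else 0)))).trans ?_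
          refine Finset.sum_congr rfl fun D _ => ?_
          rw [Fintype.card_fin]; push_cast; rw [mul_pow]; ring
  have h5 := (abs_le.mp h1).1
  rw [← Q2_eq] at h5
  have h6 := mul_le_mul_of_nonneg_left h4 (sq_nonneg Λ)
  linarith
end
end
end

section
section
open Module nonZeroDivisors Ideal Pointwise Filter Topology
section
variable {n k : ℕ} {V R D0 W : ℕ} {pp : Fin n → ℕ} {h : Fin k → ℕ}

lemma PD_dvd (hP : PEnum V R D0 pp) (D : Finset (Fin n)) (p : Fin n) : pp p ∣ PD pp D ↔ p ∈ D := by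
  refine ⟨fun hd => ?_, fun hp => Finset.dvd_prod_of_mem _ hp⟩
  obtain ⟨q, hq, hd⟩ := (Prime.dvd_finsetProd_iff (hP.prime p).prime _).mp hd
  exact hP.inj ((Nat.prime_dvd_prime_iff_eq (hP.prime p) (hP.prime q)).mp hd) ▸ hq

lemma PD_inj (hP : PEnum V R D0 pp) {D D' : Finset (Fin n)} (e : PD pp D = PD pp D') : D = D' := by
  ext p; rw [← PD_dvd hP, ← PD_dvd hP, e]

lemma PD_tot (hP : PEnum V R D0 pp) (D : Finset (Fin n)) : PD pp D ≤ 2 ^ D.card * Nat.totient (PD pp D) := by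
  induction D using Finset.induction_on with
  | empty => simp [PD]
  | insert p D hp ih =>
    rw [PD, Finset.prod_insert hp, Nat.totient_mul, Finset.card_insert_of_notMem hp, Nat.totient_prime (hP.prime p), pow_succ]
    · change pp p * PD pp D ≤ 2 ^ D.card * 2 * ((pp p - 1) * Nat.totient (PD pp D))
      have h2 := (hP.prime p).two_le
      calc pp p * PD pp D ≤ (2 * (pp p - 1)) * (2 ^ D.card * Nat.totient (PD pp D)) := Nat.mul_le_mul (by omega) ih
        _ = _ := by ring
    · exact ((Nat.Prime.coprime_iff_not_dvd (hP.prime p)).mpr fun hd => hp ((PD_dvd hP D p).mp hd))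

lemma err_bound (P : Set ℕ) (Δ : ℕ) (θ : ℝ) (A c : ℝ) (hP : PEnum V R D0 pp) (hW0 : 0 < W) (hW : W ∣ V) (hΔ : Δ ∣ V) (hWΔ : Nat.Coprime W Δ) (hR : 2 ≤ R) (N : ℕ)
    (hc : ∑ q ∈ (Finset.Icc 1 ⌊(N : ℝ) ^ θ⌋₊).filter (fun q => Nat.Coprime q Δ), chebErr P N q ≤ c * N / Real.log N ^ A)
    (h1 : ((W * R ^ 2 : ℕ):ℝ) ≤ (N:ℝ) ^ θ) (h2 : W * R ^ 2 ≤ N) :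
    (∑ D : Finset (Fin n), ((4 * k : ℕ):ℝ) ^ D.card * (if PD pp D ≤ R ^ 2 then chebErr P N (W * PD pp D) else 0)) ^ 2 ≤
      (c * N / Real.log N ^ A) * (3 * N * (1 + Real.log ((R ^ 2 : ℕ):ℝ)) ^ (32 * k ^ 2)) := by
  classical
  set e : Finset (Fin n) → ℝ := fun D => if PD pp D ≤ R ^ 2 then chebErr P N (W * PD pp D) else 0 with he
  have he0 : ∀ D, 0 ≤ e D := fun D => by simp only [he]; split_ifs; exacts [chebErr_nonneg _ _ _, le_rfl]
  have hcs : (∑ D : Finset (Fin n), ((4 * k : ℕ):ℝ) ^ D.card * e D) ^ 2 ≤ (∑ D, e D) * ∑ D, ((16 * k ^ 2 : ℕ):ℝ) ^ D.card * e D := by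
    refine Finset.sum_sq_le_sum_mul_sum_of_sq_le_mul _ (fun D _ => he0 D) (fun D _ => mul_nonneg (by positivity) (he0 D)) fun D _ => le_of_eq ?_
    have : ((16 * k ^ 2 : ℕ):ℝ) = ((4 * k : ℕ):ℝ) ^ 2 := by push_cast; ring
    rw [this, ← pow_mul, mul_comm 2, pow_mul]; ring
  refine hcs.trans (mul_le_mul ?_ ?_ (Finset.sum_nonneg fun D _ => mul_nonneg (by positivity) (he0 D)) ?_)
  · refine le_trans ?_ hc
    simp only [he]
    rw [← Finset.sum_filter, ← Finset.sum_image (f := fun q => chebErr P N q) (g := fun D => W * PD pp D) (s := Finset.univ.filter (fun D => PD pp D ≤ R ^ 2))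
      (fun D _ D' _ hDD => PD_inj hP (Nat.eq_of_mul_eq_mul_left hW0 hDD))]
    refine Finset.sum_le_sum_of_subset_of_nonneg ?_ fun q _ _ => chebErr_nonneg _ _ _
    intro q hq
    obtain ⟨D, hD, rfl⟩ := Finset.mem_image.mp hq
    refine Finset.mem_filter.mpr ⟨Finset.mem_Icc.mpr ⟨Nat.mul_pos hW0 (PD_pos hP D), Nat.le_floor (le_trans ?_ h1)⟩, ?_⟩
    · exact_mod_cast Nat.mul_le_mul_left W (Finset.mem_filter.mp hD).2
    · exact Nat.Coprime.mul_left hWΔ (PD_cop hP hΔ D).symm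
  · have hN0 : (0:ℝ) ≤ 3 * N := by positivity
    have h3 := divsum hP (32 * k ^ 2) (R ^ 2) (Nat.one_le_pow _ _ (by omega))
    refine le_trans ?_ (mul_le_mul_of_nonneg_left h3 hN0)
    rw [Finset.mul_sum]
    refine Finset.sum_le_sum fun D _ => ?_
    simp only [he]
    split_ifs with hD
    swap
    · simp
    have hpos := PD_pos hP D
    have hφ : 0 < Nat.totient (PD pp D) := Nat.totient_pos.mpr hpos
    have hφW : 0 < Nat.totient W := Nat.totient_pos.mpr hW0
    have h4 := chebErr_le P N (W * PD pp D) (Nat.mul_pos hW0 hpos)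
    have h5 : (Nat.totient (W * PD pp D) : ℝ) ≤ N := by
      exact_mod_cast (Nat.totient_le _).trans ((Nat.mul_le_mul_left W hD).trans h2)
    have h6 : (Nat.totient (PD pp D) : ℝ) ≤ Nat.totient (W * PD pp D) := by
      rw [Nat.totient_mul (PD_cop hP hW D)]
      exact_mod_cast Nat.le_mul_of_pos_left _ hφW
    have hφ' : (0:ℝ) < Nat.totient (PD pp D) := by exact_mod_cast hφ
    have h7 : (PD pp D : ℝ) ≤ 2 ^ D.card * Nat.totient (PD pp D) := by exact_mod_cast PD_tot hP D
    have hpos' : (0:ℝ) < PD pp D := by exact_mod_cast hpos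
    have h8 : chebErr P N (W * PD pp D) ≤ 3 * N * (2 ^ D.card * (1 / (PD pp D : ℝ))) := by
      have h9 : (1:ℝ) ≤ N / Nat.totient (W * PD pp D) := by rw [le_div_iff₀ (by linarith)]; linarith
      have h10 : (N:ℝ) / Nat.totient (W * PD pp D) ≤ N / Nat.totient (PD pp D) := by gcongr
      have h11 : 1 / (Nat.totient (PD pp D) : ℝ) ≤ 2 ^ D.card * (1 / (PD pp D : ℝ)) := by
        rw [mul_one_div, div_le_div_iff₀ hφ' hpos']; linarith
      have h12 := mul_le_mul_of_nonneg_left h11 hN0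
      have e1 : 2 * (N:ℝ) / Nat.totient (W * PD pp D) = 2 * (N / Nat.totient (W * PD pp D)) := by ring
      have e2 : 3 * (N:ℝ) * (1 / (Nat.totient (PD pp D) : ℝ)) = 3 * (N / Nat.totient (PD pp D)) := by ring
      rw [e1] at h4; rw [e2] at h12
      linarith
    have e3 : ((32 * k ^ 2 : ℕ):ℝ) = ((16 * k ^ 2 : ℕ):ℝ) * 2 := by push_cast; ring
    rw [e3, mul_pow]
    calc _ ≤ ((16 * k ^ 2 : ℕ):ℝ) ^ D.card * (3 * N * (2 ^ D.card * (1 / (PD pp D : ℝ)))) := by gcongr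
      _ = _ := by ring
  · exact le_trans (Finset.sum_nonneg fun q _ => chebErr_nonneg _ _ _) hc

lemma exists_v0 (hadm : ∀ p : ℕ, p.Prime → ∃ r : ZMod p, ∀ i, (h i : ZMod p) ≠ r) (S : Finset ℕ) (hS : ∀ q ∈ S, q.Prime) : ∃ v, ∀ i, Nat.Coprime (v + h i) (∏ q ∈ S, q) := by
  classical
  induction S using Finset.induction_on with
  | empty => exact ⟨0, fun i => by simp⟩
  | insert q S hq ih =>
    obtain ⟨v, hv⟩ := ih fun x hx => hS x (Finset.mem_insert_of_mem hx)
    have hqp := hS q (Finset.mem_insert_self _ _)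
    have : Fact q.Prime := ⟨hqp⟩
    obtain ⟨r, hr⟩ := hadm q hqp
    have hcop : Nat.Coprime q (∏ x ∈ S, x) := Nat.Coprime.prod_right fun x hx =>
      (Nat.coprime_primes hqp (hS x (Finset.mem_insert_of_mem hx))).mpr fun e => hq (e ▸ hx)
    obtain ⟨w, hw1, hw2⟩ := Nat.chineseRemainder hcop (-r).val v
    refine ⟨w, fun i => ?_⟩
    rw [Finset.prod_insert hq]
    refine Nat.Coprime.mul_right ?_ ?_
    · rw [Nat.coprime_comm, hqp.coprime_iff_not_dvd, ← ZMod.natCast_eq_zero_iff]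
      have e1 : (w : ZMod q) = -r := by
        rw [(ZMod.natCast_eq_natCast_iff _ _ _).mpr hw1]; simp
      push_cast
      rw [e1]
      intro e
      exact hr i (by linear_combination e)
    · rw [Nat.Coprime, (hw2.add_right (h i)).gcd_eq]; exact hv i

lemma theta_lt_one (P : Set ℕ) (θ : ℝ) (Δ : ℕ) (hΔ : 0 < Δ) (p : ℕ) (hp : p ∈ P) (hp0 : 0 < p) (hl : HasLevelOfDistribution P θ Δ) : θ < 1 := by
  by_contra hθ
  push Not at hθ
  obtain ⟨c, hc⟩ := hl.2 1 one_pos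
  obtain ⟨l, hl1, hlp⟩ := Nat.exists_infinite_primes (p * Δ + 2 * p + 1)
  have hpΔ : 0 < p * Δ := Nat.mul_pos hp0 hΔ
  have hcl : Nat.Coprime l (p * Δ) := (hlp.coprime_iff_not_dvd).mpr fun hd => by
    have := Nat.le_of_dvd hpΔ hd; omega
  have key : ∀ J : ℕ, 2 ≤ J → Real.log ((l * (1 + p * Δ) * J : ℕ):ℝ) ≤ 2 * c * (l * (1 + p * Δ)) := by
    intro J hJ
    set N := l * (1 + p * Δ) * J with hN
    have hl2 := hlp.two_le
    have hNJ : J ≤ N := Nat.le_mul_of_pos_left _ (by positivity)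
    have hpN : p ≤ N := by
      have h0 : l ≤ l * ((1 + p * Δ) * J) := Nat.le_mul_of_pos_right l (by positivity)
      rw [hN, mul_assoc]; omega
    have h1 := hc N (by omega)
    have hlog : 0 < Real.log N := Real.log_pos (by exact_mod_cast (by omega : 1 < N))
    set g : ℕ → ℕ := fun j => l * (1 + p * Δ * j) with hg
    have hginj : Function.Injective g := by
      intro i j hij
      have h2 := Nat.eq_of_mul_eq_mul_left hlp.pos hij
      exact Nat.eq_of_mul_eq_mul_left hpΔ (by omega)
    have hcopj : ∀ j, Nat.Coprime (g j) (p * Δ) := fun j => Nat.Coprime.mul_left hcl (by simp)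
    have h2 : ∑ j ∈ Finset.range J, (1/2 : ℝ) ≤ ∑ q ∈ (Finset.Icc 1 ⌊(N : ℝ) ^ θ⌋₊).filter (fun q => Nat.Coprime q Δ), chebErr P N q := by
      calc _ ≤ ∑ j ∈ Finset.range J, chebErr P N (g j) := by
            refine Finset.sum_le_sum fun j _ => ?_
            have hgp : 0 < g j := Nat.mul_pos hlp.pos (by positivity)
            have hb : |(chebCountMod P p (g j) p : ℝ) - (chebCount P p : ℝ) / (Nat.totient (g j) : ℝ)| ≤ chebErr P N (g j) := by
              refine le_csSup ⟨2 * N / Nat.totient (g j) + 1, ?_⟩ ⟨p, hpN, p, ((hcopj j).coprime_dvd_right (dvd_mul_right _ _)).symm, rfl⟩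
              rintro x ⟨y, hy, a, -, rfl⟩
              exact chebTerm_le' P _ _ hgp hy
            have h3 : 1 ≤ chebCountMod P p (g j) p := by
              rw [chebCountMod, Nat.succ_le_iff, Set.ncard_pos ((Set.finite_lt_nat (2 * p)).subset fun x hx => hx.2.2.1)]
              exact ⟨p, hp, le_rfl, by omega, rfl⟩
            have h4 : 2 * p ≤ Nat.totient (g j) := by
              have h5 : Nat.totient l ≤ Nat.totient (g j) := Nat.le_of_dvd (Nat.totient_pos.mpr hgp) (Nat.totient_dvd_of_dvd (dvd_mul_right _ _))
              rw [Nat.totient_prime hlp] at h5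
              omega
            have h5 : (chebCount P p : ℝ) / (Nat.totient (g j) : ℝ) ≤ 1 / 2 := by
              have h6 : (chebCount P p : ℝ) ≤ p := by exact_mod_cast chebCount_le P p
              have h7 : (2:ℝ) * p ≤ Nat.totient (g j) := by exact_mod_cast h4
              have h8 : (0:ℝ) < p := by exact_mod_cast hp0
              rw [div_le_div_iff₀ (by linarith) (by norm_num)]; linarith
            have h9 : (1:ℝ) ≤ chebCountMod P p (g j) p := by exact_mod_cast h3
            have := (le_abs_self _).trans hb
            linarith
        _ = ∑ q ∈ (Finset.range J).image g, chebErr P N q := by rw [Finset.sum_image fun i _ j _ hij => hginj hij]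
        _ ≤ _ := by
            refine Finset.sum_le_sum_of_subset_of_nonneg ?_ fun q _ _ => chebErr_nonneg _ _ _
            intro q hq
            obtain ⟨j, hj, rfl⟩ := Finset.mem_image.mp hq
            rw [Finset.mem_range] at hj
            refine Finset.mem_filter.mpr ⟨Finset.mem_Icc.mpr ⟨Nat.mul_pos hlp.pos (by positivity), Nat.le_floor ?_⟩, (hcopj j).coprime_dvd_right (dvd_mul_left _ _)⟩
            have h3 : g j ≤ N := by
              simp only [hg, hN, mul_assoc]
              gcongr
              calc 1 + p * (Δ * j) ≤ J + p * (Δ * J) := by gcongr; omega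
                _ = _ := by ring
            have h4 : (N:ℝ) ≤ (N:ℝ) ^ θ := Real.self_le_rpow_of_one_le (by exact_mod_cast (by omega : 1 ≤ N)) hθ
            exact le_trans (by exact_mod_cast h3) h4
    rw [Finset.sum_const, Finset.card_range, nsmul_eq_mul] at h2
    have h3 := h2.trans h1
    rw [Real.rpow_one, le_div_iff₀ hlog] at h3
    have hJ0 : (0:ℝ) < J := by exact_mod_cast (by omega : 0 < J)
    have hNc : (N:ℝ) = l * (1 + p * Δ) * J := by rw [hN]; push_cast; ring
    have h4 : (J:ℝ) * Real.log N ≤ J * (2 * c * (l * (1 + p * Δ))) := by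
      have : c * (N:ℝ) = c * (l * (1 + p * Δ) * J) := by rw [hNc]
      nlinarith
    exact le_of_mul_le_mul_left h4 hJ0
  have ht : Tendsto (fun J : ℕ => Real.log ((l * (1 + p * Δ) * J : ℕ):ℝ)) atTop atTop := by
    refine Real.tendsto_log_atTop.comp (tendsto_natCast_atTop_atTop.comp ?_)
    exact tendsto_atTop_mono (fun J => Nat.le_mul_of_pos_left J (Nat.mul_pos hlp.pos (by positivity))) tendsto_id
  obtain ⟨J, hJ1, hJ2⟩ := ((ht.eventually_gt_atTop (2 * c * (l * (1 + p * Δ)))).and (eventually_ge_atTop 2)).exists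
  exact absurd (key J hJ2) (not_le.mpr hJ1)
end
end
end

section
section
open Module nonZeroDivisors Ideal Pointwise Filter Topology
section
/-- the sieve level -/
noncomputable def RR (ρ : ℝ) (N : ℕ) : ℕ := ⌊(N:ℝ) ^ ρ⌋₊

lemma RR_tendsto (ρ : ℝ) (hρ : 0 < ρ) : Tendsto (RR ρ) atTop atTop :=
  tendsto_nat_floor_atTop.comp ((tendsto_rpow_atTop hρ).comp tendsto_natCast_atTop_atTop)

lemma logR_bounds (ρ : ℝ) (N : ℕ) (hN : 1 ≤ N) (hR : 1 ≤ RR ρ N) : ρ * Real.log N - Real.log 2 ≤ Real.log (RR ρ N) ∧ Real.log (RR ρ N) ≤ ρ * Real.log N := by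
  have hN0 : (0:ℝ) < N := by exact_mod_cast hN
  have hR0 : (1:ℝ) ≤ RR ρ N := by exact_mod_cast hR
  rw [← Real.log_rpow hN0]
  have h1 : ((RR ρ N : ℕ):ℝ) ≤ (N:ℝ) ^ ρ := Nat.floor_le (by positivity)
  have h2 : (N:ℝ) ^ ρ < RR ρ N + 1 := Nat.lt_floor_add_one _
  constructor
  · rw [sub_le_iff_le_add, ← Real.log_mul (by linarith) (by norm_num)]
    exact Real.log_le_log (by positivity) (by linarith)
  · exact Real.log_le_log (by linarith) h1

lemma logN_tendsto : Tendsto (fun N : ℕ => Real.log N) atTop atTop := Real.tendsto_log_atTop.comp tendsto_natCast_atTop_atTop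

lemma logR_tendsto (ρ : ℝ) (hρ : 0 < ρ) : Tendsto (fun N : ℕ => Real.log (RR ρ N) / Real.log N) atTop (𝓝 ρ) := by
  have h1 : Tendsto (fun N : ℕ => ρ - Real.log 2 / Real.log N) atTop (𝓝 ρ) := by
    simpa using tendsto_const_nhds.sub (logN_tendsto.const_div_atTop (Real.log 2))
  refine tendsto_of_tendsto_of_tendsto_of_le_of_le' h1 tendsto_const_nhds ?_ ?_
  all_goals
    filter_upwards [eventually_ge_atTop 1, (RR_tendsto ρ hρ).eventually_ge_atTop 1, logN_tendsto.eventually_gt_atTop 0] with N hN hR hL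
    have h2 := logR_bounds ρ N hN hR
  · rw [le_div_iff₀ hL, sub_mul, div_mul_cancel₀ _ hL.ne']; exact h2.1
  · rw [div_le_iff₀ hL]; exact h2.2

lemma pow_small (k : ℕ) (s : ℝ) (hs : s < 1) : Tendsto (fun N : ℕ => Real.log N ^ k * (N:ℝ) ^ s / N) atTop (𝓝 0) := by
  have h1 := ((isLittleO_log_rpow_rpow_atTop (k:ℝ) (by linarith : 0 < 1 - s)).tendsto_div_nhds_zero).comp tendsto_natCast_atTop_atTop
  refine h1.congr' ?_
  filter_upwards [eventually_ge_atTop 1] with N hN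
  have hN0 : (0:ℝ) < N := by exact_mod_cast hN
  simp only [Function.comp, Real.rpow_natCast]
  rw [Real.rpow_sub hN0, Real.rpow_one, div_div_eq_mul_div]

lemma ev_facts (θ ρ : ℝ) (hρ : 0 < ρ) (hρθ : 2 * ρ < θ) (hθ : θ < 1) (W : ℕ) (hW : 0 < W) :
    ∀ᶠ N : ℕ in atTop, 1 ≤ Real.log N ∧ 2 ≤ RR ρ N ∧ ((W * RR ρ N ^ 2 : ℕ):ℝ) ≤ (N:ℝ) ^ θ ∧ W * RR ρ N ^ 2 ≤ N ∧ RR ρ N < N ∧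
      1 + Real.log (RR ρ N) ≤ 3 * Real.log N ∧ 1 + Real.log ((RR ρ N ^ 2 : ℕ):ℝ) ≤ 3 * Real.log N ∧ ((RR ρ N:ℕ):ℝ) ^ 2 ≤ (N:ℝ) ^ (2 * ρ) := by
  have h1 := ((tendsto_rpow_atTop (by linarith : 0 < θ - 2 * ρ)).comp tendsto_natCast_atTop_atTop).eventually_ge_atTop (W:ℝ)
  filter_upwards [eventually_ge_atTop 1, (RR_tendsto ρ hρ).eventually_ge_atTop 2, logN_tendsto.eventually_ge_atTop 1, h1] with N hN hR hL hW'
  have hN0 : (0:ℝ) < N := by exact_mod_cast hN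
  have h2 := (logR_bounds ρ N hN (by omega)).2
  have h3 : ((RR ρ N:ℕ):ℝ) ^ 2 ≤ (N:ℝ) ^ (2 * ρ) := by
    have : ((RR ρ N : ℕ):ℝ) ≤ (N:ℝ) ^ ρ := Nat.floor_le (by positivity)
    calc _ ≤ ((N:ℝ) ^ ρ) ^ 2 := by gcongr
      _ = _ := by rw [← Real.rpow_natCast, ← Real.rpow_mul hN0.le]; congr 1; push_cast; ring
  have h4 : ((W * RR ρ N ^ 2 : ℕ):ℝ) ≤ (N:ℝ) ^ θ := by
    push_cast
    simp only [Function.comp] at hW'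
    calc (W:ℝ) * (RR ρ N : ℝ) ^ 2 ≤ (N:ℝ) ^ (θ - 2 * ρ) * (N:ℝ) ^ (2 * ρ) := by gcongr
      _ = _ := by rw [← Real.rpow_add hN0]; congr 1; ring
  have h5 : W * RR ρ N ^ 2 ≤ N := by
    have h6 : (N:ℝ) ^ θ ≤ (N:ℝ) ^ (1:ℝ) := Real.rpow_le_rpow_of_exponent_le (by exact_mod_cast hN) hθ.le
    rw [Real.rpow_one] at h6
    exact_mod_cast h4.trans h6
  have h7 : ρ * Real.log N ≤ 1 / 2 * Real.log N := by gcongr; linarith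
  refine ⟨hL, hR, h4, h5, ?_, by linarith, ?_, h3⟩
  · nlinarith [Nat.le_mul_of_pos_left (RR ρ N ^ 2) hW]
  · push_cast; rw [Real.log_pow]; push_cast; linarith

/-- choice of the parameters -/
lemma choose_D (k : ℕ) (r1 δ θ φ B I SJ : ℝ) (hkey : r1 * I < δ * (θ / 2) * φ * SJ) (D1 : ℕ) :
    ∃ D0 : ℕ, D1 ≤ D0 ∧ 2 ≤ D0 ∧ r1 * (Real.exp (8 * k / (D0:ℝ)) * (I + 1 / (D0:ℝ))) <
      δ * (1 - 1 / (D0:ℝ)) * (θ / 2 * (1 - 1 / (D0:ℝ)) * φ * (SJ - k * (B ^ 2 * (((k + 2) ^ 2 + k * (k + 2)) / (D0:ℝ)) + 1 / (D0:ℝ)))) := by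
  have h0 : Tendsto (fun D0 : ℕ => 1 / (D0:ℝ)) atTop (𝓝 0) := tendsto_one_div_atTop_nhds_zero_nat
  have hL : Continuous (fun x : ℝ => r1 * (Real.exp (8 * k * x) * (I + x))) := by fun_prop
  have hR : Continuous (fun x : ℝ => δ * (1 - x) * (θ / 2 * (1 - x) * φ * (SJ - k * (B ^ 2 * (((k + 2) ^ 2 + k * (k + 2)) * x) + x)))) := by fun_prop
  have h1 := (hL.tendsto 0).comp h0
  have h2 := (hR.tendsto 0).comp h0
  have h3 := h1.eventually_lt h2 (by simp; linarith)
  obtain ⟨D0, h4, h5, h6⟩ := (h3.and ((eventually_ge_atTop D1).and (eventually_ge_atTop 2))).exists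
  refine ⟨D0, h5, h6, ?_⟩
  simp only [Function.comp, mul_one_div] at h4
  exact h4
end
end
end

section
section
open Module nonZeroDivisors Ideal Pointwise Filter Topology
section
variable {n k : ℕ} {V R D0 W : ℕ} {pp : Fin n → ℕ} {h : Fin k → ℕ}

lemma sum_exchange (P : Set ℕ) (N : ℕ) (A : Finset ℕ) (X : ℕ → ℝ) (r1 : ℕ) (hr : ∀ a ∈ A, {i : Fin k | a + h i ∈ P}.ncard ≤ r1) :
    ∑ m, ∑ a ∈ AP P N (h m) A, X a ^ 2 ≤ r1 * ∑ a ∈ A, X a ^ 2 := by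
  classical
  have e1 : ∑ m, ∑ a ∈ AP P N (h m) A, X a ^ 2 = ∑ a ∈ A, ∑ m, if (a + h m ∈ P ∧ N ≤ a + h m ∧ a + h m < 2 * N) then X a ^ 2 else 0 := by
    rw [Finset.sum_comm]
    refine Finset.sum_congr rfl fun m _ => ?_
    rw [← Finset.sum_filter]
    unfold AP; congr!
  rw [e1, Finset.mul_sum]
  refine Finset.sum_le_sum fun a ha => ?_
  rw [← Finset.sum_filter, Finset.sum_const, nsmul_eq_mul]
  refine mul_le_mul_of_nonneg_right ?_ (sq_nonneg _)
  have h1 := hr a ha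
  rw [Set.ncard_eq_toFinset_card'] at h1
  refine Nat.cast_le.mpr (le_trans (Finset.card_le_card fun i hi => ?_) h1)
  simp only [Finset.mem_filter, Finset.mem_univ, true_and, Set.mem_toFinset, Set.mem_ofPred_eq] at hi ⊢
  exact hi.1

lemma err2 (L Λ2 B c N Z : ℝ) (k : ℕ) (hL : 1 ≤ L) (hN : 0 ≤ N) (hc : 0 ≤ c) (hΛ0 : 0 ≤ Λ2) (hΛ : Λ2 ≤ B ^ 2 * (3 * L) ^ (4 * k)) (u : ℝ) (hu0 : 0 ≤ u) (hu : u ≤ 3 * L)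
    (hZ : Z ^ 2 ≤ (c * N / L ^ (32 * k ^ 2 + 8 * k + 2)) * (3 * N * u ^ (32 * k ^ 2))) :
    Λ2 * Z ≤ B ^ 2 * 3 ^ (4 * k) * √(3 * c * 3 ^ (32 * k ^ 2)) * N / L := by
  have hL0 : 0 < L := by linarith
  have h1 : Z ≤ √(3 * c * 3 ^ (32 * k ^ 2)) * N / L ^ (4 * k + 1) := by
    apply le_of_abs_le
    apply abs_le_of_sq_le_sq _ (by positivity)
    rw [div_pow, mul_pow, Real.sq_sqrt (by positivity)]
    refine hZ.trans ?_
    have : (c * N / L ^ (32 * k ^ 2 + 8 * k + 2)) * (3 * N * u ^ (32 * k ^ 2)) ≤ (c * N / L ^ (32 * k ^ 2 + 8 * k + 2)) * (3 * N * (3 * L) ^ (32 * k ^ 2)) := by gcongr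
    refine this.trans (le_of_eq ?_)
    have e : (32 * k ^ 2 + 8 * k + 2) = 32 * k ^ 2 + (4 * k + 1) * 2 := by ring
    rw [e, pow_add, pow_mul L (4 * k + 1) 2, mul_pow]
    have hx : 0 < L ^ (4 * k + 1) := by positivity
    have hy : 0 < L ^ (32 * k ^ 2) := by positivity
    generalize L ^ (4 * k + 1) = x at hx ⊢
    generalize L ^ (32 * k ^ 2) = y at hy ⊢
    generalize (3:ℝ) ^ (32 * k ^ 2) = z
    field_simp
  have h2 : 0 ≤ √(3 * c * 3 ^ (32 * k ^ 2)) * N / L ^ (4 * k + 1) := by positivity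
  calc Λ2 * Z ≤ (B ^ 2 * (3 * L) ^ (4 * k)) * (√(3 * c * 3 ^ (32 * k ^ 2)) * N / L ^ (4 * k + 1)) :=
        (mul_le_mul_of_nonneg_left h1 hΛ0).trans (mul_le_mul_of_nonneg_right hΛ h2)
    _ = _ := by rw [mul_pow, pow_succ]; field_simp; ring

lemma final_alg (d N L w f S Y cnt k C2 r1 H e C1 T : ℝ) (j : ℕ) (hN : 0 < N) (hL : 0 < L) (hw : 0 < w) (hf : 0 < f) (hS : 0 ≤ S) (hY : 1 ≤ Y)
    (hk : 0 ≤ k) (hC2 : 0 ≤ C2) (hr1 : 0 ≤ r1) (hC1 : 0 ≤ C1) (hT : 0 ≤ T)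
    (hcnt : d * N / L ≤ cnt) (hm : cnt / f * (S * Y ^ (j + 1)) - k * (C2 * N / L) ≤ r1 * ((N + H) / w * (e * Y ^ j) + C1 * T)) :
    d * (Y / L) * (w / f) * S ≤ r1 * (1 + H / N) * e + w * (k * C2 / L + r1 * C1 * (T / N)) := by
  have hYj : 1 ≤ Y ^ j := one_le_pow₀ hY
  have h1 : d * N / L / f * (S * Y ^ (j + 1)) ≤ cnt / f * (S * Y ^ (j + 1)) := by gcongr
  have h2 : k * (C2 * N / L) ≤ k * (C2 * N / L) * Y ^ j := le_mul_of_one_le_right (by positivity) hYj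
  have h3 : r1 * (C1 * T) ≤ r1 * (C1 * T) * Y ^ j := le_mul_of_one_le_right (by positivity) hYj
  have h4 : (d * (Y / L) * (w / f) * S) * (N / w * Y ^ j) ≤ (r1 * (1 + H / N) * e + w * (k * C2 / L + r1 * C1 * (T / N))) * (N / w * Y ^ j) := by
    have e1 : (d * (Y / L) * (w / f) * S) * (N / w * Y ^ j) = d * N / L / f * (S * Y ^ (j + 1)) := by rw [pow_succ]; field_simp
    have e2 : (r1 * (1 + H / N) * e + w * (k * C2 / L + r1 * C1 * (T / N))) * (N / w * Y ^ j) =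
      r1 * ((N + H) / w * (e * Y ^ j)) + k * (C2 * N / L) * Y ^ j + r1 * (C1 * T) * Y ^ j := by field_simp; ring
    rw [e1, e2]; rw [mul_add] at hm; linarith
  exact le_of_mul_le_mul_right h4 (by positivity)

/-- the inequality at a fixed `N` -/
lemma fixed_N (P : Set ℕ) (hPp : ∀ q ∈ P, q.Prime) (Δ : ℕ) (θ c : ℝ) (hP : PEnum V R D0 pp) (hR : 2 ≤ R) (hW : W ∣ V) (hW0 : 0 < W) (hΔ : Δ ∣ V)
    (hWΔ : Nat.Coprime W Δ) (hinj : Function.Injective h) (hD : ∀ i j, h i ≤ h j + D0)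
    {F : (Fin k → ℝ) → ℝ} (hF : Function.support F ⊆ maynardSimplex k) (B : ℝ) (hB : ∀ t, |F t| ≤ B) (N H v0 r1 : ℕ) (hN : H ≤ N) (hRN : R < N)
    (hH : ∀ m, h m ≤ H) (hv : ∀ m, Nat.Coprime (v0 + h m) W) (hr : ∀ a, N - H ≤ a → {i : Fin k | a + h i ∈ P}.ncard ≤ r1)
    (hc0 : 0 ≤ c)
    (hc : ∑ q ∈ (Finset.Icc 1 ⌊(N : ℝ) ^ θ⌋₊).filter (fun q => Nat.Coprime q Δ), chebErr P N q ≤ c * N / Real.log N ^ ((32 * k ^ 2 + 8 * k + 2 : ℕ):ℝ))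
    (h1 : ((W * R ^ 2 : ℕ):ℝ) ≤ (N:ℝ) ^ θ) (h2 : W * R ^ 2 ≤ N) (hL : 1 ≤ Real.log N) (hu : 1 + Real.log R ≤ 3 * Real.log N)
    (hu2 : 1 + Real.log ((R ^ 2 : ℕ):ℝ) ≤ 3 * Real.log N) :
    (chebCount P N : ℝ) / Nat.totient W * (∑ m, Q2 m F R pp) - k * (B ^ 2 * 3 ^ (4 * k) * √(3 * c * 3 ^ (32 * k ^ 2)) * N / Real.log N) ≤
      r1 * ((N + H) / W * Q1 F R pp + B ^ 2 * 3 ^ (8 * k) * (Real.log N ^ (8 * k) * (R:ℝ) ^ 2)) := by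
  set Λ := B * (1 + Real.log R) ^ (2 * k) with hΛ
  have hlR : 0 ≤ Real.log R := Real.log_natCast_nonneg _
  have hlR2 : 0 ≤ Real.log ((R ^ 2 : ℕ):ℝ) := Real.log_natCast_nonneg _
  have hlam := lam_bound hP hR hF B hB
  have hΛ2 : Λ ^ 2 ≤ B ^ 2 * (3 * Real.log N) ^ (4 * k) := by
    rw [hΛ, mul_pow, ← pow_mul, show 2 * k * 2 = 4 * k by ring]
    gcongr
  have hS1 := S1_bound hP hR hW hW0 hinj hD hF Λ hlam N H v0 hN
  have hS2 := fun m => S2_bound P hPp hP hR hW hW0 hinj hD hF Λ hlam N H v0 hN hRN m (hH m) (hv m)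
  have hZ := err_bound (k := k) P Δ θ _ c hP hW0 hW hΔ hWΔ hR N hc h1 h2
  rw [Real.rpow_natCast] at hZ
  have hE2 := err2 (Real.log N) (Λ ^ 2) B c N _ k hL (by positivity) hc0 (sq_nonneg _) hΛ2 _ (by positivity) hu2 hZ
  have hE1 : Λ ^ 2 * (R ^ 2 * (1 + Real.log ((R ^ 2 : ℕ):ℝ)) ^ (4 * k)) ≤ B ^ 2 * 3 ^ (8 * k) * (Real.log N ^ (8 * k) * (R:ℝ) ^ 2) := by
    calc _ ≤ B ^ 2 * (3 * Real.log N) ^ (4 * k) * (R ^ 2 * (3 * Real.log N) ^ (4 * k)) := by gcongr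
      _ = _ := by rw [show 8 * k = 4 * k + 4 * k by ring]; simp only [mul_pow, pow_add]; ring
  have hex := sum_exchange (h := h) P N (AS N H W v0) (fun a => XX F R pp (om h pp a)) r1 fun a ha => hr a (by
    simp only [AS, Finset.mem_filter, Finset.mem_Ico] at ha; exact ha.1.1)
  have hsum := Finset.sum_le_sum fun m (_ : m ∈ Finset.univ) => hS2 m
  rw [Finset.sum_sub_distrib, ← Finset.mul_sum, Finset.sum_const, Finset.card_univ, Fintype.card_fin, nsmul_eq_mul] at hsum
  have h3 := mul_le_mul_of_nonneg_left hE2 (Nat.cast_nonneg (α := ℝ) k)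
  have h4 := mul_le_mul_of_nonneg_left (hS1.trans (add_le_add_right hE1 _)) (Nat.cast_nonneg (α := ℝ) r1)
  linarith

end
end
end

section
section
open Module nonZeroDivisors Ideal Pointwise Filter Topology
section

theorem maynard_core (K : Type) [Field K] [NumberField K] [IsGalois ℚ K] (C : ConjClasses (K ≃ₐ[ℚ] K)) (θ : ℝ)
    (hlod : HasLevelOfDistribution (chebotarevSet K C) θ (discr K).natAbs)
    (k : ℕ) (hk : 0 < k) (h : Fin k → ℕ) (hinj : Function.Injective h)
    (hadm : ∀ p : ℕ, p.Prime → ∃ r : ZMod p, ∀ i, (h i : ZMod p) ≠ r)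
    (F : (Fin k → ℝ) → ℝ) (hF : Continuous F) (hS : Function.support F ⊆ maynardSimplex k) (hF0 : ∀ t, 0 ≤ F t) (B : ℝ) (hB : ∀ t, F t ≤ B)
    (r1 : ℕ) (hkey : r1 * maynardI k F < ((Nat.card C.carrier : ℝ) / (Nat.card (K ≃ₐ[ℚ] K) : ℝ)) * (θ / 2) * cV (discr K).natAbs * ∑ i, maynardJ k i F)
    (N0 : ℕ) : ∃ n ≥ N0, r1 + 1 ≤ {i : Fin k | n + h i ∈ chebotarevSet K C}.ncard := by
  classical
  set P := chebotarevSet K C with hPdef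
  set Δ := (discr K).natAbs with hΔdef
  set δ : ℝ := (Nat.card C.carrier : ℝ) / (Nat.card (K ≃ₐ[ℚ] K) : ℝ) with hδdef
  have hΔ0 : 0 < Δ := Int.natAbs_pos.mpr (discr_ne_zero K)
  have hPp : ∀ q ∈ P, q.Prime := fun q hq => hq.1
  have hδ : 0 < δ := by
    have : Nonempty C.carrier := by
      obtain ⟨g, rfl⟩ := ConjClasses.exists_rep C
      exact ⟨⟨g, ConjClasses.mem_carrier_mk⟩⟩
    have h1 : 0 < Nat.card C.carrier := Nat.card_pos
    have h2 : 0 < Nat.card (K ≃ₐ[ℚ] K) := Nat.card_pos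
    positivity
  have hθ0 := hlod.1
  have hθ1 : θ < 1 := by
    obtain ⟨N, hN, hc⟩ := cheb_count_lower K C θ hlod (δ / 2) (by positivity) (half_lt_self hδ) 2
    have h1 : 0 < Real.log N := Real.log_pos (by exact_mod_cast (by omega : 1 < N))
    have h2 : 0 < chebCount P N := by
      have : (0:ℝ) < δ / 2 * N / Real.log N := by
        have : (0:ℝ) < N := by exact_mod_cast (by omega : 0 < N)
        positivity
      exact_mod_cast this.trans_le hc
    obtain ⟨p, hp⟩ := Set.nonempty_of_ncard_ne_zero h2.ne'
    exact theta_lt_one P θ Δ hΔ0 p hp.1 (hPp p hp.1).pos hlod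
  set H := ∑ i, h i with hHdef
  have hH : ∀ m, h m ≤ H := fun m => Finset.single_le_sum (fun i _ => Nat.zero_le (h i)) (Finset.mem_univ m)
  obtain ⟨D0, hD1, hD2, hgap⟩ := choose_D k r1 δ θ (cV Δ) B (maynardI k F) (∑ i, maynardJ k i F) hkey (k + 1 + H)
  set x : ℝ := 1 / (D0:ℝ) with hx
  have hx0 : 0 < x := by
    have : (0:ℝ) < D0 := by exact_mod_cast (by omega : 0 < D0)
    positivity
  have hx1 : x < 1 := by
    rw [hx, div_lt_one (by exact_mod_cast (by omega : 0 < D0))]; exact_mod_cast (by omega : 1 < D0)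
  set η : ℝ := B ^ 2 * (((k + 2) ^ 2 + k * (k + 2)) / (D0:ℝ)) + x with hη
  set SS : ℝ := ∑ i, maynardJ k i F - k * η with hSS
  set ee : ℝ := Real.exp (8 * k / (D0:ℝ)) * (maynardI k F + x) with hee
  set d := δ * (1 - x) with hd
  set ρ := θ / 2 * (1 - x) with hρ
  have hx1' : 0 < 1 - x := by linarith
  have hI0 : 0 ≤ maynardI k F := integral_nonneg fun t => sq_nonneg _
  have hee0 : 0 ≤ ee := by positivity
  have hd0 : 0 < d := by positivity
  have hρ0 : 0 < ρ := by positivity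
  have hdlt : d < δ := by rw [hd]; nlinarith
  have hρθ : 2 * ρ < θ := by rw [hρ]; nlinarith
  have hcΔ := cV_pos Δ hΔ0
  have hSS0 : 0 ≤ SS := by
    have h1 : 0 < d * (ρ * cV Δ * SS) := lt_of_le_of_lt (by positivity) hgap
    by_contra hneg
    push Not at hneg
    have : d * (ρ * cV Δ * SS) ≤ 0 := mul_nonpos_of_nonneg_of_nonpos hd0.le (mul_nonpos_of_nonneg_of_nonpos (by positivity) hneg.le)
    linarith
  set S := (Finset.range (D0 + 1)).filter (fun q => q.Prime ∧ ¬ q ∣ Δ) with hSdef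
  have hSp : ∀ q ∈ S, q.Prime := fun q hq => (Finset.mem_filter.mp hq).2.1
  obtain ⟨v0, hv0⟩ := exists_v0 hadm S hSp
  set W := ∏ q ∈ S, q with hW
  have hW0 : 0 < W := Finset.prod_pos fun q hq => (hSp q hq).pos
  have hWΔ : Nat.Coprime W Δ := Nat.Coprime.prod_left fun q hq => ((hSp q hq).coprime_iff_not_dvd).mpr (Finset.mem_filter.mp hq).2.2
  set V := W * Δ with hV
  have hV0 : 0 < V := Nat.mul_pos hW0 hΔ0
  have hVD : ∀ q : ℕ, q.Prime → q ≤ D0 → ¬ Nat.Coprime q V := by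
    intro q hq hqD hcop
    refine (hq.coprime_iff_not_dvd.mp hcop) ?_
    by_cases hqΔ : q ∣ Δ
    · exact hqΔ.mul_left _
    · exact (Finset.dvd_prod_of_mem (fun q => q) (Finset.mem_filter.mpr ⟨Finset.mem_range.mpr (by omega), hq, hqΔ⟩)).mul_right _
  have hφW : (0:ℝ) < Nat.totient W := by exact_mod_cast Nat.totient_pos.mpr hW0
  have hWr : (0:ℝ) < W := by exact_mod_cast hW0
  have hcV : cV V * (W / Nat.totient W) = cV Δ := by
    have : (0:ℝ) < Δ := by exact_mod_cast hΔ0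
    unfold cV
    rw [hV, Nat.totient_mul hWΔ]; push_cast; field_simp
  have hcV0 := cV_pos V hV0
  obtain ⟨c, hc⟩ := hlod.2 ((32 * k ^ 2 + 8 * k + 2 : ℕ):ℝ) (by exact_mod_cast (by omega : 0 < 32 * k ^ 2 + 8 * k + 2))
  by_contra hcon
  push Not at hcon
  set C2 := B ^ 2 * 3 ^ (4 * k) * √(3 * |c| * 3 ^ (32 * k ^ 2)) with hC2
  set C1 := B ^ 2 * 3 ^ (8 * k) with hC1
  have hRt := RR_tendsto ρ hρ0
  have ev1 := hRt.eventually (Q1_asymp V D0 hV0 hk (by omega) F hF hS x hx0)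
  have ev2 := hRt.eventually (eventually_all.mpr fun m => Q2_asymp V D0 hV0 m (by omega) F hF hF0 B hB x hx0)
  have ev3 := ev_facts θ ρ hρ0 hρθ hθ1 W hW0
  have evY : ∀ᶠ N : ℕ in atTop, 1 ≤ cV V * Real.log (RR ρ N) :=
    ((logN_tendsto.comp hRt).const_mul_atTop hcV0).eventually_ge_atTop 1
  have t1 : Tendsto (fun N : ℕ => d * (cV V * Real.log (RR ρ N) / Real.log N) * (W / Nat.totient W) * SS) atTop (𝓝 (d * (cV V * ρ) * (W / Nat.totient W) * SS)) := by
    have := ((logR_tendsto ρ hρ0).const_mul (cV V))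
    simp only [← mul_div_assoc] at this
    exact (((this).const_mul d).mul_const _).mul_const _
  have t2 : Tendsto (fun N : ℕ => r1 * (1 + (H:ℝ) / N) * ee + W * (k * C2 / Real.log N + r1 * C1 * (Real.log N ^ (8 * k) * (N:ℝ) ^ (2 * ρ) / N))) atTop
      (𝓝 (r1 * (1 + 0) * ee + W * (0 + r1 * C1 * 0))) :=
    (((tendsto_const_div_atTop_nhds_zero_nat (H:ℝ)).const_add 1).const_mul (r1:ℝ)).mul_const ee |>.add
      (((logN_tendsto.const_div_atTop _).add ((pow_small (8 * k) (2 * ρ) (by linarith)).const_mul _)).const_mul _)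
  have evG := t2.eventually_lt t1 (by
    have e : d * (cV V * ρ) * (W / Nat.totient W) * SS = d * (ρ * cV Δ * SS) := by rw [← hcV]; ring
    rw [e]; simpa using hgap)
  obtain ⟨N1, hN1⟩ := eventually_atTop.mp (ev1.and (ev2.and (ev3.and (evY.and (evG.and (eventually_ge_atTop (N0 + H + 2)))))))
  obtain ⟨N, hN, hcnt⟩ := cheb_count_lower K C θ hlod d hd0.le hdlt N1
  obtain ⟨e1, e2, ⟨f1, f2, f3, f4, f5, f6, f7, f8⟩, eY, eG, eN⟩ := hN1 N hN
  obtain ⟨n, pp, hP⟩ := exists_PEnum V (RR ρ N) D0 hVD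
  have hcN : ∑ q ∈ (Finset.Icc 1 ⌊(N : ℝ) ^ θ⌋₊).filter (fun q => Nat.Coprime q Δ), chebErr P N q ≤ |c| * N / Real.log N ^ ((32 * k ^ 2 + 8 * k + 2 : ℕ):ℝ) := by
    refine (hc N (by omega)).trans ?_
    have := le_abs_self c
    gcongr
  have hfix := fixed_N P hPp Δ θ |c| hP f2 (Dvd.intro _ rfl : W ∣ V) hW0 (Dvd.intro_left _ rfl : Δ ∣ V) hWΔ hinj
    (fun i j => by have := hH i; omega) hS B (fun t => by rw [abs_of_nonneg (hF0 t)]; exact hB t) N H v0 r1 (by omega) f5 hH hv0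
    (fun a ha => by have := hcon a (by omega); omega) (abs_nonneg c) hcN f3 f4 f1 f6 f7
  have hQ2 : SS * (cV V * Real.log (RR ρ N)) ^ (k + 1) ≤ ∑ m, Q2 m F (RR ρ N) pp := by
    refine le_trans (le_of_eq ?_) (Finset.sum_le_sum fun m _ => e2 m n pp hP)
    rw [← Finset.sum_mul, hSS, hη]
    congr 1
    simp only [Finset.sum_sub_distrib, Finset.sum_const, Finset.card_univ, Fintype.card_fin, nsmul_eq_mul]
    ring
  have hQ1 : Q1 F (RR ρ N) pp ≤ ee * (cV V * Real.log (RR ρ N)) ^ k := by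
    refine (e1 n pp hP).trans (le_of_eq ?_); rw [hee]; ring
  have hNr : (0:ℝ) < N := by exact_mod_cast (by omega : 0 < N)
  have hB2 : 0 ≤ C1 := by positivity
  have hm : (chebCount P N : ℝ) / Nat.totient W * (SS * (cV V * Real.log (RR ρ N)) ^ (k + 1)) - k * (C2 * N / Real.log N) ≤
      r1 * ((N + H) / W * (ee * (cV V * Real.log (RR ρ N)) ^ k) + C1 * (Real.log N ^ (8 * k) * (N:ℝ) ^ (2 * ρ))) := by
    refine le_trans (sub_le_sub_right (mul_le_mul_of_nonneg_left hQ2 (by positivity)) _) (hfix.trans ?_)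
    gcongr
  have hfin := final_alg d N (Real.log N) W (Nat.totient W) SS (cV V * Real.log (RR ρ N)) _ k C2 r1 H ee C1 _ k hNr (by linarith) hWr hφW hSS0 eY
    (by positivity) (by positivity) (by positivity) hB2 (by positivity) hcnt hm
  linarith

end
end
end


section
open Module nonZeroDivisors Ideal Pointwise Filter Topology
section

lemma absF {k : ℕ} (F : (Fin k → ℝ) → ℝ) (hF : Continuous F) (hS : Function.support F ⊆ maynardSimplex k) :
    (∃ B, ∀ t, |F t| ≤ B) ∧ maynardI k (fun t => |F t|) = maynardI k F ∧ ∀ i, maynardJ k i F ≤ maynardJ k i (fun t => |F t|) := by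
  have hc : IsCompact (Set.univ.pi fun _ : Fin k => Set.Icc (0:ℝ) 1) := isCompact_univ_pi fun _ => isCompact_Icc
  have hFs : HasCompactSupport F := HasCompactSupport.of_support_subset_isCompact hc fun t ht i _ => (hS ht).1 i
  refine ⟨?_, ?_, fun i => ?_⟩
  · obtain ⟨B, hB⟩ := hF.bounded_above_of_compact_support hFs
    exact ⟨B, hB⟩
  · simp [maynardI, sq_abs]
  · unfold maynardJ
    have hcont : ∀ t, Continuous fun x : ℝ => F (Function.update t i x) := fun t => hF.comp (continuous_const.update i continuous_id)
    have hG : Continuous fun t : Fin k → ℝ => (∫ x in (0:ℝ)..1, |F (Function.update t i x)|) ^ 2 := by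
      refine Continuous.pow ?_ 2
      refine intervalIntegral.continuous_parametric_intervalIntegral_of_continuous' ?_ 0 1
      exact (hF.comp (continuous_fst.update i continuous_snd)).abs
    refine integral_mono_of_nonneg (Filter.Eventually.of_forall fun t => sq_nonneg _) (hG.continuousOn.integrableOn_compact hc) (Filter.Eventually.of_forall fun t => ?_)
    simp only
    rw [← sq_abs]
    gcongr
    exact intervalIntegral.abs_integral_le_integral_abs (by norm_num)

lemma liminf_bound {k : ℕ} (h : Fin k → ℕ) (hinj : Function.Injective h) (P : Set ℕ) (r1 : ℕ) (hr : ∀ N : ℕ, ∃ n ≥ N, r1 + 1 ≤ {i : Fin k | n + h i ∈ P}.ncard) (D : ℕ)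
    (hD : ∀ i j, h i - h j ≤ D) :
    Filter.liminf (fun n => (Nat.nth (· ∈ P) (n + r1) : ℝ) - (Nat.nth (· ∈ P) n : ℝ)) Filter.atTop ≤ (D:ℝ) := by
  classical
  have hinf : {n | n ∈ P}.Infinite := by
    refine Set.infinite_of_not_bddAbove fun ⟨b, hb⟩ => ?_
    obtain ⟨n, hn, hc⟩ := hr (b + 1)
    obtain ⟨i, hi⟩ := Set.nonempty_of_ncard_ne_zero (by omega : {i : Fin k | n + h i ∈ P}.ncard ≠ 0)
    have := hb hi
    omega
  refine Filter.liminf_le_of_frequently_le ?_ ?_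
  · refine Filter.frequently_atTop.mpr fun M0 => ?_
    obtain ⟨n, hn, hc⟩ := hr (Nat.nth (· ∈ P) M0)
    set T := Finset.univ.filter (fun i : Fin k => n + h i ∈ P) with hT
    have hTc : r1 + 1 ≤ T.card := by
      rw [Set.ncard_eq_toFinset_card'] at hc
      refine hc.trans (le_of_eq (congrArg _ ?_))
      ext i; simp [hT]
    have hTn : T.Nonempty := Finset.card_pos.mp (by omega)
    obtain ⟨i0, hi0, hmin⟩ := Finset.exists_min_image T h hTn
    obtain ⟨i1, hi1, hmax⟩ := Finset.exists_max_image T h hTn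
    have hi0P : n + h i0 ∈ P := (Finset.mem_filter.mp hi0).2
    refine ⟨Nat.count (· ∈ P) (n + h i0), ?_, ?_⟩
    · rw [← Nat.count_nth_of_infinite hinf M0]
      exact Nat.count_monotone _ (by omega)
    · have hlt : Nat.count (· ∈ P) (n + h i0) + r1 < Nat.count (· ∈ P) (n + h i1 + 1) := by
        rw [Nat.count_eq_card_filter_range, Nat.count_eq_card_filter_range]
        have hTi : (T.image fun i => n + h i).card = T.card := Finset.card_image_of_injective _ fun i j hij => hinj (by simpa using hij)
        have hdis : Disjoint ((Finset.range (n + h i0)).filter (· ∈ P)) (T.image fun i => n + h i) := by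
          rw [Finset.disjoint_left]
          intro a ha hb
          obtain ⟨i, hi, rfl⟩ := Finset.mem_image.mp hb
          have := hmin i hi
          have := Finset.mem_range.mp (Finset.mem_filter.mp ha).1
          omega
        have hsub : ((Finset.range (n + h i0)).filter (· ∈ P)) ∪ (T.image fun i => n + h i) ⊆ (Finset.range (n + h i1 + 1)).filter (· ∈ P) := by
          intro a ha
          rcases Finset.mem_union.mp ha with ha | ha
          · have h1 := Finset.mem_filter.mp ha
            have := Finset.mem_range.mp h1.1
            have := hmin i1 hi1
            exact Finset.mem_filter.mpr ⟨Finset.mem_range.mpr (by omega), h1.2⟩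
          · obtain ⟨i, hi, rfl⟩ := Finset.mem_image.mp ha
            have := hmax i hi
            exact Finset.mem_filter.mpr ⟨Finset.mem_range.mpr (by omega), (Finset.mem_filter.mp hi).2⟩
        have := Finset.card_le_card hsub
        rw [Finset.card_union_of_disjoint hdis, hTi] at this
        omega
      have h2 := Nat.nth_lt_of_lt_count hlt
      have h3 : Nat.nth (· ∈ P) (Nat.count (· ∈ P) (n + h i0)) = n + h i0 := Nat.nth_count (p := (· ∈ P)) hi0P
      have h4 := hD i1 i0
      have h5 : Nat.nth (· ∈ P) (Nat.count (· ∈ P) (n + h i0) + r1) ≤ D + (n + h i0) := by omega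
      rw [h3, sub_le_iff_le_add]
      exact_mod_cast h5
  · exact Filter.isBoundedUnder_of ⟨0, fun m => sub_nonneg.mpr (Nat.cast_le.mpr ((Nat.nth_monotone hinf) (Nat.le_add_right _ _)))⟩

end
end
end MCheb

theorem maynard_for_chebotarev_sets
    (K : Type) [Field K] [NumberField K] [IsGalois ℚ K]
    (C : ConjClasses (K ≃ₐ[ℚ] K))
    (θ : ℝ)
    (hlod : HasLevelOfDistribution (chebotarevSet K C) θ (discr K).natAbs)
    (k : ℕ) (hk : 0 < k) (h : Fin k → ℕ) (hinj : Function.Injective h)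
    (hadm : ∀ p : ℕ, p.Prime → ∃ r : ZMod p, ∀ i, (h i : ZMod p) ≠ r) :
    -- with δ = |C|/|G|, Δ the (positive) discriminant and r_k = ⌈δθφ(Δ)M_k/(2Δ)⌉ :
    letI Δ : ℕ := (discr K).natAbs
    letI δ : ℝ := (Nat.card C.carrier : ℝ) / (Nat.card (K ≃ₐ[ℚ] K) : ℝ)
    letI rk : ℕ := ⌈δ * θ * (Nat.totient Δ : ℝ) * maynardM k / (2 * Δ)⌉₊
    -- there are infinitely many `n` with at least `r_k` of the `n + hᵢ` in `𝒫`: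
    (∀ N : ℕ, ∃ n ≥ N,
      rk ≤ {i : Fin k | n + h i ∈ chebotarevSet K C}.ncard) ∧
    -- and, `p_n` denoting the `n`-th prime of `𝒫` (zero-indexed by `Nat.nth`),
    -- the liminf of `p_{n+r_k−1} − p_n` is at most the diameter of `ℋ`:
    Filter.liminf
        (fun n => (Nat.nth (· ∈ chebotarevSet K C) (n + (rk - 1)) : ℝ) -
          (Nat.nth (· ∈ chebotarevSet K C) n : ℝ)) Filter.atTop ≤
      Finset.univ.sup (fun ij : Fin k × Fin k => h ij.1 - h ij.2) := by
  set Δ : ℕ := (discr K).natAbs with hΔ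
  set δ : ℝ := (Nat.card C.carrier : ℝ) / (Nat.card (K ≃ₐ[ℚ] K) : ℝ) with hδ
  set rk : ℕ := ⌈δ * θ * (Nat.totient Δ : ℝ) * maynardM k / (2 * Δ)⌉₊ with hrk
  rcases Nat.eq_zero_or_pos rk with h0 | h0
  · rw [h0]
    refine ⟨fun N => ⟨N, le_rfl, Nat.zero_le _⟩, ?_⟩
    simp
  obtain ⟨r1, hr1⟩ : ∃ r1, rk = r1 + 1 := ⟨rk - 1, by omega⟩
  set c0 : ℝ := δ * (θ / 2) * MCheb.cV Δ with hc0
  have hc0n : 0 ≤ c0 := mul_nonneg (mul_nonneg (by positivity) (by linarith [hlod.1])) (MCheb.cV_mem Δ).1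
  have hlt : (r1:ℝ) < c0 * maynardM k := by
    have h1 : r1 < rk := by omega
    have h2 := Nat.lt_ceil.mp h1
    refine h2.trans_le (le_of_eq ?_)
    rw [hc0, MCheb.cV]
    ring
  have hc0p : 0 < c0 := by
    rcases hc0n.eq_or_lt with h1 | h1
    · rw [← h1, zero_mul] at hlt
      exact absurd hlt (not_lt.mpr (Nat.cast_nonneg _))
    · exact h1
  have hlt2 : (r1:ℝ) / c0 < maynardM k := by rwa [div_lt_iff₀' hc0p]
  have hr0 : (0:ℝ) ≤ (r1:ℝ) / c0 := by positivity
  have hne : {r : ℝ | ∃ F ∈ maynardS k, r = (∑ i, maynardJ k i F) / maynardI k F}.Nonempty := by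
    by_contra hemp
    rw [Set.not_nonempty_iff_eq_empty] at hemp
    rw [maynardM, hemp, Real.sSup_empty] at hlt2
    linarith
  obtain ⟨r, ⟨F, hF, rfl⟩, hr⟩ := exists_lt_of_lt_csSup hne hlt2
  obtain ⟨hFc, hFS, hFI, -⟩ := hF
  obtain ⟨⟨B, hB⟩, hI, hJ⟩ := MCheb.absF F hFc.continuous hFS
  have hIpos : 0 < maynardI k F := lt_of_le_of_ne (integral_nonneg fun t => sq_nonneg _) (Ne.symm hFI)
  have hkey : r1 * maynardI k (fun t => |F t|) < c0 * ∑ i, maynardJ k i (fun t => |F t|) := by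
    rw [hI]
    rw [div_lt_div_iff₀ hc0p hIpos] at hr
    have := mul_le_mul_of_nonneg_left (Finset.sum_le_sum fun i (_ : i ∈ Finset.univ) => hJ i) hc0n
    linarith
  have hmain : ∀ N : ℕ, ∃ n ≥ N, r1 + 1 ≤ {i : Fin k | n + h i ∈ chebotarevSet K C}.ncard :=
    MCheb.maynard_core K C θ hlod k hk h hinj hadm (fun t => |F t|) hFc.continuous.abs
      (fun t ht => hFS (fun e => ht (by simp [e]))) (fun t => abs_nonneg _) B hB r1 hkey
  rw [hr1]
  refine ⟨hmain, ?_⟩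
  exact MCheb.liminf_bound h hinj (chebotarevSet K C) r1 hmain _ fun i j =>
    Finset.le_sup (f := fun ij : Fin k × Fin k => h ij.1 - h ij.2) (Finset.mem_univ (i, j))
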